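/- Assume N ≤ 2, or N ≥ 3 and p = 2r+1 < p_B(N). There exists a constant C = C(N,p,B) > 0 such that for every T ∈ (0,∞) and every nonnegative classical solution U = (u_1,…,u_m) of (S) on ℝ^N × (0,T), one has u_i(x,t) ≤ C ( t^{−1/(p−1)} + (T−t)^{−1/(p−1)} ) for all (x,t) ∈ ℝ^N × (0,T) and all i = 1,…,m. -/

import Mathlib

open Real Set Metric MeasureTheory

/-- The Laplacian in the space variable, as the sum of second derivatives in
the coordinate directions. -/
noncomputable def lap {N : ℕ} (f : EuclideanSpace ℝ (Fin N) → ℝ)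
    (x : EuclideanSpace ℝ (Fin N)) : ℝ :=
  ∑ i, iteratedFDeriv ℝ 2 f x ![EuclideanSpace.single i 1, EuclideanSpace.single i 1]

section

open Filter
open scoped ContDiff Topology

/-- Space `ℝ^N`. -/
abbrev Sp (N : ℕ) := EuclideanSpace ℝ (Fin N)

/-- Space-time `ℝ^N × ℝ`. -/
abbrev SpT (N : ℕ) := Sp N × ℝ

section Calculus

variable {E : Type*} [NormedAddCommGroup E] [NormedSpace ℝ E]

/-- Directional derivative. -/
noncomputable def pd (v : E) (f : E → ℝ) (P : E) : ℝ := fderiv ℝ f P v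

/-- Smooth real functions. -/
def Sm (f : E → ℝ) : Prop := ContDiff ℝ ∞ f

variable {f g : E → ℝ} {v w : E}

theorem Sm.diff (hf : Sm f) (P : E) : DifferentiableAt ℝ f P :=
  (ContDiff.differentiable hf (by simp)) P

theorem Sm.cont (hf : Sm f) : Continuous f := ContDiff.continuous hf

theorem Sm.pd (hf : Sm f) (v : E) : Sm (pd v f) := by
  have h : ContDiff ℝ ∞ (fderiv ℝ f) := ContDiff.fderiv_right hf (by simp)
  exact h.clm_apply contDiff_const

theorem Sm.add (hf : Sm f) (hg : Sm g) : Sm (fun P => f P + g P) := ContDiff.add hf hg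
theorem Sm.sub (hf : Sm f) (hg : Sm g) : Sm (fun P => f P - g P) := ContDiff.sub hf hg
theorem Sm.mul (hf : Sm f) (hg : Sm g) : Sm (fun P => f P * g P) := ContDiff.mul hf hg
theorem Sm.neg (hf : Sm f) : Sm (fun P => -f P) := ContDiff.neg hf
theorem Sm.const (c : ℝ) : Sm (fun _ : E => c) := contDiff_const
theorem Sm.sum {ι : Type*} {s : Finset ι} {F : ι → E → ℝ} (hf : ∀ i ∈ s, Sm (F i)) :
    Sm (fun P => ∑ i ∈ s, F i P) := ContDiff.sum hf
theorem Sm.pow (hf : Sm f) (n : ℕ) : Sm (fun P => f P ^ n) := ContDiff.pow hf n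
theorem Sm.rpow (hf : Sm f) (h : ∀ P, 0 < f P) (s : ℝ) : Sm (fun P => f P ^ s) :=
  ContDiff.rpow_const_of_ne hf fun P => (h P).ne'
theorem Sm.div (hf : Sm f) (hg : Sm g) (h : ∀ P, g P ≠ 0) : Sm (fun P => f P / g P) :=
  ContDiff.div hf hg h

theorem pd_add (hf : Sm f) (hg : Sm g) (v P : E) :
    pd v (fun P => f P + g P) P = pd v f P + pd v g P := by
  unfold pd; rw [fderiv_fun_add (hf.diff P) (hg.diff P)]; rfl

theorem pd_sub (hf : Sm f) (hg : Sm g) (v P : E) :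
    pd v (fun P => f P - g P) P = pd v f P - pd v g P := by
  unfold pd; rw [fderiv_fun_sub (hf.diff P) (hg.diff P)]; rfl

theorem pd_neg (f : E → ℝ) (v P : E) : pd v (fun P => -f P) P = -pd v f P := by
  unfold pd; rw [fderiv_fun_neg]; rfl

theorem pd_mul (hf : Sm f) (hg : Sm g) (v P : E) :
    pd v (fun P => f P * g P) P = pd v f P * g P + f P * pd v g P := by
  unfold pd; rw [fderiv_fun_mul (hf.diff P) (hg.diff P)]; simp; ring

theorem pd_const (c : ℝ) (v P : E) : pd v (fun _ => c) P = 0 := by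
  unfold pd; simp

theorem pd_const_mul (hf : Sm f) (c : ℝ) (v P : E) :
    pd v (fun P => c * f P) P = c * pd v f P := by
  rw [pd_mul (Sm.const c) hf, pd_const]; ring

theorem pd_sum {ι : Type*} {s : Finset ι} {F : ι → E → ℝ} (hf : ∀ i ∈ s, Sm (F i)) (v P : E) :
    pd v (fun P => ∑ i ∈ s, F i P) P = ∑ i ∈ s, pd v (F i) P := by
  unfold pd; rw [fderiv_fun_sum fun i hi => (hf i hi).diff P]; simp

theorem pd_comp (hf : Sm f) {H : ℝ → ℝ} {H' : ℝ} {P : E} (hH : HasDerivAt H H' (f P)) (v : E) :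
    pd v (fun P => H (f P)) P = H' * pd v f P := by
  unfold pd
  have := hH.comp_hasFDerivAt P (hf.diff P).hasFDerivAt
  have h2 : fderiv ℝ (fun P => H (f P)) P = H' • fderiv ℝ f P := this.fderiv
  rw [h2]; simp

theorem pd_pow (hf : Sm f) (n : ℕ) (v P : E) :
    pd v (fun P => f P ^ n) P = n * f P ^ (n - 1) * pd v f P :=
  pd_comp hf (hasDerivAt_pow n (f P)) v

theorem pd_rpow (hf : Sm f) (h : ∀ P, 0 < f P) (s : ℝ) (v P : E) :
    pd v (fun P => f P ^ s) P = s * f P ^ (s - 1) * pd v f P :=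
  pd_comp hf (Real.hasDerivAt_rpow_const (Or.inl (h P).ne')) v

theorem pd_div (hf : Sm f) (hg : Sm g) (h : ∀ P, g P ≠ 0) (v P : E) :
    pd v (fun P => f P / g P) P = pd v f P / g P - f P * pd v g P / g P ^ 2 := by
  have hi : Sm (fun P => (g P)⁻¹) := ContDiff.inv hg h
  have e : (fun P => f P / g P) = fun P => f P * (g P)⁻¹ := by ext; rw [div_eq_mul_inv]
  rw [e, pd_mul hf hi, pd_comp hg (hasDerivAt_inv (h P)) v]
  field_simp [h P]
  ring

theorem pd_comm (hf : Sm f) (v w P : E) : pd v (pd w f) P = pd w (pd v f) P := by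
  have hs : IsSymmSndFDerivAt ℝ f P :=
    (ContDiff.contDiffAt hf).isSymmSndFDerivAt (by simp; exact ENat.LEInfty.out)
  have hd : DifferentiableAt ℝ (fderiv ℝ f) P := by
    have h : ContDiff ℝ ∞ (fderiv ℝ f) := ContDiff.fderiv_right hf (by simp)
    exact h.differentiable (by simp) P
  have key : ∀ a b : E, pd a (pd b f) P = fderiv ℝ (fderiv ℝ f) P a b := by
    intro a b
    unfold pd
    rw [fderiv_clm_apply hd (differentiableAt_const b)]
    simp
  rw [key, key]
  exact hs.eq v w

theorem HasCompactSupport.pd_of (hf : HasCompactSupport f) (v : E) :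
    HasCompactSupport (pd v f) := by
  have := hf.fderiv_apply ℝ v
  exact this

theorem pd_eq_zero_of_notMem (P : E) (hP : P ∉ tsupport f) (v : E) : pd v f P = 0 := by
  have : f =ᶠ[𝓝 P] fun _ => 0 := notMem_tsupport_iff_eventuallyEq.1 hP
  unfold pd; rw [this.fderiv_eq]; simp

/-- Integrable with zero integral. -/
def IsNull {α : Type*} [MeasurableSpace α] (μ : Measure α) (g : α → ℝ) : Prop :=
  Integrable g μ ∧ ∫ P, g P ∂μ = 0

section
variable {α : Type*} [MeasurableSpace α] {μ : Measure α} {f g : α → ℝ}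

theorem IsNull.add (hf : IsNull μ f) (hg : IsNull μ g) : IsNull μ (fun P => f P + g P) :=
  ⟨hf.1.add hg.1, by rw [integral_add hf.1 hg.1, hf.2, hg.2]; simp⟩

theorem IsNull.sub (hf : IsNull μ f) (hg : IsNull μ g) : IsNull μ (fun P => f P - g P) :=
  ⟨hf.1.sub hg.1, by rw [integral_sub hf.1 hg.1, hf.2, hg.2]; simp⟩

theorem IsNull.const_mul (c : ℝ) (hf : IsNull μ f) : IsNull μ (fun P => c * f P) :=
  ⟨hf.1.const_mul c, by rw [integral_const_mul, hf.2]; simp⟩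

theorem IsNull.sum {ι : Type*} {s : Finset ι} {F : ι → α → ℝ} (hf : ∀ i ∈ s, IsNull μ (F i)) :
    IsNull μ (fun P => ∑ i ∈ s, F i P) :=
  ⟨integrable_finsetSum _ fun i hi => (hf i hi).1, by
    rw [integral_finsetSum _ fun i hi => (hf i hi).1]
    exact Finset.sum_eq_zero fun i hi => (hf i hi).2⟩

/-- A pointwise bound by a null function plus an integrable one gives an integral bound. -/
theorem integral_le_of_null {G B Z : α → ℝ} (hG : Integrable G μ) (hB : Integrable B μ)
    (hZ : IsNull μ Z) (h : ∀ P, G P ≤ Z P + B P) : ∫ P, G P ∂μ ≤ ∫ P, B P ∂μ := by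
  have := integral_mono hG (hZ.1.add hB) h
  rw [integral_add' hZ.1 hB, hZ.2] at this
  simpa using this

end

theorem isNull_pd [MeasurableSpace E] {μ : Measure E} [BorelSpace E] [FiniteDimensional ℝ E] [μ.IsAddHaarMeasure]
    (hf : Sm f) (hc : HasCompactSupport f) (v : E) : IsNull μ (pd v f) := by
  have i1 : Integrable (pd v f) μ := (hf.pd v).cont.integrable_of_hasCompactSupport (hc.pd_of v)
  have i2 : Integrable f μ := hf.cont.integrable_of_hasCompactSupport hc
  refine ⟨i1, ?_⟩
  have := integral_mul_fderiv_eq_neg_fderiv_mul_of_integrable (μ := μ) (f := fun _ : E => (1:ℝ))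
    (g := f) (v := v) (by simp) (by simpa using (show Integrable (fun x => fderiv ℝ f x v) μ from i1)) (by simpa using i2)
    (fun x _ => differentiableAt_const _) (fun x _ => hf.diff x)
  simpa [pd] using this

end Calculus

variable {N : ℕ}

/-- Coordinate directions in space-time. -/
noncomputable def bx (i : Fin N) : SpT N := (EuclideanSpace.single i 1, 0)

/-- Time direction. -/
def bt : SpT N := (0, 1)

/-- The heat operator `∂_t - Δ`. -/
noncomputable def heat (V : SpT N → ℝ) (P : SpT N) : ℝ := pd bt V P - ∑ i, pd (bx i) (pd (bx i) V) P

theorem Sm.heat {V : SpT N → ℝ} (hV : Sm V) : Sm (heat V) :=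
  (hV.pd _).sub (Sm.sum fun _ _ => (hV.pd _).pd _)

/-- The nonlinearity. -/
noncomputable def nl {m : ℕ} (β : Fin m → Fin m → ℝ) (r : ℝ) (y : Fin m → ℝ) (i : Fin m) : ℝ :=
  ∑ j, β i j * y i ^ r * y j ^ (r + 1)

variable {N : ℕ}

instance : (volume : Measure (SpT N)).IsAddHaarMeasure :=
  inferInstanceAs (((volume : Measure (Sp N)).prod (volume : Measure ℝ)).IsAddHaarMeasure)

/-- Spatial gradient product. -/
noncomputable def gdot (f g : SpT N → ℝ) (P : SpT N) : ℝ := ∑ k, pd (bx k) f P * pd (bx k) g P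

/-- Spatial Laplacian on space-time. -/
noncomputable def lapl (f : SpT N → ℝ) (P : SpT N) : ℝ := ∑ k, pd (bx k) (pd (bx k) f) P

/-- Squared norm of the spatial Hessian. -/
noncomputable def hess2 (f : SpT N → ℝ) (P : SpT N) : ℝ :=
  ∑ k, ∑ j, pd (bx k) (pd (bx j) f) P ^ 2

/-- The Hessian evaluated on the gradient. -/
noncomputable def haa (f : SpT N → ℝ) (P : SpT N) : ℝ :=
  ∑ k, ∑ j, pd (bx k) (pd (bx j) f) P * pd (bx j) f P * pd (bx k) f P

variable {φ f g V : SpT N → ℝ}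

theorem Sm.gdot (hf : Sm f) (hg : Sm g) : Sm (gdot f g) :=
  Sm.sum fun _ _ => (hf.pd _).mul (hg.pd _)

theorem Sm.lapl (hf : Sm f) : Sm (lapl f) := Sm.sum fun _ _ => (hf.pd _).pd _

theorem heat_eq (V : SpT N → ℝ) (P : SpT N) : heat V P = pd bt V P - lapl V P := rfl

theorem gdot_comm (f g : SpT N → ℝ) (P : SpT N) : gdot f g P = gdot g f P :=
  Finset.sum_congr rfl fun _ _ => mul_comm _ _

theorem gdot_self_nonneg (f : SpT N → ℝ) (P : SpT N) : 0 ≤ gdot f f P :=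
  Finset.sum_nonneg fun _ _ => mul_self_nonneg _

theorem gdot_sq_le (f g : SpT N → ℝ) (P : SpT N) : gdot f g P ^ 2 ≤ gdot f f P * gdot g g P := by
  have := Finset.sum_mul_sq_le_sq_mul_sq Finset.univ (fun k => pd (bx k) f P)
    (fun k => pd (bx k) g P)
  simpa only [gdot, ← pow_two] using this

theorem isNull_pd_mul (hφ : Sm φ) (hc : HasCompactSupport φ) (hf : Sm f) (v : SpT N) :
    IsNull volume (fun P => pd v φ P * f P + φ P * pd v f P) := by
  have := isNull_pd (μ := volume) (hφ.mul hf) hc.mul_right v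
  exact (funext fun P => pd_mul hφ hf v P) ▸ this

theorem isNull_div (hφ : Sm φ) (hc : HasCompactSupport φ) {X : Fin N → SpT N → ℝ}
    (hX : ∀ k, Sm (X k)) :
    IsNull volume (fun P => ∑ k, (pd (bx k) φ P * X k P + φ P * pd (bx k) (X k) P)) :=
  IsNull.sum fun k _ => isNull_pd_mul hφ hc (hX k) (bx k)

/-- `div (φ f ∇V)`. -/
theorem isNull_div_grad (hφ : Sm φ) (hc : HasCompactSupport φ) (hf : Sm f) (hV : Sm V) :
    IsNull volume (fun P => gdot φ V P * f P + φ P * gdot f V P + φ P * f P * lapl V P) := by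
  have := isNull_div hφ hc (X := fun k P => f P * pd (bx k) V P) fun k => hf.mul (hV.pd _)
  convert this using 2 with P
  simp only [pd_mul hf (hV.pd _), gdot, lapl, Finset.sum_mul, Finset.mul_sum,
    ← Finset.sum_add_distrib]
  exact Finset.sum_congr rfl fun k _ => by ring

theorem pd_lapl (hV : Sm V) (v P : SpT N) :
    pd v (lapl V) P = ∑ k, pd (bx k) (pd (bx k) (pd v V)) P := by
  have : pd v (lapl V) P = ∑ k, pd v (pd (bx k) (pd (bx k) V)) P :=
    pd_sum (fun k _ => (hV.pd _).pd _) v P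
  rw [this]
  refine Finset.sum_congr rfl fun k _ => ?_
  rw [pd_comm (hV.pd _) v]
  congr 1
  exact funext fun Q => pd_comm hV v (bx k) Q

theorem pd_gdot (hf : Sm f) (hg : Sm g) (v P : SpT N) :
    pd v (gdot f g) P = gdot (pd v f) g P + gdot f (pd v g) P := by
  have : pd v (gdot f g) P = ∑ k, pd v (fun P => pd (bx k) f P * pd (bx k) g P) P :=
    pd_sum (fun k _ => (hf.pd _).mul (hg.pd _)) v P
  rw [this, gdot, gdot, ← Finset.sum_add_distrib]
  refine Finset.sum_congr rfl fun k _ => ?_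
  rw [pd_mul (hf.pd _) (hg.pd _), pd_comm hf v, pd_comm hg v]

theorem isNull_bochner (hφ : Sm φ) (hc : HasCompactSupport φ) (hV : Sm V) :
    IsNull volume (fun P => φ P * (hess2 V P - lapl V P ^ 2) - gdot φ V P * lapl V P
      - 1 / 2 * gdot V V P * lapl φ P) := by
  have n1 := isNull_div hφ hc (X := fun k P => 1 / 2 * pd (bx k) (gdot V V) P)
    fun k => (Sm.const _).mul ((hV.gdot hV).pd _)
  have n2 := isNull_div_grad hφ hc hV.lapl hV
  have n3 : IsNull volume (fun P => ∑ k, (pd (bx k) (pd (bx k) φ) P * gdot V V P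
      + pd (bx k) φ P * pd (bx k) (gdot V V) P)) :=
    IsNull.sum fun k _ => isNull_pd_mul (hφ.pd _) (hc.pd_of _) (hV.gdot hV) (bx k)
  convert (n1.sub n2).sub (n3.const_mul (1 / 2)) using 2 with P
  have e1 : ∀ k, pd (bx k) (fun P => 1 / 2 * pd (bx k) (gdot V V) P) P
      = ∑ j, (pd (bx k) (pd (bx j) V) P ^ 2
        + pd (bx j) V P * pd (bx k) (pd (bx k) (pd (bx j) V)) P) := by
    intro k
    rw [pd_const_mul ((hV.gdot hV).pd _)]
    have : pd (bx k) (gdot V V) = fun P => 2 * gdot V (pd (bx k) V) P :=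
      funext fun P => by rw [pd_gdot hV hV, gdot_comm (pd (bx k) V)]; ring
    rw [this, pd_const_mul (hV.gdot (hV.pd _)), pd_gdot hV (hV.pd _), gdot, gdot,
      ← Finset.sum_add_distrib, ← mul_assoc, one_div_mul_cancel two_ne_zero, one_mul]
    refine Finset.sum_congr rfl fun j _ => ?_
    rw [pd_comm hV (bx j), pd_comm (hV.pd _) (bx j),
      show pd (bx j) (pd (bx k) V) = pd (bx k) (pd (bx j) V) from
        funext fun Q => pd_comm hV _ _ Q]
    ring
  have e2 : gdot (lapl V) V P
      = ∑ k, ∑ j, pd (bx j) V P * pd (bx k) (pd (bx k) (pd (bx j) V)) P := by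
    rw [Finset.sum_comm, gdot]
    refine Finset.sum_congr rfl fun j _ => ?_
    rw [pd_lapl hV, Finset.sum_mul]
    exact Finset.sum_congr rfl fun k _ => mul_comm _ _
  simp only [e1, e2, hess2, Finset.sum_add_distrib, ← Finset.mul_sum, ← Finset.sum_mul, lapl]
  have : ∑ k, pd (bx k) φ P * (1 / 2 * pd (bx k) (gdot V V) P)
      = 1 / 2 * ∑ k, pd (bx k) φ P * pd (bx k) (gdot V V) P := by
    rw [Finset.mul_sum]; exact Finset.sum_congr rfl fun k _ => by ring
  rw [this]
  ring

theorem gdot_gdot_self (hV : Sm V) (P : SpT N) : gdot (gdot V V) V P = 2 * haa V P := by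
  rw [gdot, haa, Finset.mul_sum]
  refine Finset.sum_congr rfl fun k _ => ?_
  rw [pd_gdot hV hV, gdot_comm (pd (bx k) V), gdot, Finset.mul_sum, ← Finset.sum_add_distrib,
    Finset.sum_mul]
  refine Finset.sum_congr rfl fun j _ => ?_
  rw [pd_comm hV (bx j)]; ring

theorem isNull_grad_quartic (hφ : Sm φ) (hc : HasCompactSupport φ) (hV : Sm V)
    (hp : ∀ P, 0 < V P) :
    IsNull volume (fun P => φ P * (2 * haa V P / V P + gdot V V P / V P * lapl V P
      - (gdot V V P / V P) ^ 2) + gdot φ V P * (gdot V V P / V P)) := by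
  have hp' : ∀ P, V P ≠ 0 := fun P => (hp P).ne'
  convert isNull_div_grad hφ hc ((hV.gdot hV).div hV hp') hV using 2 with P
  have : gdot (fun P => gdot V V P / V P) V P = 2 * haa V P / V P - (gdot V V P / V P) ^ 2 := by
    have h1 : gdot (fun P => gdot V V P / V P) V P
        = (∑ k, pd (bx k) (gdot V V) P * pd (bx k) V P) / V P
          - gdot V V P * gdot V V P / V P ^ 2 := by
      rw [gdot, Finset.sum_div]
      conv_rhs => rw [gdot, Finset.mul_sum, Finset.sum_div, ← Finset.sum_sub_distrib]
      refine Finset.sum_congr rfl fun k _ => ?_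
      rw [pd_div (hV.gdot hV) hV hp']
      unfold gdot
      ring
    rw [h1, ← gdot_gdot_self hV]
    unfold gdot
    ring
  rw [this]
  ring

theorem isNull_dt_grad (hφ : Sm φ) (hc : HasCompactSupport φ) (hV : Sm V) :
    IsNull volume (fun P => gdot φ V P * pd bt V P + φ P * (pd bt V P * lapl V P)
      - 1 / 2 * (pd bt φ P * gdot V V P)) := by
  convert (isNull_div_grad hφ hc (hV.pd bt) hV).sub
    ((isNull_pd_mul hφ hc (hV.gdot hV) bt).const_mul (1 / 2)) using 2 with P
  rw [pd_gdot hV hV, gdot_comm V (pd bt V)]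
  ring

theorem trace_sq_le (M : Fin N → Fin N → ℝ) :
    (∑ k, M k k) ^ 2 ≤ N * ∑ k, ∑ j, M k j ^ 2 := by
  have h1 := sq_sum_le_card_mul_sum_sq (s := Finset.univ) (f := fun k : Fin N => M k k)
  have h2 : ∑ k, M k k ^ 2 ≤ ∑ k, ∑ j, M k j ^ 2 :=
    Finset.sum_le_sum fun k _ =>
      Finset.single_le_sum (f := fun j => M k j ^ 2) (fun j _ => sq_nonneg _) (Finset.mem_univ k)
  simp only [Finset.card_univ, Fintype.card_fin] at h1
  exact h1.trans (by gcongr)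

theorem hess_trace_ineq (V : SpT N → ℝ) (P : SpT N) (c : ℝ) :
    (lapl V P + c * (gdot V V P / V P)) ^ 2 ≤ N * (hess2 V P + 2 * c * haa V P / V P
      + c ^ 2 * (gdot V V P / V P) ^ 2) := by
  have := trace_sq_le fun k j =>
    pd (bx k) (pd (bx j) V) P + c / V P * (pd (bx j) V P * pd (bx k) V P)
  convert this using 2
  · rw [Finset.sum_add_distrib, ← Finset.mul_sum, lapl, gdot]; ring
  · have : ∀ k j, (pd (bx k) (pd (bx j) V) P + c / V P * (pd (bx j) V P * pd (bx k) V P)) ^ 2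
      = pd (bx k) (pd (bx j) V) P ^ 2
        + 2 * c / V P * (pd (bx k) (pd (bx j) V) P * pd (bx j) V P * pd (bx k) V P)
        + (c / V P) ^ 2 * ((pd (bx k) V P * pd (bx k) V P) * (pd (bx j) V P * pd (bx j) V P)) := by
      intro k j; ring
    simp only [this, Finset.sum_add_distrib, ← Finset.mul_sum, ← Finset.sum_mul, hess2, haa, gdot]
    ring

variable {N m : ℕ}

/-- The potential of the nonlinearity. -/
noncomputable def pot (β : Fin m → Fin m → ℝ) (r : ℝ) (y : Fin m → ℝ) : ℝ :=
  1 / (2 * (r + 1)) * ∑ i, ∑ j, β i j * y i ^ (r + 1) * y j ^ (r + 1)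

/-- The nonlinearity evaluated along functions. -/
noncomputable def nlf (β : Fin m → Fin m → ℝ) (r : ℝ) (V : Fin m → SpT N → ℝ) (i : Fin m)
    (P : SpT N) : ℝ := nl β r (fun j => V j P) i

variable {β : Fin m → Fin m → ℝ} {r : ℝ} {V : Fin m → SpT N → ℝ}

theorem sm_nlf (hV : ∀ i, Sm (V i)) (hp : ∀ i P, 0 < V i P) (i : Fin m) : Sm (nlf β r V i) := by
  show Sm (fun P => ∑ j, β i j * V i P ^ r * V j P ^ (r + 1))
  exact Sm.sum fun j _ => ((Sm.const _).mul ((hV i).rpow (hp i) _)).mul ((hV j).rpow (hp j) _)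

theorem sm_pot (hV : ∀ i, Sm (V i)) (hp : ∀ i P, 0 < V i P) :
    Sm (fun P => pot β r fun j => V j P) :=
  (Sm.const _).mul (Sm.sum fun i _ => Sm.sum fun j _ =>
    ((Sm.const _).mul ((hV i).rpow (hp i) _)).mul ((hV j).rpow (hp j) _))

theorem pd_pot (hr : 0 < r) (hsym : ∀ i j, β i j = β j i) (hV : ∀ i, Sm (V i))
    (hp : ∀ i P, 0 < V i P) (v P : SpT N) :
    pd v (fun P => pot β r fun j => V j P) P = ∑ i, nlf β r V i P * pd v (V i) P := by
  have s1 : ∀ i, Sm (fun P => V i P ^ (r + 1)) := fun i => (hV i).rpow (hp i) _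
  have s2 : ∀ i j, Sm (fun P => β i j * V i P ^ (r + 1) * V j P ^ (r + 1)) := fun i j =>
    ((Sm.const _).mul (s1 i)).mul (s1 j)
  unfold pot
  rw [pd_const_mul (Sm.sum fun i _ => Sm.sum fun j _ => s2 i j),
    pd_sum fun i _ => Sm.sum fun j _ => s2 i j]
  have e : ∀ i, pd v (fun P => ∑ j, β i j * V i P ^ (r + 1) * V j P ^ (r + 1)) P
      = ∑ j, ((r + 1) * (β i j * V i P ^ r * V j P ^ (r + 1) * pd v (V i) P)
        + (r + 1) * (β j i * V j P ^ r * V i P ^ (r + 1) * pd v (V j) P)) := by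
    intro i
    rw [pd_sum fun j _ => s2 i j]
    refine Finset.sum_congr rfl fun j _ => ?_
    rw [pd_mul ((Sm.const _).mul (s1 i)) (s1 j), pd_const_mul (s1 i), pd_rpow (hV i) (hp i),
      pd_rpow (hV j) (hp j), hsym j i, add_sub_cancel_right]
    ring
  simp only [e, Finset.sum_add_distrib, ← Finset.mul_sum]
  rw [Finset.sum_comm (f := fun i j => β j i * V j P ^ r * V i P ^ (r + 1) * pd v (V j) P)]
  simp only [nlf, nl, Finset.sum_mul]
  field_simp
  ring

theorem gdot_nlf (hV : ∀ i, Sm (V i)) (hp : ∀ i P, 0 < V i P) (i : Fin m) (P : SpT N) :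
    gdot (nlf β r V i) (V i) P = ∑ j, (r * (β i j * V i P ^ r * V j P ^ (r + 1)
        * (gdot (V i) (V i) P / V i P))
      + (r + 1) * (β i j * V i P ^ r * V j P ^ r * gdot (V i) (V j) P)) := by
  have s1 : ∀ i (s : ℝ), Sm (fun P => V i P ^ s) := fun i s => (hV i).rpow (hp i) s
  have e : ∀ k, pd (bx k) (nlf β r V i) P = ∑ j, (r * (β i j * V i P ^ r * V j P ^ (r + 1)
        * (pd (bx k) (V i) P / V i P))
      + (r + 1) * (β i j * V i P ^ r * V j P ^ r * pd (bx k) (V j) P)) := by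
    intro k
    unfold nlf nl
    rw [pd_sum fun j _ => ((Sm.const _).mul (s1 i r)).mul (s1 j (r + 1))]
    refine Finset.sum_congr rfl fun j _ => ?_
    rw [pd_mul ((Sm.const _).mul (s1 i r)) (s1 j (r + 1)), pd_const_mul (s1 i r),
      pd_rpow (hV i) (hp i), pd_rpow (hV j) (hp j), add_sub_cancel_right,
      rpow_sub_one (hp i P).ne']
    ring
  unfold gdot
  simp only [e, Finset.sum_mul]
  rw [Finset.sum_comm]
  refine Finset.sum_congr rfl fun j _ => ?_
  rw [Finset.sum_div, Finset.mul_sum, Finset.mul_sum, Finset.mul_sum, Finset.mul_sum,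
    ← Finset.sum_add_distrib]
  exact Finset.sum_congr rfl fun k _ => by ring

theorem gdot_le_half (a b : SpT N → ℝ) (P : SpT N) {x y : ℝ} (hx : 0 < x) (hy : 0 < y) :
    gdot a b P ≤ 1 / 2 * (gdot a a P / x * y + gdot b b P / y * x) := by
  unfold gdot
  rw [Finset.sum_div, Finset.sum_div, Finset.sum_mul, Finset.sum_mul, ← Finset.sum_add_distrib,
    Finset.mul_sum]
  refine Finset.sum_le_sum fun k _ => ?_
  set u := pd (bx k) a P
  set w := pd (bx k) b P
  have : 1 / 2 * (u * u / x * y + w * w / y * x) - u * w = (u * y - w * x) ^ 2 / (2 * x * y) := by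
    field_simp; ring
  have : 0 ≤ (u * y - w * x) ^ 2 / (2 * x * y) := by positivity
  linarith

theorem sum_gdot_nlf_le (hr : 0 < r) (hsym : ∀ i j, β i j = β j i) (hβ : ∀ i j, 0 ≤ β i j)
    (hV : ∀ i, Sm (V i)) (hp : ∀ i P, 0 < V i P) (P : SpT N) :
    ∑ i, gdot (nlf β r V i) (V i) P
      ≤ (2 * r + 1) * ∑ i, gdot (V i) (V i) P / V i P * nlf β r V i P := by
  set L := ∑ i, gdot (V i) (V i) P / V i P * nlf β r V i P with hL
  have hL1 : ∑ i, ∑ j, β i j * V i P ^ r * V j P ^ (r + 1) * (gdot (V i) (V i) P / V i P) = L := by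
    rw [hL]
    refine Finset.sum_congr rfl fun i _ => ?_
    rw [nlf, nl, Finset.mul_sum]
    exact Finset.sum_congr rfl fun j _ => by ring
  have h2 : ∑ i, ∑ j, β i j * V i P ^ r * V j P ^ r * gdot (V i) (V j) P ≤ L := by
    have : ∀ i j, β i j * V i P ^ r * V j P ^ r * gdot (V i) (V j) P
        ≤ 1 / 2 * (β i j * V i P ^ r * V j P ^ (r + 1) * (gdot (V i) (V i) P / V i P))
          + 1 / 2 * (β j i * V j P ^ r * V i P ^ (r + 1) * (gdot (V j) (V j) P / V j P)) := by
      intro i j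
      have h := gdot_le_half (V i) (V j) P (hp i P) (hp j P)
      have hc : 0 ≤ β i j * V i P ^ r * V j P ^ r :=
        mul_nonneg (mul_nonneg (hβ i j) (rpow_nonneg (hp i P).le _)) (rpow_nonneg (hp j P).le _)
      refine (mul_le_mul_of_nonneg_left h hc).trans_eq ?_
      rw [hsym j i, rpow_add_one (hp i P).ne', rpow_add_one (hp j P).ne']
      ring
    refine (Finset.sum_le_sum fun i _ => Finset.sum_le_sum fun j _ => this i j).trans_eq ?_
    simp only [Finset.sum_add_distrib, ← Finset.mul_sum]
    rw [Finset.sum_comm (f := fun i j =>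
      β j i * V j P ^ r * V i P ^ (r + 1) * (gdot (V j) (V j) P / V j P)), hL1]
    ring
  simp only [gdot_nlf hV hp, Finset.sum_add_distrib, ← Finset.mul_sum]
  rw [hL1]
  nlinarith

theorem young_small {s η : ℝ} (hs0 : 0 ≤ s) (hs : s < 1) (hη : 0 < η) :
    ∃ C : ℝ, 0 ≤ C ∧ ∀ Λ y : ℝ, 0 ≤ Λ → 0 ≤ y → Λ * y ^ s ≤ η * y + C * Λ ^ (1 / (1 - s)) := by
  have h1 : 0 < 1 - s := by linarith
  refine ⟨(η⁻¹) ^ (s / (1 - s)), by positivity, fun Λ y hΛ hy => ?_⟩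
  rcases eq_or_lt_of_le hy with rfl | hy'
  · rcases eq_or_lt_of_le hs0 with rfl | hs'
    · simp
    · rw [zero_rpow hs'.ne']; simp only [mul_zero, zero_add]; positivity
  by_cases h : Λ * y ^ s ≤ η * y
  · exact h.trans (le_add_of_nonneg_right (by positivity))
  · push Not at h
    have h2 : y ^ (1 - s) ≤ η⁻¹ * Λ := by
      have : y = y ^ (1 - s) * y ^ s := by rw [← rpow_add hy']; simp
      rw [this] at h
      have h4 : 0 < y ^ s := by positivity
      have h5 : ((y ^ (1 - s) * y ^ s) ^ s) = y ^ s := by rw [← this]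
      rw [h5] at h
      have : η * y ^ (1 - s) < Λ := by nlinarith
      rw [inv_mul_eq_div, le_div_iff₀ hη]; linarith
    have h3 : y ^ s ≤ (η⁻¹ * Λ) ^ (s / (1 - s)) := by
      have : y ^ s = (y ^ (1 - s)) ^ (s / (1 - s)) := by
        rw [← rpow_mul hy]; congr 1; field_simp
      rw [this]
      exact rpow_le_rpow (by positivity) h2 (by positivity)
    have h6 : Λ * Λ ^ (s / (1 - s)) = Λ ^ (1 / (1 - s)) := by
      have e : 1 / (1 - s) = 1 + s / (1 - s) := by field_simp; ring
      rw [e, rpow_add_of_nonneg hΛ zero_le_one (by positivity), rpow_one]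
    calc Λ * y ^ s ≤ Λ * (η⁻¹ * Λ) ^ (s / (1 - s)) := by gcongr
      _ = (η⁻¹) ^ (s / (1 - s)) * Λ ^ (1 / (1 - s)) := by
          rw [mul_rpow (by positivity) hΛ, ← h6]; ring
      _ ≤ _ := le_add_of_nonneg_left (by positivity)

/-- The pointwise quantities entering the Bochner-type estimate. -/
structure Dat (m : ℕ) (p c : ℝ) where
  (φ Λ ε S pt lp F : ℝ)
  (A V τ e f g : Fin m → ℝ)
  φ0 : 0 ≤ φ
  φ1 : φ ≤ 1
  Λ0 : 0 ≤ Λ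
  hpt : |pt| ≤ Λ * φ ^ ((p + 1) / (2 * p))
  hlp : |lp| ≤ Λ * φ ^ ((p + 1) / (2 * p))
  A0 : ∀ i, 0 ≤ A i
  V0 : ∀ i, 0 < V i
  hg : ∀ i, g i ^ 2 ≤ Λ * φ * φ ^ ((p + 1) / (2 * p)) * (A i * V i)
  he : ∀ i, e i ^ 2 ≤ ε ^ 2
  hA : ∀ i, A i ^ 2 ≤ S
  hτ : ∀ i, τ i ^ 2 ≤ S
  hV : ∀ i, (V i ^ p) ^ 2 ≤ S
  hf : ∀ i, f i ^ 2 ≤ c * S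
  S0 : 0 ≤ S
  hF : |F| ≤ c * ∑ i, V i ^ (p + 1)

variable {m : ℕ} {p c : ℝ}

/-- The error level. -/
noncomputable def Dat.R (d : Dat m p c) : ℝ := d.Λ ^ (2 * p / (p - 1)) + d.ε ^ 2

theorem Dat.R0 (d : Dat m p c) : 0 ≤ d.R :=
  add_nonneg (rpow_nonneg d.Λ0 _) (sq_nonneg _)

theorem Dat.G0 (d : Dat m p c) : 0 ≤ d.φ * d.S := mul_nonneg d.φ0 d.S0

/-- Quantities absorbed by `φ S` up to the error level. -/
def Absorbed (x : Dat m p c → ℝ) : Prop :=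
  ∀ η : ℝ, 0 < η → ∃ C : ℝ, 0 ≤ C ∧ ∀ d, |x d| ≤ η * (d.φ * d.S) + C * d.R

namespace Absorbed

variable {x y : Dat m p c → ℝ}

theorem add (hx : Absorbed x) (hy : Absorbed y) : Absorbed (fun d => x d + y d) := by
  intro η hη
  obtain ⟨C, hC, h1⟩ := hx (η / 2) (by positivity)
  obtain ⟨D, hD, h2⟩ := hy (η / 2) (by positivity)
  refine ⟨C + D, by positivity, fun d => (abs_add_le _ _).trans ?_⟩
  linarith [h1 d, h2 d]

theorem const_mul (k : ℝ) (hx : Absorbed x) : Absorbed (fun d => k * x d) := by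
  intro η hη
  obtain ⟨C, hC, h1⟩ := hx (η / (|k| + 1)) (by positivity)
  refine ⟨|k| * C, by positivity, fun d => ?_⟩
  have hk : |k| * (η / (|k| + 1)) ≤ η := by
    rw [← mul_div_assoc, div_le_iff₀ (by positivity)]; nlinarith [abs_nonneg k]
  rw [abs_mul]
  calc |k| * |x d| ≤ |k| * (η / (|k| + 1) * (d.φ * d.S) + C * d.R) := by gcongr; exact h1 d
    _ = |k| * (η / (|k| + 1)) * (d.φ * d.S) + |k| * C * d.R := by ring
    _ ≤ _ := by gcongr; exact d.G0

theorem sub (hx : Absorbed x) (hy : Absorbed y) : Absorbed (fun d => x d - y d) := by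
  have := hx.add (hy.const_mul (-1))
  simpa [sub_eq_add_neg] using this

theorem sum {ι : Type*} {s : Finset ι} {X : ι → Dat m p c → ℝ} (h : ∀ i ∈ s, Absorbed (X i)) :
    Absorbed (fun d => ∑ i ∈ s, X i d) := by
  classical
  induction s using Finset.induction_on with
  | empty =>
    intro η hη
    exact ⟨0, le_rfl, fun d => by simpa using mul_nonneg hη.le d.G0⟩
  | insert a s ha ih =>
    simp only [Finset.sum_insert ha]
    exact (h a (Finset.mem_insert_self _ _)).add
      (ih fun i hi => h i (Finset.mem_insert_of_mem hi))

theorem of_le (hx : Absorbed x) (h : ∀ d, |y d| ≤ |x d|) : Absorbed y := fun η hη => by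
  obtain ⟨C, hC, h1⟩ := hx η hη
  exact ⟨C, hC, fun d => (h d).trans (h1 d)⟩

end Absorbed

theorem small_of_rpow (hp : 1 < p) {x : Dat m p c → ℝ}
    (h : ∀ d, |x d| ≤ d.Λ * (d.φ * d.S) ^ ((p + 1) / (2 * p))) : Absorbed x := by
  intro η hη
  have hp0 : 0 < p := by linarith
  have hs : (p + 1) / (2 * p) < 1 := by rw [div_lt_one (by positivity)]; linarith
  obtain ⟨C, hC, hY⟩ := young_small (s := (p + 1) / (2 * p)) (by positivity) hs hη
  refine ⟨C, hC, fun d => (h d).trans ((hY _ _ d.Λ0 d.G0).trans ?_)⟩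
  have e : 1 / (1 - (p + 1) / (2 * p)) = 2 * p / (p - 1) := by
    have : p - 1 ≠ 0 := by linarith
    have h2 : 1 - (p + 1) / (2 * p) = (p - 1) / (2 * p) := by field_simp; ring
    rw [h2, one_div_div]
  rw [e, Dat.R]
  nlinarith [mul_nonneg hC (sq_nonneg d.ε)]

/-- The factor `Λ φ^σ A V`. -/
noncomputable def Dat.D (d : Dat m p c) (i : Fin m) : ℝ :=
  d.Λ * d.φ ^ ((p + 1) / (2 * p)) * (d.A i * d.V i)

theorem Dat.D0 (d : Dat m p c) (i : Fin m) : 0 ≤ d.D i :=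
  mul_nonneg (mul_nonneg d.Λ0 (rpow_nonneg d.φ0 _)) (mul_nonneg (d.A0 i) (d.V0 i).le)

theorem Dat.V_le (hp : 1 < p) (d : Dat m p c) (i : Fin m) {s : ℝ} (hs : 0 ≤ s) :
    d.V i ^ s ≤ d.S ^ (s / (2 * p)) := by
  have hV := d.V0 i
  have : d.V i ^ s = ((d.V i ^ p) ^ 2) ^ (s / (2 * p)) := by
    rw [← rpow_natCast, ← rpow_mul hV.le, ← rpow_mul hV.le]
    congr 1; push_cast; field_simp
  rw [this]
  exact rpow_le_rpow (by positivity) (d.hV i) (by positivity)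

theorem small_D (hp : 1 < p) (i : Fin m) : Absorbed (fun d : Dat m p c => d.D i) := by
  refine small_of_rpow hp fun d => ?_
  rw [abs_of_nonneg (d.D0 i), Dat.D, mul_rpow d.φ0 d.S0, ← mul_assoc d.Λ]
  have h0 : 0 ≤ d.Λ * d.φ ^ ((p + 1) / (2 * p)) := mul_nonneg d.Λ0 (rpow_nonneg d.φ0 _)
  refine mul_le_mul_of_nonneg_left ?_ h0
  have h1 : d.A i ≤ d.S ^ (1 / 2 : ℝ) := by
    rw [← sqrt_eq_rpow]; exact Real.le_sqrt_of_sq_le (d.hA i)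
  have h2 := d.V_le hp i zero_le_one
  rw [rpow_one] at h2
  have e : (p + 1) / (2 * p) = 1 / 2 + 1 / (2 * p) := by field_simp
  rw [e, rpow_add_of_nonneg d.S0 (by positivity) (by positivity)]
  exact mul_le_mul h1 h2 (d.V0 i).le (by have := d.S0; positivity)

theorem small_time_pow (hp : 1 < p) (i : Fin m) :
    Absorbed (fun d : Dat m p c => d.pt * d.V i ^ (p + 1)) := by
  refine small_of_rpow hp fun d => ?_
  have hV := d.V0 i
  rw [abs_mul, abs_of_nonneg (by positivity : 0 ≤ d.V i ^ (p + 1)), mul_rpow d.φ0 d.S0, ← mul_assoc]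
  exact mul_le_mul d.hpt (d.V_le hp i (by positivity)) (by positivity)
    (mul_nonneg d.Λ0 (rpow_nonneg d.φ0 _))

theorem small_pot (hp : 1 < p) : Absorbed (fun d : Dat m p c => d.pt * d.F) := by
  refine ((Absorbed.sum (s := Finset.univ) fun i _ => small_time_pow (c := c) hp i).const_mul
    c).of_le fun d => ?_
  rw [← Finset.mul_sum, abs_mul, abs_mul, abs_mul]
  have h := (d.hF).trans (le_abs_self _)
  rw [abs_mul] at h
  calc |d.pt| * |d.F| ≤ |d.pt| * (|c| * |∑ i, d.V i ^ (p + 1)|) := by gcongr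
    _ = _ := by ring

theorem small_time_grad (hp : 1 < p) (i : Fin m) :
    Absorbed (fun d : Dat m p c => d.pt * (d.A i * d.V i)) := by
  refine (small_D hp i).of_le fun d => ?_
  have h0 : 0 ≤ d.A i * d.V i := mul_nonneg (d.A0 i) (d.V0 i).le
  rw [abs_of_nonneg (d.D0 i), abs_mul, abs_of_nonneg h0]
  exact mul_le_mul_of_nonneg_right d.hpt h0

theorem small_lap_grad (hp : 1 < p) (i : Fin m) :
    Absorbed (fun d : Dat m p c => d.lp * (d.A i * d.V i)) := by
  refine (small_D hp i).of_le fun d => ?_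
  have h0 : 0 ≤ d.A i * d.V i := mul_nonneg (d.A0 i) (d.V0 i).le
  rw [abs_of_nonneg (d.D0 i), abs_mul, abs_of_nonneg h0]
  exact mul_le_mul_of_nonneg_right d.hlp h0

/-- Quantities of the size of `√S`. -/
def SqBdd (q : Dat m p c → ℝ) : Prop := ∃ k : ℝ, 0 < k ∧ ∀ d, q d ^ 2 ≤ k * (d.S + d.ε ^ 2)

theorem SqBdd.add {q q' : Dat m p c → ℝ} (h : SqBdd q) (h' : SqBdd q') :
    SqBdd (fun d => q d + q' d) := by
  obtain ⟨k, hk, h1⟩ := h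
  obtain ⟨l, hl, h2⟩ := h'
  refine ⟨2 * (k + l), by positivity, fun d => ?_⟩
  nlinarith [h1 d, h2 d, sq_nonneg (q d - q' d)]

theorem SqBdd.neg {q : Dat m p c → ℝ} (h : SqBdd q) : SqBdd (fun d => -q d) := by
  obtain ⟨k, hk, h1⟩ := h
  exact ⟨k, hk, fun d => by simpa using h1 d⟩

theorem Dat.eps_le (d : Dat m p c) : d.ε ^ 2 ≤ d.R := le_add_of_nonneg_left (rpow_nonneg d.Λ0 _)

theorem small_sq_e {q : Dat m p c → ℝ} (h : SqBdd q) (i : Fin m) :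
    Absorbed (fun d => d.φ * (q d * d.e i)) := by
  obtain ⟨k, hk, h1⟩ := h
  intro η hη
  refine ⟨η + k / (4 * η), by positivity, fun d => ?_⟩
  rw [abs_mul, abs_of_nonneg d.φ0]
  have h2 : |q d * d.e i| ≤ η / k * q d ^ 2 + k / (4 * η) * d.e i ^ 2 := by
    rw [abs_mul]
    have : η / k * q d ^ 2 + k / (4 * η) * d.e i ^ 2 - |q d| * |d.e i|
        = η / k * (|q d| - k / (2 * η) * |d.e i|) ^ 2 := by
      rw [← sq_abs (q d), ← sq_abs (d.e i)]; field_simp; ring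
    have : 0 ≤ η / k * (|q d| - k / (2 * η) * |d.e i|) ^ 2 := by positivity
    linarith
  have h3 : η / k * q d ^ 2 ≤ η * (d.S + d.ε ^ 2) := by
    calc η / k * q d ^ 2 ≤ η / k * (k * (d.S + d.ε ^ 2)) := by gcongr; exact h1 d
      _ = _ := by field_simp
  have h4 : k / (4 * η) * d.e i ^ 2 ≤ k / (4 * η) * d.ε ^ 2 :=
    mul_le_mul_of_nonneg_left (d.he i) (by positivity)
  have h5 : d.φ * |q d * d.e i| ≤ d.φ * (η * d.S + (η + k / (4 * η)) * d.ε ^ 2) := by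
    refine mul_le_mul_of_nonneg_left ?_ d.φ0
    linarith
  have h6 : d.φ * ((η + k / (4 * η)) * d.ε ^ 2) ≤ (η + k / (4 * η)) * d.R := by
    have : d.φ * ((η + k / (4 * η)) * d.ε ^ 2) ≤ 1 * ((η + k / (4 * η)) * d.R) :=
      mul_le_mul d.φ1 (by gcongr; exact d.eps_le) (by positivity) zero_le_one
    linarith
  linarith

theorem small_sq_g (hp : 1 < p) {q : Dat m p c → ℝ} (h : SqBdd q) (i : Fin m) :
    Absorbed (fun d => d.g i * q d) := by
  obtain ⟨k, hk, h1⟩ := h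
  intro η hη
  obtain ⟨C, hC, hD⟩ := ((small_D (c := c) hp i).const_mul (k / (2 * η))) (η / 2) (by positivity)
  refine ⟨C + η / 2, by positivity, fun d => ?_⟩
  have h2 : |d.g i * q d| ≤ η / (2 * k) * (d.φ * q d ^ 2) + k / (2 * η) * d.D i := by
    have hφ := d.φ0
    have hD0 := d.D0 i
    refine abs_le_of_sq_le_sq ?_ (by positivity)
    have hg : d.g i ^ 2 ≤ d.φ * d.D i := (d.hg i).trans_eq (by rw [Dat.D]; ring)
    calc (d.g i * q d) ^ 2 = d.g i ^ 2 * q d ^ 2 := by ring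
      _ ≤ d.φ * d.D i * q d ^ 2 := by gcongr
      _ = 4 * ((η / (2 * k) * (d.φ * q d ^ 2)) * (k / (2 * η) * d.D i)) := by field_simp; ring
      _ ≤ _ := by
        nlinarith [sq_nonneg (η / (2 * k) * (d.φ * q d ^ 2) - k / (2 * η) * d.D i)]
  have h3 : η / (2 * k) * (d.φ * q d ^ 2) ≤ η / 2 * (d.φ * (d.S + d.ε ^ 2)) := by
    have hφ := d.φ0
    calc η / (2 * k) * (d.φ * q d ^ 2) ≤ η / (2 * k) * (d.φ * (k * (d.S + d.ε ^ 2))) := by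
          gcongr; exact h1 d
      _ = _ := by field_simp
  have h4 := (le_abs_self _).trans (hD d)
  have h5 : d.φ * d.ε ^ 2 ≤ d.R :=
    (mul_le_of_le_one_left (sq_nonneg _) d.φ1).trans d.eps_le
  nlinarith

variable {m : ℕ} {p c : ℝ}

theorem sqBdd_A (i : Fin m) : SqBdd (fun d : Dat m p c => d.A i) :=
  ⟨1, one_pos, fun d => by nlinarith [d.hA i, sq_nonneg d.ε]⟩

theorem sqBdd_tau (i : Fin m) : SqBdd (fun d : Dat m p c => d.τ i) :=
  ⟨1, one_pos, fun d => by nlinarith [d.hτ i, sq_nonneg d.ε]⟩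

theorem sqBdd_V (i : Fin m) : SqBdd (fun d : Dat m p c => d.V i ^ p) :=
  ⟨1, one_pos, fun d => by nlinarith [d.hV i, sq_nonneg d.ε]⟩

theorem sqBdd_e (i : Fin m) : SqBdd (fun d : Dat m p c => d.e i) :=
  ⟨1, one_pos, fun d => by nlinarith [d.he i, d.S0]⟩

theorem sqBdd_f (i : Fin m) : SqBdd (fun d : Dat m p c => d.f i) :=
  ⟨|c| + 1, by positivity, fun d => by
    nlinarith [d.hf i, d.S0, sq_nonneg d.ε, le_abs_self c, abs_nonneg c,
      mul_nonneg (abs_nonneg c) (sq_nonneg d.ε), mul_le_mul_of_nonneg_right (le_abs_self c) d.S0]⟩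

/-- The spatial Laplacian, recovered from the equation. -/
def Dat.Δ (d : Dat m p c) (i : Fin m) : ℝ := d.τ i - d.f i - d.e i

theorem sqBdd_lap (i : Fin m) : SqBdd (fun d : Dat m p c => d.Δ i) := by
  have := ((sqBdd_tau (p := p) (c := c) i).add (sqBdd_f i).neg).add (sqBdd_e i).neg
  simpa [Dat.Δ, sub_eq_add_neg] using this

theorem absorb_main (hp : 1 < p) {κ ν k' b0 : ℝ} (h1 : 0 < κ - κ ^ 2 * ν)
    (h2 : 0 < k' - ν * p) (hb0 : 0 < b0) :
    ∃ K k2 k3 C : ℝ, 0 ≤ C ∧ ∀ (d : Dat m p c) (z1 z2 : ℝ) (z3 : Fin m → ℝ),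
      d.S = ∑ i, d.A i ^ 2 + ∑ i, d.τ i ^ 2 + ∑ i, (d.V i ^ p) ^ 2 →
      (∀ i, b0 * d.V i ^ p ≤ d.f i) →
      d.φ * ((κ - κ ^ 2 * ν) * ∑ i, d.A i ^ 2) + d.φ * ((k' - ν * p) * ∑ i, d.A i * d.f i)
        ≤ z1 + ∑ i, (ν * (-(d.g i * d.τ i) + 1 / 2 * (d.pt * (d.A i * d.V i)) + d.g i * d.f i)
          - ν * (d.φ * (d.Δ i * d.e i)) + k' * (d.φ * (d.A i * d.τ i))
          - k' * (d.φ * (d.A i * d.e i)) + d.g i * d.Δ i + 1 / 2 * (d.lp * (d.A i * d.V i))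
          + κ * (d.g i * d.A i)) →
      d.φ * ∑ i, d.τ i ^ 2 ≤ z2 + (∑ i, (-(d.g i * d.τ i) + d.φ * (d.τ i * d.e i)
          + 1 / 2 * (d.pt * (d.A i * d.V i))) - d.pt * d.F) →
      (∀ i, d.φ * (b0 * (d.V i ^ p) ^ 2) ≤ z3 i + d.φ * (p * (d.V i ^ p * d.A i))
        - d.φ * (d.V i ^ p * d.e i) - 1 / (p + 1) * (d.pt * d.V i ^ (p + 1))
        + d.g i * d.V i ^ p) →
      d.φ * d.S ≤ K * (z1 + k2 * z2 + k3 * ∑ i, z3 i) + C * d.R := by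
  set b1 := κ - κ ^ 2 * ν with hb1
  set b2 := k' - ν * p with hb2
  have hp0 : 0 < p := by linarith
  set k2 : ℝ := k' ^ 2 / (2 * b1) + 1 with hk2
  set k3 : ℝ := b2 * b0 / p with hk3
  have hk2' : 0 < k2 := by positivity
  have hk3' : 0 < k3 := by positivity
  set c0 := min (b1 / 2) (min 1 (k3 * b0)) with hc0
  have hc0' : 0 < c0 := by positivity
  have E1 : Absorbed (fun d : Dat m p c => ∑ i, (ν * (-(1:ℝ) * (d.g i * d.τ i)
          + 1 / 2 * (d.pt * (d.A i * d.V i)) + d.g i * d.f i)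
          - ν * (d.φ * (d.Δ i * d.e i))
          - k' * (d.φ * (d.A i * d.e i)) + d.g i * d.Δ i + 1 / 2 * (d.lp * (d.A i * d.V i))
          + κ * (d.g i * d.A i))) :=
    Absorbed.sum fun i _ => (((((((((small_sq_g hp (sqBdd_tau i) i).const_mul _).add
      ((small_time_grad hp i).const_mul _)).add (small_sq_g hp (sqBdd_f i) i)).const_mul _).sub
      ((small_sq_e (sqBdd_lap i) i).const_mul _)).sub
      ((small_sq_e (sqBdd_A i) i).const_mul _)).add (small_sq_g hp (sqBdd_lap i) i)).add
      ((small_lap_grad hp i).const_mul _)).add ((small_sq_g hp (sqBdd_A i) i).const_mul _)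
  have E2 : Absorbed (fun d : Dat m p c => ∑ i, (-(1:ℝ) * (d.g i * d.τ i)
          + d.φ * (d.τ i * d.e i) + 1 / 2 * (d.pt * (d.A i * d.V i))) - d.pt * d.F) :=
    (Absorbed.sum fun i _ => ((((small_sq_g hp (sqBdd_tau i) i).const_mul _).add
      (small_sq_e (sqBdd_tau i) i)).add ((small_time_grad hp i).const_mul _))).sub (small_pot hp)
  have E3 : Absorbed (fun d : Dat m p c => ∑ i, (-(1:ℝ) * (d.φ * (d.V i ^ p * d.e i))
      - 1 / (p + 1) * (d.pt * d.V i ^ (p + 1)) + d.g i * d.V i ^ p)) :=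
    Absorbed.sum fun i _ => ((((small_sq_e (sqBdd_V i) i).const_mul _).sub
      ((small_time_pow hp i).const_mul _))).add (small_sq_g hp (sqBdd_V i) i)
  obtain ⟨C, hC, hE⟩ := ((E1.add (E2.const_mul k2)).add (E3.const_mul k3)) (c0 / 2) (by positivity)
  refine ⟨2 / c0, k2, k3, 2 / c0 * C, by positivity, fun d z1 z2 z3 hS hf g1 g2 g3 => ?_⟩
  have hE' := (le_abs_self _).trans (hE d)
  have hφ := d.φ0
  have h3 : d.φ * (b0 * ∑ i, (d.V i ^ p) ^ 2) ≤ ∑ i, z3 i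
      + d.φ * (p / b0 * ∑ i, d.A i * d.f i) + ∑ i, (-(1:ℝ) * (d.φ * (d.V i ^ p * d.e i))
      - 1 / (p + 1) * (d.pt * d.V i ^ (p + 1)) + d.g i * d.V i ^ p) := by
    simp only [Finset.mul_sum]
    rw [← Finset.sum_add_distrib, ← Finset.sum_add_distrib]
    refine Finset.sum_le_sum fun i _ => (g3 i).trans ?_
    have : d.φ * (p * (d.V i ^ p * d.A i)) ≤ d.φ * (p / b0 * (d.A i * d.f i)) := by
      refine mul_le_mul_of_nonneg_left ?_ hφ
      have := mul_le_mul_of_nonneg_left (hf i) (mul_nonneg (div_pos hp0 hb0).le (d.A0 i))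
      calc _ = p / b0 * d.A i * (b0 * d.V i ^ p) := by field_simp
        _ ≤ _ := this
        _ = _ := by ring
    linarith
  have h4 : d.φ * (k' * ∑ i, d.A i * d.τ i) ≤ d.φ * (b1 / 2 * ∑ i, d.A i ^ 2)
      + (k2 - 1) * (d.φ * ∑ i, d.τ i ^ 2) := by
    have : k' * ∑ i, d.A i * d.τ i ≤ b1 / 2 * ∑ i, d.A i ^ 2 + (k2 - 1) * ∑ i, d.τ i ^ 2 := by
      simp only [Finset.mul_sum]
      rw [← Finset.sum_add_distrib]
      refine Finset.sum_le_sum fun i _ => ?_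
      have : b1 / 2 * d.A i ^ 2 + (k2 - 1) * d.τ i ^ 2 - k' * (d.A i * d.τ i)
          = b1 / 2 * (d.A i - k' / b1 * d.τ i) ^ 2 := by rw [hk2]; field_simp; ring
      have : 0 ≤ b1 / 2 * (d.A i - k' / b1 * d.τ i) ^ 2 := by positivity
      linarith
    have := mul_le_mul_of_nonneg_left this hφ
    linarith
  have h5 : ∑ i, (ν * (-(d.g i * d.τ i) + 1 / 2 * (d.pt * (d.A i * d.V i)) + d.g i * d.f i)
          - ν * (d.φ * (d.Δ i * d.e i)) + k' * (d.φ * (d.A i * d.τ i))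
          - k' * (d.φ * (d.A i * d.e i)) + d.g i * d.Δ i + 1 / 2 * (d.lp * (d.A i * d.V i))
          + κ * (d.g i * d.A i))
      = d.φ * (k' * ∑ i, d.A i * d.τ i) + ∑ i, (ν * (-(1:ℝ) * (d.g i * d.τ i)
          + 1 / 2 * (d.pt * (d.A i * d.V i)) + d.g i * d.f i)
          - ν * (d.φ * (d.Δ i * d.e i))
          - k' * (d.φ * (d.A i * d.e i)) + d.g i * d.Δ i + 1 / 2 * (d.lp * (d.A i * d.V i))
          + κ * (d.g i * d.A i)) := by
    simp only [Finset.mul_sum]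
    rw [← Finset.sum_add_distrib]
    exact Finset.sum_congr rfl fun i _ => by ring
  rw [h5] at g1
  have h6 := mul_le_mul_of_nonneg_left g2 hk2'.le
  have h7 := mul_le_mul_of_nonneg_left h3 hk3'.le
  have h8 : k3 * (d.φ * (p / b0 * ∑ i, d.A i * d.f i)) = d.φ * (b2 * ∑ i, d.A i * d.f i) := by
    rw [hk3]; field_simp
  simp only [neg_mul, one_mul] at hE' h7 g1 h6
  have hc1 : c0 ≤ b1 / 2 := min_le_left _ _
  have hc2 : c0 ≤ 1 := (min_le_right _ _).trans (min_le_left _ _)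
  have hc3 : c0 ≤ k3 * b0 := (min_le_right _ _).trans (min_le_right _ _)
  have i1 := mul_le_mul_of_nonneg_right hc1
    (mul_nonneg hφ (Finset.sum_nonneg fun i (_ : i ∈ Finset.univ) => sq_nonneg (d.A i)))
  have i2 := mul_le_mul_of_nonneg_right hc2
    (mul_nonneg hφ (Finset.sum_nonneg fun i (_ : i ∈ Finset.univ) => sq_nonneg (d.τ i)))
  have i3 := mul_le_mul_of_nonneg_right hc3
    (mul_nonneg hφ (Finset.sum_nonneg fun i (_ : i ∈ Finset.univ) => sq_nonneg (d.V i ^ p)))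
  have hS2 : c0 * (d.φ * d.S) = c0 * (d.φ * ∑ i, d.A i ^ 2) + c0 * (d.φ * ∑ i, d.τ i ^ 2)
    + c0 * (d.φ * ∑ i, (d.V i ^ p) ^ 2) := by rw [hS]; ring
  have key : c0 * (d.φ * d.S) ≤ (z1 + k2 * z2 + k3 * ∑ i, z3 i) + c0 / 2 * (d.φ * d.S)
    + C * d.R := by linarith
  have : d.φ * d.S = 2 / c0 * (c0 / 2 * (d.φ * d.S)) := by field_simp
  calc d.φ * d.S = 2 / c0 * (c0 / 2 * (d.φ * d.S)) := this
    _ ≤ 2 / c0 * ((z1 + k2 * z2 + k3 * ∑ i, z3 i) + C * d.R) := by gcongr; linarith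
    _ = _ := by ring

variable {N m : ℕ}

/-- Cutoff functions whose derivatives are controlled by powers of the function. -/
structure IsCut (φ : SpT N → ℝ) (Λ σ : ℝ) : Prop where
  sm : Sm φ
  cs : HasCompactSupport φ
  nonneg : ∀ P, 0 ≤ φ P
  le_one : ∀ P, φ P ≤ 1
  Λ0 : 0 ≤ Λ
  dt : ∀ P, |pd bt φ P| ≤ Λ * φ P ^ σ
  lap : ∀ P, |lapl φ P| ≤ Λ * φ P ^ σ
  grad : ∀ P, gdot φ φ P ≤ Λ * φ P * φ P ^ σ

theorem lapl_eq_zero {φ : SpT N → ℝ} {P : SpT N} (hP : P ∉ tsupport φ) : lapl φ P = 0 := by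
  refine Finset.sum_eq_zero fun k _ => pd_eq_zero_of_notMem P (fun h => hP ?_) _
  refine closure_minimal (fun Q hQ => ?_) isClosed_closure h
  by_contra h'
  exact hQ (pd_eq_zero_of_notMem Q h' _)

theorem gdot_eq_zero {φ : SpT N → ℝ} {P : SpT N} (hP : P ∉ tsupport φ) (f : SpT N → ℝ) :
    gdot φ f P = 0 :=
  Finset.sum_eq_zero fun k _ => by rw [pd_eq_zero_of_notMem P hP, zero_mul]

section
variable {β : Fin m → Fin m → ℝ} {r : ℝ}

theorem mul_rpow_le_add {x y a b : ℝ} (hx : 0 ≤ x) (hy : 0 ≤ y) (ha : 0 < a) (hb : 0 < b) :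
    x ^ a * y ^ b ≤ x ^ (a + b) + y ^ (a + b) := by
  rcases le_total x y with h | h
  · calc x ^ a * y ^ b ≤ y ^ a * y ^ b := by gcongr
      _ = y ^ (a + b) := (rpow_add_of_nonneg hy ha.le hb.le).symm
      _ ≤ _ := le_add_of_nonneg_left (by positivity)
  · calc x ^ a * y ^ b ≤ x ^ a * x ^ b := by gcongr
      _ = x ^ (a + b) := (rpow_add_of_nonneg hx ha.le hb.le).symm
      _ ≤ _ := le_add_of_nonneg_right (by positivity)

/-- Sum of all coefficients. -/
noncomputable def bsum (β : Fin m → Fin m → ℝ) : ℝ := ∑ i, ∑ j, β i j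

theorem bsum_nonneg (hβ : ∀ i j, 0 ≤ β i j) : 0 ≤ bsum β :=
  Finset.sum_nonneg fun i _ => Finset.sum_nonneg fun j _ => hβ i j

theorem nl_nonneg (hβ : ∀ i j, 0 ≤ β i j) {y : Fin m → ℝ} (hy : ∀ i, 0 ≤ y i) (i : Fin m) :
    0 ≤ nl β r y i :=
  Finset.sum_nonneg fun j _ =>
    mul_nonneg (mul_nonneg (hβ i j) (rpow_nonneg (hy i) _)) (rpow_nonneg (hy j) _)

theorem nl_le (hr : 0 < r) (hβ : ∀ i j, 0 ≤ β i j) {y : Fin m → ℝ} (hy : ∀ i, 0 ≤ y i) {M : ℝ}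
    (hM : ∀ i, y i ^ (2 * r + 1) ≤ M) (i : Fin m) : nl β r y i ≤ 2 * bsum β * M := by
  have hM0 : 0 ≤ M := (rpow_nonneg (hy i) _).trans (hM i)
  have : ∀ j, β i j * y i ^ r * y j ^ (r + 1) ≤ β i j * (2 * M) := fun j => by
    rw [mul_assoc]
    refine mul_le_mul_of_nonneg_left ?_ (hβ i j)
    refine (mul_rpow_le_add (hy i) (hy j) hr (by linarith)).trans ?_
    rw [show r + (r + 1) = 2 * r + 1 by ring]
    linarith [hM i, hM j]
  refine (Finset.sum_le_sum fun j _ => this j).trans ?_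
  rw [← Finset.sum_mul]
  have h2 : ∑ j, β i j ≤ bsum β := Finset.single_le_sum (f := fun i => ∑ j, β i j)
      (fun i _ => Finset.sum_nonneg fun j _ => hβ i j) (Finset.mem_univ i)
  nlinarith

theorem le_nl (hr : 0 < r) (hβ : ∀ i j, 0 ≤ β i j) {y : Fin m → ℝ} (hy : ∀ i, 0 ≤ y i)
    (i : Fin m) : β i i * y i ^ (2 * r + 1) ≤ nl β r y i := by
  have := Finset.single_le_sum (f := fun j => β i j * y i ^ r * y j ^ (r + 1)) (fun j _ =>
    mul_nonneg (mul_nonneg (hβ i j) (rpow_nonneg (hy i) _)) (rpow_nonneg (hy j) _))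
    (Finset.mem_univ i)
  refine le_trans (le_of_eq ?_) this
  rw [mul_assoc, ← rpow_add_of_nonneg (hy i) hr.le (by linarith)]
  ring_nf

theorem pot_nonneg (hr : 0 < r) (hβ : ∀ i j, 0 ≤ β i j) {y : Fin m → ℝ} (hy : ∀ i, 0 ≤ y i) :
    0 ≤ pot β r y := by
  unfold pot
  exact mul_nonneg (by positivity) (Finset.sum_nonneg fun i _ => Finset.sum_nonneg fun j _ =>
    mul_nonneg (mul_nonneg (hβ i j) (rpow_nonneg (hy i) _)) (rpow_nonneg (hy j) _))

theorem pot_le (hr : 0 < r) (hβ : ∀ i j, 0 ≤ β i j) {y : Fin m → ℝ} (hy : ∀ i, 0 ≤ y i) :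
    pot β r y ≤ (2 * bsum β) * ∑ i, y i ^ (2 * r + 2) := by
  have hS : ∀ i, y i ^ (2 * r + 2) ≤ ∑ i, y i ^ (2 * r + 2) := fun i =>
    Finset.single_le_sum (f := fun i => y i ^ (2 * r + 2)) (fun i _ => rpow_nonneg (hy i) _)
      (Finset.mem_univ i)
  have : ∀ i j, β i j * y i ^ (r + 1) * y j ^ (r + 1)
      ≤ β i j * (2 * ∑ i, y i ^ (2 * r + 2)) := fun i j => by
    rw [mul_assoc]
    refine mul_le_mul_of_nonneg_left ?_ (hβ i j)
    refine (mul_rpow_le_add (hy i) (hy j) (by linarith) (by linarith)).trans ?_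
    rw [show r + 1 + (r + 1) = 2 * r + 2 by ring]
    linarith [hS i, hS j]
  have h1 : ∑ i, ∑ j, β i j * y i ^ (r + 1) * y j ^ (r + 1)
      ≤ bsum β * (2 * ∑ i, y i ^ (2 * r + 2)) := by
    rw [bsum, Finset.sum_mul]
    simp only [Finset.sum_mul]
    exact Finset.sum_le_sum fun i _ => Finset.sum_le_sum fun j _ => this i j
  have h2 : 1 / (2 * (r + 1)) ≤ 1 := by rw [div_le_one (by positivity)]; linarith
  have h3 : 0 ≤ ∑ i, ∑ j, β i j * y i ^ (r + 1) * y j ^ (r + 1) :=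
    Finset.sum_nonneg fun i _ => Finset.sum_nonneg fun j _ =>
      mul_nonneg (mul_nonneg (hβ i j) (rpow_nonneg (hy i) _)) (rpow_nonneg (hy j) _)
  unfold pot
  nlinarith

/-- The pointwise data attached to functions at a point. -/
noncomputable def mkDat (hr : 0 < r) (hβ : ∀ i j, 0 ≤ β i j) {φ : SpT N → ℝ}
    {Λ ε : ℝ} {V : Fin m → SpT N → ℝ} (hφ : IsCut φ Λ ((2 * r + 1 + 1) / (2 * (2 * r + 1))))
    (hp : ∀ i P, 0 < V i P) (P : SpT N) (hε : ∀ i, |heat (V i) P - nlf β r V i P| ≤ ε) :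
    Dat m (2 * r + 1) ((2 * bsum β) ^ 2 + 2 * bsum β) where
  φ := φ P
  Λ := Λ
  ε := ε
  S := ∑ i, (gdot (V i) (V i) P / V i P) ^ 2 + ∑ i, pd bt (V i) P ^ 2
    + ∑ i, (V i P ^ (2 * r + 1)) ^ 2
  pt := pd bt φ P
  lp := lapl φ P
  F := pot β r fun j => V j P
  A i := gdot (V i) (V i) P / V i P
  V i := V i P
  τ i := pd bt (V i) P
  e i := heat (V i) P - nlf β r V i P
  f i := nlf β r V i P
  g i := gdot φ (V i) P
  φ0 := hφ.nonneg P
  φ1 := hφ.le_one P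
  Λ0 := hφ.Λ0
  hpt := hφ.dt P
  hlp := hφ.lap P
  A0 i := div_nonneg (gdot_self_nonneg _ _) (hp i P).le
  V0 i := hp i P
  hg i := by
    rw [div_mul_cancel₀ _ (hp i P).ne']
    exact (gdot_sq_le φ (V i) P).trans
      (mul_le_mul_of_nonneg_right (hφ.grad P) (gdot_self_nonneg _ _))
  he i := sq_le_sq' (neg_le_of_abs_le (hε i)) (le_of_abs_le (hε i))
  hA i := by
    have := Finset.single_le_sum (f := fun i => (gdot (V i) (V i) P / V i P) ^ 2)
      (fun i _ => sq_nonneg _) (Finset.mem_univ i)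
    refine this.trans ?_
    rw [add_assoc]
    exact le_add_of_nonneg_right (by positivity)
  hτ i := by
    have := Finset.single_le_sum (f := fun i => pd bt (V i) P ^ 2)
      (fun i _ => sq_nonneg _) (Finset.mem_univ i)
    refine this.trans ?_
    rw [add_right_comm]
    exact le_add_of_nonneg_left (by positivity)
  hV i := by
    have := Finset.single_le_sum (f := fun i => (V i P ^ (2 * r + 1)) ^ 2)
      (fun i _ => sq_nonneg _) (Finset.mem_univ i)
    exact this.trans (le_add_of_nonneg_left (by positivity))
  hf i := by
    set S := ∑ i, (gdot (V i) (V i) P / V i P) ^ 2 + ∑ i, pd bt (V i) P ^ 2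
      + ∑ i, (V i P ^ (2 * r + 1)) ^ 2 with hS
    have hS0 : 0 ≤ S := by positivity
    have h : nlf β r V i P ≤ 2 * bsum β * √S := nl_le hr hβ (fun j => (hp j P).le) (fun j => by
      refine Real.le_sqrt_of_sq_le ?_
      have := Finset.single_le_sum (f := fun i => (V i P ^ (2 * r + 1)) ^ 2)
        (fun i _ => sq_nonneg _) (Finset.mem_univ j)
      exact this.trans (le_add_of_nonneg_left (by positivity))) i
    have h0 : 0 ≤ nlf β r V i P := nl_nonneg hβ (fun j => (hp j P).le) i
    have hb := bsum_nonneg hβ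
    calc nlf β r V i P ^ 2 ≤ (2 * bsum β * √S) ^ 2 := by gcongr
      _ = (2 * bsum β) ^ 2 * S := by rw [mul_pow, Real.sq_sqrt hS0]
      _ ≤ _ := by gcongr; linarith
  S0 := by positivity
  hF := by
    rw [abs_of_nonneg (pot_nonneg hr hβ fun j => (hp j P).le),
      show 2 * r + 1 + 1 = 2 * r + 2 by ring]
    refine (pot_le hr hβ fun j => (hp j P).le).trans ?_
    refine mul_le_mul_of_nonneg_right (le_add_of_nonneg_left (sq_nonneg _)) ?_
    exact Finset.sum_nonneg fun i _ => rpow_nonneg (hp i P).le _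

theorem bochner_pointwise {φ V : SpT N → ℝ} (hN : 0 < N)
    (P : SpT N) (hφ0 : 0 ≤ φ P) (κ ν : ℝ) (hν : ν = 1 - 1 / N) :
    φ P * ((κ - κ ^ 2 * ν) * (gdot V V P / V P) ^ 2) ≤
      (φ P * (hess2 V P - lapl V P ^ 2) - gdot φ V P * lapl V P - 1 / 2 * gdot V V P * lapl φ P)
      - κ * (φ P * (2 * haa V P / V P + gdot V V P / V P * lapl V P
      - (gdot V V P / V P) ^ 2) + gdot φ V P * (gdot V V P / V P))
      + ν * (φ P * lapl V P ^ 2) + κ * (1 + 2 / N) * (φ P * (gdot V V P / V P * lapl V P))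
      + gdot φ V P * lapl V P + 1 / 2 * (lapl φ P * gdot V V P)
      + κ * (gdot φ V P * (gdot V V P / V P)) := by
  have h := hess_trace_ineq V P (-κ)
  have hN' : (0 : ℝ) < N := by exact_mod_cast hN
  set A := gdot V V P / V P
  rw [← div_le_iff₀' hN'] at h
  have h2 := mul_le_mul_of_nonneg_left h hφ0
  have e : (lapl V P + -κ * A) ^ 2 / N
      = 1 / N * lapl V P ^ 2 - 2 / N * κ * (A * lapl V P) + 1 / N * κ ^ 2 * A ^ 2 := by
    field_simp; ring
  rw [e] at h2
  rw [hν]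
  have e2 : 2 * -κ * haa V P / V P = -κ * (2 * haa V P / V P) := by ring
  rw [e2] at h2
  linear_combination h2
end

variable {N m : ℕ} {β : Fin m → Fin m → ℝ} {r : ℝ}

theorem gdot_rpow_self {V : SpT N → ℝ} (hV : Sm V) (hp : ∀ P, 0 < V P) (p : ℝ) (P : SpT N) :
    gdot (fun P => V P ^ p) V P = p * (V P ^ p * (gdot V V P / V P)) := by
  have h : V P ^ (p - 1) = V P ^ p / V P := by
    rw [rpow_sub (hp P), rpow_one]
  simp only [gdot, Finset.sum_div, Finset.mul_sum]
  refine Finset.sum_congr rfl fun k _ => ?_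
  rw [pd_rpow hV hp, h]
  have := (hp P).ne'
  field_simp

/-- Weighted high-power estimate for approximate positive solutions. -/
theorem integral_high (hN : 0 < N) (hr : 0 < r) (hsym : ∀ i j, β i j = β j i)
    (hβ : ∀ i j, 0 ≤ β i j) {b0 : ℝ} (hb0 : 0 < b0) (hdiag : ∀ i, b0 ≤ β i i)
    {κ : ℝ} (hκ0 : 0 < κ) (hκ1 : (2 * r + 1) * (1 - 1 / N) < κ * (1 + 2 / N))
    (hκ2 : κ * (1 - 1 / N) < 1) :
    ∃ C : ℝ, 0 ≤ C ∧ ∀ (φ : SpT N → ℝ) (Λ ε : ℝ) (V : Fin m → SpT N → ℝ),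
      IsCut φ Λ ((2 * r + 1 + 1) / (2 * (2 * r + 1))) → (∀ i, Sm (V i)) → (∀ i P, 0 < V i P) →
      (∀ P ∈ tsupport φ, ∀ i, |heat (V i) P - nlf β r V i P| ≤ ε) →
      ∫ P, φ P * ∑ i, (V i P ^ (2 * r + 1)) ^ 2
        ≤ C * (Λ ^ (2 * (2 * r + 1) / (2 * r + 1 - 1)) + ε ^ 2)
          * (volume (tsupport φ)).toReal := by
  set p := 2 * r + 1 with hp
  have hp1 : 1 < p := by linarith
  set ν : ℝ := 1 - 1 / N with hν
  set k' : ℝ := κ * (1 + 2 / N) with hk'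
  have hν0 : 0 ≤ ν := by
    have : (1:ℝ) ≤ N := by exact_mod_cast hN
    have : (1:ℝ) / N ≤ 1 := by rw [div_le_one (by linarith)]; exact this
    linarith
  obtain ⟨K, k2, k3, C, hC, H⟩ := absorb_main (m := m) (p := p)
    (c := (2 * bsum β) ^ 2 + 2 * bsum β) hp1 (κ := κ) (ν := ν) (k' := k')
    (b0 := b0) (by nlinarith) (by nlinarith) hb0
  refine ⟨C, hC, fun φ Λ ε V hφ hV hVp hε => ?_⟩
  set N1 : Fin m → SpT N → ℝ := fun i P => φ P * (hess2 (V i) P - lapl (V i) P ^ 2)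
      - gdot φ (V i) P * lapl (V i) P - 1 / 2 * gdot (V i) (V i) P * lapl φ P with hN1
  set N2 : Fin m → SpT N → ℝ := fun i P => φ P * (2 * haa (V i) P / V i P
      + gdot (V i) (V i) P / V i P * lapl (V i) P - (gdot (V i) (V i) P / V i P) ^ 2)
      + gdot φ (V i) P * (gdot (V i) (V i) P / V i P) with hN2
  set N3 : Fin m → SpT N → ℝ := fun i P => gdot φ (V i) P * pd bt (V i) P
      + φ P * (pd bt (V i) P * lapl (V i) P) - 1 / 2 * (pd bt φ P * gdot (V i) (V i) P) with hN3
  set N4 : SpT N → ℝ := fun P => pd bt φ P * pot β r (fun j => V j P)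
      + φ P * pd bt (fun P => pot β r fun j => V j P) P with hN4
  set N5 : Fin m → SpT N → ℝ := fun i P => gdot φ (V i) P * nlf β r V i P
      + φ P * gdot (nlf β r V i) (V i) P + φ P * nlf β r V i P * lapl (V i) P with hN5
  set N6 : Fin m → SpT N → ℝ := fun i P => pd bt φ P * V i P ^ (p + 1)
      + φ P * pd bt (fun P => V i P ^ (p + 1)) P with hN6
  set N7 : Fin m → SpT N → ℝ := fun i P => gdot φ (V i) P * V i P ^ p
      + φ P * gdot (fun P => V i P ^ p) (V i) P + φ P * V i P ^ p * lapl (V i) P with hN7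
  have n1 : ∀ i, IsNull volume (N1 i) := fun i => isNull_bochner hφ.sm hφ.cs (hV i)
  have n2 : ∀ i, IsNull volume (N2 i) := fun i => isNull_grad_quartic hφ.sm hφ.cs (hV i) (hVp i)
  have n3 : ∀ i, IsNull volume (N3 i) := fun i => isNull_dt_grad hφ.sm hφ.cs (hV i)
  have n4 : IsNull volume N4 := isNull_pd_mul hφ.sm hφ.cs (sm_pot hV hVp) bt
  have n5 : ∀ i, IsNull volume (N5 i) := fun i =>
    isNull_div_grad hφ.sm hφ.cs (sm_nlf hV hVp i) (hV i)
  have n6 : ∀ i, IsNull volume (N6 i) := fun i =>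
    isNull_pd_mul hφ.sm hφ.cs ((hV i).rpow (hVp i) _) bt
  have n7 : ∀ i, IsNull volume (N7 i) := fun i =>
    isNull_div_grad hφ.sm hφ.cs ((hV i).rpow (hVp i) _) (hV i)
  set Z1 : SpT N → ℝ := fun P => ∑ i, (N1 i P - κ * N2 i P + ν * N3 i P - ν * N5 i P) with hZ1
  set Z2 : SpT N → ℝ := fun P => ∑ i, N3 i P + N4 P with hZ2
  set Z3 : Fin m → SpT N → ℝ := fun i P => 1 / (p + 1) * N6 i P - N7 i P with hZ3
  have hZ : IsNull volume (fun P => K * (Z1 P + k2 * Z2 P + k3 * ∑ i, Z3 i P)) :=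
    (((IsNull.sum fun i _ => (((n1 i).sub ((n2 i).const_mul κ)).add ((n3 i).const_mul ν)).sub
      ((n5 i).const_mul ν)).add (((IsNull.sum fun i _ => n3 i).add n4).const_mul k2)).add
      ((IsNull.sum fun i _ => ((n6 i).const_mul _).sub (n7 i)).const_mul k3)).const_mul K
  have hts : MeasurableSet (tsupport φ) := (isClosed_tsupport φ).measurableSet
  have hfin : volume (tsupport φ) ≠ ⊤ := hφ.cs.isCompact.measure_lt_top.ne
  set R : ℝ := C * (Λ ^ (2 * p / (p - 1)) + ε ^ 2) with hR
  have hG : Integrable (fun P => φ P * ∑ i, (V i P ^ p) ^ 2) :=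
    (hφ.sm.mul (Sm.sum fun i _ => ((hV i).rpow (hVp i) p).pow 2)).cont.integrable_of_hasCompactSupport
      hφ.cs.mul_right
  have hB : Integrable ((tsupport φ).indicator fun _ : SpT N => R) :=
    (integrable_indicator_iff hts).2 (integrableOn_const hfin)
  have key := integral_le_of_null hG hB hZ fun P => ?_
  · refine key.trans (le_of_eq ?_)
    rw [integral_indicator_const _ hts, smul_eq_mul, mul_comm]; rfl
  by_cases hP : P ∈ tsupport φ
  · rw [indicator_of_mem hP]
    set d := mkDat hr hβ hφ hVp P (hε P hP) with hd
    have hlap : ∀ i, lapl (V i) P = d.Δ i := fun i => by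
      show _ = pd bt (V i) P - nlf β r V i P - (heat (V i) P - nlf β r V i P)
      rw [heat_eq]; ring
    have hAV : ∀ i, d.A i * d.V i = gdot (V i) (V i) P := fun i =>
      div_mul_cancel₀ _ (hVp i P).ne'
    have hle := H d (Z1 P) (Z2 P) (fun i => Z3 i P) rfl (fun i =>
      (mul_le_mul_of_nonneg_right (hdiag i) (rpow_nonneg (hVp i P).le _)).trans
        (le_nl hr hβ (fun j => (hVp j P).le) i)) ?_ ?_ ?_
    · refine le_trans ?_ hle
      refine mul_le_mul_of_nonneg_left ?_ (hφ.nonneg P)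
      exact le_add_of_nonneg_left (by positivity)
    · have hs := mul_le_mul_of_nonneg_left (sum_gdot_nlf_le hr hsym hβ hV hVp P)
        (mul_nonneg hν0 (hφ.nonneg P))
      have hb := Finset.sum_le_sum fun i (_ : i ∈ Finset.univ) =>
        bochner_pointwise (V := V i) hN P (hφ.nonneg P) κ ν hν
      rw [← Finset.mul_sum, ← Finset.mul_sum] at hb
      have e : ∀ i, (φ P * (hess2 (V i) P - lapl (V i) P ^ 2) - gdot φ (V i) P * lapl (V i) P
          - 1 / 2 * gdot (V i) (V i) P * lapl φ P)
        - κ * (φ P * (2 * haa (V i) P / V i P + gdot (V i) (V i) P / V i P * lapl (V i) P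
        - (gdot (V i) (V i) P / V i P) ^ 2) + gdot φ (V i) P * (gdot (V i) (V i) P / V i P))
        + ν * (φ P * lapl (V i) P ^ 2)
        + κ * (1 + 2 / N) * (φ P * (gdot (V i) (V i) P / V i P * lapl (V i) P))
        + gdot φ (V i) P * lapl (V i) P + 1 / 2 * (lapl φ P * gdot (V i) (V i) P)
        + κ * (gdot φ (V i) P * (gdot (V i) (V i) P / V i P))
        = (N1 i P - κ * N2 i P + ν * N3 i P - ν * N5 i P)
          + (ν * (-(d.g i * d.τ i) + 1 / 2 * (d.pt * (d.A i * d.V i)) + d.g i * d.f i)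
          - ν * (d.φ * (d.Δ i * d.e i)) + k' * (d.φ * (d.A i * d.τ i))
          - k' * (d.φ * (d.A i * d.e i)) + d.g i * d.Δ i + 1 / 2 * (d.lp * (d.A i * d.V i))
          + κ * (d.g i * d.A i)) + ν * φ P * gdot (nlf β r V i) (V i) P
          - k' * φ P * (gdot (V i) (V i) P / V i P * nlf β r V i P) := fun i => by
        have h1 : gdot (V i) (V i) P / V i P = d.A i := rfl
        have h2 : φ P = d.φ := rfl
        have h3 : gdot φ (V i) P = d.g i := rfl
        have h4 : pd bt (V i) P = d.τ i := rfl
        have h5 : pd bt φ P = d.pt := rfl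
        have h6 : lapl φ P = d.lp := rfl
        have h7 : nlf β r V i P = d.f i := rfl
        simp only [hN1, hN2, hN3, hN5, ← hk', h1]
        simp only [h2, h3, h4, h5, h6, h7, ← hAV, hlap]
        simp only [Dat.Δ]
        ring
      rw [Finset.sum_congr rfl fun i _ => e i, Finset.sum_sub_distrib, Finset.sum_add_distrib,
        Finset.sum_add_distrib, ← Finset.mul_sum, ← Finset.mul_sum] at hb
      have h8 : ∑ i, d.A i ^ 2 = ∑ i, (gdot (V i) (V i) P / V i P) ^ 2 := rfl
      have h9 : ∑ i, d.A i * d.f i = ∑ i, gdot (V i) (V i) P / V i P * nlf β r V i P := rfl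
      have h10 : d.φ = φ P := rfl
      rw [h8, h9]
      set L := ∑ i, gdot (V i) (V i) P / V i P * nlf β r V i P
      rw [h10] at hb ⊢
      linarith
    · have h0 : φ P * ∑ i, d.f i * d.τ i = N4 P - d.pt * d.F := by
        simp only [hN4]; rw [pd_pot hr hsym hV hVp]
        show _ = _ - pd bt φ P * pot β r (fun j => V j P)
        have : ∑ i, d.f i * d.τ i = ∑ i, nlf β r V i P * pd bt (V i) P := rfl
        rw [this]; ring
      have h1 : ∀ i, φ P * d.τ i ^ 2 = N3 i P + (-(d.g i * d.τ i) + d.φ * (d.τ i * d.e i)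
          + 1 / 2 * (d.pt * (d.A i * d.V i))) + φ P * (d.f i * d.τ i) := fun i => by
        rw [hAV]
        have h2 : φ P = d.φ := rfl
        have h3 : gdot φ (V i) P = d.g i := rfl
        have h4 : pd bt (V i) P = d.τ i := rfl
        have h5 : pd bt φ P = d.pt := rfl
        simp only [hN3, h2, h3, h4, h5, hlap]
        simp only [Dat.Δ]
        ring
      have h2 : d.φ * ∑ i, d.τ i ^ 2 = ∑ i, φ P * d.τ i ^ 2 := by rw [Finset.mul_sum]; rfl
      rw [h2, Finset.sum_congr rfl fun i _ => h1 i, Finset.sum_add_distrib,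
        Finset.sum_add_distrib, ← Finset.mul_sum, h0]
      simp only [hZ2]
      linarith
    · intro i
      have h0 := mul_le_mul_of_nonneg_left ((mul_le_mul_of_nonneg_right (hdiag i)
        (rpow_nonneg (hVp i P).le _)).trans (le_nl hr hβ (fun j => (hVp j P).le) i))
        (mul_nonneg (hφ.nonneg P) (rpow_nonneg (hVp i P).le p))
      have h2 : φ P = d.φ := rfl
      have h3 : gdot φ (V i) P = d.g i := rfl
      have h4 : pd bt (V i) P = d.τ i := rfl
      have h5 : pd bt φ P = d.pt := rfl
      have h6 : V i P = d.V i := rfl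
      have h7 : nl β r (fun j => V j P) i = d.f i := rfl
      have h8 : gdot (V i) (V i) P / V i P = d.A i := rfl
      have e : d.φ * d.V i ^ p * d.f i = Z3 i P + d.φ * (p * (d.V i ^ p * d.A i))
        - d.φ * (d.V i ^ p * d.e i) - 1 / (p + 1) * (d.pt * d.V i ^ (p + 1))
        + d.g i * d.V i ^ p := by
        simp only [hZ3, hN6, hN7]
        rw [gdot_rpow_self (hV i) (hVp i), pd_rpow (hV i) (hVp i), h8, h6, hlap, h3, h4, h5, h2]
        simp only [Dat.Δ, add_sub_cancel_right]
        have : p + 1 ≠ 0 := by linarith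
        field_simp
        ring
      rw [← e]
      rw [h2, h6, h7] at h0
      calc _ = d.φ * d.V i ^ p * (b0 * d.V i ^ p) := by ring
        _ ≤ _ := h0
  · rw [indicator_of_notMem hP]
    have h1 : φ P = 0 := image_eq_zero_of_notMem_tsupport hP
    simp [hZ1, hZ2, hZ3, hN1, hN2, hN3, hN4, hN5, hN6, hN7, h1, gdot_eq_zero hP, lapl_eq_zero hP,
      pd_eq_zero_of_notMem P hP]

variable {N m : ℕ}

theorem exists_bump {E : Type*} [NormedAddCommGroup E] [NormedSpace ℝ E] [FiniteDimensional ℝ E]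
    {a b : ℝ} (ha : 0 < a) (hab : a < b) :
    ∃ g : E → ℝ, Sm g ∧ HasCompactSupport g ∧ (∀ P, 0 ≤ g P) ∧ (∀ P, g P ≤ 1) ∧
      (∀ P, ‖P‖ ≤ a → g P = 1) ∧ tsupport g ⊆ closedBall 0 b := by
  let f : ContDiffBump (0 : E) := ⟨a, b, ha, hab⟩
  exact ⟨f, f.contDiff, f.hasCompactSupport, fun _ => f.nonneg, fun _ => f.le_one,
    fun P hP => f.one_of_mem_closedBall (by simpa using hP), f.tsupport_eq.subset⟩

theorem Sm.comp_clm {E F : Type*} [NormedAddCommGroup E] [NormedSpace ℝ E]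
    [NormedAddCommGroup F] [NormedSpace ℝ F] {f : F → ℝ} (hf : Sm f) (A : E →L[ℝ] F) (c : F) :
    Sm (fun P => f (A P + c)) := ContDiff.comp hf (A.contDiff.add contDiff_const)

theorem pd_comp_clm {E F : Type*} [NormedAddCommGroup E] [NormedSpace ℝ E]
    [NormedAddCommGroup F] [NormedSpace ℝ F] {f : F → ℝ} (hf : Sm f) (A : E →L[ℝ] F) (c : F)
    (v P : E) : pd v (fun P => f (A P + c)) P = pd (A v) f (A P + c) := by
  unfold pd
  have h := (hf.diff (A P + c)).hasFDerivAt.comp P (A.hasFDerivAt.add_const c)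
  have h2 : fderiv ℝ (fun P => f (A P + c)) P = (fderiv ℝ f (A P + c)).comp A := h.fderiv
  rw [h2]; rfl

theorem pd_smul (c : ℝ) (v : SpT N) (f : SpT N → ℝ) (P : SpT N) :
    pd (c • v) f P = c * pd v f P := by
  unfold pd; simp

/-- Anisotropic scaling of space-time. -/
noncomputable def scl (a b : ℝ) : SpT N →L[ℝ] SpT N :=
  (a • ContinuousLinearMap.id ℝ (Sp N)).prodMap (b • ContinuousLinearMap.id ℝ ℝ)

theorem scl_apply (a b : ℝ) (P : SpT N) : scl a b P = (a • P.1, b * P.2) := rfl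

theorem scl_bt (a b : ℝ) : scl a b (bt : SpT N) = b • bt := by simp [scl_apply, bt]

theorem scl_bx (a b : ℝ) (i : Fin N) : scl a b (bx i : SpT N) = a • bx i := by
  simp [scl_apply, bx]

section scaling
variable {f g : SpT N → ℝ} (hf : Sm f) (hg : Sm g) (a b : ℝ) (c P : SpT N)
include hf

theorem pd_bt_scl : pd bt (fun P => f (scl a b P + c)) P = b * pd bt f (scl a b P + c) := by
  rw [pd_comp_clm hf, scl_bt, pd_smul]

theorem pd_bx_scl (i : Fin N) :
    pd (bx i) (fun P => f (scl a b P + c)) P = a * pd (bx i) f (scl a b P + c) := by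
  rw [pd_comp_clm hf, scl_bx, pd_smul]

theorem lapl_scl : lapl (fun P => f (scl a b P + c)) P = a ^ 2 * lapl f (scl a b P + c) := by
  simp only [lapl, Finset.mul_sum]
  refine Finset.sum_congr rfl fun k _ => ?_
  have : pd (bx k) (fun P => f (scl a b P + c)) = fun P => a * pd (bx k) f (scl a b P + c) :=
    funext fun P => pd_bx_scl hf a b c P k
  rw [this, pd_const_mul ((hf.pd _).comp_clm _ _), pd_bx_scl (hf.pd _)]; ring

include hg in
theorem gdot_scl : gdot (fun P => f (scl a b P + c)) (fun P => g (scl a b P + c)) P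
    = a ^ 2 * gdot f g (scl a b P + c) := by
  simp only [gdot, Finset.mul_sum]
  refine Finset.sum_congr rfl fun k _ => ?_
  rw [pd_bx_scl hf, pd_bx_scl hg]; ring

end scaling

theorem gdot_pow_self {g : SpT N → ℝ} (hg : Sm g) (k : ℕ) (P : SpT N) :
    gdot (fun P => g P ^ k) (fun P => g P ^ k) P = k ^ 2 * (g P ^ (k - 1)) ^ 2 * gdot g g P := by
  simp only [gdot, Finset.mul_sum]
  refine Finset.sum_congr rfl fun i _ => ?_
  rw [pd_pow hg]; ring

theorem lapl_pow {g : SpT N → ℝ} (hg : Sm g) (k : ℕ) (P : SpT N) :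
    lapl (fun P => g P ^ (k + 2)) P = (k + 2) * (k + 1) * g P ^ k * gdot g g P
      + (k + 2) * g P ^ (k + 1) * lapl g P := by
  simp only [lapl, gdot, Finset.mul_sum, ← Finset.sum_add_distrib]
  refine Finset.sum_congr rfl fun i _ => ?_
  have : pd (bx i) (fun P => g P ^ (k + 2))
      = fun P => (((k : ℝ) + 2) * g P ^ (k + 1)) * pd (bx i) g P := by
    funext P; rw [pd_pow hg]; push_cast; rfl
  rw [this, pd_mul ((Sm.const _).mul (hg.pow _)) (hg.pd _), pd_const_mul (hg.pow _), pd_pow hg]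
  push_cast; ring

/-- Powers of smooth bumps are cutoffs. -/
theorem isCut_pow {g : SpT N → ℝ} (hg : Sm g) (hc : HasCompactSupport g) (h0 : ∀ P, 0 ≤ g P)
    (h1 : ∀ P, g P ≤ 1) {L σ : ℝ} (hL : 0 ≤ L) (ht : ∀ P, |pd bt g P| ≤ L)
    (hl : ∀ P, |lapl g P| ≤ L) (hgr : ∀ P, gdot g g P ≤ L) {k : ℕ} (hk0 : k ≠ 0)
    (hk : ((k : ℝ) + 2) * σ ≤ k) :
    IsCut (fun P => g P ^ (k + 2)) (((k : ℝ) + 2) ^ 2 * L) σ := by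
  have hs : ∀ P, g P ^ k ≤ (g P ^ (k + 2)) ^ σ := fun P => by
    rcases eq_or_lt_of_le (h0 P) with h | h
    · rw [← h, zero_pow hk0]; positivity
    · rw [← rpow_natCast (g P) k, ← rpow_natCast (g P) (k + 2), ← rpow_mul h.le]
      refine rpow_le_rpow_of_exponent_ge h (h1 P) ?_
      push_cast; linarith
  have hk1 : ∀ P, g P ^ (k + 1) ≤ g P ^ k := fun P =>
    pow_le_pow_of_le_one (h0 P) (h1 P) (Nat.le_succ k)
  refine ⟨hg.pow _, hc.comp_left (g := fun x => x ^ (k + 2)) (by simp), fun P => pow_nonneg (h0 P) _,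
    fun P => pow_le_one₀ (h0 P) (h1 P), by positivity, fun P => ?_, fun P => ?_, fun P => ?_⟩
  · rw [pd_pow hg, abs_mul, abs_of_nonneg (mul_nonneg (by positivity) (pow_nonneg (h0 P) _))]
    have e : k + 2 - 1 = k + 1 := rfl
    rw [e]
    push_cast
    calc ((k : ℝ) + 2) * g P ^ (k + 1) * |pd bt g P| ≤ ((k : ℝ) + 2) * g P ^ k * L := by
          have := pow_nonneg (h0 P) k
          refine mul_le_mul (mul_le_mul_of_nonneg_left (hk1 P) (by positivity)) (ht P)
            (abs_nonneg _) (by positivity)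
      _ ≤ ((k : ℝ) + 2) ^ 2 * L * g P ^ k := by
          have : 0 ≤ L * g P ^ k := mul_nonneg hL (pow_nonneg (h0 P) _)
          nlinarith [(Nat.cast_nonneg k : (0:ℝ) ≤ k), mul_nonneg (Nat.cast_nonneg k : (0:ℝ) ≤ k) this]
      _ ≤ _ := mul_le_mul_of_nonneg_left (hs P) (by positivity)
  · rw [lapl_pow hg]
    have hG := gdot_self_nonneg g P
    have hp := pow_nonneg (h0 P) k
    have hp1 := pow_nonneg (h0 P) (k + 1)
    calc |((k : ℝ) + 2) * (k + 1) * g P ^ k * gdot g g P + (k + 2) * g P ^ (k + 1) * lapl g P|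
        ≤ ((k : ℝ) + 2) * (k + 1) * g P ^ k * gdot g g P
          + (k + 2) * g P ^ (k + 1) * |lapl g P| := by
          refine (abs_add_le _ _).trans (add_le_add (le_of_eq (abs_of_nonneg (by positivity)))
            (le_of_eq ?_))
          rw [abs_mul, abs_of_nonneg (by positivity)]
      _ ≤ ((k : ℝ) + 2) * (k + 1) * g P ^ k * L + (k + 2) * g P ^ k * L := by
          refine add_le_add (mul_le_mul_of_nonneg_left (hgr P) (by positivity)) ?_
          exact mul_le_mul (mul_le_mul_of_nonneg_left (hk1 P) (by positivity)) (hl P)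
            (abs_nonneg _) (by positivity)
      _ = ((k : ℝ) + 2) ^ 2 * L * g P ^ k := by ring
      _ ≤ _ := mul_le_mul_of_nonneg_left (hs P) (by positivity)
  · rw [gdot_pow_self hg]
    have e : k + 2 - 1 = k + 1 := rfl
    rw [e]
    push_cast
    have hp := pow_nonneg (h0 P) k
    have hp2 := pow_nonneg (h0 P) (k + 2)
    calc ((k : ℝ) + 2) ^ 2 * (g P ^ (k + 1)) ^ 2 * gdot g g P
        ≤ ((k : ℝ) + 2) ^ 2 * (g P ^ (k + 1)) ^ 2 * L := by gcongr; exact hgr P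
      _ = ((k : ℝ) + 2) ^ 2 * L * g P ^ (k + 2) * g P ^ k := by ring
      _ ≤ _ := mul_le_mul_of_nonneg_left (hs P) (by positivity)

theorem exists_abs_bound {f : SpT N → ℝ} (hf : Continuous f) (hc : HasCompactSupport f) :
    ∃ L : ℝ, 0 ≤ L ∧ ∀ P, |f P| ≤ L := by
  obtain ⟨L, hL⟩ := hc.exists_bound_of_continuous hf
  exact ⟨L, (norm_nonneg _).trans (hL 0), hL⟩

theorem HasCompactSupport.lapl_of {f : SpT N → ℝ} (hc : HasCompactSupport f) :
    HasCompactSupport (lapl f) :=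
  hc.mono' fun P hP => by
    by_contra h
    exact hP (lapl_eq_zero h)

theorem HasCompactSupport.gdot_of {f : SpT N → ℝ} (hc : HasCompactSupport f) (g : SpT N → ℝ) :
    HasCompactSupport (gdot f g) :=
  hc.mono' fun P hP => by
    by_contra h
    exact hP (gdot_eq_zero h g)

/-- Parabolic boxes. -/
def pbox (N : ℕ) (R : ℝ) : Set (SpT N) := {P | ‖P.1‖ ≤ R ∧ |P.2| ≤ R ^ 2}

theorem pbox_eq (N : ℕ) (R : ℝ) :
    pbox N R = closedBall (0 : Sp N) R ×ˢ Icc (-R ^ 2) (R ^ 2) := by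
  ext P; simp [pbox, abs_le]

theorem isCompact_pbox (R : ℝ) : IsCompact (pbox N R) := by
  rw [pbox_eq]; exact (isCompact_closedBall _ _).prod isCompact_Icc

theorem volume_pbox {R : ℝ} (hR : 0 ≤ R) : (volume (pbox N R)).toReal
    = 2 * (volume (ball (0 : Sp N) 1)).toReal * R ^ (N + 2) := by
  rw [pbox_eq, Measure.volume_eq_prod, Measure.prod_prod, Real.volume_Icc,
    Measure.addHaar_closedBall volume _ hR, finrank_euclideanSpace_fin, ENNReal.toReal_mul,
    ENNReal.toReal_mul, ENNReal.toReal_ofReal (by positivity),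
    ENNReal.toReal_ofReal (by nlinarith [sq_nonneg R])]
  ring

theorem pbox_mono {a b : ℝ} (ha : 0 ≤ a) (hab : a ≤ b) : pbox N a ⊆ pbox N b := fun P hP =>
  ⟨hP.1.trans hab, hP.2.trans (by gcongr)⟩

/-- A scaled family of cutoffs. -/
theorem exists_cut (N : ℕ) {σ : ℝ} (hσ : σ < 1) : ∃ C : ℝ, 0 ≤ C ∧ ∀ R : ℝ, 0 < R →
    ∃ φ : SpT N → ℝ, IsCut φ (C / R ^ 2) σ ∧ (∀ P ∈ pbox N R, φ P = 1) ∧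
      tsupport φ ⊆ pbox N (2 * R) := by
  obtain ⟨g, hg, hc, h0, h1, he, hsupp⟩ := exists_bump (E := SpT N) one_pos one_lt_two
  obtain ⟨L1, hL1, ht⟩ := exists_abs_bound (hg.pd bt).cont (hc.pd_of bt)
  obtain ⟨L2, hL2, hl⟩ := exists_abs_bound hg.lapl.cont hc.lapl_of
  obtain ⟨L3, hL3, hgr⟩ := exists_abs_bound (hg.gdot hg).cont (hc.gdot_of g)
  set L := L1 + L2 + L3
  obtain ⟨k, hk⟩ := exists_nat_ge (max 1 (2 * σ / (1 - σ)))
  have hk1 : (1:ℝ) ≤ k := (le_max_left _ _).trans hk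
  have hk2 := (le_max_right _ _).trans hk
  rw [div_le_iff₀ (by linarith)] at hk2
  refine ⟨((k : ℝ) + 2) ^ 2 * L, by positivity, fun R hR => ?_⟩
  set S : SpT N →L[ℝ] SpT N := scl R⁻¹ (R ^ 2)⁻¹
  set G : SpT N → ℝ := fun P => g (S P + 0) with hG
  have hGs : Sm G := hg.comp_clm S 0
  have hRi : (R⁻¹) ^ 2 = (R ^ 2)⁻¹ := inv_pow _ _
  have hsub : tsupport G ⊆ pbox N (2 * R) := by
    refine closure_minimal (fun P hP => ?_) (isCompact_pbox _).isClosed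
    have h3 := hsupp (subset_tsupport _ hP)
    rw [mem_closedBall_zero_iff, add_zero, scl_apply, Prod.norm_mk, max_le_iff, norm_smul,
      norm_mul, norm_inv, norm_inv, norm_of_nonneg hR.le, norm_of_nonneg (sq_nonneg R),
      inv_mul_le_iff₀ hR, inv_mul_le_iff₀ (by positivity)] at h3
    refine ⟨by linarith [h3.1], ?_⟩
    have := h3.2
    rw [norm_eq_abs] at this
    nlinarith [sq_nonneg R]
  have hGc : HasCompactSupport G := (isCompact_pbox _).of_isClosed_subset (isClosed_tsupport _) hsub
  have hR2 : 0 < (R ^ 2)⁻¹ := by positivity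
  have cut := isCut_pow (σ := σ) (L := L / R ^ 2) hGs hGc (fun P => h0 _) (fun P => h1 _)
    (by positivity)
    (fun P => by
      rw [pd_bt_scl hg, abs_mul, abs_of_pos hR2, div_eq_inv_mul]
      exact mul_le_mul_of_nonneg_left ((ht _).trans (by linarith)) hR2.le)
    (fun P => by
      rw [lapl_scl hg, abs_mul, hRi, abs_of_pos hR2, div_eq_inv_mul]
      exact mul_le_mul_of_nonneg_left ((hl _).trans (by linarith)) hR2.le)
    (fun P => by
      rw [gdot_scl hg hg, hRi, div_eq_inv_mul]
      exact mul_le_mul_of_nonneg_left ((le_abs_self _).trans ((hgr _).trans (by linarith))) hR2.le)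
    (k := k) (by rintro rfl; norm_num at hk1) (by linarith)
  refine ⟨_, (mul_div_assoc _ L _).symm ▸ cut, fun P hP => ?_, ?_⟩
  · have : G P = 1 := he _ (by
      rw [add_zero, scl_apply, Prod.norm_mk, max_le_iff, norm_smul, norm_mul, norm_inv, norm_inv,
        norm_of_nonneg hR.le, norm_of_nonneg (sq_nonneg R), inv_mul_le_iff₀ hR,
        inv_mul_le_iff₀ (by positivity), mul_one, mul_one]
      exact hP)
    simp [this]
  · refine (closure_mono fun P hP => ?_).trans hsub
    exact fun h => hP (by simp [h])

variable {N m : ℕ} {β : Fin m → Fin m → ℝ} {r : ℝ}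

theorem exists_rpow_le (A R₀ : ℝ) {s η : ℝ} (hs : s < 0) (hη : 0 < η) :
    ∃ R : ℝ, R₀ ≤ R ∧ A * R ^ s ≤ η := by
  have h := (tendsto_rpow_neg_atTop (y := -s) (by linarith)).const_mul A
  rw [mul_zero, neg_neg] at h
  obtain ⟨R, h1, h2⟩ := ((h.eventually (gt_mem_nhds hη)).and (eventually_ge_atTop R₀)).exists
  exact ⟨R, h2, h1.le⟩

/-- Smallness of integral norms for approximate positive solutions on large boxes. -/
def IntegralSmall (N : ℕ) (β : Fin m → Fin m → ℝ) (r M q : ℝ) : Prop :=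
  ∀ η : ℝ, 0 < η → ∃ R : ℝ, 1 ≤ R ∧ ∃ ε : ℝ, 0 < ε ∧ ∀ V : Fin m → SpT N → ℝ,
    (∀ i, Sm (V i)) → (∀ i P, 0 < V i P) →
    (∀ P ∈ pbox N R, ∀ i, V i P ≤ M ∧ |heat (V i) P - nlf β r V i P| ≤ ε) →
    ∫ P in pbox N 1, ∑ i, V i P ^ q ≤ η

theorem setIntegral_le_cut {φ g : SpT N → ℝ} {R : ℝ} (hR : 1 ≤ R) (hφ : Continuous φ)
    (hc : HasCompactSupport φ) (h0 : ∀ P, 0 ≤ φ P)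
    (h1 : ∀ P ∈ pbox N R, φ P = 1) (hg : Continuous g) (hg0 : ∀ P, 0 ≤ g P) :
    ∫ P in pbox N 1, g P ≤ ∫ P, φ P * g P := by
  have hi : Integrable (fun P => φ P * g P) :=
    (hφ.mul hg).integrable_of_hasCompactSupport hc.mul_right
  have hm : MeasurableSet (pbox N 1) := (isCompact_pbox 1).measurableSet
  calc ∫ P in pbox N 1, g P = ∫ P in pbox N 1, φ P * g P :=
        setIntegral_congr_fun hm fun P hP => by
          simp [h1 P (pbox_mono zero_le_one hR hP)]
    _ ≤ _ := setIntegral_le_integral hi (Eventually.of_forall fun P => mul_nonneg (h0 P) (hg0 P))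

theorem integralSmall_high (hN : 3 ≤ N) (hr : 0 < r) (hsym : ∀ i j, β i j = β j i)
    (hβ : ∀ i j, 0 ≤ β i j) {b0 : ℝ} (hb0 : 0 < b0) (hdiag : ∀ i, b0 ≤ β i i)
    (hpB : 2 * r + 1 < ((N : ℝ) * (N + 2)) / ((N : ℝ) - 1) ^ 2) (M : ℝ) :
    IntegralSmall N β r M (2 * (2 * r + 1)) := by
  have hN3 : (3:ℝ) ≤ N := by exact_mod_cast hN
  have hN0 : (0:ℝ) < N := by linarith
  rw [lt_div_iff₀ (by nlinarith)] at hpB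
  obtain ⟨κ, hκ1, hκ2⟩ : ∃ κ : ℝ, (2 * r + 1) * (N - 1) / (N + 2) < κ ∧ κ < N / (N - 1) := by
    refine exists_between ?_
    rw [div_lt_div_iff₀ (by linarith) (by linarith)]
    nlinarith
  have hκ0 : 0 < κ := lt_trans (by
    have : (0:ℝ) < N - 1 := by linarith
    positivity) hκ1
  obtain ⟨C, hC, H⟩ := integral_high (N := N) (by omega) hr hsym hβ hb0 hdiag hκ0 (by
      rw [div_lt_iff₀ (by linarith)] at hκ1
      have : κ * (1 + 2 / N) = κ * (N + 2) / N := by field_simp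
      rw [this, lt_div_iff₀ hN0]
      have : (2 * r + 1) * (1 - 1 / (N:ℝ)) * N = (2 * r + 1) * (N - 1) := by field_simp
      rw [this]; exact hκ1) (by
      rw [lt_div_iff₀ (by linarith)] at hκ2
      have : κ * (1 - 1 / (N:ℝ)) = κ * (N - 1) / N := by field_simp
      rw [this, div_lt_one hN0]; exact hκ2)
  set p := 2 * r + 1 with hp
  have hp1 : 1 < p := by linarith
  have hσ : (p + 1) / (2 * p) < 1 := by rw [div_lt_one (by linarith)]; linarith
  obtain ⟨C1, hC1, cut⟩ := exists_cut N hσ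
  set e := 2 * p / (p - 1) with he
  have he2 : -(2 * e) + (N + 2 : ℝ) < 0 := by
    have : (N + 2 : ℝ) * (p - 1) < 2 * (2 * p) := by
      have h1 : p * ((N:ℝ) - 2) < N + 2 := by
        by_contra h
        push Not at h
        have : N * (N + 2) * ((N:ℝ) - 2) ≤ (N + 2) * (N * (N - 2)) := by linarith
        nlinarith [mul_le_mul_of_nonneg_right h (by linarith : (0:ℝ) ≤ N)]
      nlinarith
    have h2 : (N + 2 : ℝ) < 2 * (2 * p) / (p - 1) := by
      rw [lt_div_iff₀ (by linarith)]; exact this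
    have : 2 * e = 2 * (2 * p) / (p - 1) := by rw [he]; ring
    linarith
  intro η hη
  set c := 2 * (volume (ball (0 : Sp N) 1)).toReal with hc
  have hc0 : 0 ≤ c := by positivity
  obtain ⟨R, hR, hRη⟩ := exists_rpow_le (C * C1 ^ e * c * 2 ^ (N + 2)) 1 he2 (half_pos hη)
  have hR0 : 0 < R := by linarith
  set W := C * c * (2 * R) ^ (N + 2) with hW
  have hW0 : 0 ≤ W := by positivity
  set ε := √(η / 2 / (W + 1)) with hε
  have hε0 : 0 < ε := by positivity
  refine ⟨2 * R, by linarith, ε, hε0, fun V hV hVp hVe => ?_⟩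
  obtain ⟨φ, hφ, hφ1, hsupp⟩ := cut R hR0
  have h1 := H φ (C1 / R ^ 2) ε V hφ hV hVp fun P hP i => (hVe P (hsupp hP) i).2
  have h2 := setIntegral_le_cut (g := fun P => ∑ i, (V i P ^ p) ^ 2) hR hφ.sm.cont hφ.cs
    hφ.nonneg hφ1 (Sm.sum fun i _ => ((hV i).rpow (hVp i) p).pow 2).cont
    (fun P => Finset.sum_nonneg fun i _ => sq_nonneg _)
  have h3 : ∀ P, ∑ i, V i P ^ (2 * p) = ∑ i, (V i P ^ p) ^ 2 := fun P =>
    Finset.sum_congr rfl fun i _ => by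
      rw [← rpow_natCast, ← rpow_mul (hVp i P).le]; congr 1; push_cast; ring
  simp only [h3]
  refine (h2.trans h1).trans ?_
  have h4 : (volume (tsupport φ)).toReal ≤ c * (2 * R) ^ (N + 2) := by
    rw [← volume_pbox (N := N) (R := 2 * R) (by linarith)]
    exact ENNReal.toReal_mono (isCompact_pbox _).measure_lt_top.ne (measure_mono hsupp)
  have h5 : (C1 / R ^ 2) ^ e = C1 ^ e * R ^ (-(2 * e)) := by
    rw [div_rpow hC1 (by positivity), rpow_neg hR0.le, div_eq_mul_inv, rpow_mul hR0.le]
    norm_num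
  calc _ ≤ C * ((C1 / R ^ 2) ^ e + ε ^ 2) * (c * (2 * R) ^ (N + 2)) :=
        mul_le_mul_of_nonneg_left h4 (by positivity)
    _ = C * C1 ^ e * c * 2 ^ (N + 2) * R ^ (-(2 * e) + (N + 2 : ℝ)) + ε ^ 2 * W := by
        rw [rpow_add hR0, h5, show ((N : ℝ) + 2) = ((N + 2 : ℕ) : ℝ) by push_cast; rfl,
          rpow_natCast, hW, mul_pow]
        ring
    _ ≤ η / 2 + η / 2 := by
        refine add_le_add hRη ?_
        rw [hε, sq_sqrt (by positivity), div_mul_eq_mul_div, div_le_iff₀ (by linarith)]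
        have : 0 < η / 2 := by positivity
        nlinarith
    _ = η := by ring

variable {N m : ℕ} {β : Fin m → Fin m → ℝ} {r : ℝ}

/-- `G` is dominated by a null function plus the constant `c` on the support of `φ`. -/
def Dominated (φ G : SpT N → ℝ) (c : ℝ) : Prop :=
  ∃ Z, IsNull volume Z ∧ ∀ P, G P ≤ Z P + (tsupport φ).indicator (fun _ => c) P

namespace Dominated
variable {φ G H : SpT N → ℝ} {c d : ℝ}

theorem add (hG : Dominated φ G c) (hH : Dominated φ H d) :
    Dominated φ (fun P => G P + H P) (c + d) := by
  obtain ⟨Z, hZ, h⟩ := hG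
  obtain ⟨Y, hY, h'⟩ := hH
  refine ⟨_, hZ.add hY, fun P => ?_⟩
  have : (tsupport φ).indicator (fun _ => c + d) P = (tsupport φ).indicator (fun _ => c) P
    + (tsupport φ).indicator (fun _ => d) P := by
    by_cases hP : P ∈ tsupport φ <;> simp [hP]
  linarith [h P, h' P]

theorem const_mul {a : ℝ} (ha : 0 ≤ a) (hG : Dominated φ G c) :
    Dominated φ (fun P => a * G P) (a * c) := by
  obtain ⟨Z, hZ, h⟩ := hG
  refine ⟨_, hZ.const_mul a, fun P => ?_⟩
  have : (tsupport φ).indicator (fun _ => a * c) P = a * (tsupport φ).indicator (fun _ => c) P := by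
    by_cases hP : P ∈ tsupport φ <;> simp [hP]
  rw [this, ← mul_add]
  exact mul_le_mul_of_nonneg_left (h P) ha

theorem sum {ι : Type*} [Fintype ι] {G : ι → SpT N → ℝ} {c : ℝ}
    (hG : ∀ i, Dominated φ (G i) c) :
    Dominated φ (fun P => ∑ i, G i P) (Fintype.card ι * c) := by
  choose Z hZ h using hG
  refine ⟨_, IsNull.sum (s := Finset.univ) fun i _ => hZ i, fun P => ?_⟩
  refine (Finset.sum_le_sum fun i _ => h i P).trans (le_of_eq ?_)
  rw [Finset.sum_add_distrib]
  congr 1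
  by_cases hP : P ∈ tsupport φ <;> simp [hP]

theorem of_le {Z : SpT N → ℝ} (hZ : IsNull volume Z) (hG : Dominated φ G c)
    (h : ∀ P ∈ tsupport φ, H P ≤ Z P + G P + d) (h0 : ∀ P, P ∉ tsupport φ → H P ≤ Z P + G P) :
    Dominated φ H (c + d) := by
  obtain ⟨Y, hY, h'⟩ := hG
  refine ⟨_, hZ.add hY, fun P => ?_⟩
  have := h' P
  by_cases hP : P ∈ tsupport φ
  · simp only [hP, indicator_of_mem] at this ⊢
    linarith [h P hP]
  · simp only [hP, not_false_eq_true, indicator_of_notMem] at this ⊢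
    linarith [h0 P hP]

theorem zero : Dominated φ (fun _ => 0) 0 :=
  ⟨fun _ => 0, ⟨integrable_zero _ _ _, by simp⟩, fun P => by
    by_cases hP : P ∈ tsupport φ <;> simp [hP]⟩

theorem integral_le (hG : Dominated φ G c) (hi : Integrable G) (hc : HasCompactSupport φ) :
    ∫ P, G P ≤ c * (volume (tsupport φ)).toReal := by
  obtain ⟨Z, hZ, h⟩ := hG
  have hts : MeasurableSet (tsupport φ) := (isClosed_tsupport φ).measurableSet
  have hfin : volume (tsupport φ) ≠ ⊤ := hc.isCompact.measure_lt_top.ne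
  refine (integral_le_of_null hi ((integrable_indicator_iff hts).2 (integrableOn_const hfin)) hZ
    h).trans (le_of_eq ?_)
  rw [integral_indicator_const _ hts, smul_eq_mul, mul_comm]; rfl

end Dominated

theorem isNull_weak {φ V : SpT N → ℝ} (hφ : Sm φ) (hc : HasCompactSupport φ) (hV : Sm V) :
    IsNull volume (fun P => φ P * heat V P + V P * (pd bt φ P + lapl φ P)) := by
  have h1 := isNull_pd_mul hφ hc hV bt
  have h2 := isNull_div_grad hφ hc (Sm.const 1) hV
  have h3 : IsNull volume (fun P => ∑ k, (pd (bx k) (pd (bx k) φ) P * V P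
      + pd (bx k) φ P * pd (bx k) V P)) :=
    IsNull.sum fun k _ => isNull_pd_mul (hφ.pd _) (hc.pd_of _) hV (bx k)
  convert (h1.sub h2).add h3 using 2 with P
  have h4 : gdot (fun _ => (1:ℝ)) V P = 0 := by simp [gdot, pd_const]
  rw [heat_eq, Finset.sum_add_distrib, ← Finset.sum_mul, h4]
  have : ∑ k, pd (bx k) (pd (bx k) φ) P = lapl φ P := rfl
  rw [this]
  have : ∑ k, pd (bx k) φ P * pd (bx k) V P = gdot φ V P := rfl
  rw [this]; ring

theorem heat_sq {V : SpT N → ℝ} (hV : Sm V) (P : SpT N) :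
    heat (fun P => V P ^ 2) P = 2 * V P * heat V P - 2 * gdot V V P := by
  have := lapl_pow hV 0 P
  rw [heat_eq, heat_eq, this, pd_pow hV]
  simp; ring

theorem cut_term_le {φ σ Λ y p C : ℝ} (hp : 1 < p) (hσ : 1 / p ≤ σ) (h0 : 0 ≤ φ) (h1 : φ ≤ 1)
    (hΛ : 0 ≤ Λ) (hy : 0 ≤ y) {η : ℝ}
    (hC : ∀ Λ y : ℝ, 0 ≤ Λ → 0 ≤ y → Λ * y ^ (1 / p) ≤ η * y + C * Λ ^ (1 / (1 - 1 / p))) :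
    Λ * φ ^ σ * y ≤ η * (φ * y ^ p) + C * Λ ^ (1 / (1 - 1 / p)) := by
  refine le_trans ?_ (hC Λ (φ * y ^ p) hΛ (by positivity))
  have : (φ * y ^ p) ^ (1 / p) = φ ^ (1 / p) * y := by
    rw [mul_rpow h0 (by positivity), ← rpow_mul hy, mul_one_div_cancel (by linarith), rpow_one]
  rw [this, ← mul_assoc]
  gcongr ?_ * y
  refine mul_le_mul_of_nonneg_left ?_ hΛ
  rcases eq_or_lt_of_le h0 with h | h
  · rw [← h, zero_rpow, zero_rpow]
    · have : 0 < 1 / p := by positivity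
      exact this.ne'
    · have : 0 < 1 / p := by positivity
      linarith
  · exact rpow_le_rpow_of_exponent_ge h h1 hσ

section low
variable (hr : 0 < r) (hsym : ∀ i j, β i j = β j i) (hβ : ∀ i j, 0 ≤ β i j) {b0 : ℝ}
  (hb0 : 0 < b0) (hdiag : ∀ i, b0 ≤ β i i) {M : ℝ} (hM : 0 ≤ M)
include hr hβ hb0 hdiag

theorem dominated_pow {σ : ℝ} (hσ : 1 / (2 * r + 1) ≤ σ) :
    ∃ C : ℝ, 0 ≤ C ∧ ∀ (φ : SpT N → ℝ) (Λ ε : ℝ) (V : Fin m → SpT N → ℝ),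
      IsCut φ Λ σ → (∀ i, Sm (V i)) → (∀ i P, 0 < V i P) → 0 ≤ ε →
      (∀ P ∈ tsupport φ, ∀ i, |heat (V i) P - nlf β r V i P| ≤ ε) →
      Dominated φ (fun P => φ P * ∑ i, V i P ^ (2 * r + 1))
        (C * (Λ ^ (1 / (1 - 1 / (2 * r + 1))) + ε)) := by
  set p := 2 * r + 1 with hp
  have hp1 : 1 < p := by linarith
  obtain ⟨C, hC, hY⟩ := young_small (s := 1 / p) (η := b0 / 4) (by positivity)
    (by rw [div_lt_one (by linarith)]; exact hp1) (by positivity)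
  refine ⟨m * (2 / b0 * (2 * C + 1)), by positivity, fun φ Λ ε V hφ hV hVp hε0 hε => ?_⟩
  set E := Λ ^ (1 / (1 - 1 / p))
  have hE : 0 ≤ E := rpow_nonneg hφ.Λ0 _
  have h : ∀ i, Dominated φ (fun P => φ P * V i P ^ p) (2 / b0 * (2 * C + 1) * (E + ε)) :=
      fun i => by
    have hd := Dominated.of_le (H := fun P => b0 / 2 * (φ P * V i P ^ p)) (φ := φ)
      (G := fun _ => 0) (c := 0) (d := 2 * C * E + ε) (isNull_weak hφ.sm hφ.cs (hV i)) Dominated.zero (fun P hP => ?_)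
      (fun P hP => ?_)
    · obtain ⟨Z, hZ, hd⟩ := hd.const_mul (a := 2 / b0) (by positivity)
      refine ⟨Z, hZ, fun P => ?_⟩
      have h1 := hd P
      beta_reduce at h1 ⊢
      have h2 : 2 / b0 * (b0 / 2 * (φ P * V i P ^ p)) = φ P * V i P ^ p := by field_simp
      rw [h2] at h1
      have h3 : 2 / b0 * (0 + (2 * C * E + ε)) ≤ 2 / b0 * (2 * C + 1) * (E + ε) := by
        rw [zero_add, mul_assoc (2 / b0)]
        refine mul_le_mul_of_nonneg_left ?_ (by positivity)
        nlinarith [mul_nonneg hC hε0]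
      by_cases hP : P ∈ tsupport φ
      · simp only [hP, indicator_of_mem] at h1 ⊢
        linarith
      · simp only [hP, not_false_eq_true, indicator_of_notMem] at h1 ⊢
        linarith
    · have h1 := (mul_le_mul_of_nonneg_right (hdiag i)
        (rpow_nonneg (hVp i P).le _)).trans (le_nl hr hβ (fun j => (hVp j P).le) i)
      have h2 := hε P hP i
      rw [abs_le] at h2
      have hf : nlf β r V i P = nl β r (fun j => V j P) i := rfl
      have hφ0 := hφ.nonneg P
      have h3 := mul_le_mul_of_nonneg_left h1 hφ0
      have h4 := mul_le_mul_of_nonneg_left h2.1 hφ0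
      have h5 := cut_term_le hp1 hσ hφ0 (hφ.le_one P) hφ.Λ0 (hVp i P).le hY
      have h6 : φ P * ε ≤ ε := mul_le_of_le_one_left hε0 (hφ.le_one P)
      have h7 := mul_le_mul_of_nonneg_left ((neg_abs_le _).trans' (neg_le_neg (hφ.dt P)))
        (hVp i P).le
      have h8 := mul_le_mul_of_nonneg_left ((neg_abs_le _).trans' (neg_le_neg (hφ.lap P)))
        (hVp i P).le
      rw [hf] at h4
      linarith
    · have h1 : φ P = 0 := image_eq_zero_of_notMem_tsupport hP
      simp [h1, lapl_eq_zero hP, pd_eq_zero_of_notMem P hP]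
  have := Dominated.sum h
  simp only [Fintype.card_fin] at this
  convert this using 1
  · ext P; rw [Finset.mul_sum]
  · ring
end low

section low
variable {N m : ℕ} {β : Fin m → Fin m → ℝ} {r : ℝ}
variable (hr : 0 < r) (hsym : ∀ i j, β i j = β j i) (hβ : ∀ i j, 0 ≤ β i j) {b0 : ℝ}
  (hb0 : 0 < b0) (hdiag : ∀ i, b0 ≤ β i i) {M : ℝ} (hM : 0 ≤ M)
include hr hβ hb0 hdiag hM

theorem dominated_grad {σ : ℝ} (hσ : 1 / (2 * r + 1) ≤ σ) :
    ∃ C : ℝ, 0 ≤ C ∧ ∀ (φ : SpT N → ℝ) (Λ ε : ℝ) (V : Fin m → SpT N → ℝ),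
      IsCut φ Λ σ → (∀ i, Sm (V i)) → (∀ i P, 0 < V i P) → 0 ≤ ε →
      (∀ P ∈ tsupport φ, ∀ i, V i P ≤ M ∧ |heat (V i) P - nlf β r V i P| ≤ ε) →
      Dominated φ (fun P => φ P * ∑ i, gdot (V i) (V i) P)
        (C * (Λ ^ (1 / (1 - 1 / (2 * r + 1))) + ε)) := by
  obtain ⟨C1, hC1, H1⟩ := dominated_pow (N := N) hr hβ hb0 hdiag hσ
  set p := 2 * r + 1 with hp
  have hp1 : 1 < p := by linarith
  obtain ⟨C, hC, hY⟩ := young_small (s := 1 / p) (η := 1) (by positivity)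
    (by rw [div_lt_one (by linarith)]; exact hp1) (by positivity)
  have hB := bsum_nonneg hβ
  refine ⟨m * ((2 * bsum β + 1) * M * C1 + (M * C + M)), by positivity,
    fun φ Λ ε V hφ hV hVp hε0 hε => ?_⟩
  have hE : 0 ≤ Λ ^ (1 / (1 - 1 / p)) := rpow_nonneg hφ.Λ0 _
  set E := Λ ^ (1 / (1 - 1 / p)) with hE'
  have hS := H1 φ Λ ε V hφ hV hVp hε0 fun P hP i => (hε P hP i).2
  have h : ∀ i, Dominated φ (fun P => φ P * gdot (V i) (V i) P)
      (((2 * bsum β + 1) * M) * (C1 * (E + ε)) + (M * C * E + M * ε)) := fun i => by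
    refine Dominated.of_le ((isNull_weak hφ.sm hφ.cs ((hV i).pow 2)).const_mul (-1 / 2))
      (hS.const_mul (a := (2 * bsum β + 1) * M) (by positivity)) (fun P hP => ?_) (fun P hP => ?_)
    · have hv0 := (hVp i P).le
      have hφ0 := hφ.nonneg P
      have hVM := (hε P hP i).1
      set S := ∑ j, V j P ^ p with hSdef
      have hVS : ∀ j, V j P ^ p ≤ S := fun j => Finset.single_le_sum
        (f := fun j => V j P ^ p) (fun j _ => rpow_nonneg (hVp j P).le _) (Finset.mem_univ j)
      have hS0 : 0 ≤ S := (rpow_nonneg hv0 _).trans (hVS i)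
      have h1 : nlf β r V i P ≤ 2 * bsum β * S := nl_le hr hβ (fun j => (hVp j P).le) hVS i
      have h2 := (abs_le.1 (hε P hP i).2).2
      have h3 : V i P * heat (V i) P ≤ M * (2 * bsum β * S) + M * ε := by
        have : 0 ≤ 2 * bsum β * S + ε := by positivity
        nlinarith [mul_le_mul_of_nonneg_left (show heat (V i) P ≤ 2 * bsum β * S + ε by linarith)
          hv0, mul_le_mul_of_nonneg_right hVM this]
      have h3' := mul_le_mul_of_nonneg_left h3 hφ0
      have h6 : φ P * (M * ε) ≤ M * ε :=
        mul_le_of_le_one_left (by positivity) (hφ.le_one P)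
      have h5 := cut_term_le hp1 hσ hφ0 (hφ.le_one P) hφ.Λ0 hv0 hY
      have h7 := le_abs_self _ |>.trans (hφ.dt P)
      have h8 := le_abs_self _ |>.trans (hφ.lap P)
      have h9 : V i P ^ 2 * (pd bt φ P + lapl φ P) ≤ 2 * M * (Λ * φ P ^ σ * V i P) := by
        have : 0 ≤ Λ * φ P ^ σ * V i P :=
          mul_nonneg (mul_nonneg hφ.Λ0 (rpow_nonneg hφ0 _)) hv0
        nlinarith [mul_le_mul_of_nonneg_left (add_le_add h7 h8) (sq_nonneg (V i P)),
          mul_le_mul_of_nonneg_right hVM this]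
      have h10 : M * (Λ * φ P ^ σ * V i P) ≤ M * (φ P * S + C * E) := by
        refine mul_le_mul_of_nonneg_left (h5.trans ?_) hM
        have := mul_le_mul_of_nonneg_left (hVS i) hφ0
        linarith
      rw [heat_sq (hV i)]
      linarith
    · have h1 : φ P = 0 := image_eq_zero_of_notMem_tsupport hP
      simp [h1, lapl_eq_zero hP, pd_eq_zero_of_notMem P hP]
  obtain ⟨Z, hZ, h⟩ := Dominated.sum h
  refine ⟨Z, hZ, fun P => ?_⟩
  have h1 := h P
  have h3 : m * ((2 * bsum β + 1) * M * (C1 * (E + ε)) + (M * C * E + M * ε)) ≤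
      m * ((2 * bsum β + 1) * M * C1 + (M * C + M)) * (E + ε) := by
    rw [mul_assoc (m:ℝ)]
    refine mul_le_mul_of_nonneg_left ?_ (by positivity)
    nlinarith [mul_nonneg (mul_nonneg hM hC) hε0, mul_nonneg hM hE]
  beta_reduce
  rw [Finset.mul_sum]
  simp only [Fintype.card_fin] at h1
  by_cases hP : P ∈ tsupport φ
  · simp only [hP, indicator_of_mem] at h1 ⊢
    linarith
  · simp only [hP, not_false_eq_true, indicator_of_notMem] at h1 ⊢
    linarith

include hsym in
theorem dominated_dt {σ : ℝ} (hσ : 1 / (2 * r + 1) ≤ σ) :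
    ∃ C : ℝ, 0 ≤ C ∧ ∀ (φ : SpT N → ℝ) (Λ ε : ℝ) (V : Fin m → SpT N → ℝ),
      IsCut φ Λ σ → (∀ i, Sm (V i)) → (∀ i P, 0 < V i P) → 0 ≤ ε →
      (∀ P ∈ tsupport φ, ∀ i, V i P ≤ M ∧ |heat (V i) P - nlf β r V i P| ≤ ε) →
      Dominated φ (fun P => φ P ^ 2 * ∑ i, pd bt (V i) P ^ 2)
        (C * (Λ * (Λ ^ (1 / (1 - 1 / (2 * r + 1))) + ε) + ε ^ 2)) := by
  obtain ⟨C1, hC1, H1⟩ := dominated_pow (N := N) hr hβ hb0 hdiag hσ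
  obtain ⟨C2, hC2, H2⟩ := dominated_grad (N := N) hr hβ hb0 hdiag hM hσ
  set p := 2 * r + 1 with hp
  have hp1 : 1 < p := by linarith
  have hB := bsum_nonneg hβ
  refine ⟨10 * C2 + 8 * bsum β * M * C1 + 2 * m, by positivity,
    fun φ Λ ε V hφ hV hVp hε0 hε => ?_⟩
  have hE : 0 ≤ Λ ^ (1 / (1 - 1 / p)) := rpow_nonneg hφ.Λ0 _
  set E := Λ ^ (1 / (1 - 1 / p)) with hE'
  have hS := H1 φ Λ ε V hφ hV hVp hε0 fun P hP i => (hε P hP i).2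
  have hG := H2 φ Λ ε V hφ hV hVp hε0 hε
  have hΛ := hφ.Λ0
  have hc2 : HasCompactSupport (fun P => φ P ^ 2) := by
    simp only [pow_two]
    exact hφ.cs.mul_right
  have hN3 := IsNull.sum (s := Finset.univ) fun i (_ : i ∈ Finset.univ) =>
    isNull_dt_grad (hφ.sm.pow 2) hc2 (hV i)
  have hN4 := isNull_pd_mul (hφ.sm.pow 2) hc2 (sm_pot (β := β) (r := r) hV hVp) bt
  have hgp : ∀ i P, gdot (fun P => φ P ^ 2) (V i) P = 2 * φ P * gdot φ (V i) P := fun i P => by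
    simp only [gdot, pd_pow hφ.sm, Finset.mul_sum]
    refine Finset.sum_congr rfl fun k _ => ?_
    simp; try ring
  have hbp : ∀ P, pd bt (fun P => φ P ^ 2) P = 2 * φ P * pd bt φ P := fun P => by
    rw [pd_pow hφ.sm]; simp; try ring
  obtain ⟨Z, hZ, h⟩ : Dominated φ (fun P => φ P ^ 2 * ∑ i, pd bt (V i) P ^ 2)
      (10 * Λ * (C2 * (E + ε)) + 8 * Λ * bsum β * M * (C1 * (E + ε)) + 2 * m * ε ^ 2) := by
    refine Dominated.of_le ((hN3.add hN4).const_mul 2)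
      ((hG.const_mul (a := 10 * Λ) (by positivity)).add
        (hS.const_mul (a := 8 * Λ * bsum β * M) (by positivity))) (fun P hP => ?_) (fun P hP => ?_)
    · have hφ0 := hφ.nonneg P
      have hφ1 := hφ.le_one P
      rw [hbp, pd_pot hr hsym hV hVp]
      set S := ∑ j, V j P ^ p with hSdef
      have hpot : pot β r (fun j => V j P) ≤ 2 * bsum β * (M * S) := by
        refine (pot_le hr hβ fun j => (hVp j P).le).trans ?_
        refine mul_le_mul_of_nonneg_left ?_ (by positivity)
        rw [hSdef, Finset.mul_sum]
        refine Finset.sum_le_sum fun i _ => ?_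
        rw [show 2 * r + 2 = 1 + p by rw [hp]; ring, rpow_add (hVp i P), rpow_one]
        exact mul_le_mul_of_nonneg_right (hε P hP i).1 (rpow_nonneg (hVp i P).le _)
      have hpot0 := pot_nonneg hr hβ fun j => (hVp j P).le
      have hφσ : φ P ^ σ ≤ 1 := rpow_le_one hφ0 hφ1 (le_trans (by positivity) hσ)
      have hφσ0 : 0 ≤ φ P ^ σ := rpow_nonneg hφ0 _
      have hdt : |pd bt φ P| ≤ Λ :=
        (hφ.dt P).trans (mul_le_of_le_one_right hΛ hφσ)
      have hF : -(2 * φ P * pd bt φ P * pot β r (fun j => V j P)) ≤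
          4 * Λ * bsum β * M * (φ P * S) := by
        have h1 : -pd bt φ P * pot β r (fun j => V j P) ≤ Λ * (2 * bsum β * (M * S)) :=
          mul_le_mul (((neg_le_abs _)).trans hdt) hpot hpot0 hΛ
        nlinarith [mul_le_mul_of_nonneg_left h1 hφ0]
      have hi : ∀ i, φ P ^ 2 * pd bt (V i) P ^ 2 ≤
          2 * ((gdot (fun P => φ P ^ 2) (V i) P * pd bt (V i) P
            + φ P ^ 2 * (pd bt (V i) P * lapl (V i) P)
            - 1 / 2 * (2 * φ P * pd bt φ P * gdot (V i) (V i) P)) +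
            φ P ^ 2 * (nlf β r V i P * pd bt (V i) P))
          + 10 * Λ * (φ P * gdot (V i) (V i) P) + 2 * ε ^ 2 := fun i => by
        rw [hgp]
        have h1 := (hε P hP i).2
        rw [heat_eq] at h1
        set e := pd bt (V i) P - lapl (V i) P - nlf β r V i P with he
        have h2 : lapl (V i) P + nlf β r V i P = pd bt (V i) P - e := by rw [he]; ring
        have he2 : e ^ 2 ≤ ε ^ 2 := sq_le_sq' (abs_le.1 h1).1 (abs_le.1 h1).2
        set D := pd bt (V i) P
        set G := gdot (V i) (V i) P
        have hG0 : 0 ≤ G := gdot_self_nonneg _ _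
        have hg2 : gdot φ (V i) P ^ 2 ≤ Λ * (φ P * G) := by
          refine (gdot_sq_le _ _ _).trans ?_
          have := hφ.grad P
          have h3 : gdot φ φ P ≤ Λ * φ P := this.trans
            (mul_le_of_le_one_right (by positivity) hφσ)
          nlinarith [mul_le_mul_of_nonneg_right h3 hG0]
        have h4 : φ P * pd bt φ P * G ≤ Λ * (φ P * G) := by
          nlinarith [mul_le_mul_of_nonneg_right ((le_abs_self _).trans hdt) (mul_nonneg hφ0 hG0)]
        have h5 : φ P ^ 2 * (e * D) ≤ 1 / 4 * (φ P ^ 2 * D ^ 2) + ε ^ 2 := by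
          have : φ P ^ 2 * e ^ 2 ≤ ε ^ 2 :=
            (mul_le_of_le_one_left (sq_nonneg e) (pow_le_one₀ hφ0 hφ1)).trans he2
          nlinarith [sq_nonneg (φ P * (D / 2 - e))]
        have h6 : -(2 * φ P * gdot φ (V i) P * D) ≤
            1 / 4 * (φ P ^ 2 * D ^ 2) + 4 * gdot φ (V i) P ^ 2 := by
          nlinarith [sq_nonneg (φ P * D / 2 + 2 * gdot φ (V i) P)]
        have h7 : φ P ^ 2 * (D * lapl (V i) P) + φ P ^ 2 * (nlf β r V i P * D) =
            φ P ^ 2 * D ^ 2 - φ P ^ 2 * (e * D) := by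
          linear_combination φ P ^ 2 * D * h2
        linarith
      have hs := Finset.sum_le_sum fun i (_ : i ∈ Finset.univ) => hi i
      simp only [Finset.sum_add_distrib, ← Finset.mul_sum, Finset.sum_const, Finset.card_univ,
        Fintype.card_fin, nsmul_eq_mul] at hs ⊢
      linarith
    · have h1 : φ P = 0 := image_eq_zero_of_notMem_tsupport hP
      simp [h1, hgp, hbp]
  refine ⟨Z, hZ, fun P => ?_⟩
  have h1 := h P
  have h3 : 10 * Λ * (C2 * (E + ε)) + 8 * Λ * bsum β * M * (C1 * (E + ε)) + 2 * m * ε ^ 2 ≤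
      (10 * C2 + 8 * bsum β * M * C1 + 2 * m) * (Λ * (E + ε) + ε ^ 2) := by
    have h4 : 0 ≤ (10 * C2 + 8 * bsum β * M * C1) * ε ^ 2 := by positivity
    have h5 : 0 ≤ 2 * m * (Λ * (E + ε)) := by positivity
    linarith
  by_cases hP : P ∈ tsupport φ
  · simp only [hP, indicator_of_mem] at h1 ⊢
    linarith
  · simp only [hP, not_false_eq_true, indicator_of_notMem] at h1 ⊢
    linarith
end low

section
variable {N : ℕ}

theorem sq_sum_of_disjoint {ι : Type*} (s : Finset ι) (y : ι → ℝ)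
    (h : ∀ j ∈ s, ∀ k ∈ s, j ≠ k → y j * y k = 0) : (∑ j ∈ s, y j) * (∑ j ∈ s, y j) = ∑ j ∈ s, y j * y j := by
  rw [Finset.sum_mul_sum]
  refine Finset.sum_congr rfl fun j hj => ?_
  exact Finset.sum_eq_single_of_mem j hj fun k hk hne => h j hj k hk hne.symm

/-- In dimension at most two, balls have vanishing capacity. -/
theorem exists_capacity (hN : N ≤ 2) {δ : ℝ} (hδ : 0 < δ) :
    ∃ (χ G : SpT N → ℝ) (R : ℝ), 1 ≤ R ∧ Sm χ ∧ HasCompactSupport χ ∧ (∀ P, 0 ≤ χ P) ∧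
      (∀ P, χ P ≤ 1) ∧ (∀ P ∈ pbox N 1, χ P = 1) ∧ tsupport χ ⊆ pbox N R ∧ (∀ P, 0 ≤ G P) ∧
      (∀ V P, gdot χ V P ^ 2 ≤ 4 * (χ P * G P) * gdot V V P) ∧ Integrable G ∧ ∫ P, G P ≤ δ := by
  obtain ⟨ζ, hζ, hc, h0, h1, he, hsupp⟩ := exists_bump (E := SpT N) one_pos one_lt_two
  obtain ⟨L, hL, hgr⟩ := exists_abs_bound (hζ.gdot hζ).cont (hc.gdot_of ζ)
  have hz2 : ∀ Q : SpT N, 2 < ‖Q‖ → ζ Q = 0 := fun Q hQ => image_eq_zero_of_notMem_tsupport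
    fun h => by have := hsupp h; rw [mem_closedBall_zero_iff] at this; linarith
  have hp2 : ∀ (Q : SpT N) v, 2 < ‖Q‖ → pd v ζ Q = 0 := fun Q v hQ => pd_eq_zero_of_notMem Q
    (fun h => by have := hsupp h; rw [mem_closedBall_zero_iff] at this; linarith) v
  have hp1 : ∀ (Q : SpT N) v, ‖Q‖ < 1 → pd v ζ Q = 0 := fun Q v hQ => by
    have : ζ =ᶠ[𝓝 Q] fun _ => 1 := by
      filter_upwards [(isOpen_lt continuous_norm continuous_const).mem_nhds hQ] with q hq
      exact he q (le_of_lt hq)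
    rw [pd, this.fderiv_eq]; simp
  set c := L * (4 * (volume (ball (0 : Sp N) 1)).toReal * 2 ^ N) with hcdef
  have hc0 : 0 ≤ c := by positivity
  obtain ⟨n, hn⟩ := exists_nat_gt (c / δ)
  have hn0 : (0:ℝ) < n := lt_of_le_of_lt (by positivity) hn
  set a : ℕ → ℝ := fun j => (1 / 4) ^ j with ha
  have ha0 : ∀ j, 0 < a j := fun j => by positivity
  have ha1 : ∀ j, a j ≤ 1 := fun j => pow_le_one₀ (by norm_num) (by norm_num)
  set Z : ℕ → SpT N → ℝ := fun j P => ζ (scl (a j) 0 P + 0) with hZ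
  set θ : SpT N → ℝ := fun P => ζ (scl 0 1 P + 0) with hθ
  have hZs : ∀ j, Sm (Z j) := fun j => hζ.comp_clm _ _
  have hθs : Sm θ := hζ.comp_clm _ _
  set ξ : SpT N → ℝ := fun P => 1 / n * ∑ j ∈ Finset.range n, Z j P with hξ
  have hξs : Sm ξ := (Sm.const _).mul (Sm.sum fun j _ => hZs j)
  have hpξ : ∀ i P, pd (bx i) ξ P = 1 / n * ∑ j ∈ Finset.range n, a j * pd (bx i) ζ (scl (a j) 0 P + 0) :=
    fun i P => by
      rw [hξ, pd_const_mul (Sm.sum fun j _ => hZs j), pd_sum fun j _ => hZs j]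
      simp only [hZ, pd_bx_scl hζ]
  have hdis : ∀ P : SpT N, ∀ j k, j < k → ∀ v w,
      pd v ζ (scl (a j) 0 P + 0) * pd w ζ (scl (a k) 0 P + 0) = 0 := fun P j k hjk v w => by
    by_contra h
    have h2 : ‖scl (a j) 0 P + 0‖ ≤ 2 := le_of_not_gt fun h' => h (by rw [hp2 _ _ h', zero_mul])
    have h3 : 1 ≤ ‖scl (a k) 0 P + 0‖ := le_of_not_gt fun h' => h (by rw [hp1 _ _ h', mul_zero])
    have h4 : a k ≤ 1 / 4 * a j := by
      simp only [ha]; rw [← pow_succ']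
      exact pow_le_pow_of_le_one (by norm_num) (by norm_num) hjk
    simp only [add_zero, scl_apply, zero_mul, Prod.norm_def, norm_smul, norm_zero,
      Real.norm_of_nonneg (ha0 _).le, max_le_iff, le_max_iff] at h2 h3
    rcases h3 with h3 | h3
    · nlinarith [norm_nonneg P.1]
    · linarith
  have hgξ : ∀ P, gdot ξ ξ P = (1 / n) ^ 2 * ∑ j ∈ Finset.range n, a j ^ 2 * gdot ζ ζ (scl (a j) 0 P + 0) :=
    fun P => by
      have hi : ∀ i, pd (bx i) ξ P * pd (bx i) ξ P = (1 / n) ^ 2 * ∑ j ∈ Finset.range n, a j ^ 2 *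
          (pd (bx i) ζ (scl (a j) 0 P + 0) * pd (bx i) ζ (scl (a j) 0 P + 0)) := fun i => by
        rw [hpξ, mul_mul_mul_comm, ← pow_two, sq_sum_of_disjoint]
        · congr 1
          exact Finset.sum_congr rfl fun j _ => by ring
        · intro j _ k _ hjk
          rw [mul_mul_mul_comm]
          rcases lt_or_gt_of_ne hjk with h | h
          · rw [hdis P j k h, mul_zero]
          · rw [mul_comm (pd _ _ _), hdis P k j h, mul_zero]
      simp only [gdot, hi]
      rw [← Finset.mul_sum, Finset.sum_comm]
      simp only [Finset.mul_sum]
  have hθx : ∀ i P, pd (bx i) θ P = 0 := fun i P => by rw [hθ, pd_bx_scl hζ, zero_mul]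
  have hξ0 : ∀ P, 0 ≤ ξ P := fun P => by
    exact mul_nonneg (by positivity) (Finset.sum_nonneg fun j _ => h0 _)
  have hξ1 : ∀ P, ξ P ≤ 1 := fun P => by
    have : ∑ j ∈ Finset.range n, Z j P ≤ ∑ j ∈ Finset.range n, (1:ℝ) :=
      Finset.sum_le_sum fun j _ => h1 _
    simp at this
    simp only [hξ]
    rw [div_mul_eq_mul_div, one_mul, div_le_one hn0]; exact this
  set R : ℝ := 2 * 4 ^ n with hR
  have hR2 : 2 ≤ R := by
    have : (1:ℝ) ≤ 4 ^ n := one_le_pow₀ (by norm_num)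
    linarith
  set χ : SpT N → ℝ := fun P => ξ P ^ 2 * θ P with hχ
  have hsub : Function.support χ ⊆ pbox N R := fun P hP => by
    rw [Function.mem_support] at hP
    have hθ0 : θ P ≠ 0 := right_ne_zero_of_mul hP
    have hξ0 : ξ P ≠ 0 := fun h => hP (by simp [hχ, h])
    obtain ⟨j, hj, hjZ⟩ := Finset.exists_ne_zero_of_sum_ne_zero (right_ne_zero_of_mul hξ0)
    have h2 : ‖scl (a j) 0 P + 0‖ ≤ 2 := le_of_not_gt fun h' => hjZ (hz2 _ h')
    have h3 : ‖scl 0 1 P + 0‖ ≤ 2 := le_of_not_gt fun h' => hθ0 (hz2 _ h')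
    simp only [add_zero, scl_apply, zero_mul, Prod.norm_def, norm_smul, norm_zero, one_mul,
      Real.norm_of_nonneg (ha0 _).le, max_le_iff, Real.norm_eq_abs] at h2 h3
    refine ⟨?_, by nlinarith [h3.2]⟩
    have h4 : 1 ≤ a j * 4 ^ n := by
      simp only [ha]
      rw [one_div, inv_pow, ← div_eq_inv_mul, one_le_div (by positivity)]
      exact pow_le_pow_right₀ (by norm_num) (Finset.mem_range.1 hj).le
    have h5 : (0:ℝ) < 4 ^ n := by positivity
    nlinarith [norm_nonneg P.1, mul_le_mul_of_nonneg_right h2.1 h5.le, mul_le_mul_of_nonneg_right h4 (norm_nonneg P.1)]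
  have htsub : tsupport χ ⊆ pbox N R := closure_minimal hsub (isCompact_pbox R).isClosed
  have hθ0 : ∀ P, 0 ≤ θ P := fun P => h0 _
  have hG0 : ∀ P, 0 ≤ θ P * gdot ξ ξ P := fun P => mul_nonneg (hθ0 P) (gdot_self_nonneg _ _)
  set W : ℕ → Set (SpT N) := fun j => closedBall (0 : Sp N) (2 / a j) ×ˢ Icc (-2) 2 with hW
  have hWc : ∀ j, IsCompact (W j) := fun j => (isCompact_closedBall _ _).prod isCompact_Icc
  have hWv : ∀ j, (volume (W j)).toReal = 4 * (volume (ball (0 : Sp N) 1)).toReal * (2 / a j) ^ N := fun j => by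
    rw [hW, Measure.volume_eq_prod, Measure.prod_prod, Real.volume_Icc,
      Measure.addHaar_closedBall volume _ (by have := ha0 j; positivity), finrank_euclideanSpace_fin, ENNReal.toReal_mul,
      ENNReal.toReal_mul, ENNReal.toReal_ofReal (by have := ha0 j; positivity),
      ENNReal.toReal_ofReal (by norm_num)]
    ring
  have hGle : ∀ P, θ P * gdot ξ ξ P ≤ (1 / n) ^ 2 * ∑ j ∈ Finset.range n,
      (W j).indicator (fun _ => a j ^ 2 * L) P := fun P => by
    rw [hgξ, mul_left_comm, Finset.mul_sum]
    refine mul_le_mul_of_nonneg_left (Finset.sum_le_sum fun j _ => ?_) (by positivity)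
    by_cases hP : P ∈ W j
    · rw [indicator_of_mem hP]
      have h2 := (le_abs_self _).trans (hgr (scl (a j) 0 P + 0))
      have h3 : 0 ≤ gdot ζ ζ (scl (a j) 0 P + 0) := gdot_self_nonneg _ _
      have h4 : θ P ≤ 1 := h1 _
      calc _ ≤ 1 * (a j ^ 2 * gdot ζ ζ (scl (a j) 0 P + 0)) := by gcongr
        _ ≤ _ := by rw [one_mul]; gcongr
    · rw [indicator_of_notMem hP]
      refine le_of_eq ?_
      by_cases ht : |P.2| ≤ 2
      · have : 2 < ‖scl (a j) 0 P + 0‖ := by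
          simp only [add_zero, scl_apply, zero_mul, Prod.norm_def, norm_smul, norm_zero,
            Real.norm_of_nonneg (ha0 _).le, lt_max_iff]
          left
          by_contra h
          refine hP ⟨?_, abs_le.1 ht⟩
          rw [mem_closedBall_zero_iff, le_div_iff₀ (ha0 j), mul_comm]
          linarith
        simp only [gdot, hp2 _ _ this, mul_zero, Finset.sum_const_zero]
      · have : θ P = 0 := hz2 _ (by
          simp only [add_zero, scl_apply, zero_smul, Prod.norm_def, norm_zero, one_mul,
            lt_max_iff, Real.norm_eq_abs]
          right; linarith)
        rw [this, zero_mul]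
  have hind : ∀ j, Integrable ((W j).indicator (fun _ => a j ^ 2 * L)) := fun j =>
    (integrable_indicator_iff (hWc j).measurableSet).2
      (integrableOn_const (hWc j).measure_lt_top.ne)
  have hBint := (integrable_finsetSum (Finset.range n) fun j _ => hind j).const_mul ((1 / n : ℝ) ^ 2)
  have hGs : Sm (fun P => θ P * gdot ξ ξ P) := hθs.mul (hξs.gdot hξs)
  have hGi : Integrable (fun P => θ P * gdot ξ ξ P) := by
    refine hBint.mono' hGs.cont.aestronglyMeasurable (Eventually.of_forall fun P => ?_)
    rw [Real.norm_of_nonneg (hG0 P)]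
    exact hGle P
  refine ⟨χ, fun P => θ P * gdot ξ ξ P, R, by linarith, (hξs.pow 2).mul hθs,
    (isCompact_pbox R).of_isClosed_subset isClosed_closure htsub,
    fun P => mul_nonneg (sq_nonneg _) (hθ0 P), fun P => ?_, fun P hP => ?_, htsub, hG0,
    fun V P => ?_, hGi, ?_⟩
  · exact mul_le_one₀ (pow_le_one₀ (hξ0 P) (hξ1 P)) (hθ0 P) (h1 _)
  · have h2 : ∀ j, Z j P = 1 := fun j => he _ (by
      simp only [add_zero, scl_apply, zero_mul, Prod.norm_def, norm_smul, norm_zero,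
        Real.norm_of_nonneg (ha0 _).le, max_le_iff]
      exact ⟨mul_le_one₀ (ha1 j) (norm_nonneg _) hP.1, zero_le_one⟩)
    have h3 : θ P = 1 := he _ (by
      simp only [add_zero, scl_apply, zero_smul, Prod.norm_def, norm_zero, one_mul,
        max_le_iff, Real.norm_eq_abs]
      exact ⟨zero_le_one, by simpa using hP.2⟩)
    simp only [hχ, h3, hξ, h2]
    simp [hn0.ne']
  · have h2 : gdot χ V P = 2 * ξ P * θ P * gdot ξ V P := by
      simp only [gdot, hχ, Finset.mul_sum]
      refine Finset.sum_congr rfl fun k _ => ?_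
      rw [pd_mul (hξs.pow 2) hθs, hθx, pd_pow hξs]
      simp; ring
    rw [h2]
    have h3 := gdot_sq_le ξ V P
    simp only [hχ]
    nlinarith [mul_le_mul_of_nonneg_left h3 (sq_nonneg (ξ P * θ P))]
  · refine (integral_mono hGi hBint hGle).trans ?_
    rw [integral_const_mul, integral_finsetSum _ fun j _ => hind j]
    have h2 : ∀ j, ∫ P, (W j).indicator (fun _ => a j ^ 2 * L) P ≤ c := fun j => by
      rw [integral_indicator_const _ (hWc j).measurableSet, smul_eq_mul]
      change (volume (W j)).toReal * _ ≤ c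
      rw [hWv, div_pow, hcdef]
      have h3 : a j ^ 2 / a j ^ N ≤ 1 := by
        rw [div_le_one (pow_pos (ha0 j) _)]
        exact pow_le_pow_of_le_one (ha0 j).le (ha1 j) hN
      calc _ = L * (4 * (volume (ball (0 : Sp N) 1)).toReal * 2 ^ N) * (a j ^ 2 / a j ^ N) := by ring
        _ ≤ _ := mul_le_of_le_one_right hc0 h3
    have h4 := Finset.sum_le_sum fun j (_ : j ∈ Finset.range n) => h2 j
    simp only [Finset.sum_const, Finset.card_range, nsmul_eq_mul] at h4
    calc _ ≤ (1 / (n:ℝ)) ^ 2 * (n * c) := by gcongr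
      _ = c / n := by field_simp
      _ ≤ δ := by
        rw [div_le_iff₀ hn0]; rw [div_lt_iff₀ hδ] at hn; linarith
end

section
variable {N m : ℕ} {β : Fin m → Fin m → ℝ} {r : ℝ}

theorem cross_term_le {g χ G D s : ℝ} (hg : g ^ 2 ≤ 4 * (χ * G) * D) (hχ : 0 ≤ χ) (hG : 0 ≤ G)
    (hD : 0 ≤ D) : g * s ≤ G + χ * D * s ^ 2 := by
  refine abs_le_of_sq_le_sq' (a := g * s) ?_ (by positivity) |>.2
  nlinarith [mul_le_mul_of_nonneg_right hg (sq_nonneg s), sq_nonneg (G - χ * D * s ^ 2)]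

theorem integral_low_test (hr : 0 < r) (hβ : ∀ i j, 0 ≤ β i j) {b0 : ℝ}
    (hdiag : ∀ i, b0 ≤ β i i) {M : ℝ} (hM : 0 ≤ M) (hb0 : 0 < b0)
    {χ G φ : SpT N → ℝ} (hχ : Sm χ) (hc : HasCompactSupport χ) (h0 : ∀ P, 0 ≤ χ P)
    (h1 : ∀ P, χ P ≤ 1) (hG0 : ∀ P, 0 ≤ G P)
    (hcap : ∀ V P, gdot χ V P ^ 2 ≤ 4 * (χ P * G P) * gdot V V P) (hGi : Integrable G)
    (hφ : Sm φ) (hφc : HasCompactSupport φ) (hφχ : ∀ P, χ P ≠ 0 → φ P = 1)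
    {V : Fin m → SpT N → ℝ} (hV : ∀ i, Sm (V i)) (hVp : ∀ i P, 0 < V i P)
    {ε κ : ℝ} (hκ : 0 < κ)
    (hε : ∀ P, χ P ≠ 0 → ∀ i, V i P ≤ M ∧ |heat (V i) P - nlf β r V i P| ≤ ε) :
    b0 / (1 + M) * ∫ P, χ P * ∑ i, V i P ^ (2 * r + 1) ≤
      m * (∫ P, G P) + m * (κ + ε) * (∫ P, χ P)
        + 1 / (4 * κ) * ∫ P, φ P ^ 2 * ∑ i, pd bt (V i) P ^ 2 := by
  have hχi : Integrable χ := hχ.cont.integrable_of_hasCompactSupport hc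
  have hc2 : HasCompactSupport (fun P => φ P ^ 2) := by
    simp only [pow_two]
    exact hφc.mul_right
  have hLi : Integrable (fun P => χ P * ∑ i, V i P ^ (2 * r + 1)) :=
    ((hχ.mul (Sm.sum fun i _ => (hV i).rpow (hVp i) _)).cont).integrable_of_hasCompactSupport
      hc.mul_right
  have hTi : Integrable (fun P => φ P ^ 2 * ∑ i, pd bt (V i) P ^ 2) :=
    (((hφ.pow 2).mul (Sm.sum fun i _ => ((hV i).pd _).pow 2)).cont).integrable_of_hasCompactSupport
      hc2.mul_right
  have h1V : ∀ i P, 0 < 1 + V i P := fun i P => by linarith [hVp i P]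
  have hψs : ∀ i, Sm (fun P => χ P / (1 + V i P)) := fun i =>
    hχ.div ((Sm.const 1).add (hV i)) fun P => (h1V i P).ne'
  have hψc : ∀ i, HasCompactSupport (fun P => χ P / (1 + V i P)) := fun i => by
    simp only [div_eq_mul_inv]; exact hc.mul_right
  have hZ := IsNull.sum (s := Finset.univ) fun i (_ : i ∈ Finset.univ) =>
    isNull_div_grad (hψs i) (hψc i) (Sm.const 1) (hV i)
  have hg1 : ∀ i P, gdot (fun _ => (1:ℝ)) (V i) P = 0 := fun i P => by simp [gdot, pd_const]
  have hgψ : ∀ i P, gdot (fun P => χ P / (1 + V i P)) (V i) P =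
      gdot χ (V i) P * (1 / (1 + V i P)) - χ P * gdot (V i) (V i) P * (1 / (1 + V i P)) ^ 2 :=
    fun i P => by
      simp only [gdot, Finset.sum_mul, Finset.mul_sum]
      rw [← Finset.sum_sub_distrib]
      refine Finset.sum_congr rfl fun k _ => ?_
      rw [pd_div hχ ((Sm.const 1).add (hV i)) fun P => (h1V i P).ne',
        pd_add (Sm.const 1) (hV i), pd_const]
      have := (h1V i P).ne'
      field_simp
      ring
  have h12 : Integrable (fun P => m * G P + m * (κ + ε) * χ P) :=
    (hGi.const_mul _).add (hχi.const_mul _)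
  rw [← integral_const_mul, ← integral_const_mul, ← integral_const_mul, ← integral_const_mul,
    ← integral_add (hGi.const_mul _) (hχi.const_mul _),
    ← integral_add h12 (hTi.const_mul _)]
  refine integral_le_of_null (hLi.const_mul _)
    (h12.add (hTi.const_mul _)) (hZ.const_mul (-1))
    fun P => ?_
  by_cases hP : χ P = 0
  · have h2 : ∀ i, gdot χ (V i) P = 0 := fun i => by
      have := hcap (V i) P
      rw [hP] at this
      nlinarith [sq_nonneg (gdot χ (V i) P)]
    have h3 : 0 ≤ 1 / (4 * κ) * (φ P ^ 2 * ∑ i, pd bt (V i) P ^ 2) := by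
      have : 0 ≤ ∑ i, pd bt (V i) P ^ 2 := Finset.sum_nonneg fun i _ => sq_nonneg _
      positivity
    simp only [hgψ, hg1, h2, hP, zero_mul, zero_div, mul_zero, sub_zero, add_zero,
      Finset.sum_const_zero, zero_add]
    have : 0 ≤ m * G P := mul_nonneg (by positivity) (hG0 P)
    linarith
  · have hi : ∀ i, b0 / (1 + M) * (χ P * V i P ^ (2 * r + 1)) ≤
        -1 * (gdot (fun P => χ P / (1 + V i P)) (V i) P * 1 + χ P / (1 + V i P) *
          gdot (fun _ => (1:ℝ)) (V i) P + χ P / (1 + V i P) * 1 * lapl (V i) P)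
        + (G P + (κ + ε) * χ P + 1 / (4 * κ) * (φ P ^ 2 * pd bt (V i) P ^ 2)) := fun i => by
      obtain ⟨hVM, he⟩ := hε P hP i
      have hv0 := (hVp i P).le
      rw [hgψ, hg1, hφχ P hP]
      have h2 := cross_term_le (hcap (V i) P) (h0 P) (hG0 P) (gdot_self_nonneg (V i) P)
        (s := 1 / (1 + V i P))
      have h3 := (mul_le_mul_of_nonneg_right (hdiag i)
        (rpow_nonneg hv0 _)).trans (le_nl hr hβ (fun j => (hVp j P).le) i)
      have h4 : nlf β r V i P = nl β r (fun j => V j P) i := rfl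
      rw [← h4] at h3
      rw [heat_eq] at he
      have h5 := (abs_le.1 he).1
      set ψ := χ P / (1 + V i P) with hψ
      have hψ0 : 0 ≤ ψ := div_nonneg (h0 P) (h1V i P).le
      have hψ1 : ψ ≤ χ P := div_le_self (h0 P) (by linarith)
      have hψM : χ P / (1 + M) ≤ ψ := div_le_div_of_nonneg_left (h0 P) (h1V i P) (by linarith)
      set D := pd bt (V i) P
      have hb : 0 ≤ b0 * V i P ^ (2 * r + 1) := mul_nonneg hb0.le (rpow_nonneg hv0 _)
      have h6 : b0 / (1 + M) * (χ P * V i P ^ (2 * r + 1)) ≤ ψ * (D - lapl (V i) P + ε) := by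
        calc _ = χ P / (1 + M) * (b0 * V i P ^ (2 * r + 1)) := by ring
          _ ≤ ψ * (b0 * V i P ^ (2 * r + 1)) := mul_le_mul_of_nonneg_right hψM hb
          _ ≤ _ := mul_le_mul_of_nonneg_left (by linarith) hψ0
      have hε0 : 0 ≤ ε := (abs_nonneg _).trans he
      have h7 : D ≤ κ + 1 / (4 * κ) * D ^ 2 := by
        have : κ + 1 / (4 * κ) * D ^ 2 - D = (2 * κ - D) ^ 2 / (4 * κ) := by field_simp; ring
        have h8 : 0 ≤ (2 * κ - D) ^ 2 / (4 * κ) := by positivity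
        linarith
      have h8 : ψ * D ≤ κ * χ P + 1 / (4 * κ) * D ^ 2 := by
        have h9 : 0 ≤ 1 / (4 * κ) * D ^ 2 := by positivity
        have h10 := mul_le_mul_of_nonneg_left h7 hψ0
        have h11 := mul_le_mul_of_nonneg_right hψ1 hκ.le
        have h12 := mul_le_of_le_one_left h9 (hψ1.trans (h1 P))
        linarith
      have h9 := mul_le_mul_of_nonneg_right hψ1 hε0
      linarith
    have hs := Finset.sum_le_sum fun i (_ : i ∈ Finset.univ) => hi i
    simp only [Finset.sum_add_distrib, ← Finset.mul_sum, Finset.sum_const, Finset.card_univ,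
      Fintype.card_fin, nsmul_eq_mul] at hs ⊢
    linarith

set_option maxHeartbeats 800000 in
theorem integralSmall_low (hN : N ≤ 2) (hr : 0 < r) (hsym : ∀ i j, β i j = β j i)
    (hβ : ∀ i j, 0 ≤ β i j) {b0 : ℝ} (hb0 : 0 < b0) (hdiag : ∀ i, b0 ≤ β i i)
    {M : ℝ} (hM : 0 ≤ M) : IntegralSmall N β r M (2 * r + 1) := by
  set p := 2 * r + 1 with hp
  have hp1 : 1 < p := by linarith
  set σ := (p + 1) / (2 * p) with hσd
  have hσ : σ < 1 := by rw [hσd, div_lt_one (by linarith)]; linarith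
  have hσ' : 1 / p ≤ σ := by
    rw [hσd, div_le_div_iff₀ (by linarith) (by linarith)]; nlinarith
  obtain ⟨C, hC, H⟩ := dominated_dt (N := N) hr hsym hβ hb0 hdiag hM hσ'
  rw [← hp] at H
  obtain ⟨C1, hC1, cut⟩ := exists_cut N hσ
  set e := 1 / (1 - 1 / p) with he
  have hip : 1 / p < 1 := by rw [div_lt_one (by linarith)]; exact hp1
  have hip0 : 0 < 1 / p := by positivity
  have he1 : 1 < e := by rw [he, lt_div_iff₀ (by linarith)]; linarith
  have hN2 : (N:ℝ) ≤ 2 := by exact_mod_cast hN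
  have he2 : -(2 * (1 + e)) + (N + 2 : ℝ) < 0 := by linarith
  intro η hη
  set K := (1 + M) / b0 with hK
  have hK0 : 0 < K := by positivity
  obtain ⟨χ, G, Rχ, hRχ, hχ, hχc, h0, h1, hχ1, hsupp, hG0, hcap, hGi, hGδ⟩ :=
    exists_capacity (N := N) hN (δ := η / 4 / (K * m + 1)) (by positivity)
  set v := ∫ P, χ P with hv
  have hv0 : 0 ≤ v := integral_nonneg h0
  set κ := η / 4 / (K * m * v + 1) with hκd
  have hκ : 0 < κ := by positivity
  set c := 2 * (volume (ball (0 : Sp N) 1)).toReal with hc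
  have hc0 : 0 ≤ c := by positivity
  set Q := K / (4 * κ) * C * c with hQ
  have hQ0 : 0 ≤ Q := by positivity
  obtain ⟨R, hR, hRη⟩ := exists_rpow_le (Q * C1 ^ (1 + e) * 2 ^ (N + 2)) Rχ he2
    (show 0 < η / 4 by positivity)
  have hR0 : 0 < R := by linarith
  set Λ := C1 / R ^ 2 with hΛ
  have hΛ0 : 0 ≤ Λ := by positivity
  set A := K * m * v + Q * (Λ + 1) * (2 * R) ^ (N + 2) with hA
  have hA0 : 0 ≤ A := by positivity
  set ε := min 1 (η / 4 / (A + 1)) with hε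
  have hε0 : 0 < ε := lt_min one_pos (by positivity)
  have hεA : ε * A ≤ η / 4 := by
    have : ε * (A + 1) ≤ η / 4 := by
      rw [← le_div_iff₀ (by linarith)]; exact min_le_right _ _
    nlinarith
  have hε1 : ε ≤ 1 := min_le_left _ _
  refine ⟨2 * R, by linarith, ε, hε0, fun V hV hVp hVe => ?_⟩
  obtain ⟨φ, hφ, hφ1, hφs⟩ := cut R hR0
  have hTi : Integrable (fun P => φ P ^ 2 * ∑ i, pd bt (V i) P ^ 2) := by
    refine (((hφ.sm.pow 2).mul (Sm.sum fun i _ => ((hV i).pd _).pow 2)).cont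
      ).integrable_of_hasCompactSupport ?_
    simp only [pow_two, mul_assoc]
    exact hφ.cs.mul_right
  have hd := (H φ Λ ε V hφ hV hVp hε0.le fun P hP i => hVe P (hφs hP) i).integral_le hTi hφ.cs
  have hvol : (volume (tsupport φ)).toReal ≤ c * (2 * R) ^ (N + 2) := by
    rw [← volume_pbox (N := N) (R := 2 * R) (by linarith)]
    exact ENNReal.toReal_mono (isCompact_pbox _).measure_lt_top.ne (measure_mono hφs)
  have hsub : ∀ P, χ P ≠ 0 → P ∈ pbox N R := fun P hP =>
    pbox_mono (by linarith) hR (hsupp (subset_tsupport _ hP))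
  have ht := integral_low_test hr hβ hdiag hM hb0 hχ hχc h0 h1 hG0 hcap hGi hφ.sm hφ.cs
    (fun P hP => hφ1 P (hsub P hP)) hV hVp hκ (ε := ε)
    (fun P hP i => hVe P (pbox_mono hR0.le (by linarith) (hsub P hP)) i)
  have h2 := setIntegral_le_cut (g := fun P => ∑ i, V i P ^ p) le_rfl hχ.cont hχc h0 hχ1
    (Sm.sum fun i _ => (hV i).rpow (hVp i) p).cont
    (fun P => Finset.sum_nonneg fun i _ => rpow_nonneg (hVp i P).le _)
  refine h2.trans ?_
  have h3 := mul_le_mul_of_nonneg_left ht hK0.le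
  rw [← mul_assoc, show K * (b0 / (1 + M)) = 1 by rw [hK]; field_simp, one_mul] at h3
  refine h3.trans ?_
  have hE0 : 0 ≤ Λ ^ e := rpow_nonneg hΛ0 _
  have hd' : ∫ P, φ P ^ 2 * ∑ i, pd bt (V i) P ^ 2 ≤
      C * (Λ * (Λ ^ e + ε) + ε ^ 2) * (c * (2 * R) ^ (N + 2)) :=
    hd.trans (mul_le_mul_of_nonneg_left hvol (by positivity))
  have hΛE : Λ * Λ ^ e = C1 ^ (1 + e) * R ^ (-(2 * (1 + e))) := by
    have : Λ * Λ ^ e = Λ ^ (1 + e) := by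
      rw [rpow_add_of_nonneg hΛ0 zero_le_one (by linarith), rpow_one]
    rw [this, hΛ, div_rpow hC1 (by positivity), rpow_neg hR0.le, div_eq_mul_inv, rpow_mul hR0.le]
    norm_num
  have hG' : K * m * ∫ P, G P ≤ η / 4 := by
    have h4 : 0 < K * m + 1 := by positivity
    have : (K * m + 1) * ∫ P, G P ≤ η / 4 := by
      rw [mul_comm, ← le_div_iff₀ h4]; exact hGδ
    have : 0 ≤ ∫ P, G P := integral_nonneg hG0
    linarith
  have hκ' : K * m * κ * v ≤ η / 4 := by
    have h4 : 0 < K * m * v + 1 := by positivity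
    have : (K * m * v + 1) * κ = η / 4 := by rw [hκd]; field_simp
    linarith
  have h5 : K * (1 / (4 * κ) * ∫ P, φ P ^ 2 * ∑ i, pd bt (V i) P ^ 2) ≤
      η / 4 + ε * (Q * (Λ + 1) * (2 * R) ^ (N + 2)) := by
    calc _ ≤ K * (1 / (4 * κ) * (C * (Λ * (Λ ^ e + ε) + ε ^ 2) * (c * (2 * R) ^ (N + 2)))) := by
          gcongr
      _ = Q * (Λ * Λ ^ e) * (2 * R) ^ (N + 2) + Q * (Λ * ε + ε ^ 2) * (2 * R) ^ (N + 2) := by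
          rw [hQ]; ring
      _ ≤ _ := by
          refine add_le_add ?_ ?_
          · refine le_trans (le_of_eq ?_) hRη
            rw [rpow_add hR0, hΛE, show ((N : ℝ) + 2) = ((N + 2 : ℕ) : ℝ) by push_cast; rfl,
              rpow_natCast, mul_pow]
            ring
          · have : ε ^ 2 ≤ ε := by nlinarith
            have h6 : 0 ≤ Q * (2 * R) ^ (N + 2) := by positivity
            linarith [mul_le_mul_of_nonneg_left this h6]
  calc _ = K * m * (∫ P, G P) + K * m * κ * v + ε * (K * m * v)
        + K * (1 / (4 * κ) * ∫ P, φ P ^ 2 * ∑ i, pd bt (V i) P ^ 2) := by ring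
    _ ≤ η / 4 + η / 4 + ε * A + η / 4 := by rw [hA]; linarith
    _ ≤ η := by linarith
end

section
variable {N : ℕ}

theorem Sm.exp {E : Type*} [NormedAddCommGroup E] [NormedSpace ℝ E] {f : E → ℝ} (hf : Sm f) :
    Sm (fun P => exp (f P)) := ContDiff.exp hf

/-- A smooth positive clock agreeing with `η - s` up to time `η / 4`. -/
theorem exists_clock {η : ℝ} (hη : 0 < η) : ∃ h : ℝ → ℝ, Sm h ∧ (∀ s, 0 < h s) ∧
    ∀ s ≤ η / 4, h s = η - s := by
  have hc : Sm (fun s : ℝ => smoothTransition (2 - 4 / η * s)) :=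
    smoothTransition.contDiff.comp (contDiff_const.sub (contDiff_const.mul contDiff_id))
  have hid : Sm (fun s : ℝ => s) := contDiff_id
  refine ⟨fun s => smoothTransition (2 - 4 / η * s) * (η - s) +
    (1 - smoothTransition (2 - 4 / η * s)) * 1, (hc.mul ((Sm.const η).sub hid)).add
      (((Sm.const 1).sub hc).mul (Sm.const 1)), fun s => ?_, fun s hs => ?_⟩
  · have h0 := smoothTransition.nonneg (2 - 4 / η * s)
    have h1 := smoothTransition.le_one (2 - 4 / η * s)
    rcases le_or_gt (η / 2) s with h | h
    · beta_reduce
      rw [smoothTransition.zero_of_nonpos]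
      · norm_num
      · have : 4 / η * (η / 2) ≤ 4 / η * s := by gcongr
        have h2 : 4 / η * (η / 2) = 2 := by field_simp; norm_num
        linarith
    · rcases eq_or_lt_of_le h0 with h2 | h2
      · beta_reduce
        rw [← h2]; norm_num
      · have : 0 < η - s := by linarith
        nlinarith [mul_pos h2 this]
  · beta_reduce
    rw [smoothTransition.one_of_one_le]
    · ring
    · have : 4 / η * s ≤ 4 / η * (η / 4) := by gcongr
      have h2 : 4 / η * (η / 4) = 1 := by field_simp
      linarith

theorem sm_normsq : Sm (fun P : SpT N => ‖P.1‖ ^ 2) := (contDiff_norm_sq ℝ).comp contDiff_fst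

theorem Sm.time {h : ℝ → ℝ} (hh : Sm h) : Sm (fun P : SpT N => h P.2) :=
  ContDiff.comp hh contDiff_snd

theorem pd_time {h : ℝ → ℝ} {h' : ℝ} (P : SpT N) (hh : HasDerivAt h h' P.2) (v : SpT N) :
    pd v (fun P : SpT N => h P.2) P = h' * v.2 := by
  have : HasFDerivAt (fun P : SpT N => h P.2) _ P := hh.hasFDerivAt.comp P hasFDerivAt_snd
  rw [pd, this.fderiv]
  simp [mul_comm]

theorem pd_normsq (P v : SpT N) : pd v (fun P : SpT N => ‖P.1‖ ^ 2) P = 2 * inner ℝ P.1 v.1 := by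
  have h : HasFDerivAt (fun P : SpT N => ‖P.1‖ ^ 2) _ P :=
    (hasFDerivAt_fst (p := P) (𝕜 := ℝ)).norm_sq
  rw [pd, h.fderiv]
  simp

theorem pd_normsq_bt (P : SpT N) : pd bt (fun P : SpT N => ‖P.1‖ ^ 2) P = 0 := by
  rw [pd_normsq]; simp [bt]

theorem pd_normsq_bx (i : Fin N) (P : SpT N) :
    pd (bx i) (fun P : SpT N => ‖P.1‖ ^ 2) P = 2 * P.1 i := by
  rw [pd_normsq]; simp [bx, EuclideanSpace.inner_single_right]

theorem pd_coord (i : Fin N) (P : SpT N) :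
    pd (bx i) (fun P : SpT N => P.1 i) P = 1 := by
  have h : HasFDerivAt (fun P : SpT N => P.1 i) ((EuclideanSpace.proj i).comp
    (ContinuousLinearMap.fst ℝ (Sp N) ℝ)) P :=
    ((EuclideanSpace.proj (𝕜 := ℝ) i).comp (ContinuousLinearMap.fst ℝ (Sp N) ℝ)).hasFDerivAt
  rw [pd, h.fderiv]
  simp [bx]

/-- The unnormalised Gaussian with clock `h`. -/
noncomputable def gk (h : ℝ → ℝ) (P : SpT N) : ℝ :=
  exp (-(1 / (4 * h P.2)) * ‖P.1‖ ^ 2 + -(N / 2) * log (h P.2))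

variable {h : ℝ → ℝ} (hh : Sm h) (hp : ∀ s, 0 < h s)

theorem gk_pos (h : ℝ → ℝ) (P : SpT N) : 0 < gk h P := exp_pos _

theorem gk_eq (P : SpT N) (hp : 0 < h P.2) :
    gk h P = h P.2 ^ (-(N / 2 : ℝ)) * exp (-(1 / (4 * h P.2)) * ‖P.1‖ ^ 2) := by
  rw [gk, exp_add, rpow_def_of_pos hp, mul_comm, mul_comm (log _)]

section
include hh hp

theorem sm_inv4 : Sm (fun P : SpT N => -(1 / (4 * h P.2))) :=
  ((Sm.const 1).div ((Sm.const 4).mul hh.time) fun P => by have := hp P.2; positivity).neg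

theorem sm_log : Sm (fun P : SpT N => -(N / 2) * log (h P.2)) :=
  (Sm.const _).mul (ContDiff.log hh.time fun P => (hp P.2).ne')

theorem sm_gk : Sm (gk h : SpT N → ℝ) :=
  (((sm_inv4 hh hp).mul sm_normsq).add (sm_log hh hp)).exp

theorem pd_gk_bx (i : Fin N) (P : SpT N) :
    pd (bx i) (gk h) P = gk h P * (-(1 / (2 * h P.2)) * P.1 i) := by
  have h1 := pd_comp (f := fun P : SpT N => -(1 / (4 * h P.2)) * ‖P.1‖ ^ 2 + -(N / 2) * log (h P.2))
    (((sm_inv4 hh hp).mul sm_normsq).add (sm_log hh hp)) (P := P) (hasDerivAt_exp _) (bx i)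
  have hd : HasDerivAt h (deriv h P.2) P.2 := (hh.diff _).hasDerivAt
  have h2 := pd_time (N := N) P ((((hasDerivAt_const _ (1:ℝ)).div (hd.const_mul 4) (by
    have := hp P.2; positivity))).neg) (bx i)
  have h3 := pd_time (N := N) P ((hd.log (hp P.2).ne').const_mul (-(N / 2 : ℝ))) (bx i)
  have hb : (bx i : SpT N).2 = 0 := rfl
  rw [hb, mul_zero] at h2 h3
  simp only [Pi.neg_def, Pi.div_def] at h2
  rw [pd_add ((sm_inv4 hh hp).mul sm_normsq) (sm_log hh hp), pd_mul (sm_inv4 hh hp) sm_normsq,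
    pd_normsq_bx, h2, h3] at h1
  refine h1.trans ?_
  change gk h P * _ = _
  congr 1
  have := (hp P.2).ne'
  field_simp
  ring

theorem lapl_gk (P : SpT N) :
    lapl (gk h) P = gk h P * (‖P.1‖ ^ 2 / (4 * h P.2 ^ 2) - N / (2 * h P.2)) := by
  have hK := sm_gk (N := N) hh hp
  have h1 : ∀ i, pd (bx i) (pd (bx i) (gk h)) P =
      gk h P * (P.1 i ^ 2 / (4 * h P.2 ^ 2) - 1 / (2 * h P.2)) := fun i => by
    have e : pd (bx i) (gk h) = fun P => gk h P * (-(1 / (2 * h P.2)) * P.1 i) := by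
      ext P; exact pd_gk_bx hh hp i P
    have hc : Sm (fun P : SpT N => P.1 i) :=
      ((EuclideanSpace.proj i).comp (ContinuousLinearMap.fst ℝ (Sp N) ℝ)).contDiff
    have h2 : Sm (fun P : SpT N => -(1 / (2 * h P.2))) :=
      ((Sm.const 1).div ((Sm.const 2).mul hh.time) fun P => by have := hp P.2; positivity).neg
    have hd : HasDerivAt h (deriv h P.2) P.2 := (hh.diff _).hasDerivAt
    have h3 := pd_time (N := N) P ((((hasDerivAt_const _ (1:ℝ)).div (hd.const_mul 2) (by
      have := hp P.2; positivity))).neg) (bx i)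
    have hb : (bx i : SpT N).2 = 0 := rfl
    rw [hb, mul_zero] at h3
    simp only [Pi.neg_def, Pi.div_def] at h3
    rw [e, pd_mul hK (h2.mul hc), pd_mul h2 hc, pd_coord, h3, pd_gk_bx hh hp]
    have := (hp P.2).ne'
    field_simp
    ring
  simp only [lapl, h1]
  rw [← Finset.mul_sum, Finset.sum_sub_distrib, ← Finset.sum_div, EuclideanSpace.real_norm_sq_eq]
  simp; left; ring

theorem pd_gk_bt (P : SpT N) : pd bt (gk h) P =
    gk h P * (deriv h P.2 * (‖P.1‖ ^ 2 / (4 * h P.2 ^ 2) - N / (2 * h P.2))) := by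
  have h1 := pd_comp (f := fun P : SpT N => -(1 / (4 * h P.2)) * ‖P.1‖ ^ 2 + -(N / 2) * log (h P.2))
    (((sm_inv4 hh hp).mul sm_normsq).add (sm_log hh hp)) (P := P) (hasDerivAt_exp _) bt
  have hd : HasDerivAt h (deriv h P.2) P.2 := (hh.diff _).hasDerivAt
  have h2 := pd_time (N := N) P ((((hasDerivAt_const _ (1:ℝ)).div (hd.const_mul 4) (by
    have := hp P.2; positivity))).neg) bt
  have h3 := pd_time (N := N) P ((hd.log (hp P.2).ne').const_mul (-(N / 2 : ℝ))) bt
  have hb : (bt : SpT N).2 = 1 := rfl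
  rw [hb, mul_one] at h2 h3
  simp only [Pi.neg_def, Pi.div_def] at h2
  rw [pd_add ((sm_inv4 hh hp).mul sm_normsq) (sm_log hh hp), pd_mul (sm_inv4 hh hp) sm_normsq,
    pd_normsq_bt, h2, h3] at h1
  refine h1.trans ?_
  change gk h P * _ = _
  congr 1
  have := (hp P.2).ne'
  field_simp
  ring

theorem gk_backward {η : ℝ} (hη : 0 < η) (he : ∀ s ≤ η / 4, h s = η - s) {P : SpT N}
    (hP : P.2 ≤ 0) : pd bt (gk h) P + lapl (gk h) P = 0 := by
  have h1 : deriv h P.2 = -1 := by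
    have : h =ᶠ[𝓝 P.2] fun s => η - s := by
      filter_upwards [Iio_mem_nhds (show P.2 < η / 4 by linarith)] with s hs using he s hs.le
    rw [this.deriv_eq]; simp
  rw [pd_gk_bt hh hp, lapl_gk hh hp, h1]; ring

theorem gdot_gk_self (P : SpT N) :
    gdot (gk h) (gk h) P = (gk h P * (‖P.1‖ / (2 * h P.2))) ^ 2 := by
  simp only [gdot, pd_gk_bx hh hp]
  rw [mul_pow, div_pow, EuclideanSpace.real_norm_sq_eq, Finset.sum_div, Finset.mul_sum]
  refine Finset.sum_congr rfl fun i _ => ?_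
  ring
end
end

section
variable {N : ℕ} {F Γ V : SpT N → ℝ} {k : ℝ}

/-- Vanishing outside a space-time cylinder. -/
def CylSupp (F : SpT N → ℝ) (k : ℝ) : Prop := ∀ P, k < ‖P.1‖ → F P = 0

theorem CylSupp.eventually (hk : CylSupp F k) {P : SpT N} (hP : k < ‖P.1‖) :
    F =ᶠ[𝓝 P] fun _ => 0 := by
  have : {Q : SpT N | k < ‖Q.1‖} ∈ 𝓝 P :=
    (isOpen_lt continuous_const (continuous_fst.norm)).mem_nhds hP
  filter_upwards [this] with Q hQ using hk Q hQ

theorem CylSupp.pd (hk : CylSupp F k) (v : SpT N) : CylSupp (pd v F) k := fun P hP => by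
  unfold _root_.pd; rw [(hk.eventually hP).fderiv_eq]; simp

theorem CylSupp.mul (hk : CylSupp F k) (V : SpT N → ℝ) : CylSupp (fun P => F P * V P) k :=
  fun P hP => by simp [hk P hP]

theorem CylSupp.hcs (hk : CylSupp F k) (s : ℝ) : HasCompactSupport fun z => F (z, s) :=
  HasCompactSupport.intro (isCompact_closedBall (0 : Sp N) k) fun z hz => hk (z, s) (by simpa using hz)

theorem CylSupp.integrable (hk : CylSupp F k) (hF : Continuous F) (s : ℝ) :
    Integrable fun z => F (z, s) :=
  Continuous.integrable_of_hasCompactSupport (by fun_prop) (hk.hcs s)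

theorem sm_slice (hF : Sm F) (s : ℝ) : Sm fun z => F (z, s) :=
  ContDiff.comp hF (contDiff_prodMk_left s)

theorem pd_slice (hF : Sm F) (z : Sp N) (s : ℝ) (i : Fin N) :
    pd (EuclideanSpace.single i 1) (fun z => F (z, s)) z = pd (bx i) F (z, s) := by
  have h1 : HasFDerivAt (fun z : Sp N => (z, s)) (ContinuousLinearMap.inl ℝ (Sp N) ℝ) z :=
    hasFDerivAt_prodMk_left z s
  have h2 : HasFDerivAt (fun z => F (z, s)) _ z := (hF.diff (z, s)).hasFDerivAt.comp z h1
  unfold pd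
  rw [h2.fderiv]; rfl

theorem hasDerivAt_time (hF : Sm F) (z : Sp N) (s : ℝ) :
    HasDerivAt (fun s => F (z, s)) (pd bt F (z, s)) s := by
  have h1 : HasDerivAt (fun s : ℝ => (z, s)) (bt : SpT N) s :=
    (hasDerivAt_const s z).prodMk (hasDerivAt_id s)
  exact (hF.diff (z, s)).hasFDerivAt.comp_hasDerivAt s h1

theorem isNull_slice (hF : Sm F) (hk : CylSupp F k) (s : ℝ) (i : Fin N) :
    IsNull volume fun z => pd (bx i) F (z, s) := by
  have := isNull_pd (μ := volume) (sm_slice hF s) (hk.hcs s) (EuclideanSpace.single i 1)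
  rwa [funext fun z => pd_slice hF z s i] at this

theorem hasDerivAt_slice (hF : Sm F) (hk : CylSupp F k) (s : ℝ) :
    HasDerivAt (fun s => ∫ z, F (z, s)) (∫ z, pd bt F (z, s)) s := by
  obtain ⟨B, hB⟩ := ((isCompact_closedBall (0 : Sp N) k).prod (isCompact_Icc (a := s - 1)
    (b := s + 1))).exists_bound_of_continuousOn (hF.pd bt).cont.continuousOn
  refine (hasDerivAt_integral_of_dominated_loc_of_deriv_le (μ := volume)
    (F := fun s (z : Sp N) => F (z, s)) (F' := fun s z => pd bt F (z, s))
    (bound := indicator (closedBall 0 k) fun _ => B) (ball_mem_nhds s one_pos)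
    (Eventually.of_forall fun x => (hk.integrable hF.cont x).aestronglyMeasurable)
    (hk.integrable hF.cont s) ((hk.pd bt).integrable (hF.pd bt).cont s).aestronglyMeasurable
    (Eventually.of_forall fun z x hx => ?_) ?_
    (Eventually.of_forall fun z x _ => hasDerivAt_time hF z x)).2
  · by_cases hz : z ∈ closedBall (0 : Sp N) k
    · rw [indicator_of_mem hz]
      rw [Real.ball_eq_Ioo] at hx
      exact hB (z, x) ⟨hz, hx.1.le, hx.2.le⟩
    · rw [indicator_of_notMem hz, hk.pd bt (z, x) (by simpa using hz), norm_zero]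
  · exact (integrable_indicator_iff measurableSet_closedBall).2
      (integrableOn_const (isCompact_closedBall _ _).measure_lt_top.ne)

theorem slice_deriv (hG : Sm Γ) (hV : Sm V) (hk : CylSupp Γ k) (s : ℝ) :
    HasDerivAt (fun s => ∫ z, Γ (z, s) * V (z, s))
      (∫ z, (Γ (z, s) * heat V (z, s) + V (z, s) * (pd bt Γ (z, s) + lapl Γ (z, s)))) s := by
  have h := hasDerivAt_slice (hG.mul hV) (hk.mul V) s
  convert h using 1
  have hd : ∀ i, Sm (fun P => pd (bx i) Γ P * V P - Γ P * pd (bx i) V P) := fun i =>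
    ((hG.pd _).mul hV).sub (hG.mul (hV.pd _))
  have hn : IsNull volume fun z => ∑ i, pd (bx i) (fun P => pd (bx i) Γ P * V P - Γ P * pd (bx i) V P) (z, s) :=
    IsNull.sum fun i _ => isNull_slice (hd i) (k := k) (fun P hP => by
      simp [(hk.pd (bx i)) P hP, hk P hP]) s i
  have hi := ((hk.mul V).pd bt).integrable ((hG.mul hV).pd bt).cont s
  calc _ = ∫ z, (pd bt (fun P => Γ P * V P) (z, s)
      + ∑ i, pd (bx i) (fun P => pd (bx i) Γ P * V P - Γ P * pd (bx i) V P) (z, s)) := by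
        refine integral_congr_ae (Eventually.of_forall fun z => ?_)
        beta_reduce
        rw [pd_mul hG hV, heat_eq]
        have : ∀ i, pd (bx i) (fun P => pd (bx i) Γ P * V P - Γ P * pd (bx i) V P) (z, s)
          = pd (bx i) (pd (bx i) Γ) (z, s) * V (z, s) - Γ (z, s) * pd (bx i) (pd (bx i) V) (z, s) :=
          fun i => by
            rw [pd_sub ((hG.pd _).mul hV) (hG.mul (hV.pd _)), pd_mul (hG.pd _) hV,
              pd_mul hG (hV.pd _)]; ring
        simp only [this, Finset.sum_sub_distrib, ← Finset.sum_mul, ← Finset.mul_sum]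
        simp only [lapl]; ring
    _ = _ := by rw [integral_add hi hn.1, hn.2, add_zero]

/-- One-sided growth estimate for weighted slice integrals. -/
theorem slice_le (hG : Sm Γ) (hV : Sm V) (hk : CylSupp Γ k) {D a b : ℝ} (hab : a ≤ b)
    (hD : ∀ s ∈ Icc a b, ∫ z, (Γ (z, s) * heat V (z, s) + V (z, s) * (pd bt Γ (z, s) + lapl Γ (z, s))) ≤ D) :
    ∫ z, Γ (z, b) * V (z, b) ≤ (∫ z, Γ (z, a) * V (z, a)) + D * (b - a) := by
  have h := slice_deriv hG hV hk
  have := Convex.image_sub_le_mul_sub_of_deriv_le (convex_Icc a b)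
    (f := fun s => ∫ z, Γ (z, s) * V (z, s)) (fun s _ => (h s).continuousAt.continuousWithinAt)
    (fun s _ => (h s).differentiableAt.differentiableWithinAt)
    (C := D) (fun s hs => by rw [(h s).deriv]; exact hD s (interior_subset hs)) a
    (left_mem_Icc.2 hab) b (right_mem_Icc.2 hab) hab
  beta_reduce at this
  linarith
end

section
variable {N : ℕ}

/-- The unnormalised heat kernel at age `σ`. -/
noncomputable def hk (z : Sp N) (σ : ℝ) : ℝ := σ ^ (-(N / 2 : ℝ)) * exp (-(1 / (4 * σ)) * ‖z‖ ^ 2)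

/-- Mass of the unnormalised heat kernel. -/
noncomputable def hmass (N : ℕ) : ℝ := ∫ z : Sp N, exp (-(1 / 4) * ‖z‖ ^ 2)

theorem hmass_eq (N : ℕ) : hmass N = (4 * π) ^ (N / 2 : ℝ) := by
  rw [hmass, GaussianFourier.integral_rexp_neg_mul_sq_norm (by norm_num)]
  simp; congr 1; ring

theorem hmass_pos (N : ℕ) : 0 < hmass N := by
  rw [hmass_eq]; positivity

theorem integrable_gauss {b : ℝ} (hb : 0 < b) : Integrable fun z : Sp N => exp (-b * ‖z‖ ^ 2) := by
  by_contra h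
  have := GaussianFourier.integral_rexp_neg_mul_sq_norm (V := Sp N) hb
  rw [integral_undef h] at this
  have h2 : 0 < (π / b) ^ (Module.finrank ℝ (Sp N) / 2 : ℝ) := by positivity
  linarith

theorem hk_pos (z : Sp N) {σ : ℝ} (hσ : 0 < σ) : 0 < hk z σ := by unfold hk; positivity

theorem hk_cont (σ : ℝ) : Continuous fun z : Sp N => hk z σ := by unfold hk; fun_prop

theorem hk_integrable {σ : ℝ} (hσ : 0 < σ) : Integrable fun z : Sp N => hk z σ :=
  (integrable_gauss (by positivity)).const_mul _

theorem hk_le_rpow (z : Sp N) {σ : ℝ} (hσ : 0 < σ) : hk z σ ≤ σ ^ (-(N / 2 : ℝ)) := by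
  unfold hk
  refine mul_le_of_le_one_right (by positivity) (exp_le_one_iff.2 ?_)
  have : 0 ≤ 1 / (4 * σ) * ‖z‖ ^ 2 := by positivity
  linarith

/-- Rescaling to age one. -/
theorem integral_hk_mul {σ : ℝ} (hσ : 0 < σ) (f : Sp N → ℝ) :
    ∫ z, hk z σ * f z = ∫ z : Sp N, exp (-(1 / 4) * ‖z‖ ^ 2) * f (√σ • z) := by
  have hs : 0 < √σ := sqrt_pos.2 hσ
  have h := Measure.integral_comp_smul (volume : Measure (Sp N)) (fun z => hk z σ * f z) (√σ)
  have e1 : |(√σ ^ Module.finrank ℝ (Sp N))⁻¹| = σ ^ (-(N / 2 : ℝ)) := by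
    rw [abs_of_pos (by positivity), finrank_euclideanSpace, Fintype.card_fin, rpow_neg hσ.le,
      sqrt_eq_rpow, ← rpow_natCast, ← rpow_mul hσ.le]
    congr 2; ring
  have e2 : ∀ z : Sp N, hk (√σ • z) σ * f (√σ • z)
      = σ ^ (-(N / 2 : ℝ)) * (exp (-(1 / 4) * ‖z‖ ^ 2) * f (√σ • z)) := fun z => by
    unfold hk
    rw [norm_smul, norm_of_nonneg hs.le, mul_pow, sq_sqrt hσ.le]
    rw [show -(1 / (4 * σ)) * (σ * ‖z‖ ^ 2) = -(1 / 4) * ‖z‖ ^ 2 by field_simp]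
    ring
  simp only [e2, e1, smul_eq_mul, integral_const_mul] at h
  exact (mul_left_cancel₀ (by positivity) h).symm

theorem integral_hk {σ : ℝ} (hσ : 0 < σ) : ∫ z : Sp N, hk z σ = hmass N := by
  simpa [hmass] using integral_hk_mul hσ (fun _ : Sp N => (1 : ℝ))

theorem tendsto_hk {f : Sp N → ℝ} (hf : Continuous f) (hc : HasCompactSupport f) :
    Tendsto (fun η => ∫ z, hk z η * f z) (𝓝[>] 0) (𝓝 (hmass N * f 0)) := by
  obtain ⟨B, hB⟩ := hf.bounded_above_of_compact_support hc
  have h1 : (fun η => ∫ z, hk z η * f z) =ᶠ[𝓝[>] 0]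
      fun η => ∫ z : Sp N, exp (-(1 / 4) * ‖z‖ ^ 2) * f (√η • z) := by
    filter_upwards [self_mem_nhdsWithin] with η hη using integral_hk_mul hη f
  rw [tendsto_congr' h1, hmass, ← integral_mul_const]
  refine tendsto_integral_filter_of_dominated_convergence
    (fun z => exp (-(1 / 4) * ‖z‖ ^ 2) * B)
    (Eventually.of_forall fun η => by
      refine Continuous.aestronglyMeasurable ?_
      fun_prop)
    (Eventually.of_forall fun η => Eventually.of_forall fun z => ?_)
    ((integrable_gauss (by norm_num)).mul_const B) (Eventually.of_forall fun z => ?_)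
  · rw [norm_mul, norm_of_nonneg (exp_pos _).le]
    exact mul_le_mul_of_nonneg_left (hB _) (exp_pos _).le
  · refine Tendsto.const_mul _ ?_
    have : Continuous fun η : ℝ => f (√η • z) := by fun_prop
    have h2 := this.tendsto 0
    simp only [sqrt_zero, zero_smul] at h2
    exact h2.mono_left nhdsWithin_le_nhds

/-- Off-diagonal decay of the kernel for bounded ages. -/
theorem exists_hk_decay (N : ℕ) : ∃ C : ℝ, 0 < C ∧ ∀ (z : Sp N) (σ : ℝ), 0 < σ → σ ≤ 3 → z ≠ 0 →
    hk z σ ≤ C * σ / ‖z‖ ^ (2 * (N + 1)) := by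
  refine ⟨3 ^ (N / 2 : ℝ) * ((N + 1).factorial * 4 ^ (N + 1)), by positivity, fun z σ hσ h3 hz => ?_⟩
  have hz' : 0 < ‖z‖ := norm_pos_iff.2 hz
  have h1 := pow_div_factorial_le_exp (x := 1 / (4 * σ) * ‖z‖ ^ 2) (by positivity) (N + 1)
  have h2 : exp (-(1 / (4 * σ)) * ‖z‖ ^ 2)
      ≤ ((N + 1).factorial * 4 ^ (N + 1)) * σ ^ (N + 1) / ‖z‖ ^ (2 * (N + 1)) := by
    rw [neg_mul, exp_neg, inv_le_comm₀ (exp_pos _) (by positivity)]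
    refine le_trans (le_of_eq ?_) h1
    rw [mul_pow, div_pow, mul_pow, ← pow_mul]
    field_simp
    simp
  have h4 : σ ^ (-(N / 2 : ℝ)) * σ ^ (N + 1) ≤ 3 ^ (N / 2 : ℝ) * σ := by
    have e : σ ^ (-(N / 2 : ℝ)) * σ ^ (N + 1) = σ ^ (N / 2 : ℝ) * σ := by
      rw [← rpow_natCast σ (N + 1), ← rpow_add hσ]
      nth_rw 3 [← rpow_one σ]
      rw [← rpow_add hσ]
      congr 1; push_cast; ring
    rw [e]
    exact mul_le_mul_of_nonneg_right (rpow_le_rpow hσ.le h3 (by positivity)) hσ.le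
  unfold hk
  calc _ ≤ σ ^ (-(N / 2 : ℝ)) * (((N + 1).factorial * 4 ^ (N + 1)) * σ ^ (N + 1) / ‖z‖ ^ (2 * (N + 1))) :=
        mul_le_mul_of_nonneg_left h2 (by positivity)
    _ = (σ ^ (-(N / 2 : ℝ)) * σ ^ (N + 1)) * ((N + 1).factorial * 4 ^ (N + 1)) / ‖z‖ ^ (2 * (N + 1)) := by
        ring
    _ ≤ (3 ^ (N / 2 : ℝ) * σ) * ((N + 1).factorial * 4 ^ (N + 1)) / ‖z‖ ^ (2 * (N + 1)) := by gcongr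
    _ = _ := by ring

theorem gk_eq_hk {h : ℝ → ℝ} (P : SpT N) (hp : 0 < h P.2) : gk h P = hk P.1 (h P.2) := gk_eq P hp

theorem lapl_mul {f g : SpT N → ℝ} (hf : Sm f) (hg : Sm g) (P : SpT N) :
    lapl (fun P => f P * g P) P = lapl f P * g P + 2 * gdot f g P + f P * lapl g P := by
  have : ∀ i, pd (bx i) (pd (bx i) (fun P => f P * g P)) P
    = pd (bx i) (pd (bx i) f) P * g P + 2 * (pd (bx i) f P * pd (bx i) g P)
      + f P * pd (bx i) (pd (bx i) g) P := fun i => by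
    have e : pd (bx i) (fun P => f P * g P) = fun P => _ := funext fun P => pd_mul hf hg (bx i) P
    beta_reduce at e
    rw [e, pd_add, pd_mul (hf.pd _) hg, pd_mul hf (hg.pd _)]
    · ring
    · exact (hf.pd _).mul hg
    · exact hf.mul (hg.pd _)
  simp only [lapl, gdot, this, Finset.sum_add_distrib, ← Finset.sum_mul, ← Finset.mul_sum]
end

section
variable {N : ℕ}

/-- A smooth spatial cutoff, one on the half ball and supported in the unit ball. -/
structure IsPatch (ψ : Sp N → ℝ) : Prop where
  sm : Sm ψ
  nonneg : ∀ z, 0 ≤ ψ z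
  le_one : ∀ z, ψ z ≤ 1
  one : ∀ z, ‖z‖ ≤ 1 / 2 → ψ z = 1
  zero : ∀ z, 1 < ‖z‖ → ψ z = 0

theorem exists_patch (N : ℕ) : ∃ ψ : Sp N → ℝ, IsPatch ψ := by
  obtain ⟨g, h1, h2, h3, h4, h5, h6⟩ := exists_bump (E := Sp N) (a := 1 / 2) (b := 1)
    (by norm_num) (by norm_num)
  refine ⟨g, h1, h3, h4, h5, fun z hz => ?_⟩
  by_contra h
  have := h6 (subset_tsupport _ (Function.mem_support.2 h))
  rw [mem_closedBall_zero_iff] at this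
  linarith

theorem CylSupp.lapl {F : SpT N → ℝ} {k : ℝ} (hk : CylSupp F k) : CylSupp (lapl F) k :=
  fun P hP => Finset.sum_eq_zero fun i _ => (hk.pd (bx i)).pd (bx i) P hP

variable {ψ : Sp N → ℝ} (hψ : IsPatch ψ)
include hψ

theorem IsPatch.lift : Sm (fun P : SpT N => ψ P.1) := ContDiff.comp hψ.sm contDiff_fst

theorem IsPatch.cyl : CylSupp (fun P : SpT N => ψ P.1) 1 := fun _ hP => hψ.zero _ hP

theorem IsPatch.hcs : HasCompactSupport ψ :=
  HasCompactSupport.intro (isCompact_closedBall (0 : Sp N) 1) fun z hz => hψ.zero z (by simpa using hz)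

theorem IsPatch.bt_zero (P : SpT N) : pd bt (fun P : SpT N => ψ P.1) P = 0 := by
  have h : HasFDerivAt (fun P : SpT N => ψ P.1) _ P :=
    (hψ.sm.diff P.1).hasFDerivAt.comp P hasFDerivAt_fst
  rw [pd, h.fderiv]; simp [bt]

theorem IsPatch.bx_zero (i : Fin N) {P : SpT N} (hP : ‖P.1‖ < 1 / 2) :
    pd (bx i) (fun P : SpT N => ψ P.1) P = 0 := by
  have : (fun P : SpT N => ψ P.1) =ᶠ[𝓝 P] fun _ => 1 := by
    have : {Q : SpT N | ‖Q.1‖ < 1 / 2} ∈ 𝓝 P :=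
      (isOpen_lt continuous_fst.norm continuous_const).mem_nhds hP
    filter_upwards [this] with Q hQ using hψ.one _ (le_of_lt hQ)
  unfold pd; rw [this.fderiv_eq]; simp

theorem IsPatch.lapl_zero {P : SpT N} (hP : ‖P.1‖ < 1 / 2) :
    lapl (fun P : SpT N => ψ P.1) P = 0 := by
  unfold lapl
  refine Finset.sum_eq_zero fun i _ => ?_
  have : pd (bx i) (fun P : SpT N => ψ P.1) =ᶠ[𝓝 P] fun _ => 0 := by
    have : {Q : SpT N | ‖Q.1‖ < 1 / 2} ∈ 𝓝 P :=
      (isOpen_lt continuous_fst.norm continuous_const).mem_nhds hP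
    filter_upwards [this] with Q hQ using hψ.bx_zero i hQ
  rw [pd, this.fderiv_eq]; simp

theorem IsPatch.exists_comm_bound : ∃ C : ℝ, 0 ≤ C ∧ ∀ h : ℝ → ℝ, Sm h → (∀ s, 0 < h s) →
    ∀ P : SpT N, P.2 ∈ Icc (-1) 0 → h P.2 ≤ 3 →
      |2 * gdot (gk h) (fun P => ψ P.1) P + gk h P * lapl (fun P => ψ P.1) P| ≤ C := by
  obtain ⟨C0, hC0, hdec⟩ := exists_hk_decay N
  have hcp := (isCompact_closedBall (0 : Sp N) 1).prod (isCompact_Icc (a := (-1 : ℝ)) (b := 0))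
  obtain ⟨G, hG⟩ := hcp.exists_bound_of_continuousOn (hψ.lift.gdot hψ.lift).cont.continuousOn
  obtain ⟨L, hL⟩ := hcp.exists_bound_of_continuousOn hψ.lift.lapl.cont.continuousOn
  set D := C0 * 4 ^ (N + 1) with hD
  have hDp : 0 < D := by positivity
  have hG0 : 0 ≤ G := (norm_nonneg _).trans (hG (0, 0) (by simp))
  have hL0 : 0 ≤ L := (norm_nonneg _).trans (hL (0, 0) (by simp))
  refine ⟨(D / 2) ^ 2 + G + D * 3 * L, by positivity, fun h hh hp P hP h3 => ?_⟩
  by_cases h1 : ‖P.1‖ < 1 / 2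
  · have : gdot (gk h) (fun P => ψ P.1) P = 0 := by
      unfold gdot
      exact Finset.sum_eq_zero fun i _ => by rw [hψ.bx_zero i h1, mul_zero]
    rw [this, hψ.lapl_zero h1]
    simp only [mul_zero, add_zero, abs_zero]; positivity
  push Not at h1
  by_cases h2 : 1 < ‖P.1‖
  · have : gdot (gk h) (fun P => ψ P.1) P = 0 := by
      unfold gdot
      exact Finset.sum_eq_zero fun i _ => by rw [hψ.cyl.pd (bx i) P h2, mul_zero]
    have h4 : lapl (fun P : SpT N => ψ P.1) P = 0 := by
      unfold lapl
      exact Finset.sum_eq_zero fun i _ => (hψ.cyl.pd (bx i)).pd (bx i) P h2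
    rw [this, h4]
    simp only [mul_zero, add_zero, abs_zero]; positivity
  push Not at h2
  have hmem : P ∈ closedBall (0 : Sp N) 1 ×ˢ Icc (-1 : ℝ) 0 := ⟨by simpa using h2, hP⟩
  have hz : P.1 ≠ 0 := by
    intro h0; rw [h0, norm_zero] at h1; norm_num at h1
  have hKb : gk h P ≤ D * h P.2 := by
    rw [gk_eq_hk P (hp _)]
    refine (hdec P.1 _ (hp _) h3 hz).trans ?_
    have : (1 / 4 : ℝ) ^ (N + 1) ≤ ‖P.1‖ ^ (2 * (N + 1)) := by
      rw [pow_mul]; exact pow_le_pow_left₀ (by norm_num) (by nlinarith) _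
    rw [div_le_iff₀ (by positivity)]
    calc C0 * h P.2 = D * h P.2 * (1 / 4) ^ (N + 1) := by
          rw [hD, one_div, inv_pow]; field_simp
      _ ≤ _ := by
          have := hp P.2
          gcongr
  have hg1 := gdot_sq_le (gk h) (fun P => ψ P.1) P
  have hg2 : gdot (gk h) (gk h) P ≤ (D / 2) ^ 2 := by
    rw [gdot_gk_self hh hp]
    have := hp P.2
    refine pow_le_pow_left₀ (by have := gk_pos h P; positivity) ?_ 2
    calc gk h P * (‖P.1‖ / (2 * h P.2)) ≤ (D * h P.2) * (1 / (2 * h P.2)) := by gcongr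
      _ = D / 2 := by field_simp
  have hg3 : gdot (fun P => ψ P.1) (fun P => ψ P.1) P ≤ G := (le_abs_self _).trans (hG P hmem)
  have hg4 : |2 * gdot (gk h) (fun P => ψ P.1) P| ≤ (D / 2) ^ 2 + G := by
    refine abs_le_of_sq_le_sq ?_ (by positivity)
    have a1 := gdot_self_nonneg (gk h) P
    have a2 := gdot_self_nonneg (fun P : SpT N => ψ P.1) P
    nlinarith [mul_le_mul hg2 hg3 a2 (by positivity), sq_nonneg ((D / 2) ^ 2 - G)]
  have hg5 : |gk h P * lapl (fun P => ψ P.1) P| ≤ D * 3 * L := by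
    rw [abs_mul, abs_of_pos (gk_pos h P)]
    have := gk_pos h P
    exact mul_le_mul (hKb.trans (by gcongr)) (hL P hmem) (abs_nonneg _) (by positivity)
  exact (abs_add_le _ _).trans (add_le_add hg4 hg5)

/-- One-sided representation inequality for subsolutions. -/
theorem IsPatch.rep : ∃ C : ℝ, 0 ≤ C ∧ ∀ V : SpT N → ℝ, Sm V → ∀ a ε A : ℝ, a ∈ Icc (-1) 0 →
    a < 0 → 0 ≤ ε → (∀ s ∈ Icc a 0, ∀ z ∈ closedBall (0 : Sp N) 1, heat V (z, s) ≤ ε) →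
    (∀ s ∈ Icc a 0, ∫ z in closedBall (0 : Sp N) 1, |V (z, s)| ≤ A) →
    hmass N * V (0, 0) ≤ (∫ z, hk z (-a) * (ψ z * V (z, a))) + C * (ε + A) * (-a) := by
  obtain ⟨C, hC0, hC⟩ := hψ.exists_comm_bound
  refine ⟨C + hmass N, add_nonneg hC0 (hmass_pos N).le, fun V hV a ε A ha ha0 hε hh hA => ?_⟩
  have hA0 : 0 ≤ A := le_trans (by positivity) (hA 0 ⟨ha0.le, le_rfl⟩)
  have hvs : ∀ s, Continuous fun z => ψ z * V (z, s) := fun s => by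
    have := hψ.sm.cont; have := hV.cont; fun_prop
  have key : ∀ η ∈ Ioo (0 : ℝ) 1, ∫ z, hk z η * (ψ z * V (z, 0))
      ≤ (∫ z, hk z (η - a) * (ψ z * V (z, a))) + (C + hmass N) * (ε + A) * (-a) := fun η hη => by
    obtain ⟨h, hhs, hp, he⟩ := exists_clock hη.1
    have hK := sm_gk (N := N) hhs hp
    have hΓ : Sm (fun P : SpT N => gk h P * ψ P.1) := hK.mul hψ.lift
    have hcs : CylSupp (fun P : SpT N => gk h P * ψ P.1) 1 := fun P hP => by
      simp [hψ.zero _ hP]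
    have e1 : ∀ s ≤ 0, ∀ z : Sp N, gk h (z, s) = hk z (η - s) := fun s hs z => by
      rw [gk_eq_hk _ (hp _), he s (by linarith [hη.1])]
    have e0 := e1 0 le_rfl
    have ea := e1 a ha0.le
    rw [sub_zero] at e0
    have := slice_le hΓ hV hcs (D := (C + hmass N) * (ε + A)) ha0.le fun s hs => ?_
    · simpa only [e0, ea, mul_assoc, zero_sub] using this
    have i1 : Integrable fun z : Sp N => ε * hk z (η - s) :=
      (hk_integrable (by linarith [hη.1, hs.2])).const_mul _
    have i2 : Integrable ((closedBall (0 : Sp N) 1).indicator fun z => C * |V (z, s)|) := by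
      rw [integrable_indicator_iff measurableSet_closedBall]
      refine ContinuousOn.integrableOn_compact (isCompact_closedBall _ _) (Continuous.continuousOn ?_)
      have := hV.cont; fun_prop
    have hbk : ∀ z, pd bt (fun P : SpT N => gk h P * ψ P.1) (z, s)
        + lapl (fun P : SpT N => gk h P * ψ P.1) (z, s)
        = 2 * gdot (gk h) (fun P => ψ P.1) (z, s) + gk h (z, s) * lapl (fun P => ψ P.1) (z, s) := fun z => by
      rw [pd_mul hK hψ.lift, lapl_mul hK hψ.lift, hψ.bt_zero]
      have := gk_backward (N := N) hhs hp hη.1 he (P := (z, s)) hs.2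
      linear_combination ψ z * this
    calc _ ≤ ∫ z, (ε * hk z (η - s) + (closedBall (0 : Sp N) 1).indicator (fun z => C * |V (z, s)|) z) := by
          have i0 : Integrable fun z => (gk h (z, s) * ψ z * heat V (z, s) + V (z, s) *
              (pd bt (fun P : SpT N => gk h P * ψ P.1) (z, s)
              + lapl (fun P : SpT N => gk h P * ψ P.1) (z, s))) :=
            CylSupp.integrable (F := fun P : SpT N => gk h P * ψ P.1 * heat V P + V P *
              (pd bt (fun P : SpT N => gk h P * ψ P.1) P
              + lapl (fun P : SpT N => gk h P * ψ P.1) P)) (k := 1)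
              (fun P hP => by simp [hψ.zero _ hP, hcs.pd bt P hP, hcs.lapl P hP])
              ((hΓ.mul hV.heat).add (hV.mul ((hΓ.pd bt).add hΓ.lapl))).cont s
          refine integral_mono i0 (i1.add i2) fun z => ?_
          have hKz := hk_pos z (show 0 < η - s by linarith [hη.1, hs.2])
          simp only [Pi.add_apply, hbk]
          by_cases hz : z ∈ closedBall (0 : Sp N) 1
          · rw [indicator_of_mem hz]
            have h3 := hC h hhs hp (z, s) ⟨ha.1.trans hs.1, hs.2⟩ (by
              rw [he s (by linarith [hη.1, hs.2])]; linarith [hη.2, hs.1, ha.1])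
            refine add_le_add ?_ ?_
            · rw [e1 s hs.2]
              have h4 := hh s hs z hz
              have h5 := mul_le_mul_of_nonneg_left h4 (mul_nonneg hKz.le (hψ.nonneg z))
              have h6 := mul_le_mul_of_nonneg_left (hψ.le_one z) (mul_nonneg hKz.le hε)
              nlinarith
            · refine (le_abs_self _).trans ?_
              rw [abs_mul, mul_comm]
              exact mul_le_mul_of_nonneg_right h3 (abs_nonneg _)
          · have hz' : 1 < ‖z‖ := by simpa using hz
            rw [indicator_of_notMem hz, ← hbk, hcs.pd bt (z, s) hz', hcs.lapl (z, s) hz',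
              hψ.zero z hz']
            simp only [mul_zero, zero_mul, add_zero]; positivity
      _ = ε * hmass N + C * ∫ z in closedBall (0 : Sp N) 1, |V (z, s)| := by
          rw [integral_add i1 i2, integral_const_mul, integral_hk (by linarith [hη.1, hs.2]),
            integral_indicator measurableSet_closedBall, integral_const_mul]
      _ ≤ (C + hmass N) * (ε + A) := by
          have := mul_le_mul_of_nonneg_left (hA s hs) hC0
          nlinarith [mul_nonneg hC0 hε, mul_nonneg (hmass_pos N).le hA0]
  have t1 := tendsto_hk (hvs 0) (hψ.hcs.mul_right)
  rw [hψ.one 0 (by simp), one_mul] at t1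
  have t2 : Tendsto (fun η => ∫ z, hk z (η - a) * (ψ z * V (z, a))) (𝓝[>] 0)
      (𝓝 (∫ z, hk z (-a) * (ψ z * V (z, a)))) := by
    refine tendsto_integral_filter_of_dominated_convergence
      (fun z => (-a) ^ (-(N / 2 : ℝ)) * |ψ z * V (z, a)|)
      (Eventually.of_forall fun η => ((hk_cont _).mul (hvs a)).aestronglyMeasurable) ?_ ?_
      (Eventually.of_forall fun z => ?_)
    · filter_upwards [self_mem_nhdsWithin] with η hη
      have hη' : (0:ℝ) < η := hη
      refine Eventually.of_forall fun z => ?_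
      rw [norm_mul, norm_of_nonneg (hk_pos z (by linarith)).le]
      refine mul_le_mul_of_nonneg_right ((hk_le_rpow z (by linarith)).trans ?_) (norm_nonneg _)
      exact rpow_le_rpow_of_nonpos (by linarith) (by linarith) (neg_nonpos.2 (by positivity))
    · exact (((hvs a).integrable_of_hasCompactSupport hψ.hcs.mul_right).abs).const_mul _
    · refine Tendsto.mul_const _ ?_
      have : ContinuousAt (fun η => hk z (η - a)) 0 := by
        unfold hk
        have : (0 - a) ≠ 0 := by linarith
        have h4 : 4 * (0 - a) ≠ 0 := by simpa using this
        have h5 : ContinuousAt (fun η : ℝ => 1 / (4 * (η - a))) 0 :=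
          continuousAt_const.div (by fun_prop) h4
        exact ContinuousAt.mul (ContinuousAt.rpow_const (by fun_prop) (Or.inl this))
          ((h5.neg.mul continuousAt_const).rexp)
      have := this.tendsto
      rw [zero_sub] at this
      exact this.mono_left nhdsWithin_le_nhds
  refine le_of_tendsto_of_tendsto t1 (t2.add_const _) ?_
  filter_upwards [Ioo_mem_nhdsGT one_pos] with η hη using key η hη
end

section
variable {N : ℕ}

/-- A smooth convex truncation of the positive part. -/
noncomputable def trunc (x : ℝ) : ℝ := x * expNegInvGlue x

theorem sm_trunc : Sm trunc := contDiff_id.mul expNegInvGlue.contDiff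

theorem trunc_of_nonpos {x : ℝ} (hx : x ≤ 0) : trunc x = 0 := by
  simp [trunc, expNegInvGlue.zero_of_nonpos hx]

theorem trunc_pos {x : ℝ} (hx : 0 < x) : 0 < trunc x := mul_pos hx (expNegInvGlue.pos_of_pos hx)

theorem trunc_nonneg (x : ℝ) : 0 ≤ trunc x := by
  rcases le_or_gt x 0 with h | h
  · rw [trunc_of_nonpos h]
  · exact (trunc_pos h).le

theorem hasDerivAt_trunc (x : ℝ) : HasDerivAt trunc ((1 + x⁻¹) * expNegInvGlue x) x := by
  have h := expNegInvGlue.hasDerivAt_polynomial_eval_inv_mul 1 x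
  simp only [Polynomial.eval_one, one_mul, Polynomial.derivative_one, sub_zero, mul_one,
    Polynomial.eval_pow, Polynomial.eval_X] at h
  refine ((hasDerivAt_id x).mul h).congr_deriv ?_
  rcases eq_or_ne x 0 with rfl | hx
  · simp [expNegInvGlue.zero_of_nonpos le_rfl]
  · simp only [id]; field_simp

theorem hasDerivAt_trunc_deriv (x : ℝ) :
    HasDerivAt (fun x => (1 + x⁻¹) * expNegInvGlue x) (x⁻¹ ^ 3 * expNegInvGlue x) x := by
  have h := expNegInvGlue.hasDerivAt_polynomial_eval_inv_mul (1 + Polynomial.X) x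
  simp only [Polynomial.eval_add, Polynomial.eval_one, Polynomial.eval_X] at h
  refine h.congr_deriv ?_
  simp
  left; ring

theorem trunc_deriv_nonneg (x : ℝ) : 0 ≤ (1 + x⁻¹) * expNegInvGlue x := by
  rcases le_or_gt x 0 with h | h
  · simp [expNegInvGlue.zero_of_nonpos h]
  · exact mul_nonneg (by positivity) (expNegInvGlue.nonneg x)

theorem trunc_deriv2_nonneg (x : ℝ) : 0 ≤ x⁻¹ ^ 3 * expNegInvGlue x := by
  rcases le_or_gt x 0 with h | h
  · simp [expNegInvGlue.zero_of_nonpos h]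
  · exact mul_nonneg (by positivity) (expNegInvGlue.nonneg x)

theorem trunc_mono : Monotone trunc :=
  monotone_of_deriv_nonneg (fun x => (hasDerivAt_trunc x).differentiableAt) fun x => by
    rw [(hasDerivAt_trunc x).deriv]; exact trunc_deriv_nonneg x

theorem trunc_le {x y : ℝ} (hxy : x ≤ y) (hy : 0 ≤ y) : trunc x ≤ y := by
  rcases le_or_gt x 0 with h | h
  · rw [trunc_of_nonpos h]; exact hy
  · refine le_trans ?_ hxy
    refine mul_le_of_le_one_right h.le ?_
    rw [expNegInvGlue, if_neg (not_le.2 h)]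
    exact exp_le_one_iff.2 (neg_nonpos.2 (by positivity))

theorem trunc_backward {K : SpT N → ℝ} (hK : Sm K) (κ : ℝ) {P : SpT N}
    (hP : pd bt K P + lapl K P = 0) :
    0 ≤ pd bt (fun P => trunc (K P - κ)) P + lapl (fun P => trunc (K P - κ)) P := by
  have hf : Sm (fun P => K P - κ) := hK.sub (Sm.const κ)
  have e1 : ∀ v Q, pd v (fun P => K P - κ) Q = pd v K Q := fun v Q => by
    rw [pd_sub hK (Sm.const κ), pd_const, sub_zero]
  have h1 : ∀ v, pd v (fun P => trunc (K P - κ))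
      = fun Q => ((1 + (K Q - κ)⁻¹) * expNegInvGlue (K Q - κ)) * pd v K Q := fun v => by
    funext Q
    rw [pd_comp hf (hasDerivAt_trunc _) v, e1]
  have hG : Sm fun Q => (1 + (K Q - κ)⁻¹) * expNegInvGlue (K Q - κ) := by
    have : Sm (fun x : ℝ => (1 + x⁻¹) * expNegInvGlue x) := by
      have := expNegInvGlue.contDiff_polynomial_eval_inv_mul (n := ⊤) (1 + Polynomial.X)
      simp only [Polynomial.eval_add, Polynomial.eval_one, Polynomial.eval_X] at this
      exact this
    exact ContDiff.comp this hf
  have h2 : ∀ i : Fin N, pd (bx i) (pd (bx i) (fun P => trunc (K P - κ))) P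
      = ((K P - κ)⁻¹ ^ 3 * expNegInvGlue (K P - κ)) * (pd (bx i) K P * pd (bx i) K P)
        + ((1 + (K P - κ)⁻¹) * expNegInvGlue (K P - κ)) * pd (bx i) (pd (bx i) K) P := fun i => by
    rw [h1, pd_mul hG (hK.pd _), pd_comp hf (hasDerivAt_trunc_deriv _) (bx i), e1]; ring
  have h3 : lapl (fun P => trunc (K P - κ)) P
      = ((K P - κ)⁻¹ ^ 3 * expNegInvGlue (K P - κ)) * gdot K K P
        + ((1 + (K P - κ)⁻¹) * expNegInvGlue (K P - κ)) * lapl K P := by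
    simp only [lapl, gdot, h2, Finset.sum_add_distrib, ← Finset.mul_sum]
  rw [h3, h1]
  have := mul_nonneg (trunc_deriv2_nonneg (K P - κ)) (gdot_self_nonneg K P)
  have h5 : ((1 + (K P - κ)⁻¹) * expNegInvGlue (K P - κ)) * (pd bt K P + lapl K P) = 0 := by
    rw [hP, mul_zero]
  beta_reduce
  linarith

theorem heat_neg (V : SpT N → ℝ) (P : SpT N) : heat (fun P => -V P) P = -heat V P := by
  have : ∀ v, pd v (fun P => -V P) = fun P => -pd v V P := fun v => funext fun P => pd_neg V v P
  simp only [heat, this, pd_neg, Finset.sum_neg_distrib]; ring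

/-- Uniform decay of the kernel in space. -/
theorem hk_sq_le {z : Sp N} {σ : ℝ} (hσ : 0 < σ) (hz : z ≠ 0) :
    hk z σ ^ 2 ≤ N.factorial * 2 ^ N / ‖z‖ ^ (2 * N) := by
  have hz' : 0 < ‖z‖ := norm_pos_iff.2 hz
  have h1 := pow_div_factorial_le_exp (x := 1 / (2 * σ) * ‖z‖ ^ 2) (by positivity) N
  have e : hk z σ ^ 2 = (σ ^ N)⁻¹ * (exp (1 / (2 * σ) * ‖z‖ ^ 2))⁻¹ := by
    unfold hk
    rw [mul_pow, ← exp_nat_mul, ← exp_neg, ← rpow_natCast (σ ^ _), ← rpow_mul hσ.le,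
      ← rpow_natCast σ N, ← rpow_neg hσ.le]
    congr 2
    · push_cast; ring
    · push_cast; field_simp; ring
  rw [e, ← mul_inv, inv_le_comm₀ (by positivity) (by positivity)]
  calc _ = σ ^ N * ((1 / (2 * σ) * ‖z‖ ^ 2) ^ N / N.factorial) := by
        rw [mul_pow, div_pow, mul_pow, ← pow_mul]; field_simp; simp
    _ ≤ _ := by gcongr

/-- Lower bound for supersolutions, with the truncated kernel. -/
theorem lower_kernel (hN : 1 ≤ N) (ρ : ℝ) : ∃ κ R c : ℝ, 0 < κ ∧ 1 ≤ R ∧ ρ ≤ R ∧ 0 < c ∧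
    ∀ V : SpT N → ℝ, Sm V → ∀ a s₁ ε : ℝ, 0 < a → a ≤ 1 → s₁ ≤ 0 → 1 / 2 ≤ a - s₁ → a - s₁ ≤ 3 →
    0 ≤ ε → (∀ s ∈ Icc s₁ 0, ∀ z ∈ closedBall (0 : Sp N) R, 0 ≤ V (z, s) ∧ -ε ≤ heat V (z, s)) →
    c * ∫ z in closedBall (0 : Sp N) ρ, V (z, s₁)
      ≤ (∫ z, trunc (hk z a - κ) * V (z, 0)) + 3 * hmass N * ε ∧
    ∀ z : Sp N, R < ‖z‖ → trunc (hk z a - κ) = 0 := by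
  set κ : ℝ := 3 ^ (-(N / 2 : ℝ)) * exp (-(1 / 2) * ρ ^ 2) / 2 with hκ
  have hκ0 : 0 < κ := by positivity
  set F : ℝ := N.factorial * 2 ^ N with hF
  have hF0 : 0 < F := by positivity
  set R : ℝ := max (max 1 ρ) (√(F / κ ^ 2)) with hR
  have hR1 : 1 ≤ R := (le_max_left _ _).trans (le_max_left _ _)
  have hRF : F / κ ^ 2 ≤ R ^ (2 * N) := by
    have h1 : √(F / κ ^ 2) ≤ R := le_max_right _ _
    have h2 : F / κ ^ 2 ≤ R ^ 2 := by
      rw [← sq_sqrt (show 0 ≤ F / κ ^ 2 by positivity)]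
      exact pow_le_pow_left₀ (sqrt_nonneg _) h1 2
    exact h2.trans (pow_le_pow_right₀ hR1 (by omega))
  have hfar : ∀ (z : Sp N) (σ : ℝ), 0 < σ → R < ‖z‖ → hk z σ ≤ κ := fun z σ hσ hz => by
    have hz0 : z ≠ 0 := by
      intro h; rw [h, norm_zero] at hz; linarith
    refine abs_le_of_sq_le_sq' ?_ hκ0.le |>.2
    refine (hk_sq_le hσ hz0).trans ?_
    rw [div_le_iff₀ (by have := norm_pos_iff.2 hz0; positivity)]
    rw [div_le_iff₀ (by positivity)] at hRF
    refine hRF.trans ?_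
    rw [mul_comm]
    have : 0 ≤ R := by linarith
    gcongr
  refine ⟨κ, R, trunc κ, hκ0, hR1, (le_max_right _ _).trans (le_max_left _ _), trunc_pos hκ0,
    fun V hV a s₁ ε ha ha1 hs hl hu hε hVs =>
    ⟨?_, fun z hz => trunc_of_nonpos (sub_nonpos.2 (hfar z a ha hz))⟩⟩
  obtain ⟨h, hhs, hp, he⟩ := exists_clock ha
  have hK := sm_gk (N := N) hhs hp
  have hΓ : Sm (fun P : SpT N => trunc (gk h P - κ)) := ContDiff.comp sm_trunc (hK.sub (Sm.const κ))
  have hcs : CylSupp (fun P : SpT N => trunc (gk h P - κ)) R := fun P hP => by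
    refine trunc_of_nonpos (sub_nonpos.2 ?_)
    rw [gk_eq_hk _ (hp _)]; exact hfar _ _ (hp _) hP
  have e1 : ∀ s ≤ 0, ∀ z : Sp N, gk h (z, s) = hk z (a - s) := fun s hs z => by
    rw [gk_eq_hk _ (hp _), he s (by linarith)]
  have hVn : Sm (fun P => -V P) := hV.neg
  have key := slice_le hΓ hVn hcs (D := ε * hmass N) hs fun s hs' => ?_
  · simp only [e1 0 le_rfl, e1 s₁ hs, sub_zero, mul_neg, integral_neg, zero_sub] at key
    have h6 : trunc κ * ∫ z in closedBall (0 : Sp N) ρ, V (z, s₁)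
        ≤ ∫ z, trunc (hk z (a - s₁) - κ) * V (z, s₁) := by
      rw [← integral_const_mul, ← integral_indicator measurableSet_closedBall]
      have hcs1 : CylSupp (fun P : SpT N => trunc (gk h P - κ) * V P) R := hcs.mul V
      have i1 := hcs1.integrable (hΓ.mul hV).cont s₁
      simp only [e1 s₁ hs] at i1
      refine integral_mono ?_ i1 fun z => ?_
      · rw [integrable_indicator_iff measurableSet_closedBall]
        refine ContinuousOn.integrableOn_compact (isCompact_closedBall _ _) (Continuous.continuousOn ?_)
        have := hV.cont; fun_prop
      · have hRz : ∀ z : Sp N, 0 ≤ trunc (hk z (a - s₁) - κ) * V (z, s₁) := fun z => by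
          by_cases hz : R < ‖z‖
          · rw [trunc_of_nonpos (sub_nonpos.2 (hfar z _ (by linarith) hz)), zero_mul]
          · exact mul_nonneg (trunc_nonneg _) (hVs s₁ ⟨le_rfl, hs⟩ z (by simpa using hz)).1
        by_cases hz : z ∈ closedBall (0 : Sp N) ρ
        · rw [indicator_of_mem hz]
          have hz' : ‖z‖ ≤ ρ := by simpa using hz
          refine mul_le_mul_of_nonneg_right (trunc_mono ?_) (hVs s₁ ⟨le_rfl, hs⟩ z ?_).1
          · have : 2 * κ ≤ hk z (a - s₁) := by
              rw [hκ, mul_div_cancel₀ _ (two_ne_zero)]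
              unfold hk
              have hpos : 0 < a - s₁ := by linarith
              refine mul_le_mul (rpow_le_rpow_of_nonpos hpos hu (neg_nonpos.2 (by positivity))) ?_
                (exp_pos _).le (by positivity)
              refine exp_le_exp.2 ?_
              have h7 : 1 / (4 * (a - s₁)) ≤ 1 / 2 := by
                rw [div_le_div_iff₀ (by positivity) (by norm_num)]; linarith
              have h8 : ‖z‖ ^ 2 ≤ ρ ^ 2 := pow_le_pow_left₀ (norm_nonneg _) hz' 2
              have : 0 < 1 / (4 * (a - s₁)) := by positivity
              nlinarith [sq_nonneg ‖z‖]
            linarith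
          · exact closedBall_subset_closedBall ((le_max_right _ _).trans (le_max_left _ _)) hz
        · rw [indicator_of_notMem hz]; exact hRz z
    have h7 : ε * hmass N * -s₁ ≤ 3 * hmass N * ε := by
      have := mul_nonneg hε (hmass_pos N).le
      nlinarith
    linarith
  · have hpos : 0 < a - s := by linarith [hs'.2]
    have i0 : Integrable fun z => (trunc (gk h (z, s) - κ) * heat (fun P => -V P) (z, s) + -V (z, s) *
        (pd bt (fun P : SpT N => trunc (gk h P - κ)) (z, s)
        + lapl (fun P : SpT N => trunc (gk h P - κ)) (z, s))) :=
      CylSupp.integrable (F := fun P : SpT N => trunc (gk h P - κ) * heat (fun P => -V P) P + -V P *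
        (pd bt (fun P : SpT N => trunc (gk h P - κ)) P
        + lapl (fun P : SpT N => trunc (gk h P - κ)) P)) (k := R)
        (fun P hP => by
          have h3 := hcs P hP
          beta_reduce at h3 ⊢
          rw [h3, hcs.pd bt P hP, hcs.lapl P hP]; simp)
        ((hΓ.mul hVn.heat).add (hVn.mul ((hΓ.pd bt).add hΓ.lapl))).cont s
    refine (integral_mono i0 ((hk_integrable hpos).const_mul ε) fun z => ?_).trans_eq (by
      rw [integral_const_mul, integral_hk hpos])
    beta_reduce
    have hKz := hk_pos z hpos
    by_cases hz : z ∈ closedBall (0 : Sp N) R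
    · obtain ⟨g1, g2⟩ := hVs s hs' z hz
      rw [heat_neg]
      have g3 := trunc_backward hK κ (gk_backward (N := N) hhs hp ha he (P := (z, s)) hs'.2)
      have g4 := mul_nonneg g1 g3
      have g5 := trunc_nonneg (gk h (z, s) - κ)
      have g6 : trunc (gk h (z, s) - κ) ≤ hk z (a - s) := by
        rw [e1 s hs'.2]; exact trunc_le (by linarith) hKz.le
      nlinarith [mul_le_mul_of_nonneg_left g2 g5, mul_le_mul_of_nonneg_left g6 hε]
    · have hz' : R < ‖z‖ := by simpa using hz
      have h3 := hcs (z, s) hz'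
      beta_reduce at h3
      rw [h3, hcs.pd bt (z, s) hz', hcs.lapl (z, s) hz']
      simp only [zero_mul, add_zero, mul_zero]; positivity
end

section
variable {N : ℕ}

theorem slice_integrableOn {V : SpT N → ℝ} (hV : Continuous V) (s ρ : ℝ) :
    IntegrableOn (fun z => V (z, s)) (closedBall (0 : Sp N) ρ) :=
  ContinuousOn.integrableOn_compact (isCompact_closedBall _ _) (Continuous.continuousOn (by fun_prop))

/-- Past slice integrals of supersolutions are controlled by the present one. -/
theorem lower_slice (hN : 1 ≤ N) (ρ : ℝ) : ∃ R C : ℝ, 1 ≤ R ∧ ρ ≤ R ∧ 0 < C ∧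
    ∀ V : SpT N → ℝ, Sm V → ∀ s₁ ε : ℝ, s₁ ∈ Icc (-2) 0 → 0 ≤ ε →
    (∀ s ∈ Icc s₁ 0, ∀ z ∈ closedBall (0 : Sp N) R, 0 ≤ V (z, s) ∧ -ε ≤ heat V (z, s)) →
    ∫ z in closedBall (0 : Sp N) ρ, V (z, s₁)
      ≤ C * ((∫ z in closedBall (0 : Sp N) R, V (z, 0)) + ε) := by
  obtain ⟨κ, R, c, hκ, hR1, hρR, hc, H⟩ := lower_kernel hN ρ
  refine ⟨R, (1 + 3 * hmass N) / c, hR1, hρR, by have := hmass_pos N; positivity,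
    fun V hV s₁ ε hs hε hVs => ?_⟩
  obtain ⟨h1, h2⟩ := H V hV 1 s₁ ε one_pos le_rfl hs.2 (by linarith [hs.2]) (by linarith [hs.1]) hε hVs
  have h0 : ∀ z ∈ closedBall (0 : Sp N) R, 0 ≤ V (z, 0) := fun z hz => (hVs 0 ⟨hs.2, le_rfl⟩ z hz).1
  have h3 : ∫ z, trunc (hk z 1 - κ) * V (z, 0) ≤ ∫ z in closedBall (0 : Sp N) R, V (z, 0) := by
    rw [← integral_indicator measurableSet_closedBall]
    refine integral_mono_of_nonneg (Eventually.of_forall fun z => ?_)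
      ((integrable_indicator_iff measurableSet_closedBall).2 (slice_integrableOn hV.cont _ _))
      (Eventually.of_forall fun z => ?_)
    · by_cases hz : R < ‖z‖
      · simp [h2 z hz]
      · exact mul_nonneg (trunc_nonneg _) (h0 z (by simpa using hz))
    · by_cases hz : z ∈ closedBall (0 : Sp N) R
      · rw [indicator_of_mem hz]
        refine mul_le_of_le_one_left (h0 z hz) (trunc_le ?_ zero_le_one)
        have := hk_le_rpow z one_pos
        rw [one_rpow] at this
        linarith
      · rw [indicator_of_notMem hz]
        beta_reduce
        rw [h2 z (by simpa using hz), zero_mul]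
  have h4 : 0 ≤ ∫ z in closedBall (0 : Sp N) R, V (z, 0) :=
    setIntegral_nonneg measurableSet_closedBall h0
  rw [div_mul_eq_mul_div, le_div_iff₀ hc]
  have := mul_nonneg (hmass_pos N).le h4
  nlinarith

/-- Past slice integrals of supersolutions are controlled by a later value. -/
theorem lower_point (hN : 1 ≤ N) (ρ : ℝ) : ∃ R C : ℝ, 1 ≤ R ∧ ρ ≤ R ∧ 0 < C ∧
    ∀ V : SpT N → ℝ, Sm V → ∀ s₁ ε : ℝ, s₁ ∈ Icc (-2) (-(1 / 2)) → 0 ≤ ε →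
    (∀ s ∈ Icc s₁ 0, ∀ z ∈ closedBall (0 : Sp N) R, 0 ≤ V (z, s) ∧ -ε ≤ heat V (z, s)) →
    ∫ z in closedBall (0 : Sp N) ρ, V (z, s₁) ≤ C * (V (0, 0) + ε) := by
  obtain ⟨κ, R, c, hκ, hR1, hρR, hc, H⟩ := lower_kernel hN ρ
  obtain ⟨χ, x1, x2, x3, x4, x5, x6⟩ := exists_bump (E := Sp N) (a := R) (b := R + 1)
    (by linarith) (by linarith)
  have hm := hmass_pos N
  refine ⟨R, (hmass N + 3 * hmass N) / c, hR1, hρR, by positivity, fun V hV s₁ ε hs hε hVs => ?_⟩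
  have h0 : ∀ z ∈ closedBall (0 : Sp N) R, 0 ≤ V (z, 0) := fun z hz =>
    (hVs 0 ⟨by linarith [hs.2], le_rfl⟩ z hz).1
  have hfc : Continuous fun z => χ z * |V (z, 0)| := by
    have := x1.cont; have := hV.cont; fun_prop
  have ht := tendsto_hk hfc x2.mul_right
  rw [x5 0 (by simp; linarith), one_mul, abs_of_nonneg (h0 0 (by simp; linarith))] at ht
  have key : c * ∫ z in closedBall (0 : Sp N) ρ, V (z, s₁)
      ≤ hmass N * V (0, 0) + 3 * hmass N * ε := by
    refine ge_of_tendsto (ht.add_const _) ?_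
    filter_upwards [Ioo_mem_nhdsGT one_pos] with a ha
    obtain ⟨h1, h2⟩ := H V hV a s₁ ε ha.1 ha.2.le (by linarith [hs.2]) (by linarith [hs.2, ha.1])
      (by linarith [hs.1, ha.2]) hε hVs
    refine h1.trans (add_le_add_left ?_ _)
    refine integral_mono_of_nonneg (Eventually.of_forall fun z => ?_)
      (Continuous.integrable_of_hasCompactSupport ((hk_cont a).mul hfc) x2.mul_right.mul_left)
      (Eventually.of_forall fun z => ?_)
    · by_cases hz : R < ‖z‖
      · simp [h2 z hz]
      · exact mul_nonneg (trunc_nonneg _) (h0 z (by simpa using hz))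
    · beta_reduce
      by_cases hz : R < ‖z‖
      · rw [h2 z hz, zero_mul]
        exact mul_nonneg (hk_pos z ha.1).le (mul_nonneg (x3 z) (abs_nonneg _))
      · have hz' : ‖z‖ ≤ R := not_lt.1 hz
        have g := h0 z (by simpa using hz')
        rw [x5 z hz', one_mul, abs_of_nonneg g]
        exact mul_le_mul_of_nonneg_right (trunc_le (by linarith) (hk_pos z ha.1).le) g
  have h4 := h0 0 (by simp; linarith)
  rw [div_mul_eq_mul_div, le_div_iff₀ hc]
  have e : ((0 : Sp N), (0 : ℝ)) = (0 : SpT N) := rfl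
  have := mul_nonneg hm.le h4
  have := mul_nonneg hm.le hε
  nlinarith

/-- Local boundedness of subsolutions by slice integrals. -/
theorem mean_value (N : ℕ) {C₀ : ℝ} (hC₀ : 0 ≤ C₀) : ∃ C : ℝ, 0 < C ∧ ∀ V : SpT N → ℝ, Sm V →
    ∀ ε A : ℝ, 0 ≤ ε → (∀ s ∈ Icc (-1) 0, ∀ z ∈ closedBall (0 : Sp N) 1,
      0 ≤ V (z, s) ∧ heat V (z, s) ≤ C₀ * V (z, s) + ε) →
    (∀ s ∈ Icc (-1) 0, ∫ z in closedBall (0 : Sp N) 1, V (z, s) ≤ A) →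
    V (0, 0) ≤ C * (A + ε) := by
  obtain ⟨ψ, hψ⟩ := exists_patch N
  obtain ⟨C, hC, H⟩ := hψ.rep
  have hm := hmass_pos N
  refine ⟨exp C₀ * (1 + C) / hmass N, by positivity, fun V hV ε A hε hVs hA => ?_⟩
  have hE : Sm (fun P : SpT N => exp (-C₀ * P.2)) :=
    Sm.exp ((Sm.const (-C₀)).mul contDiff_snd)
  have hW : Sm (fun P : SpT N => exp (-C₀ * P.2) * V P) := hE.mul hV
  have hexp : ∀ s ∈ Icc (-1 : ℝ) 0, exp (-C₀ * s) ≤ exp C₀ := fun s hs =>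
    exp_le_exp.2 (by nlinarith [hs.1])
  have hle : ∀ s ∈ Icc (-1 : ℝ) 0, ∫ z in closedBall (0 : Sp N) 1, |exp (-C₀ * s) * V (z, s)|
      ≤ exp C₀ * A := fun s hs => by
    have h0 : 0 ≤ ∫ z in closedBall (0 : Sp N) 1, V (z, s) :=
      setIntegral_nonneg measurableSet_closedBall fun z hz => (hVs s hs z hz).1
    calc _ = ∫ z in closedBall (0 : Sp N) 1, exp (-C₀ * s) * V (z, s) :=
          setIntegral_congr_fun measurableSet_closedBall fun z hz =>
            abs_of_nonneg (mul_nonneg (exp_pos _).le (hVs s hs z hz).1)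
      _ = exp (-C₀ * s) * ∫ z in closedBall (0 : Sp N) 1, V (z, s) := integral_const_mul _ _
      _ ≤ _ := mul_le_mul (hexp s hs) (hA s hs) h0 (exp_pos _).le
  have hA0 : 0 ≤ A := le_trans (setIntegral_nonneg measurableSet_closedBall fun z hz =>
    (hVs 0 (by simp) z hz).1) (hA 0 (by simp))
  have hheat : ∀ P : SpT N, heat (fun P : SpT N => exp (-C₀ * P.2) * V P) P
      = exp (-C₀ * P.2) * (heat V P - C₀ * V P) := fun P => by
    have ht : ∀ v, pd v (fun P : SpT N => exp (-C₀ * P.2)) P = (-C₀ * exp (-C₀ * P.2)) * v.2 := fun v =>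
      pd_time P (h := fun s => exp (-C₀ * s)) (((hasDerivAt_id P.2).const_mul (-C₀)).exp.congr_deriv (by
        simp; ring)) v
    have hx : ∀ i : Fin N, pd (bx i) (fun P : SpT N => exp (-C₀ * P.2) * V P)
        = fun P => exp (-C₀ * P.2) * pd (bx i) V P := fun i => funext fun Q => by
      rw [pd_mul hE hV, pd_time Q (h := fun s => exp (-C₀ * s))
        (((hasDerivAt_id Q.2).const_mul (-C₀)).exp) (bx i)]
      simp [bx]
    have hxx : ∀ i : Fin N, pd (bx i) (pd (bx i) (fun P : SpT N => exp (-C₀ * P.2) * V P)) P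
        = exp (-C₀ * P.2) * pd (bx i) (pd (bx i) V) P := fun i => by
      rw [hx, pd_mul hE (hV.pd _), ht]
      simp [bx]
    unfold heat
    simp only [hxx, ← Finset.mul_sum]
    rw [pd_mul hE hV, ht]
    simp only [bt]; ring
  have h := H _ hW (-1) (exp C₀ * ε) (exp C₀ * A) (by simp) (by norm_num) (by positivity)
    (fun s hs z hz => by
      rw [hheat]
      have h1 := (hVs s hs z hz).2
      have h2 := hexp s hs
      have h3 := exp_pos (-C₀ * s)
      calc _ ≤ exp (-C₀ * s) * ε := mul_le_mul_of_nonneg_left (by linarith) h3.le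
        _ ≤ _ := mul_le_mul_of_nonneg_right h2 hε) hle
  beta_reduce at h
  simp only [mul_zero, exp_zero, one_mul, neg_neg, mul_one] at h
  have h5 : ∫ z, hk z 1 * (ψ z * (exp (-C₀ * -1) * V (z, -1))) ≤ exp C₀ * A := by
    refine le_trans ?_ (hle (-1) (by simp))
    rw [← integral_indicator measurableSet_closedBall]
    refine integral_mono ?_ ((integrable_indicator_iff measurableSet_closedBall).2 ?_) fun z => ?_
    · have := hψ.sm.cont; have := hV.cont; have := hk_cont (N := N) 1
      exact Continuous.integrable_of_hasCompactSupport (by fun_prop) (hψ.hcs.mul_right.mul_left)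
    · exact (slice_integrableOn hW.cont (-1) 1).abs
    · by_cases hz : z ∈ closedBall (0 : Sp N) 1
      · rw [indicator_of_mem hz]
        have h6 := hk_le_rpow z one_pos
        rw [one_rpow] at h6
        have h7 := (hVs (-1) (by simp) z hz).1
        have h8 : 0 ≤ exp (-C₀ * -1) * V (z, -1) := by positivity
        rw [abs_of_nonneg h8]
        calc _ ≤ 1 * (1 * (exp (-C₀ * -1) * V (z, -1))) :=
              mul_le_mul h6 (mul_le_mul_of_nonneg_right (hψ.le_one z) h8)
                (mul_nonneg (hψ.nonneg z) h8) zero_le_one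
          _ = _ := by ring
      · rw [indicator_of_notMem hz]
        beta_reduce
        rw [hψ.zero z (by simpa using hz)]; simp
  rw [div_mul_eq_mul_div, le_div_iff₀ hm]
  have h9 : 0 ≤ exp C₀ * ε := by positivity
  nlinarith
end

section
variable {N : ℕ}

/-- `g` is differentiable near `0` and twice differentiable at `0`, with second derivative `h`. -/
def HasD2 (g : ℝ → ℝ) (h : ℝ) : Prop :=
  (∀ᶠ s in 𝓝 (0 : ℝ), DifferentiableAt ℝ g s) ∧ HasDerivAt (deriv g) h 0

theorem HasD2.congr {g g' : ℝ → ℝ} {h : ℝ} (H : HasD2 g h) (e : g' =ᶠ[𝓝 0] g) : HasD2 g' h := by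
  refine ⟨?_, H.2.congr_of_eventuallyEq e.deriv⟩
  filter_upwards [H.1, e.eventuallyEq_nhds] with s hs hs'
  exact hs.congr_of_eventuallyEq hs'

theorem HasD2.add {g g' : ℝ → ℝ} {h h' : ℝ} (H : HasD2 g h) (H' : HasD2 g' h') :
    HasD2 (fun s => g s + g' s) (h + h') := by
  refine ⟨by filter_upwards [H.1, H'.1] with s a b using a.fun_add b,
    (H.2.fun_add H'.2).congr_of_eventuallyEq ?_⟩
  filter_upwards [H.1, H'.1] with s a b
  exact deriv_fun_add a b

theorem HasD2.const_mul {g : ℝ → ℝ} {h : ℝ} (H : HasD2 g h) (c : ℝ) :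
    HasD2 (fun s => c * g s) (c * h) := by
  refine ⟨by filter_upwards [H.1] with s a using a.const_mul c,
    (H.2.const_mul c).congr_of_eventuallyEq ?_⟩
  filter_upwards [H.1] with s a
  exact deriv_const_mul c a

theorem HasD2.scale {g : ℝ → ℝ} {h : ℝ} (H : HasD2 g h) (a : ℝ) :
    HasD2 (fun s => g (a * s)) (a ^ 2 * h) := by
  have ht : Tendsto (fun s : ℝ => a * s) (𝓝 0) (𝓝 0) := by
    have : Continuous fun s : ℝ => a * s := by fun_prop
    simpa using this.tendsto 0
  have hm : ∀ s : ℝ, HasDerivAt (fun s : ℝ => a * s) a s := fun s => by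
    simpa using (hasDerivAt_id s).const_mul a
  refine ⟨by filter_upwards [ht.eventually H.1] with s hs using
    DifferentiableAt.comp s hs (hm s).differentiableAt, ?_⟩
  have h2 : HasDerivAt (fun s : ℝ => a * deriv g (a * s)) (a * (h * a)) 0 := by
    refine HasDerivAt.const_mul a ?_
    have h0 : HasDerivAt (deriv g) h (a * 0) := by simpa using H.2
    exact h0.comp 0 (hm 0)
  have e : a ^ 2 * h = a * (h * a) := by ring
  rw [e]
  refine h2.congr_of_eventuallyEq ?_
  filter_upwards [ht.eventually H.1] with s hs
  have := (hs.hasDerivAt.comp s (hm s)).deriv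
  rw [mul_comm a]
  exact this

theorem HasD2.nonneg_of_min {g : ℝ → ℝ} {h : ℝ} (H : HasD2 g h) (hmin : IsLocalMin g 0) :
    0 ≤ h := by
  by_contra! hh
  have h1 := hmin.deriv_eq_zero
  have h2 := isLocalMax_of_deriv_deriv_neg (f := g) (x₀ := 0) (by rw [H.2.deriv]; exact hh) h1
    H.1.self_of_nhds.continuousAt
  have h3 : g =ᶠ[𝓝 0] fun _ => g 0 := by
    filter_upwards [hmin, h2] with s a b using le_antisymm b a
  have h4 : deriv g =ᶠ[𝓝 0] fun _ => (0 : ℝ) := by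
    have := h3.deriv
    simpa using this
  have := (H.2.congr_of_eventuallyEq h4.symm).unique (hasDerivAt_const (0 : ℝ) (0 : ℝ))
  linarith

/-- The function `v` has, at `P`, the pointwise derivatives occurring in the heat operator, with
value `c`. -/
def HeatAt (v : SpT N → ℝ) (P : SpT N) (c : ℝ) : Prop :=
  ∃ (a : ℝ) (h : Fin N → ℝ), HasDerivAt (fun s : ℝ => v (P + s • bt)) a 0 ∧
    (∀ i, HasD2 (fun s => v (P + s • bx i)) (h i)) ∧ a - ∑ i, h i = c

theorem tendsto_line (P v : SpT N) : Tendsto (fun s : ℝ => P + s • v) (𝓝 0) (𝓝 P) := by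
  have : Continuous fun s : ℝ => P + s • v := by fun_prop
  simpa using this.tendsto 0

theorem HeatAt.congr {v w : SpT N → ℝ} {P : SpT N} {c : ℝ} (H : HeatAt v P c) (e : w =ᶠ[𝓝 P] v) :
    HeatAt w P c := by
  obtain ⟨a, h, h1, h2, h3⟩ := H
  exact ⟨a, h, h1.congr_of_eventuallyEq ((tendsto_line P bt).eventually e),
    fun i => (h2 i).congr ((tendsto_line P (bx i)).eventually e), h3⟩

theorem HeatAt.add {v w : SpT N → ℝ} {P : SpT N} {c d : ℝ} (H : HeatAt v P c) (H' : HeatAt w P d) :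
    HeatAt (fun P => v P + w P) P (c + d) := by
  obtain ⟨a, h, h1, h2, h3⟩ := H
  obtain ⟨a', h', h1', h2', h3'⟩ := H'
  refine ⟨a + a', fun i => h i + h' i, h1.fun_add h1', fun i => (h2 i).add (h2' i), ?_⟩
  rw [Finset.sum_add_distrib]; linarith

theorem HeatAt.const_mul {v : SpT N → ℝ} {P : SpT N} {c : ℝ} (H : HeatAt v P c) (k : ℝ) :
    HeatAt (fun P => k * v P) P (k * c) := by
  obtain ⟨a, h, h1, h2, h3⟩ := H
  refine ⟨k * a, fun i => k * h i, h1.const_mul k, fun i => (h2 i).const_mul k, ?_⟩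
  rw [← Finset.mul_sum, ← h3]; ring

theorem HeatAt.const (k : ℝ) (P : SpT N) : HeatAt (fun _ => k) P 0 :=
  ⟨0, fun _ => 0, hasDerivAt_const _ _, fun i => ⟨Eventually.of_forall fun _ => by fun_prop, by
    simpa using hasDerivAt_const (0 : ℝ) (0 : ℝ)⟩, by simp⟩

theorem HeatAt.sum {ι : Type*} {s : Finset ι} {v : ι → SpT N → ℝ} {P : SpT N} {c : ι → ℝ}
    (H : ∀ i ∈ s, HeatAt (v i) P (c i)) : HeatAt (fun P => ∑ i ∈ s, v i P) P (∑ i ∈ s, c i) := by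
  classical
  induction s using Finset.induction_on with
  | empty => simpa using HeatAt.const 0 P
  | insert i s hi ih =>
    simp only [Finset.sum_insert hi]
    exact (H i (by simp)).add (ih fun j hj => H j (by simp [hj]))

theorem HeatAt.scale {v : SpT N → ℝ} {P P₀ : SpT N} {c a : ℝ}
    (H : HeatAt v (scl a (a ^ 2) P + P₀) c) :
    HeatAt (fun Q => v (scl a (a ^ 2) Q + P₀)) P (a ^ 2 * c) := by
  obtain ⟨b, h, h1, h2, h3⟩ := H
  have e1 : ∀ s : ℝ, scl a (a ^ 2) (P + s • bt) + P₀ = scl a (a ^ 2) P + P₀ + (a ^ 2 * s) • bt :=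
    fun s => by rw [map_add, map_smul, scl_bt, smul_smul, mul_comm s]; abel
  have e2 : ∀ i (s : ℝ), scl a (a ^ 2) (P + s • bx i) + P₀
      = scl a (a ^ 2) P + P₀ + (a * s) • bx i :=
    fun i s => by rw [map_add, map_smul, scl_bx, smul_smul, mul_comm s]; abel
  refine ⟨a ^ 2 * b, fun i => a ^ 2 * h i, ?_, fun i => ?_, ?_⟩
  · simp only [e1]
    have h0 : HasDerivAt (fun s : ℝ => v (scl a (a ^ 2) P + P₀ + s • bt)) b (a ^ 2 * 0) := by
      simpa using h1
    have := h0.comp 0 (by simpa using (hasDerivAt_id (0 : ℝ)).const_mul (a ^ 2))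
    rw [mul_comm b] at this
    exact this
  · simp only [e2]
    exact (h2 i).scale a
  · rw [← Finset.mul_sum, ← h3]; ring

theorem HeatAt.nonpos_of_min {v : SpT N → ℝ} {P : SpT N} {c : ℝ} (H : HeatAt v P c)
    (hmin : IsLocalMin v P) : c ≤ 0 := by
  obtain ⟨a, h, h1, h2, h3⟩ := H
  have hl : ∀ w : SpT N, IsLocalMin (fun s : ℝ => v (P + s • w)) 0 := fun w => by
    have := (tendsto_line P w).eventually hmin
    filter_upwards [this] with s hs
    simpa using hs
  have := (hl bt).hasDerivAt_eq_zero h1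
  have := Finset.sum_nonneg fun i (_ : i ∈ Finset.univ) => (h2 i).nonneg_of_min (hl (bx i))
  linarith

theorem hasDerivAt_line {V : SpT N → ℝ} (hV : Sm V) (P v : SpT N) (s : ℝ) :
    HasDerivAt (fun s : ℝ => V (P + s • v)) (pd v V (P + s • v)) s := by
  have h : HasDerivAt (fun s : ℝ => P + s • v) v s := by
    simpa using ((hasDerivAt_id s).smul_const v).const_add P
  exact (hV.diff (P + s • v)).hasFDerivAt.comp_hasDerivAt s h

theorem heatAt_of_sm {V : SpT N → ℝ} (hV : Sm V) (P : SpT N) : HeatAt V P (heat V P) := by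
  refine ⟨pd bt V P, fun i => pd (bx i) (pd (bx i) V) P, ?_, fun i => ⟨?_, ?_⟩, rfl⟩
  · simpa using hasDerivAt_line hV P bt 0
  · exact Eventually.of_forall fun s => (hasDerivAt_line hV P _ s).differentiableAt
  · have : deriv (fun s : ℝ => V (P + s • bx i)) = fun s => pd (bx i) V (P + s • bx i) :=
      funext fun s => (hasDerivAt_line hV P _ s).deriv
    rw [this]
    simpa using hasDerivAt_line (hV.pd (bx i)) P (bx i) 0

/-- Squared distance to `P₀`. -/
noncomputable def sqd (P₀ P : SpT N) : ℝ := ‖P.1 - P₀.1‖ ^ 2 + (P.2 - P₀.2) ^ 2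

theorem continuous_sqd (P₀ : SpT N) : Continuous (sqd P₀) := by unfold sqd; fun_prop

theorem heatAt_sqd (P₀ P : SpT N) : HeatAt (sqd P₀) P (2 * (P.2 - P₀.2) - 2 * N) := by
  refine ⟨2 * (P.2 - P₀.2), fun _ => 2, ?_, fun i => ?_, by simp [mul_comm]⟩
  · have e : (fun s : ℝ => sqd P₀ (P + s • bt)) =
        fun s : ℝ => ‖P.1 - P₀.1‖ ^ 2 + (P.2 + s - P₀.2) ^ 2 := by
      funext s; simp [sqd, bt]
    rw [e]
    have h := ((((hasDerivAt_id (0 : ℝ)).const_add P.2).sub_const P₀.2).pow 2).const_add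
      (‖P.1 - P₀.1‖ ^ 2)
    simpa using h
  · have e : (fun s : ℝ => sqd P₀ (P + s • bx i)) =
        fun s : ℝ => (‖P.1 - P₀.1‖ ^ 2 + (P.2 - P₀.2) ^ 2) + 2 * (P.1 i - P₀.1 i) * s + s ^ 2 := by
      funext s
      have : P.1 + s • EuclideanSpace.single i (1 : ℝ) - P₀.1
          = (P.1 - P₀.1) + s • EuclideanSpace.single i (1 : ℝ) := by abel
      simp only [sqd, bx, Prod.fst_add, Prod.smul_mk, Prod.snd_add, smul_zero, add_zero]
      rw [this, norm_add_sq_real, norm_smul, inner_smul_right]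
      simp [EuclideanSpace.inner_single_right]
      ring
    rw [e]
    have hd : ∀ s : ℝ, HasDerivAt (fun s : ℝ => (‖P.1 - P₀.1‖ ^ 2 + (P.2 - P₀.2) ^ 2)
        + 2 * (P.1 i - P₀.1 i) * s + s ^ 2) (2 * (P.1 i - P₀.1 i) + 2 * s) s := fun s => by
      have h := (((hasDerivAt_id s).const_mul (2 * (P.1 i - P₀.1 i))).const_add
        (‖P.1 - P₀.1‖ ^ 2 + (P.2 - P₀.2) ^ 2)).fun_add ((hasDerivAt_id s).fun_pow 2)
      simpa using h
    refine ⟨Eventually.of_forall fun s => (hd s).differentiableAt, ?_⟩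
    rw [funext fun s => (hd s).deriv]
    simpa using ((hasDerivAt_id (0 : ℝ)).const_mul 2).const_add (2 * (P.1 i - P₀.1 i))

theorem sq_le_sqd {P₀ P : SpT N} {ρ : ℝ} (hρ : 0 ≤ ρ) (h : ρ ≤ dist P P₀) : ρ ^ 2 ≤ sqd P₀ P := by
  rw [Prod.dist_eq, le_max_iff, dist_eq_norm, Real.dist_eq] at h
  unfold sqd
  rcases h with h | h
  · have := pow_le_pow_left₀ hρ h 2
    nlinarith [sq_nonneg (P.2 - P₀.2)]
  · have := pow_le_pow_left₀ hρ h 2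
    rw [sq_abs] at this
    nlinarith [sq_nonneg ‖P.1 - P₀.1‖]

/-- Uniform limits of pointwise subsolution data: one-sided stability. -/
theorem heat_le_of_limit {U G : SpT N → ℝ} (hU : Sm U) (hG : Continuous G) (P₀ : SpT N) {ρ₀ : ℝ}
    (hρ₀ : 0 < ρ₀)
    (H : ∀ θ > 0, ∃ v γ : SpT N → ℝ, Continuous v ∧ ∀ P ∈ ball P₀ ρ₀,
      |v P - U P| ≤ θ ∧ |γ P - G P| ≤ θ ∧ HeatAt v P (γ P)) : heat U P₀ ≤ G P₀ := by
  by_contra! hlt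
  have hc : Continuous fun P => heat U P - G P := hU.heat.cont.sub hG
  set d := heat U P₀ - G P₀ with hd
  have hd0 : 0 < d := by linarith
  obtain ⟨ρ₁, h1, h1b⟩ := Metric.continuous_iff.1 hc P₀ (d / 2) (by linarith)
  obtain ⟨ρ, hρ, hρ1, hρ2, hρ3⟩ : ∃ ρ : ℝ, 0 < ρ ∧ ρ < ρ₁ ∧ ρ < ρ₀ ∧ ρ ≤ 1 :=
    ⟨min (min ρ₁ ρ₀ / 2) 1, by positivity, by
      have : 0 < min ρ₁ ρ₀ := by positivity
      have := min_le_left (min ρ₁ ρ₀ / 2) 1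
      have := min_le_left ρ₁ ρ₀
      linarith, by
      have : 0 < min ρ₁ ρ₀ := by positivity
      have := min_le_left (min ρ₁ ρ₀ / 2) 1
      have := min_le_right ρ₁ ρ₀
      linarith, min_le_right _ _⟩
  set A := d / (8 * (N + 1)) with hA
  have hA0 : 0 < A := by positivity
  obtain ⟨v, γ, hv, hvγ⟩ := H (min (A * ρ ^ 2 / 4) (d / 8)) (by positivity)
  have hθ1 := min_le_left (A * ρ ^ 2 / 4) (d / 8)
  have hθ2 := min_le_right (A * ρ ^ 2 / 4) (d / 8)
  have hin : ∀ P ∈ closedBall P₀ ρ, P ∈ ball P₀ ρ₀ := fun P hP =>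
    mem_ball.2 (lt_of_le_of_lt (mem_closedBall.1 hP) hρ2)
  have hFc : Continuous fun P => U P + A * sqd P₀ P + -1 * v P := by
    have := hU.cont; have := continuous_sqd P₀; fun_prop
  obtain ⟨P, hP, hmin⟩ := (isCompact_closedBall P₀ ρ).exists_isMinOn
    ⟨P₀, mem_closedBall_self hρ.le⟩ hFc.continuousOn
  have hPb : P ∈ ball P₀ ρ := by
    by_contra hn
    have h3 : ρ ≤ dist P P₀ := by simpa using hn
    have h4 := sq_le_sqd hρ.le h3
    have h5 := hmin (mem_closedBall_self hρ.le)
    simp only [mem_ofPred_eq] at h5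
    have h6 : sqd P₀ P₀ = 0 := by simp [sqd]
    rw [h6] at h5
    have h7 := abs_le.1 (hvγ P (hin P hP)).1
    have h8 := abs_le.1 (hvγ P₀ (mem_ball_self hρ₀)).1
    have h9 := mul_le_mul_of_nonneg_left h4 hA0.le
    have : 0 < A * ρ ^ 2 := by positivity
    linarith
  have hmin' : IsLocalMin (fun P => U P + A * sqd P₀ P + -1 * v P) P :=
    hmin.isLocalMin (mem_of_superset (isOpen_ball.mem_nhds hPb) ball_subset_closedBall)
  have hh := (((heatAt_of_sm hU P).add ((heatAt_sqd P₀ P).const_mul A)).add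
    ((hvγ P (hin P hP)).2.2.const_mul (-1))).nonpos_of_min hmin'
  have h10 := abs_le.1 (hvγ P (hin P hP)).2.1
  have h11 := h1b P (lt_of_le_of_lt (mem_closedBall.1 hP) hρ1)
  rw [Real.dist_eq] at h11
  have h12 : -(d / 2) < heat U P - G P - d := (abs_lt.1 h11).1
  have h13 : |P.2 - P₀.2| ≤ 1 := by
    have := le_trans (le_max_right (dist P.1 P₀.1) (dist P.2 P₀.2))
      (le_of_eq_of_le (Prod.dist_eq (x := P) (y := P₀)).symm (mem_closedBall.1 hP))
    rw [Real.dist_eq] at this; linarith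
  have h14 := abs_le.1 h13
  have h15 : A * (2 * (P.2 - P₀.2) - 2 * N) ≥ -(d / 4) := by
    have : A * (8 * (N + 1)) = d := by rw [hA]; field_simp
    have := mul_le_mul_of_nonneg_left h14.1 hA0.le
    nlinarith
  linarith

theorem heat_eq_of_limit {U G : SpT N → ℝ} (hU : Sm U) (hG : Continuous G) (P₀ : SpT N) {ρ₀ : ℝ}
    (hρ₀ : 0 < ρ₀)
    (H : ∀ θ > 0, ∃ v γ : SpT N → ℝ, Continuous v ∧ ∀ P ∈ ball P₀ ρ₀,
      |v P - U P| ≤ θ ∧ |γ P - G P| ≤ θ ∧ HeatAt v P (γ P)) : heat U P₀ = G P₀ := by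
  refine le_antisymm (heat_le_of_limit hU hG P₀ hρ₀ H) ?_
  have := heat_le_of_limit (U := fun P => -U P) (G := fun P => -G P) hU.neg hG.neg P₀ hρ₀
    fun θ hθ => by
      obtain ⟨v, γ, hv, h⟩ := H θ hθ
      refine ⟨fun P => -1 * v P, fun P => -1 * γ P, by fun_prop, fun P hP => ?_⟩
      obtain ⟨h1, h2, h3⟩ := h P hP
      refine ⟨?_, ?_, h3.const_mul (-1)⟩
      · rw [show -1 * v P - -U P = -(v P - U P) by ring, abs_neg]; exact h1
      · rw [show -1 * γ P - -G P = -(γ P - G P) by ring, abs_neg]; exact h2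
  rw [heat_neg] at this
  linarith

end

section
variable {N : ℕ}

theorem integral_mem_closed_submodule {X α : Type*} [NormedAddCommGroup X] [NormedSpace ℝ X]
    [CompleteSpace X] [MeasurableSpace α] {μ : Measure α} {S : Submodule ℝ X}
    (hS : IsClosed (S : Set X)) {f : α → X} (hf : Integrable f μ) (h : ∀ a, f a ∈ S) :
    ∫ a, f a ∂μ ∈ S := by
  rw [← Submodule.Quotient.mk_eq_zero S, ← Submodule.mkQ_apply,
    ← Submodule.mkQL_apply, ← ContinuousLinearMap.integral_comp_comm _ hf]
  refine integral_eq_zero_of_ae (Eventually.of_forall fun a => ?_)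
  change S.mkQL (f a) = 0
  rw [Submodule.mkQL_apply, Submodule.mkQ_apply, Submodule.Quotient.mk_eq_zero]
  exact h a

section translates
open scoped BoundedContinuousFunction Convolution

theorem exists_translates {v γ : SpT N → ℝ} (hv : Continuous v) (hγ : Continuous γ)
    (cv : HasCompactSupport v) (cγ : HasCompactSupport γ) :
    ∃ τ : SpT N → (SpT N →ᵇ ℝ × ℝ), Continuous τ ∧ ∀ Q P, τ Q P = (v (P - Q), γ (P - Q)) := by
  have hF : Continuous fun P => (v P, γ P) := hv.prodMk hγ
  have cF : HasCompactSupport fun P => (v P, γ P) :=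
    HasCompactSupport.intro (cv.isCompact.union cγ.isCompact) fun P hP => by
      rw [mem_union, not_or] at hP
      rw [image_eq_zero_of_notMem_tsupport hP.1, image_eq_zero_of_notMem_tsupport hP.2]
      rfl
  obtain ⟨M, hM⟩ := cF.exists_bound_of_continuous hF
  let F : SpT N →ᵇ ℝ × ℝ := BoundedContinuousFunction.ofNormedAddCommGroup _ hF M hM
  refine ⟨fun Q => F.compContinuous ⟨fun P => P - Q, by fun_prop⟩, ?_, fun Q P => rfl⟩
  have huc : UniformContinuous fun P => (v P, γ P) :=
    cF.uniformContinuous_of_continuous hF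
  refine Metric.continuous_iff.2 fun Q ε hε => ?_
  obtain ⟨δ, hδ, h⟩ := Metric.uniformContinuous_iff.1 huc (ε / 2) (by linarith)
  refine ⟨δ, hδ, fun Q' hQ' => lt_of_le_of_lt
    ((BoundedContinuousFunction.dist_le (by linarith : (0:ℝ) ≤ ε / 2)).2 fun P => ?_)
    (by linarith : ε / 2 < ε)⟩
  refine (h ?_).le
  change dist (P - Q') (P - Q) < δ
  rwa [dist_sub_left]

/-- Pairs `(v, γ)` such that `γ` is the pointwise heat operator of `v` on a ball. -/
def heatPairs (P₀ : SpT N) (ρ₀ : ℝ) : Submodule ℝ (SpT N →ᵇ ℝ × ℝ) where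
  carrier := {f | ∀ P ∈ ball P₀ ρ₀, HeatAt (fun P => (f P).1) P (f P).2}
  add_mem' := fun {_ _} hf hg P hP => (hf P hP).add (hg P hP)
  zero_mem' := fun P _ => HeatAt.const 0 P
  smul_mem' := fun c _ hf P hP => (hf P hP).const_mul c

theorem mem_heatPairs {P₀ : SpT N} {ρ₀ : ℝ} {f : SpT N →ᵇ ℝ × ℝ} :
    f ∈ heatPairs P₀ ρ₀ ↔ ∀ P ∈ ball P₀ ρ₀, HeatAt (fun P => (f P).1) P (f P).2 := Iff.rfl

theorem integrable_normed_smul {X : Type*} [NormedAddCommGroup X] [NormedSpace ℝ X]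
    (η : ContDiffBump (0 : SpT N)) {τ : SpT N → X} (hτ : Continuous τ) :
    Integrable fun Q => η.normed volume Q • τ Q := by
  have h1 : Continuous fun Q => η.normed volume Q • τ Q := (η.continuous_normed).smul hτ
  have h2 : HasCompactSupport fun Q => η.normed volume Q • τ Q :=
    η.hasCompactSupport_normed.smul_right
  exact h1.integrable_of_hasCompactSupport h2

/-- Mollification commutes with the pointwise heat operator. -/
theorem heat_convolution {v γ : SpT N → ℝ} (hv : Continuous v) (hγ : Continuous γ)
    (cv : HasCompactSupport v) (cγ : HasCompactSupport γ) (η : ContDiffBump (0 : SpT N))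
    (P₀ : SpT N) {ρ₀ : ℝ} (hρ₀ : 0 < ρ₀)
    (H : ∀ P ∈ ball P₀ (ρ₀ + η.rOut), HeatAt v P (γ P)) :
    heat (η.normed volume ⋆[ContinuousLinearMap.lsmul ℝ ℝ, volume] v) P₀
      = (η.normed volume ⋆[ContinuousLinearMap.lsmul ℝ ℝ, volume] γ) P₀ := by
  obtain ⟨τ, hτc, hτ⟩ := exists_translates hv hγ cv cγ
  set S := heatPairs P₀ ρ₀
  have hint : Integrable fun Q => η.normed volume Q • τ Q :=
    integrable_normed_smul η hτc
  set Φ := ∫ Q, η.normed volume Q • τ Q with hΦ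
  have hS : ∀ Q, η.normed volume Q • τ Q ∈ S.topologicalClosure := fun Q => by
    by_cases hQ : η.normed volume Q = 0
    · have h0 : η.normed volume Q • τ Q = 0 := by ext <;> simp [hQ]
      rw [h0]; exact S.topologicalClosure.zero_mem
    · have hQ' : Q ∈ Function.support (η.normed volume) := hQ
      rw [η.support_normed_eq] at hQ'
      refine S.le_topologicalClosure (S.smul_mem _ (mem_heatPairs.2 fun P hP => ?_))
      have hb : P - Q ∈ ball P₀ (ρ₀ + η.rOut) := by
        rw [mem_ball, dist_eq_norm] at hP hQ' ⊢
        calc ‖P - Q - P₀‖ = ‖(P - P₀) - (Q - 0)‖ := by congr 1; abel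
          _ ≤ ‖P - P₀‖ + ‖Q - 0‖ := norm_sub_le _ _
          _ < _ := by linarith
      have := H _ hb
      have h1 := HeatAt.scale (P := P) (P₀ := -Q) (a := 1) (v := v) (c := γ (P - Q))
        (by simpa [scl_apply, sub_eq_add_neg] using this)
      simpa [hτ, scl_apply, sub_eq_add_neg] using h1
  have hΦS : Φ ∈ S.topologicalClosure := by
    exact integral_mem_closed_submodule S.isClosed_topologicalClosure hint hS
  have hval : ∀ P, Φ P = ∫ Q, η.normed volume Q • τ Q P := fun P =>
    ((BoundedContinuousFunction.evalCLM ℝ P).integral_comp_comm hint).symm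
  have hi : ∀ P, Integrable fun Q => η.normed volume Q • τ Q P := fun P =>
    (BoundedContinuousFunction.evalCLM ℝ P).integrable_comp hint
  have hval1 : ∀ P, (Φ P).1 = (η.normed volume ⋆[ContinuousLinearMap.lsmul ℝ ℝ, volume] v) P :=
    fun P => by
      rw [hval, convolution_def]
      refine ((ContinuousLinearMap.fst ℝ ℝ ℝ).integral_comp_comm (hi P)).symm.trans
        (integral_congr_ae (Eventually.of_forall fun Q => ?_))
      simp [hτ]
  have hval2 : ∀ P, (Φ P).2 = (η.normed volume ⋆[ContinuousLinearMap.lsmul ℝ ℝ, volume] γ) P :=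
    fun P => by
      rw [hval, convolution_def]
      refine ((ContinuousLinearMap.snd ℝ ℝ ℝ).integral_comp_comm (hi P)).symm.trans
        (integral_congr_ae (Eventually.of_forall fun Q => ?_))
      simp [hτ]
  refine heat_eq_of_limit (η.hasCompactSupport_normed.contDiff_convolution_left _
    (η.contDiff_normed (n := ⊤)) hv.locallyIntegrable) ?_ P₀ hρ₀ fun θ hθ => ?_
  · exact (η.hasCompactSupport_normed.contDiff_convolution_left (n := (0 : ℕ∞)) _
      (η.contDiff_normed) hγ.locallyIntegrable).continuous
  obtain ⟨f, hf, hfθ⟩ := Metric.mem_closure_iff.1 hΦS θ hθ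
  refine ⟨fun P => (f P).1, fun P => (f P).2, by fun_prop, fun P hP => ⟨?_, ?_, mem_heatPairs.1 hf P hP⟩⟩
  · have := (BoundedContinuousFunction.dist_coe_le_dist P).trans hfθ.le
    rw [dist_comm, Prod.dist_eq, max_le_iff, hval1] at this
    exact this.1
  · have := (BoundedContinuousFunction.dist_coe_le_dist P).trans hfθ.le
    rw [dist_comm, Prod.dist_eq, max_le_iff, hval2] at this
    exact this.2

end translates

theorem continuous_mul_of_tsupport {χ u : SpT N → ℝ} {Ω : Set (SpT N)} (hΩ : IsOpen Ω)
    (hχ : Continuous χ) (hs : tsupport χ ⊆ Ω) (hu : ContinuousOn u Ω) :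
    Continuous fun P => χ P * u P := by
  refine continuous_of_tsupport fun P hP => ?_
  have : P ∈ Ω := hs (tsupport_mul_subset_left hP)
  exact hχ.continuousAt.mul (hu.continuousAt (hΩ.mem_nhds this))

open scoped Convolution in
/-- Continuous functions with continuous pointwise heat operator are locally uniform limits of
smooth functions, together with their heat operators. -/
theorem exists_smooth_approx {Ω : Set (SpT N)} (hΩ : IsOpen Ω) {u g : SpT N → ℝ}
    (hu : ContinuousOn u Ω) (hg : ContinuousOn g Ω) (hh : ∀ P ∈ Ω, HeatAt u P (g P))
    {K : Set (SpT N)} (hK : IsCompact K) (hKΩ : K ⊆ Ω) {ε : ℝ} (hε : 0 < ε) :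
    ∃ U : SpT N → ℝ, Sm U ∧ (∀ P ∈ K, |U P - u P| ≤ ε) ∧ (∀ P ∈ K, |heat U P - g P| ≤ ε) ∧
      ((∀ P ∈ Ω, 0 ≤ u P) → ∀ P, 0 < U P) := by
  obtain ⟨δ₁, hδ₁, hδΩ⟩ := hK.exists_cthickening_subset_open hΩ hKΩ
  obtain ⟨k, k1, k2, k3⟩ := exists_compact_between hK.cthickening hΩ hδΩ
  obtain ⟨χ, x1, x2, x3, x4⟩ := exists_continuous_one_zero_of_isCompact
    (hK.cthickening (r := δ₁)) isOpen_interior.isClosed_compl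
    (disjoint_compl_right_iff_subset.2 k2)
  have hts : tsupport χ ⊆ Ω := by
    refine subset_trans (closure_minimal ?_ k1.isClosed) k3
    intro P hP
    by_contra hn
    exact hP (x2 fun h => hn (interior_subset h))
  have hvc := continuous_mul_of_tsupport hΩ χ.continuous hts hu
  have hγc := continuous_mul_of_tsupport hΩ χ.continuous hts hg
  have hvs : HasCompactSupport fun P => χ P * u P := x3.mul_right
  have hγs : HasCompactSupport fun P => χ P * g P := x3.mul_right
  obtain ⟨d1, hd1, e1⟩ := Metric.uniformContinuous_iff.1
    (hvs.uniformContinuous_of_continuous hvc) (ε / 2) (by linarith)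
  obtain ⟨d2, hd2, e2⟩ := Metric.uniformContinuous_iff.1
    (hγs.uniformContinuous_of_continuous hγc) (ε / 2) (by linarith)
  set δ := min (min d1 d2) (δ₁ / 3) with hδ
  have hδ0 : 0 < δ := by positivity
  have hδa : δ ≤ d1 := (min_le_left _ _).trans (min_le_left _ _)
  have hδb : δ ≤ d2 := (min_le_left _ _).trans (min_le_right _ _)
  have hδc : δ ≤ δ₁ / 3 := min_le_right _ _
  let η : ContDiffBump (0 : SpT N) := ⟨δ / 2, δ, half_pos hδ0, half_lt_self hδ0⟩
  have hone : ∀ P ∈ K, ∀ Q ∈ ball P δ₁, χ Q = 1 := fun P hP Q hQ =>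
    x1 (mem_cthickening_of_dist_le Q P δ₁ K hP (mem_ball.1 hQ).le)
  have hUs : Sm (η.normed volume ⋆[ContinuousLinearMap.lsmul ℝ ℝ, volume] fun P => χ P * u P) :=
    η.hasCompactSupport_normed.contDiff_convolution_left _
      (η.contDiff_normed (n := ⊤)) hvc.locallyIntegrable
  have hself : ∀ P ∈ K, χ P = 1 := fun P hP => hone P hP P (mem_ball_self hδ₁)
  refine ⟨fun P => (η.normed volume ⋆[ContinuousLinearMap.lsmul ℝ ℝ, volume]
    fun P => χ P * u P) P + ε / 2, hUs.add (Sm.const _), fun P hP => ?_, fun P hP => ?_,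
    fun h0 P => ?_⟩
  · have := η.dist_normed_convolution_le (μ := volume) (g := fun P => χ P * u P) (x₀ := P)
      (ε := ε / 2) hvc.aestronglyMeasurable
      (fun Q hQ => (e1 (lt_of_lt_of_le (mem_ball.1 hQ) hδa)).le)
    rw [Real.dist_eq, hself P hP, one_mul] at this
    have := abs_le.1 this
    exact abs_le.2 ⟨by linarith, by linarith⟩
  · have h1 := heat_convolution hvc hγc hvs hγs η P (ρ₀ := δ) hδ0 fun Q hQ => by
      have hQ1 : Q ∈ ball P δ₁ := ball_subset_ball (by change δ + δ ≤ δ₁; linarith) hQ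
      rw [hone P hP Q hQ1, one_mul]
      refine (hh Q (hδΩ (mem_cthickening_of_dist_le Q P δ₁ K hP (mem_ball.1 hQ1).le))).congr ?_
      filter_upwards [isOpen_ball.mem_nhds hQ1] with Q' hQ'
      rw [hone P hP Q' hQ', one_mul]
    have h2 := η.dist_normed_convolution_le (μ := volume) (g := fun P => χ P * g P) (x₀ := P)
      (ε := ε / 2) hγc.aestronglyMeasurable
      (fun Q hQ => (e2 (lt_of_lt_of_le (mem_ball.1 hQ) hδb)).le)
    have h3 : heat (fun P => (η.normed volume ⋆[ContinuousLinearMap.lsmul ℝ ℝ, volume]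
        fun P => χ P * u P) P + ε / 2) P = heat (η.normed volume
        ⋆[ContinuousLinearMap.lsmul ℝ ℝ, volume] fun P => χ P * u P) P := by
      refine heat_eq_of_limit (hUs.add (Sm.const _)) hUs.heat.cont P one_pos
        fun θ hθ => ⟨_, _, (hUs.add (Sm.const (ε / 2))).cont, fun Q _ => ⟨?_, ?_,
          by simpa using (heatAt_of_sm hUs Q).add (HeatAt.const (ε / 2) Q)⟩⟩
      · simpa using hθ.le
      · simpa using hθ.le
    rw [Real.dist_eq, hself P hP, one_mul] at h2
    rw [h3, h1]
    linarith
  · have : 0 ≤ (η.normed volume ⋆[ContinuousLinearMap.lsmul ℝ ℝ, volume]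
        fun P => χ P * u P) P := by
      rw [convolution_def]
      refine integral_nonneg fun Q => mul_nonneg (η.nonneg_normed _) ?_
      by_cases hQ : P - Q ∈ tsupport χ
      · exact mul_nonneg (x4 _).1 (h0 _ (hts hQ))
      · simp [image_eq_zero_of_notMem_tsupport hQ]
    linarith

end

section
variable {N : ℕ}

/-- `g` is the pointwise heat operator of `u` on the open set `Ω`, and both are continuous. -/
structure HeatOn (Ω : Set (SpT N)) (u g : SpT N → ℝ) : Prop where
  isOpen : IsOpen Ω
  cont : ContinuousOn u Ω
  cont_heat : ContinuousOn g Ω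
  heatAt : ∀ P ∈ Ω, HeatAt u P (g P)

theorem HeatOn.approx {Ω : Set (SpT N)} {u g : SpT N → ℝ} (h : HeatOn Ω u g)
    {K : Set (SpT N)} (hK : IsCompact K) (hKΩ : K ⊆ Ω) {ε : ℝ} (hε : 0 < ε) :
    ∃ U : SpT N → ℝ, Sm U ∧ (∀ P ∈ K, |U P - u P| ≤ ε) ∧ (∀ P ∈ K, |heat U P - g P| ≤ ε) ∧
      ((∀ P ∈ Ω, 0 ≤ u P) → ∀ P, 0 < U P) :=
  exists_smooth_approx h.isOpen h.cont h.cont_heat h.heatAt hK hKΩ hε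

theorem HeatOn.sum {ι : Type*} {s : Finset ι} {Ω : Set (SpT N)} {u g : ι → SpT N → ℝ}
    (ho : IsOpen Ω) (h : ∀ i ∈ s, HeatOn Ω (u i) (g i)) :
    HeatOn Ω (fun P => ∑ i ∈ s, u i P) (fun P => ∑ i ∈ s, g i P) :=
  ⟨ho, continuousOn_finsetSum _ fun i hi => (h i hi).cont,
    continuousOn_finsetSum _ fun i hi => (h i hi).cont_heat,
    fun P hP => HeatAt.sum fun i hi => (h i hi).heatAt P hP⟩

theorem HeatOn.const_mul {Ω : Set (SpT N)} {u g : SpT N → ℝ} (h : HeatOn Ω u g) (c : ℝ) :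
    HeatOn Ω (fun P => c * u P) (fun P => c * g P) :=
  ⟨h.isOpen, h.cont.const_mul c, h.cont_heat.const_mul c,
    fun P hP => (h.heatAt P hP).const_mul c⟩

theorem HeatOn.const_add {Ω : Set (SpT N)} {u g : SpT N → ℝ} (h : HeatOn Ω u g) (c : ℝ) :
    HeatOn Ω (fun P => c + u P) g :=
  ⟨h.isOpen, h.cont.const_add c, h.cont_heat, fun P hP => by
    simpa using (HeatAt.const c P).add (h.heatAt P hP)⟩

/-- Parabolic dilation followed by a translation. -/
noncomputable def zoom (a : ℝ) (P₀ : SpT N) (Q : SpT N) : SpT N := scl a (a ^ 2) Q + P₀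

theorem zoom_apply (a : ℝ) (P₀ Q : SpT N) :
    zoom a P₀ Q = (a • Q.1 + P₀.1, a ^ 2 * Q.2 + P₀.2) := rfl

theorem continuous_zoom (a : ℝ) (P₀ : SpT N) : Continuous (zoom a P₀) := by
  unfold zoom; fun_prop

theorem HeatOn.zoom {Ω : Set (SpT N)} {u g : SpT N → ℝ} (h : HeatOn Ω u g) (a : ℝ) (P₀ : SpT N) :
    HeatOn (zoom a P₀ ⁻¹' Ω) (fun Q => u (zoom a P₀ Q)) (fun Q => a ^ 2 * g (zoom a P₀ Q)) :=
  ⟨h.isOpen.preimage (continuous_zoom a P₀),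
    h.cont.comp (continuous_zoom a P₀).continuousOn fun _ hQ => hQ,
    (h.cont_heat.comp (continuous_zoom a P₀).continuousOn fun _ hQ => hQ).const_mul _,
    fun Q hQ => (h.heatAt _ hQ).scale⟩

theorem le_of_forall_pos_le_add_mul {a b k : ℝ} (h : ∀ ε > 0, a ≤ b + k * ε) : a ≤ b := by
  by_contra! hlt
  have h1 := h ((a - b) / (2 * (|k| + 1))) (by have := abs_nonneg k; apply div_pos <;> linarith)
  have h2 : k * ((a - b) / (2 * (|k| + 1))) ≤ (a - b) / 2 := by
    rw [mul_div_assoc', div_le_div_iff₀ (by have := abs_nonneg k; linarith) two_pos]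
    have := le_abs_self k
    nlinarith
  linarith

theorem setIntegral_le_add {f g : Sp N → ℝ} {ρ ε : ℝ} {x : Sp N}
    (hf : ContinuousOn f (closedBall x ρ))
    (hg : ContinuousOn g (closedBall x ρ)) (h : ∀ z ∈ closedBall x ρ, f z ≤ g z + ε) :
    ∫ z in closedBall x ρ, f z ≤ (∫ z in closedBall x ρ, g z)
      + (volume : Measure (Sp N)).real (closedBall x ρ) * ε := by
  have hfi := hf.integrableOn_compact (μ := volume) (isCompact_closedBall _ _)
  have hgi := hg.integrableOn_compact (μ := volume) (isCompact_closedBall _ _)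
  have hci : IntegrableOn (fun _ : Sp N => ε) (closedBall x ρ) volume :=
    integrableOn_const measure_closedBall_lt_top.ne
  have h1 := setIntegral_mono_on hfi (hgi.add hci) measurableSet_closedBall h
  simp only [Pi.add_apply] at h1
  rw [integral_add hgi hci, setIntegral_const] at h1
  simpa using h1

theorem slice_continuousOn {Ω : Set (SpT N)} {u : SpT N → ℝ} (hu : ContinuousOn u Ω) {s : ℝ}
    {A : Set (Sp N)} (h : ∀ z ∈ A, (z, s) ∈ Ω) : ContinuousOn (fun z => u (z, s)) A :=
  hu.comp (by fun_prop) h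

/-- Past slice integrals of nonnegative supersolutions are controlled by the present one. -/
theorem lower_slice_on (hN : 1 ≤ N) (ρ : ℝ) : ∃ R C : ℝ, 1 ≤ R ∧ ρ ≤ R ∧ 0 < C ∧
    ∀ Ω (u g : SpT N → ℝ), HeatOn Ω u g → (∀ P ∈ Ω, 0 ≤ u P) → ∀ s₁ : ℝ, s₁ ∈ Icc (-2) 0 →
    (∀ s ∈ Icc s₁ 0, ∀ z ∈ closedBall (0 : Sp N) R, (z, s) ∈ Ω ∧ 0 ≤ g (z, s)) →
    ∫ z in closedBall (0 : Sp N) ρ, u (z, s₁) ≤ C * ∫ z in closedBall (0 : Sp N) R, u (z, 0) := by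
  obtain ⟨R, C, h1, h2, h3, H⟩ := lower_slice hN ρ
  refine ⟨R, C, h1, h2, h3, fun Ω u g hu h0 s₁ hs hK => ?_⟩
  refine le_of_forall_pos_le_add_mul (k := (volume : Measure (Sp N)).real (closedBall 0 ρ)
    + C * ((volume : Measure (Sp N)).real (closedBall 0 R) + 1)) fun ε hε => ?_
  obtain ⟨U, U1, U2, U3, U4⟩ := hu.approx (K := closedBall (0 : Sp N) R ×ˢ Icc s₁ 0)
    ((isCompact_closedBall _ _).prod isCompact_Icc) (fun P hP => (hK P.2 hP.2 P.1 hP.1).1) hε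
  have h4 := H U U1 s₁ ε hs hε.le fun s hs' z hz => ⟨(U4 h0 _).le, by
    have := abs_le.1 (U3 (z, s) ⟨hz, hs'⟩)
    have := (hK s hs' z hz).2
    linarith⟩
  have hsub : ∀ z ∈ closedBall (0 : Sp N) ρ, z ∈ closedBall (0 : Sp N) R :=
    fun z hz => closedBall_subset_closedBall h2 hz
  have hl : s₁ ∈ Icc s₁ 0 := ⟨le_rfl, hs.2⟩
  have hr : (0:ℝ) ∈ Icc s₁ 0 := ⟨hs.2, le_rfl⟩
  have h5 := setIntegral_le_add (f := fun z => u (z, s₁)) (g := fun z => U (z, s₁)) (ε := ε)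
    (x := 0) (ρ := ρ) (slice_continuousOn hu.cont fun z hz => (hK _ hl z (hsub z hz)).1)
    (slice_continuousOn U1.cont.continuousOn (fun _ _ => mem_univ _)) fun z hz => by
      have := abs_le.1 (U2 (z, s₁) ⟨hsub z hz, hl⟩); linarith
  have h6 := setIntegral_le_add (g := fun z => u (z, 0)) (f := fun z => U (z, 0)) (ε := ε)
    (x := 0) (ρ := R) (slice_continuousOn U1.cont.continuousOn (fun _ _ => mem_univ _))
    (slice_continuousOn hu.cont fun z hz => (hK _ hr z hz).1) fun z hz => by
      have := abs_le.1 (U2 (z, 0) ⟨hz, hr⟩); linarith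
  have h7 := mul_le_mul_of_nonneg_left h6 h3.le
  linarith

/-- Past slice integrals of nonnegative supersolutions are controlled by a later value. -/
theorem lower_point_on (hN : 1 ≤ N) (ρ : ℝ) : ∃ R C : ℝ, 1 ≤ R ∧ ρ ≤ R ∧ 0 < C ∧
    ∀ Ω (u g : SpT N → ℝ), HeatOn Ω u g → (∀ P ∈ Ω, 0 ≤ u P) →
    ∀ s₁ : ℝ, s₁ ∈ Icc (-2) (-(1 / 2)) →
    (∀ s ∈ Icc s₁ 0, ∀ z ∈ closedBall (0 : Sp N) R, (z, s) ∈ Ω ∧ 0 ≤ g (z, s)) →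
    ∫ z in closedBall (0 : Sp N) ρ, u (z, s₁) ≤ C * u (0, 0) := by
  obtain ⟨R, C, h1, h2, h3, H⟩ := lower_point hN ρ
  refine ⟨R, C, h1, h2, h3, fun Ω u g hu h0 s₁ hs hK => ?_⟩
  refine le_of_forall_pos_le_add_mul (k := (volume : Measure (Sp N)).real (closedBall 0 ρ)
    + C * 2) fun ε hε => ?_
  obtain ⟨U, U1, U2, U3, U4⟩ := hu.approx (K := closedBall (0 : Sp N) R ×ˢ Icc s₁ 0)
    ((isCompact_closedBall _ _).prod isCompact_Icc) (fun P hP => (hK P.2 hP.2 P.1 hP.1).1) hε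
  have h4 := H U U1 s₁ ε hs hε.le fun s hs' z hz => ⟨(U4 h0 _).le, by
    have := abs_le.1 (U3 (z, s) ⟨hz, hs'⟩)
    have := (hK s hs' z hz).2
    linarith⟩
  have hsub : ∀ z ∈ closedBall (0 : Sp N) ρ, z ∈ closedBall (0 : Sp N) R :=
    fun z hz => closedBall_subset_closedBall h2 hz
  have hs0 : s₁ ≤ 0 := by linarith [hs.2]
  have hl : s₁ ∈ Icc s₁ 0 := ⟨le_rfl, hs0⟩
  have hr : (0:ℝ) ∈ Icc s₁ 0 := ⟨hs0, le_rfl⟩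
  have h5 := setIntegral_le_add (f := fun z => u (z, s₁)) (g := fun z => U (z, s₁)) (ε := ε)
    (x := 0) (ρ := ρ) (slice_continuousOn hu.cont fun z hz => (hK _ hl z (hsub z hz)).1)
    (slice_continuousOn U1.cont.continuousOn (fun _ _ => mem_univ _)) fun z hz => by
      have := abs_le.1 (U2 (z, s₁) ⟨hsub z hz, hl⟩); linarith
  have h6 := abs_le.1 (U2 (0, 0) ⟨mem_closedBall_self (by linarith), hr⟩)
  have h7 : C * U (0, 0) ≤ C * (u (0, 0) + ε) := mul_le_mul_of_nonneg_left (by linarith) h3.le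
  linarith

/-- Local maximum principle in integral form. -/
theorem mean_value_on (N : ℕ) {C₀ : ℝ} (hC₀ : 0 ≤ C₀) : ∃ C : ℝ, 0 < C ∧
    ∀ Ω (u g : SpT N → ℝ), HeatOn Ω u g → (∀ P ∈ Ω, 0 ≤ u P) → ∀ A : ℝ,
    (∀ s ∈ Icc (-1 : ℝ) 0, ∀ z ∈ closedBall (0 : Sp N) 1,
      (z, s) ∈ Ω ∧ g (z, s) ≤ C₀ * u (z, s)) →
    (∀ s ∈ Icc (-1 : ℝ) 0, ∫ z in closedBall (0 : Sp N) 1, u (z, s) ≤ A) →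
    u (0, 0) ≤ C * A := by
  obtain ⟨C, hC, H⟩ := mean_value N hC₀
  refine ⟨C, hC, fun Ω u g hu h0 A hK hA => ?_⟩
  refine le_of_forall_pos_le_add_mul (k := C * ((volume : Measure (Sp N)).real (closedBall 0 1)
    + (1 + C₀)) + 1) fun ε hε => ?_
  obtain ⟨U, U1, U2, U3, U4⟩ := hu.approx (K := closedBall (0 : Sp N) 1 ×ˢ Icc (-1) 0)
    ((isCompact_closedBall _ _).prod isCompact_Icc) (fun P hP => (hK P.2 hP.2 P.1 hP.1).1) hε
  have h4 := H U U1 ((1 + C₀) * ε) (A + (volume : Measure (Sp N)).real (closedBall 0 1) * ε)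
    (by positivity) (fun s hs z hz => ⟨(U4 h0 _).le, by
      have h1 := abs_le.1 (U3 (z, s) ⟨hz, hs⟩)
      have h2 := abs_le.1 (U2 (z, s) ⟨hz, hs⟩)
      have h3 := (hK s hs z hz).2
      have h4 : C₀ * u (z, s) ≤ C₀ * (U (z, s) + ε) := mul_le_mul_of_nonneg_left (by linarith) hC₀
      linarith⟩) fun s hs => by
    have h6 := setIntegral_le_add (g := fun z => u (z, s)) (f := fun z => U (z, s)) (ε := ε)
      (x := 0) (ρ := 1) (slice_continuousOn U1.cont.continuousOn (fun _ _ => mem_univ _))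
      (slice_continuousOn hu.cont fun z hz => (hK _ hs z hz).1) fun z hz => by
        have := abs_le.1 (U2 (z, s) ⟨hz, hs⟩); linarith
    linarith [hA s hs]
  have h6 := abs_le.1 (U2 (0, 0) ⟨mem_closedBall_self zero_le_one, by simp⟩)
  linarith

end

section
variable {N m : ℕ}

theorem HeatAt.unique {v : SpT N → ℝ} {P : SpT N} {c d : ℝ} (H : HeatAt v P c)
    (H' : HeatAt v P d) : c = d := by
  obtain ⟨a, h, h1, h2, h3⟩ := H
  obtain ⟨a', h', h1', h2', h3'⟩ := H'
  have e1 : a = a' := h1.unique h1'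
  have e2 : h = h' := funext fun i => (h2 i).2.unique (h2' i).2
  rw [← h3, ← h3', e1, e2]

theorem heat_sum {ι : Type*} {s : Finset ι} {V : ι → SpT N → ℝ} (hV : ∀ i ∈ s, Sm (V i))
    (P : SpT N) : heat (fun P => ∑ i ∈ s, V i P) P = ∑ i ∈ s, heat (V i) P :=
  (heatAt_of_sm (Sm.sum hV) P).unique (HeatAt.sum fun i hi => heatAt_of_sm (hV i hi) P)

theorem sm_zoom {V : SpT N → ℝ} (hV : Sm V) (a : ℝ) (P₀ : SpT N) :
    Sm (fun Q => V (zoom a P₀ Q)) := hV.comp_clm _ _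

theorem heat_zoom {V : SpT N → ℝ} (hV : Sm V) (a : ℝ) (P₀ Q : SpT N) :
    heat (fun Q => V (zoom a P₀ Q)) Q = a ^ 2 * heat V (zoom a P₀ Q) :=
  (heatAt_of_sm (sm_zoom hV a P₀) Q).unique (heatAt_of_sm hV _).scale

variable {β : Fin m → Fin m → ℝ} {r : ℝ}

theorem sum_nl_le (hr : 0 < r) (hβ : ∀ i j, 0 ≤ β i j) {y : Fin m → ℝ} (hy : ∀ i, 0 ≤ y i)
    {M : ℝ} (hM : ∀ i, y i ≤ M) : ∑ i, nl β r y i ≤ bsum β * M ^ (2 * r) * ∑ i, y i := by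
  rw [bsum, mul_assoc, Finset.sum_mul]
  refine Finset.sum_le_sum fun i _ => ?_
  rw [nl, Finset.sum_mul]
  refine Finset.sum_le_sum fun j _ => ?_
  have hM0 : 0 ≤ M := (hy i).trans (hM i)
  have h1 : y i ^ r ≤ M ^ r := rpow_le_rpow (hy i) (hM i) hr.le
  have h2 : y j ^ (r + 1) ≤ M ^ r * y j := by
    rw [rpow_add_one' (hy j) (by linarith)]
    exact mul_le_mul_of_nonneg_right (rpow_le_rpow (hy j) (hM j) hr.le) (hy j)
  have h3 : y j ≤ ∑ i, y i := Finset.single_le_sum (fun i _ => hy i) (Finset.mem_univ j)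
  have h4 : M ^ (2 * r) = M ^ r * M ^ r := by
    rw [two_mul, rpow_add_of_nonneg hM0 hr.le hr.le]
  rw [mul_assoc, h4, mul_assoc (M ^ r)]
  have h5 := rpow_nonneg hM0 r
  refine mul_le_mul_of_nonneg_left (mul_le_mul h1 (h2.trans ?_) (rpow_nonneg (hy j) _) h5) (hβ i j)
  exact mul_le_mul_of_nonneg_left h3 h5

theorem le_add_rpow {κ q v : ℝ} (hκ : 0 < κ) (hq : 1 ≤ q) (hv : 0 ≤ v) :
    v ≤ κ + κ ^ (1 - q) * v ^ q := by
  rcases le_total v κ with h | h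
  · have := mul_nonneg (rpow_nonneg hκ.le (1 - q)) (rpow_nonneg hv q); linarith
  · have hv0 : 0 < v := hκ.trans_le h
    have h1 : v = v ^ (1 - q) * v ^ q := by rw [← rpow_add hv0]; simp
    have h2 : v ^ (1 - q) ≤ κ ^ (1 - q) := rpow_le_rpow_of_nonpos hκ h (by linarith)
    have := mul_le_mul_of_nonneg_right h2 (rpow_nonneg hv q)
    linarith

/-- A continuous function on the unit parabolic box has a good time slice. -/
theorem exists_good_slice {S : SpT N → ℝ} (hS : Continuous S) (h0 : ∀ P, 0 ≤ S P) {a η : ℝ}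
    (ha : 0 < a) (ha1 : a ≤ 1) (h : ∫ P in pbox N 1, S P ≤ η) :
    ∃ τ ∈ Icc 0 (a ^ 2), ∫ z in closedBall (0 : Sp N) 1, S (z, τ) ≤ η / a ^ 2 := by
  have hcK : IntegrableOn S (pbox N 1) volume :=
    hS.continuousOn.integrableOn_compact (isCompact_pbox 1)
  set B := closedBall (0 : Sp N) 1
  have hsub : B ×ˢ Icc 0 (a ^ 2) ⊆ pbox N 1 := fun P hP => ⟨by simpa [B] using hP.1, by
    have h1 : P.2 ∈ Icc 0 (a ^ 2) := hP.2
    rw [abs_of_nonneg h1.1]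
    have := h1.2
    nlinarith⟩
  have h1 : ∫ P in B ×ˢ Icc 0 (a ^ 2), S P ≤ η :=
    (setIntegral_mono_set hcK (Eventually.of_forall h0) hsub.eventuallyLE).trans h
  have hi : IntegrableOn S (B ×ˢ Icc 0 (a ^ 2)) (volume.prod volume) := hcK.mono_set hsub
  have hi' : Integrable S ((volume.restrict B).prod (volume.restrict (Icc 0 (a ^ 2)))) := by
    rwa [Measure.prod_restrict]
  have h2 : ∫ P in B ×ˢ Icc 0 (a ^ 2), S P = ∫ τ in Icc 0 (a ^ 2), ∫ z in B, S (z, τ) := by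
    rw [Measure.volume_eq_prod, ← Measure.prod_restrict, integral_prod_symm _ hi']
  have hF : IntegrableOn (fun τ => ∫ z in B, S (z, τ)) (Icc 0 (a ^ 2)) volume := hi'.integral_prod_right
  have hpos : 0 < a ^ 2 := by positivity
  obtain ⟨τ, hτ, h3⟩ := exists_le_setAverage (μ := volume) (s := Icc 0 (a ^ 2))
    (by rw [Real.volume_Icc]; simpa using ha.ne') (by simp) hF
  refine ⟨τ, hτ, h3.trans ?_⟩
  rw [setAverage_eq, ← h2, smul_eq_mul, Measure.real, Real.volume_Icc, sub_zero,
    ENNReal.toReal_ofReal hpos.le, inv_mul_eq_div]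
  exact div_le_div_of_nonneg_right h1 hpos.le

theorem heat_sum_bounds (hr : 0 < r) (hβ : ∀ i j, 0 ≤ β i j) {M ε : ℝ} {V : Fin m → SpT N → ℝ}
    (hV : ∀ i, Sm (V i)) {P : SpT N} (hp : ∀ i, 0 < V i P)
    (hP : ∀ i, V i P ≤ M ∧ |heat (V i) P - nlf β r V i P| ≤ ε) :
    -(m * ε) ≤ heat (fun P => ∑ i, V i P) P ∧
      heat (fun P => ∑ i, V i P) P ≤ bsum β * M ^ (2 * r) * ∑ i, V i P + m * ε := by
  rw [heat_sum fun i _ => hV i]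
  have h1 := sum_nl_le hr hβ (y := fun j => V j P) (fun i => (hp i).le) fun i => (hP i).1
  have h2 : ∑ i : Fin m, (-ε : ℝ) = -(m * ε) := by simp
  have h3 : ∑ i : Fin m, (ε : ℝ) = m * ε := by simp
  have h4 : ∀ i, 0 ≤ nlf β r V i P := fun i => nl_nonneg hβ (fun j => (hp j).le) i
  rw [← h2, ← h3]
  constructor
  · refine Finset.sum_le_sum fun i _ => ?_
    have := abs_le.1 (hP i).2
    linarith [h4 i]
  · refine le_trans ?_ (add_le_add_left h1 _)
    rw [← Finset.sum_add_distrib]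
    refine Finset.sum_le_sum fun i _ => ?_
    have := abs_le.1 (hP i).2
    change _ ≤ nlf β r V i P + ε
    linarith

open scoped Pointwise in
theorem integral_dilate_le {V : Fin m → Sp N → ℝ} (hV : ∀ i, Continuous (V i))
    (hp : ∀ i z, 0 < V i z) {a ρ κ q η : ℝ} (ha : 0 < a) (hρ : 0 < ρ) (haρ : a * ρ ≤ 1)
    (hκ : 0 < κ) (hq : 1 ≤ q) (h : ∫ z in closedBall (0 : Sp N) 1, ∑ i, V i z ^ q ≤ η) :
    ∫ z in closedBall (0 : Sp N) ρ, ∑ i, V i (a • z)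
      ≤ m * κ * (volume : Measure (Sp N)).real (closedBall 0 ρ)
        + κ ^ (1 - q) * ((a ^ N)⁻¹ * η) := by
  have hcz : Continuous fun z : Sp N => a • z := by fun_prop
  have hW : Continuous fun z => ∑ i, V i z := continuous_finsetSum _ fun i _ => hV i
  have hS : Continuous fun z => ∑ i, V i z ^ q :=
    continuous_finsetSum _ fun i _ => (hV i).rpow_const fun z => .inl (hp i z).ne'
  have hci : IntegrableOn (fun z : Sp N => κ ^ (1 - q) * ∑ i, V i (a • z) ^ q) (closedBall 0 ρ)
      volume := (continuous_const.mul (hS.comp hcz)).continuousOn.integrableOn_compact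
        (isCompact_closedBall _ _)
  have hconst : IntegrableOn (fun _ : Sp N => m * κ) (closedBall 0 ρ) volume :=
    integrableOn_const measure_closedBall_lt_top.ne
  have h1 : ∫ z in closedBall (0 : Sp N) ρ, ∑ i, V i (a • z)
      ≤ ∫ z in closedBall (0 : Sp N) ρ, (m * κ + κ ^ (1 - q) * ∑ i, V i (a • z) ^ q) := by
    refine setIntegral_mono_on
      ((hW.comp hcz).continuousOn.integrableOn_compact (isCompact_closedBall _ _))
      (hconst.add hci) measurableSet_closedBall fun z _ => ?_
    have h2 : ∑ i : Fin m, κ = m * κ := by simp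
    rw [← h2, Finset.mul_sum, ← Finset.sum_add_distrib]
    exact Finset.sum_le_sum fun i _ => le_add_rpow hκ hq (hp i _).le
  refine h1.trans ?_
  rw [integral_add hconst hci, setIntegral_const, smul_eq_mul, integral_const_mul]
  have h3 := Measure.setIntegral_comp_smul_of_pos (volume : Measure (Sp N))
    (fun z => ∑ i, V i z ^ q) (closedBall (0 : Sp N) ρ) ha
  rw [h3, finrank_euclideanSpace_fin, smul_eq_mul, mul_comm _ ((m : ℝ) * κ)]
  have h4 : ∫ z in a • closedBall (0 : Sp N) ρ, ∑ i, V i z ^ q ≤ η := by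
    refine le_trans (setIntegral_mono_set
      (hS.continuousOn.integrableOn_compact (isCompact_closedBall _ _))
      (Eventually.of_forall fun z => Finset.sum_nonneg fun i _ => rpow_nonneg (hp i _).le q)
      (LE.le.eventuallyLE ?_)) h
    rw [_root_.smul_closedBall _ _ hρ.le, smul_zero, norm_of_nonneg ha.le]
    exact closedBall_subset_closedBall haρ
  gcongr

theorem center_le_of_slice (hN : 1 ≤ N) {C₀ : ℝ} (hC₀ : 0 ≤ C₀) :
    ∃ a C : ℝ, 0 < a ∧ a ≤ 1 / 2 ∧ 0 < C ∧ ∀ W : SpT N → ℝ, Sm W → (∀ P, 0 ≤ W P) → ∀ e, 0 ≤ e →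
      (∀ P ∈ pbox N 1, -e ≤ heat W P ∧ heat W P ≤ C₀ * W P + e) → ∀ τ ∈ Icc 0 (a ^ 2),
      W 0 ≤ C * ((∫ z in closedBall (0 : Sp N) (1 / (2 * a)), W (a • z, τ)) + e) := by
  obtain ⟨Rs, Cs, hRs, -, hCs, hlow⟩ := lower_slice hN 1
  obtain ⟨Cm, hCm, hmean⟩ := mean_value N hC₀
  obtain ⟨a, ha⟩ : ∃ a, a = 1 / (2 * Rs) := ⟨_, rfl⟩
  have ha0 : 0 < a := by rw [ha]; positivity
  have haR : a * Rs = 1 / 2 := by rw [ha]; field_simp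
  have ha1 : a ≤ 1 / 2 := by nlinarith
  have hRa : 1 / (2 * a) = Rs := by rw [ha]; field_simp
  have ha2 : a ^ 2 ≤ 1 / 4 := by nlinarith
  have hscale : ∀ x : ℝ, 0 ≤ x → a ^ 2 * x ≤ x := fun x hx => by nlinarith
  refine ⟨a, Cm * (Cs + 1), ha0, ha1, by positivity, fun W hW hW0 e he hheat τ hτ => ?_⟩
  rw [hRa]
  obtain ⟨I, hI⟩ : ∃ I, I = ∫ z in closedBall (0 : Sp N) Rs, W (a • z, τ) := ⟨_, rfl⟩
  have hI0 : 0 ≤ I := by rw [hI]; exact integral_nonneg fun _ => hW0 _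
  rw [← hI]
  have hslice : ∀ s ∈ Icc (-1 : ℝ) 0, ∫ z in closedBall (0 : Sp N) 1,
      W (zoom a 0 (z, s)) ≤ Cs * (I + e) := fun s hs => by
    have hτ1 : τ / a ^ 2 ∈ Icc (0 : ℝ) 1 :=
      ⟨div_nonneg hτ.1 (by positivity), div_le_one_of_le₀ hτ.2 (by positivity)⟩
    have hcanc : a ^ 2 * (τ / a ^ 2) = τ := by field_simp
    have h1 := hlow _ (sm_zoom hW a (0, τ)) (s - τ / a ^ 2) e
      ⟨by linarith [hs.1, hτ1.2], by linarith [hs.2, hτ1.1]⟩ he fun s' hs' z hz => by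
        refine ⟨hW0 _, ?_⟩
        rw [heat_zoom hW]
        have hin : zoom a (0, τ) (z, s') ∈ pbox N 1 := by
          rw [zoom_apply]
          refine ⟨?_, ?_⟩
          · simp only [add_zero]
            rw [norm_smul, norm_of_nonneg ha0.le]
            have := mul_le_mul_of_nonneg_left (mem_closedBall_zero_iff.1 hz) ha0.le
            linarith
          · have l1 : -2 ≤ s' := by linarith [hs'.1, hs.1, hτ1.2]
            have := hs'.2
            have := hτ.1
            have := hτ.2
            exact abs_le.2 ⟨by simp only; nlinarith, by simp only; nlinarith⟩
        have := (hheat _ hin).1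
        have := mul_le_mul_of_nonneg_left this (sq_nonneg a)
        linarith [hscale _ he]
    have e1 : ∀ z : Sp N, zoom a (0, τ) (z, s - τ / a ^ 2) = zoom a 0 (z, s) := fun z => by
      simp only [zoom_apply, mul_sub, hcanc]; simp
    have e2 : ∀ z : Sp N, zoom a (0, τ) (z, 0) = (a • z, τ) := fun z => by simp [zoom_apply]
    simp only [e1, e2] at h1
    rwa [← hI] at h1
  have hfin := hmean _ (sm_zoom hW a 0) e _ he (fun s hs z hz => ⟨hW0 _, ?_⟩) hslice
  · have e3 : W (zoom a 0 (0, 0)) = W 0 := by simp [zoom_apply, ← Prod.zero_eq_mk]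
    rw [e3] at hfin
    refine hfin.trans ?_
    rw [mul_assoc]
    exact mul_le_mul_of_nonneg_left (by linarith) hCm.le
  · rw [heat_zoom hW]
    have hin : zoom a 0 (z, s) ∈ pbox N 1 := by
      rw [zoom_apply]
      refine ⟨?_, ?_⟩
      · simp only [Prod.fst_zero, add_zero]
        rw [norm_smul, norm_of_nonneg ha0.le]
        have := mul_le_mul_of_nonneg_left (mem_closedBall_zero_iff.1 hz) ha0.le
        linarith
      · have := hs.1
        have := hs.2
        exact abs_le.2 ⟨by simp only [Prod.snd_zero]; nlinarith,
          by simp only [Prod.snd_zero]; nlinarith⟩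
    have h1 := (hheat _ hin).2
    have h2 := mul_le_mul_of_nonneg_left h1 (sq_nonneg a)
    refine h2.trans ?_
    rw [mul_add]
    exact add_le_add (hscale _ (mul_nonneg hC₀ (hW0 _))) (hscale _ he)

theorem sum_small_at_center (hN : 1 ≤ N) (hr : 0 < r) (hβ : ∀ i j, 0 ≤ β i j) {M q : ℝ}
    (hq : 1 ≤ q) (hI : IntegralSmall N β r M q) {θ : ℝ} (hθ : 0 < θ) :
    ∃ R : ℝ, 1 ≤ R ∧ ∃ ε > 0, ∀ V : Fin m → SpT N → ℝ, (∀ i, Sm (V i)) → (∀ i P, 0 < V i P) →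
      (∀ P ∈ pbox N R, ∀ i, V i P ≤ M ∧ |heat (V i) P - nlf β r V i P| ≤ ε) →
      ∑ i, V i 0 ≤ θ := by
  rcases isEmpty_or_nonempty (Fin m) with hm | ⟨⟨i₀⟩⟩
  · exact ⟨1, le_rfl, 1, one_pos, fun V _ _ _ => by simpa using hθ.le⟩
  rcases lt_or_ge M 0 with hM | hM
  · refine ⟨1, le_rfl, 1, one_pos, fun V _ hp h => ?_⟩
    have h0 : (0 : SpT N) ∈ pbox N 1 := by simp [pbox]
    have := (h 0 h0 i₀).1
    have := hp i₀ 0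
    linarith
  obtain ⟨a, C, ha0, ha1, hC, hcen⟩ := center_le_of_slice hN (C₀ := bsum β * M ^ (2 * r))
    (mul_nonneg (bsum_nonneg hβ) (rpow_nonneg hM _))
  obtain ⟨v, hv⟩ : ∃ v, v = (volume : Measure (Sp N)).real (closedBall 0 (1 / (2 * a))) := ⟨_, rfl⟩
  have hv0 : 0 ≤ v := hv ▸ measureReal_nonneg
  obtain ⟨κ, hκ0, k1⟩ : ∃ κ > 0, C * (m * κ * v) ≤ θ / 3 := by
    have : 0 ≤ C * m * v := by positivity
    refine ⟨θ / (3 * (C * m * v + 1)), by positivity, ?_⟩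
    have e : C * (m * (θ / (3 * (C * m * v + 1))) * v)
        = θ / 3 * (C * m * v / (C * m * v + 1)) := by field_simp
    rw [e]
    exact mul_le_of_le_one_right (by positivity) (div_le_one_of_le₀ (by linarith) (by positivity))
  have hκp := rpow_pos_of_pos hκ0 (1 - q)
  obtain ⟨η, hη0, k2⟩ : ∃ η > 0, C * (κ ^ (1 - q) * ((a ^ N)⁻¹ * (η / a ^ 2))) ≤ θ / 3 := by
    refine ⟨θ / 3 / (C * (κ ^ (1 - q) * ((a ^ N)⁻¹ / a ^ 2))), by positivity, le_of_eq ?_⟩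
    field_simp
  obtain ⟨ε₂, hε₂, k3⟩ : ∃ ε > 0, C * (m * ε) ≤ θ / 3 := by
    have : 0 ≤ C * m := by positivity
    refine ⟨θ / (3 * (C * m + 1)), by positivity, ?_⟩
    have e : C * (m * (θ / (3 * (C * m + 1)))) = θ / 3 * (C * m / (C * m + 1)) := by field_simp
    rw [e]
    exact mul_le_of_le_one_right (by positivity) (div_le_one_of_le₀ (by linarith) (by positivity))
  obtain ⟨R, hR, ε₁, hε₁, hIR⟩ := hI η hη0
  refine ⟨R, hR, min ε₁ ε₂, lt_min hε₁ hε₂, fun V hV hp hVs => ?_⟩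
  have hS := hIR V hV hp fun P hP i => ⟨(hVs P hP i).1, (hVs P hP i).2.trans (min_le_left _ _)⟩
  have hSc : Continuous fun P => ∑ i, V i P ^ q :=
    continuous_finsetSum _ fun i _ => ((hV i).rpow (hp i) q).cont
  obtain ⟨τ, hτ, hτS⟩ := exists_good_slice hSc
    (fun P => Finset.sum_nonneg fun i _ => rpow_nonneg (hp i P).le q) ha0 (by linarith) hS
  have h1 := integral_dilate_le (V := fun i z => V i (z, τ))
    (fun i => (hV i).cont.comp (by fun_prop)) (fun i z => hp i _) ha0
    (ρ := 1 / (2 * a)) (by positivity) (by field_simp; norm_num) hκ0 hq hτS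
  have h2 := hcen _ (Sm.sum fun i _ => hV i) (fun P => Finset.sum_nonneg fun i _ => (hp i P).le)
    (m * ε₂) (by positivity) (fun P hP => heat_sum_bounds hr hβ hV (hp · P) fun i =>
      ⟨(hVs P (pbox_mono zero_le_one hR hP) i).1,
        (hVs P (pbox_mono zero_le_one hR hP) i).2.trans (min_le_right _ _)⟩) τ hτ
  rw [← hv] at h1
  have h3 := mul_le_mul_of_nonneg_left (add_le_add_left h1 (m * ε₂)) hC.le
  refine h2.trans (h3.trans ?_)
  rw [mul_add, mul_add]
  linarith

end

section
variable {N m : ℕ} {β : Fin m → Fin m → ℝ} {r : ℝ}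

/-- `u` is a jointly continuous nonnegative solution of the system on the open set `Ω`. -/
structure SolOn (β : Fin m → Fin m → ℝ) (r : ℝ) (Ω : Set (SpT N)) (u : Fin m → SpT N → ℝ) :
    Prop where
  heatOn : ∀ i, HeatOn Ω (u i) (nlf β r u i)
  nonneg : ∀ i, ∀ P ∈ Ω, 0 ≤ u i P

theorem continuous_nl (hr : 0 < r) (i : Fin m) : Continuous fun y : Fin m → ℝ => nl β r y i := by
  unfold nl
  refine continuous_finsetSum _ fun j _ => ?_
  exact (continuous_const.mul ((continuous_apply i).rpow_const fun _ => .inr hr.le)).mul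
    ((continuous_apply j).rpow_const fun _ => .inr (by linarith))

theorem nl_smul {y : Fin m → ℝ} (hy : ∀ i, 0 ≤ y i) {c : ℝ} (hc : 0 < c) (i : Fin m) :
    nl β r (fun j => c * y j) i = c ^ (2 * r + 1) * nl β r y i := by
  unfold nl
  rw [Finset.mul_sum]
  refine Finset.sum_congr rfl fun j _ => ?_
  rw [mul_rpow hc.le (hy i), mul_rpow hc.le (hy j), show 2 * r + 1 = r + (r + 1) by ring,
    rpow_add hc r (r + 1)]
  ring

theorem HeatOn.congr {Ω : Set (SpT N)} {u g g' : SpT N → ℝ} (h : HeatOn Ω u g)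
    (hg : ∀ P ∈ Ω, g' P = g P) : HeatOn Ω u g' :=
  ⟨h.isOpen, h.cont, h.cont_heat.congr hg, fun P hP => hg P hP ▸ h.heatAt P hP⟩

theorem SolOn.zoom (hr : 0 < r) {Ω : Set (SpT N)} {u : Fin m → SpT N → ℝ} (h : SolOn β r Ω u)
    {a : ℝ} (ha : 0 < a) (P₀ : SpT N) :
    SolOn β r (zoom a P₀ ⁻¹' Ω) (fun i Q => a ^ (1 / r) * u i (zoom a P₀ Q)) where
  nonneg i P hP := mul_nonneg (rpow_nonneg ha.le _) (h.nonneg i _ hP)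
  heatOn i := by
    refine (((h.heatOn i).zoom a P₀).const_mul (a ^ (1 / r))).congr fun P hP => ?_
    have e : (a ^ (1 / r)) ^ (2 * r + 1) = a ^ (1 / r) * a ^ 2 := by
      rw [← rpow_mul ha.le, ← rpow_natCast, ← rpow_add ha]
      congr 1
      field_simp
      push_cast
      ring
    rw [nlf, nl_smul (fun j => h.nonneg j _ hP) (rpow_pos_of_pos ha _), e, mul_assoc]
    rfl

theorem SolOn.sum_small (hN : 1 ≤ N) (hr : 0 < r) (hβ : ∀ i j, 0 ≤ β i j) {M q : ℝ}
    (hq : 1 ≤ q) (hI : IntegralSmall N β r (M + 1) q) {θ : ℝ} (hθ : 0 < θ) :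
    ∃ R : ℝ, 1 ≤ R ∧ ∀ (Ω : Set (SpT N)) (u : Fin m → SpT N → ℝ), SolOn β r Ω u →
      (∀ P ∈ pbox N R, P ∈ Ω ∧ ∀ i, u i P ≤ M) → ∑ i, u i 0 ≤ θ := by
  obtain ⟨R, hR, ε, hε, hV⟩ := sum_small_at_center hN hr hβ hq hI (half_pos hθ)
  refine ⟨R, hR, fun Ω u hu hP => ?_⟩
  have hcK : IsCompact (Icc (0 : Fin m → ℝ) fun _ => M + 1) := isCompact_Icc
  have hunif : ∃ δ > 0, ∀ i, ∀ y ∈ Icc (0 : Fin m → ℝ) (fun _ => M + 1),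
      ∀ y' ∈ Icc (0 : Fin m → ℝ) (fun _ => M + 1), dist y y' < δ →
      |nl β r y i - nl β r y' i| < ε / 2 := by
    have := hcK.uniformContinuousOn_of_continuous
      (continuous_pi fun i => continuous_nl (β := β) hr i).continuousOn
    obtain ⟨δ, hδ, h⟩ := Metric.uniformContinuousOn_iff.1 this (ε / 2) (half_pos hε)
    exact ⟨δ, hδ, fun i y hy y' hy' hd =>
      (Real.dist_eq _ _).symm.le.trans (dist_le_pi_dist _ _ i) |>.trans_lt (h y hy y' hy' hd)⟩
  obtain ⟨δ, hδ, hnl⟩ := hunif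
  obtain ⟨κ, hκ, k1, k2, k3, k4⟩ : ∃ κ > 0, κ ≤ 1 ∧ κ ≤ ε / 2 ∧ κ < δ ∧ m * κ ≤ θ / 2 := by
    refine ⟨min (min 1 (ε / 2)) (min (δ / 2) (θ / (2 * (m + 1)))), by positivity,
      (min_le_left _ _).trans (min_le_left _ _), (min_le_left _ _).trans (min_le_right _ _),
      ((min_le_right _ _).trans (min_le_left _ _)).trans_lt (half_lt_self hδ), ?_⟩
    refine (mul_le_mul_of_nonneg_left ((min_le_right _ _).trans (min_le_right _ _))
      (Nat.cast_nonneg m)).trans ?_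
    rw [mul_div_assoc', div_le_div_iff₀ (by positivity) (by norm_num)]
    nlinarith
  have hsub : pbox N R ⊆ Ω := fun P h => (hP P h).1
  choose U hU1 hU2 hU3 hU4 using fun i => (hu.heatOn i).approx (isCompact_pbox R) hsub hκ
  have h0 : (0 : SpT N) ∈ pbox N R := ⟨by simp; linarith, by simp; positivity⟩
  have hs := hV U hU1 (fun i => hU4 i (hu.nonneg i)) fun P h i => by
    have hclose : ∀ j, |U j P - u j P| ≤ κ := fun j => hU2 j P h
    have hpos : ∀ j, 0 < U j P := fun j => hU4 j (hu.nonneg j) P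
    have hUM : ∀ j, U j P ≤ M + 1 := fun j => by
      have := (abs_le.1 (hclose j)).2
      have := (hP P h).2 j
      linarith
    refine ⟨hUM i, ?_⟩
    have h2 := hnl i (fun j => U j P) ⟨fun j => (hpos j).le, hUM⟩ (fun j => u j P)
      ⟨fun j => hu.nonneg j P (hsub h), fun j => ((hP P h).2 j).trans (by linarith)⟩
      (((dist_pi_le_iff hκ.le).2 fun j => (Real.dist_eq _ _).le.trans (hclose j)).trans_lt k3)
    have h3 := hU3 i P h
    have h4 : heat (U i) P - nlf β r U i P = (heat (U i) P - nlf β r u i P)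
        - (nl β r (fun j => U j P) i - nl β r (fun j => u j P) i) := by
      unfold nlf; ring
    rw [h4]
    refine (abs_sub _ _).trans ?_
    linarith
  have hfin : ∑ i, u i 0 ≤ ∑ i, (U i 0 + κ) := Finset.sum_le_sum fun i _ => by
    have := (abs_le.1 (hU2 i 0 h0)).1
    linarith
  rw [Finset.sum_add_distrib] at hfin
  simp only [Finset.sum_const, Finset.card_univ, Fintype.card_fin, nsmul_eq_mul] at hfin
  linarith

/-- Distance to the boundary of the unit box. -/
noncomputable def bdist (P : SpT N) : ℝ := min (1 - ‖P.1‖) (1 - |P.2|)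

theorem le_bdist_zoom {P Q : SpT N} {a : ℝ}
    (h : ‖a • Q.1‖ ≤ bdist P / 2) (h' : |a ^ 2 * Q.2| ≤ bdist P / 2) :
    bdist P / 2 ≤ bdist (zoom a P Q) := by
  have h1 : bdist P ≤ 1 - ‖P.1‖ := min_le_left _ _
  have h2 : bdist P ≤ 1 - |P.2| := min_le_right _ _
  rw [zoom_apply]
  refine le_min ?_ ?_
  · have := norm_add_le (a • Q.1) P.1
    simp only
    linarith
  · have := abs_add_le (a ^ 2 * Q.2) P.2
    simp only
    linarith

theorem exists_doubling_point {w : SpT N → ℝ} (hw : ContinuousOn w (pbox N 1))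
    (h0 : ∀ P ∈ pbox N 1, 0 ≤ w P) (hr : 0 < r) {K : ℝ} (hK : 0 < K) (hlt : K ^ (1 / r) < w 0) :
    ∃ P ∈ pbox N 1, 0 < w P ∧ 0 < bdist P ∧ K < w P ^ r * bdist P ∧
      ∀ Q ∈ pbox N 1, bdist P / 2 ≤ bdist Q → w Q ≤ 2 ^ (1 / r) * w P := by
  have hr' : 0 < 1 / r := by positivity
  have h00 : (0 : SpT N) ∈ pbox N 1 := by simp [pbox]
  have hwc : ContinuousOn (fun P => w P ^ r * bdist P) (pbox N 1) := by
    refine (hw.rpow_const fun _ _ => .inr hr.le).mul (Continuous.continuousOn ?_)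
    unfold bdist; fun_prop
  obtain ⟨P, hP, hmax⟩ := (isCompact_pbox (N := N) 1).exists_isMaxOn ⟨0, h00⟩ hwc
  have hbox : ∀ Q ∈ pbox N 1, w Q ^ r * bdist Q ≤ w P ^ r * bdist P := hmax
  have hb0 : bdist (0 : SpT N) = 1 := by simp [bdist]
  have h1 : K < w P ^ r * bdist P := by
    refine lt_of_lt_of_le ?_ (hbox 0 h00)
    rw [hb0, mul_one]
    have := rpow_lt_rpow (by positivity) hlt hr
    rwa [← rpow_mul hK.le, one_div_mul_cancel hr.ne', rpow_one] at this
  have hwn := h0 P hP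
  have hwr : 0 ≤ w P ^ r := rpow_nonneg hwn r
  have hd : 0 < bdist P := by
    by_contra! hd
    nlinarith
  have hwpos : 0 < w P := by
    refine hwn.lt_of_ne fun h => ?_
    rw [← h, zero_rpow hr.ne'] at h1
    linarith
  refine ⟨P, hP, hwpos, hd, h1, fun Q hQ h3 => ?_⟩
  have h4 : w Q ^ r ≤ 2 * w P ^ r := by
    have h6 := mul_le_mul_of_nonneg_left h3 (rpow_nonneg (h0 Q hQ) r)
    have h2 := hbox Q hQ
    have h7 : w Q ^ r * (bdist P / 2) ≤ 2 * w P ^ r * (bdist P / 2) := by linarith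
    exact le_of_mul_le_mul_right h7 (half_pos hd)
  have := rpow_le_rpow (rpow_nonneg (h0 Q hQ) r) h4 hr'.le
  rwa [← rpow_mul (h0 Q hQ), mul_rpow zero_le_two hwr, ← rpow_mul hwn,
    mul_one_div_cancel hr.ne', rpow_one, rpow_one] at this

theorem sum_le_of_unit_box (hN : 1 ≤ N) (hr : 0 < r) (hβ : ∀ i j, 0 ≤ β i j) {q : ℝ} (hq : 1 ≤ q)
    (hI : IntegralSmall N β r (2 ^ (1 / r) + 1) q) :
    ∃ C : ℝ, 0 < C ∧ ∀ (Ω : Set (SpT N)) (u : Fin m → SpT N → ℝ), SolOn β r Ω u →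
      pbox N 1 ⊆ Ω → ∑ i, u i 0 ≤ C := by
  obtain ⟨R, hR, hc⟩ := SolOn.sum_small hN hr hβ hq hI one_half_pos
  refine ⟨(2 * R) ^ (1 / r), by positivity, fun Ω u hu hΩ => ?_⟩
  by_contra! hlt
  have hw0 : ∀ P ∈ pbox N 1, 0 ≤ ∑ i, u i P := fun P hP =>
    Finset.sum_nonneg fun i _ => hu.nonneg i P (hΩ hP)
  obtain ⟨P, hP, hwpos, hd, h1, hdb⟩ := exists_doubling_point (w := fun P => ∑ i, u i P)
    (continuousOn_finsetSum _ fun i _ => (hu.heatOn i).cont.mono hΩ) hw0 hr (by positivity) hlt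
  obtain ⟨w, hw⟩ : ∃ w, w = ∑ i, u i P := ⟨_, rfl⟩
  simp only [← hw] at hwpos h1 hdb
  have hwrp : 0 < w ^ r := rpow_pos_of_pos hwpos r
  obtain ⟨a, ha⟩ : ∃ a, a = (w ^ r)⁻¹ := ⟨_, rfl⟩
  have ha0 : 0 < a := ha ▸ inv_pos.2 hwrp
  have haw : a * w ^ r = 1 := by rw [ha]; field_simp
  have haR : a * R ≤ bdist P / 2 := by
    have := mul_le_mul_of_nonneg_left h1.le ha0.le
    have e : a * (w ^ r * bdist P) = bdist P := by rw [← mul_assoc, haw, one_mul]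
    linarith
  have hd1 : bdist P ≤ 1 := (min_le_left _ _).trans (by linarith [norm_nonneg P.1])
  have har : a ^ (1 / r) * w = 1 := by
    rw [ha, inv_rpow hwrp.le, ← rpow_mul hwpos.le, mul_one_div_cancel hr.ne', rpow_one]
    field_simp
  have hz : ∀ Q ∈ pbox N R, bdist P / 2 ≤ bdist (zoom a P Q) := fun Q hQ => by
    refine le_bdist_zoom ?_ ?_
    · rw [norm_smul, norm_of_nonneg ha0.le]
      exact (mul_le_mul_of_nonneg_left hQ.1 ha0.le).trans haR
    · rw [abs_mul, abs_of_nonneg (sq_nonneg a)]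
      have := mul_le_mul_of_nonneg_left hQ.2 (sq_nonneg a)
      have h2 : 0 ≤ a * R := by positivity
      have h3 : (a * R) ^ 2 ≤ (bdist P / 2) ^ 2 := pow_le_pow_left₀ h2 haR 2
      nlinarith
  have hzin : ∀ Q ∈ pbox N R, zoom a P Q ∈ pbox N 1 := fun Q hQ => by
    have h2 := (hz Q hQ).trans (min_le_left _ _)
    have h3 := (hz Q hQ).trans (min_le_right _ _)
    exact ⟨by linarith, by linarith⟩
  have := hc _ _ (hu.zoom hr ha0 P) fun Q hQ => by
    refine ⟨hΩ (hzin Q hQ), fun i => ?_⟩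
    have h5 := hdb _ (hzin Q hQ) (hz Q hQ)
    have h6 : u i (zoom a P Q) ≤ ∑ i, u i (zoom a P Q) :=
      Finset.single_le_sum (fun j _ => hu.nonneg j _ (hΩ (hzin Q hQ))) (Finset.mem_univ i)
    have h7 := mul_le_mul_of_nonneg_left (h6.trans h5) (rpow_nonneg ha0.le (1 / r))
    refine h7.trans (le_of_eq ?_)
    rw [← mul_assoc, mul_comm _ ((2 : ℝ) ^ _), mul_assoc, har, mul_one]
  have e : zoom a P 0 = P := by simp [zoom_apply]
  simp only [e] at this
  rw [← Finset.mul_sum, ← hw, har] at this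
  norm_num at this

theorem sum_le_of_zoom_box (hr : 0 < r) {C : ℝ}
    (hC : ∀ (Ω : Set (SpT N)) (u : Fin m → SpT N → ℝ), SolOn β r Ω u →
      pbox N 1 ⊆ Ω → ∑ i, u i 0 ≤ C) {Ω : Set (SpT N)} {u : Fin m → SpT N → ℝ}
    (hu : SolOn β r Ω u) {P : SpT N} {ρ : ℝ} (hρ : 0 < ρ)
    (h : ∀ Q ∈ pbox N 1, zoom ρ P Q ∈ Ω) : ∑ i, u i P ≤ C * ρ ^ (-(1 / r)) := by
  have := hC _ _ (hu.zoom hr hρ P) h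
  have e : zoom ρ P 0 = P := by simp [zoom_apply]
  simp only [e] at this
  rw [← Finset.mul_sum] at this
  rw [rpow_neg hρ.le, ← div_eq_mul_inv, le_div_iff₀ (rpow_pos_of_pos hρ _)]
  linarith

/-- Universal local bound for jointly continuous solutions. -/
theorem exists_local_bound (hN : 1 ≤ N) (hr : 0 < r) (hsym : ∀ i j, β i j = β j i)
    (hβ : ∀ i j, 0 ≤ β i j) (hdiag : ∀ i, 0 < β i i)
    (hpB : N ≤ 2 ∨ (3 ≤ N ∧ 2 * r + 1 < ((N : ℝ) * (N + 2)) / ((N : ℝ) - 1) ^ 2)) :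
    ∃ C : ℝ, 0 < C ∧ ∀ (Ω : Set (SpT N)) (u : Fin m → SpT N → ℝ), SolOn β r Ω u →
      ∀ (P : SpT N) (ρ : ℝ), 0 < ρ → (∀ Q ∈ pbox N 1, zoom ρ P Q ∈ Ω) →
      ∑ i, u i P ≤ C * ρ ^ (-(1 / r)) := by
  obtain ⟨b0, hb0, hb⟩ : ∃ b0 > 0, ∀ i, b0 ≤ β i i := by
    rcases isEmpty_or_nonempty (Fin m) with hm | hm
    · exact ⟨1, one_pos, fun i => hm.elim i⟩
    · obtain ⟨i, hi⟩ := Finite.exists_min fun i => β i i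
      exact ⟨β i i, hdiag i, hi⟩
  obtain ⟨q, hq, hI⟩ : ∃ q, 1 ≤ q ∧ IntegralSmall N β r (2 ^ (1 / r) + 1) q := by
    rcases hpB with h | ⟨h, h'⟩
    · exact ⟨_, by linarith, integralSmall_low h hr hsym hβ hb0 hb (by positivity)⟩
    · exact ⟨_, by linarith, integralSmall_high h hr hsym hβ hb0 hb h' _⟩
  obtain ⟨C, hC, h⟩ := sum_le_of_unit_box hN hr hβ hq hI
  exact ⟨C, hC, fun Ω u hu P ρ hρ hP => sum_le_of_zoom_box hr h hu hρ hP⟩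

end

section
variable {N : ℕ}

theorem zoom_one (P : SpT N) (z : Sp N) (s : ℝ) : zoom 1 P (z, s) = (z + P.1, s + P.2) := by
  simp [zoom_apply]

theorem setIntegral_closedBall_add (f : Sp N → ℝ) (y : Sp N) (ρ : ℝ) :
    ∫ z in closedBall (0 : Sp N) ρ, f (z + y) = ∫ z in closedBall y ρ, f z := by
  have h := (measurePreserving_add_right (volume : Measure (Sp N)) y).setIntegral_preimage_emb
    (measurableEmbedding_addRight y) f (closedBall y ρ)
  rw [← h]
  congr 2
  ext z
  simp [dist_eq_norm]

/-- A nonnegative supersolution with controlled reaction is bounded at the centre by its values on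
a later slice, or at a later point of a nearby vertical line. -/
theorem exists_center_bound (hN : 1 ≤ N) {C₀ : ℝ} (hC₀ : 0 ≤ C₀) :
    ∃ R R' C : ℝ, 1 ≤ R ∧ 0 < R' ∧ 0 < C ∧ ∀ Ω (v g : SpT N → ℝ), HeatOn Ω v g →
      (∀ P ∈ Ω, 0 ≤ v P) →
      (∀ s ∈ Icc (-1 : ℝ) 1, ∀ z ∈ closedBall (0 : Sp N) R,
        (z, s) ∈ Ω ∧ 0 ≤ g (z, s) ∧ g (z, s) ≤ C₀ * v (z, s)) → ∀ K : ℝ, 0 ≤ K →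
      ((∃ b ∈ Icc (0 : ℝ) 1, ∀ z ∈ closedBall (0 : Sp N) R, v (z, b) ≤ K) ∨
        (∃ y : Sp N, ‖y‖ ≤ 2 * R ∧ (∀ s ∈ Icc (1 / 4 : ℝ) (7 / 8), ∀ z ∈ closedBall y R',
          (z, s) ∈ Ω ∧ 0 ≤ g (z, s)) ∧ v (y, 7 / 8) ≤ K)) → v (0, 0) ≤ C * K := by
  obtain ⟨Cm, hCm, hmean⟩ := mean_value_on N hC₀
  obtain ⟨R, Cs, hR, -, hCs, hlow⟩ := lower_slice_on hN 1
  obtain ⟨R', Cp, hR', h3R, hCp, hpt⟩ := lower_point_on hN (3 * R)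
  obtain ⟨V, hV⟩ : ∃ V, V = (volume : Measure (Sp N)).real (closedBall 0 R) := ⟨_, rfl⟩
  have hV0 : 0 ≤ V := hV ▸ measureReal_nonneg
  refine ⟨R, R', Cm * (Cs * (V + Cp)), hR, by linarith, by positivity,
    fun Ω v g hv h0 hbox K hK hcase => ?_⟩
  have hslice : ∀ b ∈ Icc (0 : ℝ) 1, ∀ s ∈ Icc (-1 : ℝ) 0,
      ∫ z in closedBall (0 : Sp N) 1, v (z, s) ≤ Cs * ∫ z in closedBall (0 : Sp N) R, v (z, b) :=
    fun b hb s hs => by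
      have := hlow _ _ _ (hv.zoom 1 (0, b)) (fun P hP => h0 _ hP) (s - b)
        ⟨by linarith [hb.2, hs.1], by linarith [hb.1, hs.2]⟩ fun s' hs' z hz => by
          have := hbox (s' + b) ⟨by linarith [hs'.1, hs.1], by linarith [hs'.2, hb.2]⟩ z hz
          simp only [mem_preimage, zoom_one, add_zero]
          exact ⟨this.1, by linarith [this.2.1]⟩
      simpa [zoom_one] using this
  have key : ∃ b ∈ Icc (0 : ℝ) 1, ∫ z in closedBall (0 : Sp N) R, v (z, b) ≤ (V + Cp) * K := by
    rcases hcase with ⟨b, hb, hbK⟩ | ⟨y, hy, hyΩ, hyK⟩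
    · refine ⟨b, hb, ?_⟩
      have h1 : ∫ z in closedBall (0 : Sp N) R, v (z, b) ≤ ∫ z in closedBall (0 : Sp N) R, K :=
        setIntegral_mono_on ((slice_continuousOn hv.cont fun z hz =>
          (hbox b ⟨by linarith [hb.1], hb.2⟩ z hz).1).integrableOn_compact (isCompact_closedBall _ _))
          (integrableOn_const measure_closedBall_lt_top.ne) measurableSet_closedBall hbK
      rw [setIntegral_const, ← hV, smul_eq_mul] at h1
      nlinarith
    · refine ⟨1 / 4, by norm_num, ?_⟩
      have h1 := hpt _ _ _ (hv.zoom 1 (y, 7 / 8)) (fun P hP => h0 _ hP) (-(5 / 8))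
        (by norm_num) fun s' hs' z hz => by
          have := hyΩ (s' + 7 / 8) ⟨by linarith [hs'.1], by linarith [hs'.2]⟩ (z + y)
            (by simpa [dist_eq_norm] using hz)
          simp only [mem_preimage, zoom_one]
          exact ⟨this.1, by linarith [this.2]⟩
      simp only [zoom_one, zero_add] at h1
      rw [show (-(5 / 8) + 7 / 8 : ℝ) = 1 / 4 by norm_num,
        setIntegral_closedBall_add (fun z => v (z, 1 / 4))] at h1
      have hsub : closedBall y (3 * R) ⊆ closedBall y R' := closedBall_subset_closedBall h3R
      have hi : IntegrableOn (fun z => v (z, 1 / 4)) (closedBall y (3 * R)) volume :=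
        (slice_continuousOn hv.cont fun z hz =>
          (hyΩ (1 / 4) (by norm_num) z (hsub hz)).1).integrableOn_compact (isCompact_closedBall _ _)
      have h2 : ∫ z in closedBall (0 : Sp N) R, v (z, 1 / 4)
          ≤ ∫ z in closedBall y (3 * R), v (z, 1 / 4) := by
        refine setIntegral_mono_set hi ?_ (LE.le.eventuallyLE ?_)
        · rw [EventuallyLE, ae_restrict_iff' measurableSet_closedBall]
          exact Eventually.of_forall fun z hz =>
            h0 _ (hyΩ (1 / 4) (by norm_num) z (hsub hz)).1
        · refine closedBall_subset_closedBall' ?_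
          rw [dist_zero_left]
          linarith
      have h3 := mul_le_mul_of_nonneg_left hyK hCp.le
      have h4 := mul_nonneg hV0 hK
      linarith
  obtain ⟨b, hb, hI⟩ := key
  have := hmean _ _ _ hv h0 (Cs * ((V + Cp) * K)) (fun s hs z hz => by
    have := hbox s ⟨hs.1, by linarith [hs.2]⟩ z (closedBall_subset_closedBall hR hz)
    exact ⟨this.1, this.2.2⟩) fun s hs =>
      (hslice b hb s hs).trans (mul_le_mul_of_nonneg_left hI hCs.le)
  refine this.trans (le_of_eq (by ring))

end

section
variable {N : ℕ} {ψ : Sp N → ℝ}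

theorem IsPatch.setIntegral (hψ : IsPatch ψ) (f h : Sp N → ℝ) :
    ∫ z in closedBall (0 : Sp N) 1, h z * (ψ z * f z) = ∫ z, h z * (ψ z * f z) :=
  setIntegral_eq_integral_of_forall_compl_eq_zero fun z hz => by
    rw [hψ.zero z (by simpa using hz)]; ring

theorem IsPatch.integral_hk_le (hψ : IsPatch ψ) {σ : ℝ} (hσ : 0 < σ) :
    ∫ z in closedBall (0 : Sp N) 1, hk z σ * ψ z ≤ hmass N := by
  rw [← integral_hk hσ]
  refine (setIntegral_mono_on ?_ (hk_integrable hσ).integrableOn measurableSet_closedBall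
    fun z _ => mul_le_of_le_one_right (hk_pos z hσ).le (hψ.le_one z)).trans
    (setIntegral_le_integral (hk_integrable hσ) (Eventually.of_forall fun z => (hk_pos z hσ).le))
  exact ((hk_cont σ).mul hψ.sm.cont).continuousOn.integrableOn_compact (isCompact_closedBall _ _)

theorem IsPatch.hk_integrableOn (hψ : IsPatch ψ) (σ : ℝ) {f : Sp N → ℝ}
    (hf : ContinuousOn f (closedBall 0 1)) :
    IntegrableOn (fun z => hk z σ * (ψ z * f z)) (closedBall 0 1) volume :=
  ((hk_cont σ).continuousOn.mul (hψ.sm.cont.continuousOn.mul hf)).integrableOn_compact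
    (isCompact_closedBall _ _)

theorem IsPatch.rep_le (hψ : IsPatch ψ) : ∃ C : ℝ, 0 ≤ C ∧ ∀ (Ω : Set (SpT N)) (V g : SpT N → ℝ),
    HeatOn Ω V g → ∀ M M' a : ℝ, a ∈ Icc (-1) 0 → a < 0 → 0 ≤ M' →
    (∀ s ∈ Icc a 0, ∀ z ∈ closedBall (0 : Sp N) 1,
      (z, s) ∈ Ω ∧ |V (z, s)| ≤ M ∧ g (z, s) ≤ M') →
    hmass N * V (0, 0) ≤ (∫ z in closedBall (0 : Sp N) 1, hk z (-a) * (ψ z * V (z, a)))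
      + C * (M + M') * (-a) := by
  obtain ⟨C, hC, hrep⟩ := hψ.rep
  obtain ⟨v, hv⟩ : ∃ v, v = (volume : Measure (Sp N)).real (closedBall 0 1) := ⟨_, rfl⟩
  have hv0 : 0 ≤ v := hv ▸ measureReal_nonneg
  refine ⟨C * (1 + v), by positivity, fun Ω V g hV M M' a ha ha0 hM' h => ?_⟩
  have hσ : 0 < -a := by linarith
  have hM : 0 ≤ M := (abs_nonneg _).trans (h 0 ⟨ha0.le, le_rfl⟩ 0 (by simp)).2.1
  refine le_of_forall_pos_le_add_mul (k := 2 * hmass N + C * (1 + v) * (-a)) fun ε hε => ?_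
  obtain ⟨U, U1, U2, U3, -⟩ := hV.approx (K := closedBall (0 : Sp N) 1 ×ˢ Icc a 0)
    ((isCompact_closedBall _ _).prod isCompact_Icc) (fun P hP => (h P.2 hP.2 P.1 hP.1).1) hε
  have h1 := hrep U U1 a (M' + ε) (v * (M + ε)) ha ha0 (by positivity) (fun s hs z hz => by
    have := (abs_le.1 (U3 (z, s) ⟨hz, hs⟩)).2
    have := (h s hs z hz).2.2
    linarith) fun s hs => by
      have := setIntegral_mono_on (μ := volume) (s := closedBall (0 : Sp N) 1)
        (f := fun z => |U (z, s)|) (g := fun _ => M + ε)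
        (((U1.cont.comp (by fun_prop : Continuous fun z : Sp N => (z, s))).abs
          ).continuousOn.integrableOn_compact (isCompact_closedBall _ _))
        (integrableOn_const measure_closedBall_lt_top.ne) measurableSet_closedBall fun z hz => by
          have h2 := U2 (z, s) ⟨hz, hs⟩
          have h3 := (h s hs z hz).2.1
          have h4 := abs_sub_abs_le_abs_sub (U (z, s)) (V (z, s))
          linarith
      rwa [setIntegral_const, ← hv, smul_eq_mul] at this
  rw [← hψ.setIntegral (fun z => U (z, a)) (fun z => hk z (-a))] at h1
  have hVc : ContinuousOn (fun z => V (z, a)) (closedBall 0 1) :=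
    slice_continuousOn hV.cont fun z hz => (h a ⟨le_rfl, ha0.le⟩ z hz).1
  have h5 : ∫ z in closedBall (0 : Sp N) 1, hk z (-a) * (ψ z * U (z, a))
      ≤ ∫ z in closedBall (0 : Sp N) 1, (hk z (-a) * (ψ z * V (z, a)) + ε * (hk z (-a) * ψ z)) := by
    have hi2 : IntegrableOn (fun z => ε * (hk z (-a) * ψ z)) (closedBall (0 : Sp N) 1) volume :=
      (continuous_const.mul ((hk_cont (-a)).mul hψ.sm.cont)).continuousOn.integrableOn_compact
        (isCompact_closedBall _ _)
    refine setIntegral_mono_on (hψ.hk_integrableOn _ (slice_continuousOn U1.cont.continuousOn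
      fun _ _ => mem_univ _)) ((hψ.hk_integrableOn _ hVc).add hi2) measurableSet_closedBall
      fun z hz => ?_
    have h2 := (abs_le.1 (U2 (z, a) ⟨hz, le_rfl, ha0.le⟩)).2
    have h3 := mul_nonneg (hk_pos z hσ).le (hψ.nonneg z)
    have h4 := mul_le_mul_of_nonneg_left (a := hk z (-a) * ψ z)
      (show U (z, a) ≤ V (z, a) + ε by linarith) h3
    linarith
  have hi2 : IntegrableOn (fun z => ε * (hk z (-a) * ψ z)) (closedBall (0 : Sp N) 1) volume :=
    (continuous_const.mul ((hk_cont (-a)).mul hψ.sm.cont)).continuousOn.integrableOn_compact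
      (isCompact_closedBall _ _)
  rw [integral_add (hψ.hk_integrableOn _ hVc) hi2, integral_const_mul] at h5
  have h6 := mul_le_mul_of_nonneg_left (hψ.integral_hk_le hσ) hε.le
  have h7 := (abs_le.1 (U2 (0, 0) ⟨by simp, ha0.le, le_rfl⟩)).1
  have h8 := mul_le_mul_of_nonneg_left (show V (0, 0) ≤ U (0, 0) + ε by linarith) (hmass_pos N).le
  have h9 : C * (M' + v * M) * (-a) ≤ C * (1 + v) * (M + M') * (-a) := by
    have : M' + v * M ≤ (1 + v) * (M + M') := by nlinarith
    have := mul_le_mul_of_nonneg_left this hC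
    have := mul_le_mul_of_nonneg_right this hσ.le
    linarith
  linarith

/-- Approximate heat kernel representation, allowing merely pointwise convergence at the initial
time. -/
theorem IsPatch.abs_rep_le (hψ : IsPatch ψ) :
    ∃ C : ℝ, 0 ≤ C ∧ ∀ (Ω : Set (SpT N)) (V g : SpT N → ℝ),
    HeatOn Ω V g → ∀ M M' a : ℝ, a ∈ Icc (-1) 0 → a < 0 →
    (∀ s ∈ Ioc a 0, ∀ z ∈ closedBall (0 : Sp N) 1,
      (z, s) ∈ Ω ∧ |V (z, s)| ≤ M ∧ |g (z, s)| ≤ M') →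
    (∀ z ∈ closedBall (0 : Sp N) 1,
      Tendsto (fun s => V (z, s)) (𝓝[>] a) (𝓝 (V (z, a)))) →
    |hmass N * V (0, 0) - ∫ z in closedBall (0 : Sp N) 1, hk z (-a) * (ψ z * V (z, a))|
      ≤ C * (M + M') * (-a) := by
  obtain ⟨C, hC, hrep⟩ := hψ.rep_le
  refine ⟨C, hC, fun Ω V g hV M M' a ha ha0 h hlim => ?_⟩
  have h00 := (h 0 ⟨ha0, le_rfl⟩ 0 (by simp)).2
  have hM : 0 ≤ M := (abs_nonneg _).trans h00.1
  have hM' : 0 ≤ M' := (abs_nonneg _).trans h00.2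
  have hev : ∀ᶠ b in 𝓝[>] a, b ∈ Ioo a (a / 2) := Ioo_mem_nhdsGT (by linarith)
  have hI : Tendsto (fun b => ∫ z in closedBall (0 : Sp N) 1, hk z (-b) * (ψ z * V (z, b)))
      (𝓝[>] a) (𝓝 (∫ z in closedBall (0 : Sp N) 1, hk z (-a) * (ψ z * V (z, a)))) := by
    refine tendsto_integral_filter_of_dominated_convergence
      (fun _ => (-(a / 2)) ^ (-(N / 2 : ℝ)) * M) ?_ ?_
      (integrable_const_iff.2 (.inr (by
        rw [isFiniteMeasure_restrict]; exact measure_closedBall_lt_top.ne))) ?_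
    · filter_upwards [hev] with b hb
      exact (hψ.hk_integrableOn _ (slice_continuousOn hV.cont fun z hz =>
        (h b ⟨hb.1, by linarith [hb.2]⟩ z hz).1)).aestronglyMeasurable
    · filter_upwards [hev] with b hb
      rw [ae_restrict_iff' measurableSet_closedBall]
      refine Eventually.of_forall fun z hz => ?_
      have hb0 : 0 < -b := by linarith [hb.2]
      have hb2 : -(a / 2) ≤ -b := by linarith [hb.2]
      rw [norm_mul, norm_of_nonneg (hk_pos z hb0).le, norm_mul, norm_of_nonneg (hψ.nonneg z)]
      have h1 : ψ z * ‖V (z, b)‖ ≤ M :=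
        (mul_le_of_le_one_left (norm_nonneg _) (hψ.le_one z)).trans
          (h b ⟨hb.1, by linarith [hb.2]⟩ z hz).2.1
      refine mul_le_mul ((hk_le_rpow z hb0).trans
        (rpow_le_rpow_of_nonpos (by linarith) hb2 ?_)) h1
        (mul_nonneg (hψ.nonneg z) (norm_nonneg _)) (rpow_nonneg (by linarith) _)
      have : (0 : ℝ) ≤ N / 2 := by positivity
      linarith
    · rw [ae_restrict_iff' measurableSet_closedBall]
      refine Eventually.of_forall fun z hz => ?_
      refine Tendsto.mul ?_ ((hlim z hz).const_mul _)
      have : ContinuousAt (fun b : ℝ => hk z (-b)) a := by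
        unfold hk
        have h1 : -a ≠ 0 := by linarith
        refine ContinuousAt.mul (ContinuousAt.rpow_const continuousAt_id.neg (.inl h1)) ?_
        refine (ContinuousAt.mul ?_ continuousAt_const).rexp
        exact (continuousAt_const.div (continuousAt_const.mul continuousAt_id.neg)
          (mul_ne_zero four_ne_zero h1)).neg
      exact this.tendsto.mono_left nhdsWithin_le_nhds
  have hC' : Tendsto (fun b : ℝ => C * (M + M') * (-b)) (𝓝[>] a) (𝓝 (C * (M + M') * (-a))) :=
    ((continuous_const.mul continuous_neg).tendsto a).mono_left nhdsWithin_le_nhds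
  refine le_of_tendsto_of_tendsto ((tendsto_const_nhds.sub hI).abs) hC' ?_
  filter_upwards [hev] with b hb
  have hb' : b ∈ Icc (-1) 0 := ⟨by linarith [hb.1, ha.1], by linarith [hb.2]⟩
  have hb0 : b < 0 := by linarith [hb.2]
  have h1 := hrep Ω V g hV M M' b hb' hb0 hM' fun s hs z hz =>
    let k := h s ⟨by linarith [hs.1, hb.1], hs.2⟩ z hz
    ⟨k.1, k.2.1, (le_abs_self _).trans k.2.2⟩
  have h2 := hrep Ω _ _ (hV.const_mul (-1)) M M' b hb' hb0 hM' fun s hs z hz =>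
    let k := h s ⟨by linarith [hs.1, hb.1], hs.2⟩ z hz
    ⟨k.1, by rw [abs_mul]; simpa using k.2.1, by linarith [neg_abs_le (g (z, s)), k.2.2]⟩
  have e : ∫ z in closedBall (0 : Sp N) 1, hk z (-b) * (ψ z * (-1 * V (z, b)))
      = -∫ z in closedBall (0 : Sp N) 1, hk z (-b) * (ψ z * V (z, b)) := by
    rw [← integral_neg]; congr 1; ext z; ring
  rw [e] at h2
  rw [abs_le]
  constructor <;> linarith

end

section
variable {N m : ℕ} {β : Fin m → Fin m → ℝ} {r : ℝ}

/-- Near `P₀`, the functions `u i` are uniformly Lipschitz along the time slices and the vertical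
lines through the points outside `G`. -/
structure Flat (u : Fin m → SpT N → ℝ) (G : Set (SpT N)) (P₀ : SpT N) (ρ n : ℝ) : Prop where
  pos : 0 < ρ
  nonneg : 0 ≤ n
  bad : P₀ ∉ G
  slice : ∀ P ∈ closedBall P₀ ρ, P ∉ G → ∀ i, ∀ y ∈ closedBall P₀.1 ρ, ∀ y' ∈ closedBall P₀.1 ρ,
    |u i (y, P.2) - u i (y', P.2)| ≤ n * dist y y'
  vert : ∀ P ∈ closedBall P₀ ρ, P ∉ G → ∀ i, ∀ s ∈ closedBall P₀.2 ρ,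
    |u i (P.1, s) - u i P| ≤ n * dist s P.2

theorem mem_closedBall_spt {P Q : SpT N} {ρ : ℝ} :
    P ∈ closedBall Q ρ ↔ dist P.1 Q.1 ≤ ρ ∧ dist P.2 Q.2 ≤ ρ := by
  rw [mem_closedBall, Prod.dist_eq, max_le_iff]

variable {u : Fin m → SpT N → ℝ} {G : Set (SpT N)} {P₀ : SpT N} {ρ n : ℝ}

theorem Flat.slice_close (hF : Flat u G P₀ ρ n) {P : SpT N} (hP : P ∈ closedBall P₀ ρ)
    (hb : P ∉ G) (i : Fin m) {y : Sp N} (hy : y ∈ closedBall P₀.1 ρ) :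
    |u i (y, P.2) - u i P₀| ≤ n * (dist y P₀.1 + dist P.2 P₀.2) := by
  have h1 := hF.slice P hP hb i y hy P₀.1 (mem_closedBall_self hF.pos.le)
  have h2 := hF.vert P₀ (mem_closedBall_self hF.pos.le) hF.bad i P.2 (mem_closedBall_spt.1 hP).2
  refine (abs_sub_le _ (u i (P₀.1, P.2)) _).trans ?_
  rw [mul_add]
  exact add_le_add h1 h2

theorem Flat.vert_close (hF : Flat u G P₀ ρ n) {P : SpT N} (hP : P ∈ closedBall P₀ ρ)
    (hb : P ∉ G) (i : Fin m) {s : ℝ} (hs : s ∈ closedBall P₀.2 ρ) :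
    |u i (P.1, s) - u i P₀| ≤ n * (dist s P.2 + (dist P.1 P₀.1 + dist P.2 P₀.2)) := by
  have h1 := hF.vert P hP hb i s hs
  have h2 := hF.slice_close hP hb i (mem_closedBall_spt.1 hP).1
  refine (abs_sub_le _ (u i P) _).trans ?_
  rw [mul_add]
  exact add_le_add h1 h2

theorem Flat.sum_slice_le (hF : Flat u G P₀ ρ n) {P : SpT N} (hP : P ∈ closedBall P₀ ρ)
    (hb : P ∉ G) {y : Sp N} (hy : y ∈ closedBall P₀.1 ρ) :
    ∑ i, u i (y, P.2) ≤ ∑ i, (u i P₀ + n * (4 * ρ)) :=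
  Finset.sum_le_sum fun i _ => by
    have h1 := (abs_le.1 (hF.slice_close hP hb i hy)).2
    have h2 : dist y P₀.1 + dist P.2 P₀.2 ≤ 4 * ρ := by
      have := (mem_closedBall_spt.1 hP).2
      have := mem_closedBall.1 hy
      linarith [hF.pos]
    have := mul_le_mul_of_nonneg_left h2 hF.nonneg
    linarith

theorem Flat.sum_vert_le (hF : Flat u G P₀ ρ n) {P : SpT N} (hP : P ∈ closedBall P₀ ρ)
    (hb : P ∉ G) {s : ℝ} (hs : s ∈ closedBall P₀.2 ρ) :
    ∑ i, u i (P.1, s) ≤ ∑ i, (u i P₀ + n * (4 * ρ)) :=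
  Finset.sum_le_sum fun i _ => by
    have h1 := (abs_le.1 (hF.vert_close hP hb i hs)).2
    have h2 : dist s P.2 + (dist P.1 P₀.1 + dist P.2 P₀.2) ≤ 4 * ρ := by
      have h3 := mem_closedBall_spt.1 hP
      have h4 := mem_closedBall.1 hs
      have := dist_triangle_right s P.2 P₀.2
      linarith [h3.1, h3.2]
    have := mul_le_mul_of_nonneg_left h2 hF.nonneg
    linarith

/-- A point of `G` near `P₀` has a maximal clean parabolic box. -/
theorem Flat.exists_dist (hF : Flat u G P₀ ρ n) (hG : IsOpen G) {P : SpT N} (hP : P ∈ G) :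
    ∃ d > 0, d ≤ max (dist P.1 P₀.1) (√(dist P.2 P₀.2)) ∧
      (∃ Q ∈ closedBall P₀ ρ, Q ∉ G ∧ dist Q.1 P.1 ≤ d) ∧
      ∀ Q ∈ closedBall P₀ ρ, dist Q.1 P.1 < d → dist Q.2 P.2 < d ^ 2 → Q ∈ G := by
  have hK : IsCompact (closedBall P₀ ρ \ G) := (isCompact_closedBall P₀ ρ).diff hG
  have hc : Continuous fun Q : SpT N => max (dist P.1 Q.1) (√(dist P.2 Q.2)) := by fun_prop
  obtain ⟨Q, hQ, hmin⟩ := hK.exists_isMinOn ⟨P₀, mem_closedBall_self hF.pos.le, hF.bad⟩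
    hc.continuousOn
  have hmin' : ∀ Q' ∈ closedBall P₀ ρ \ G, max (dist P.1 Q.1) (√(dist P.2 Q.2))
    ≤ max (dist P.1 Q'.1) (√(dist P.2 Q'.2)) := hmin
  obtain ⟨d, hd⟩ : ∃ d, d = max (dist P.1 Q.1) (√(dist P.2 Q.2)) := ⟨_, rfl⟩
  rw [← hd] at hmin'
  have hd0 : 0 < d := by
    refine (le_max_of_le_left dist_nonneg |>.trans_eq hd.symm).lt_of_ne fun h => ?_
    have h1 : dist P.1 Q.1 ≤ 0 := (le_max_left _ _).trans_eq (hd.symm.trans h.symm)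
    have h2 : √(dist P.2 Q.2) ≤ 0 := (le_max_right _ _).trans_eq (hd.symm.trans h.symm)
    have h3 : dist P.2 Q.2 ≤ 0 := by
      rwa [sqrt_le_iff, zero_pow two_ne_zero, and_iff_right le_rfl] at h2
    have : P = Q := Prod.ext (dist_le_zero.1 h1) (dist_le_zero.1 h3)
    exact hQ.2 (this ▸ hP)
  refine ⟨d, hd0, hmin' P₀ ⟨mem_closedBall_self hF.pos.le, hF.bad⟩,
    ⟨Q, hQ.1, hQ.2, by rw [dist_comm, hd]; exact le_max_left _ _⟩, fun Q' hQ' h1 h2 => ?_⟩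
  by_contra hb
  have h3 := hmin' Q' ⟨hQ', hb⟩
  rw [dist_comm] at h1 h2
  exact absurd h3 (not_le.2 (max_lt h1 ((sqrt_lt' hd0).2 h2)))

theorem dist_zoom_fst (a : ℝ) (P Q : SpT N) : dist (zoom a P Q).1 P.1 = |a| * ‖Q.1‖ := by
  simp [zoom_apply, dist_eq_norm, norm_smul]

theorem dist_zoom_snd (a : ℝ) (P Q : SpT N) : dist (zoom a P Q).2 P.2 = a ^ 2 * |Q.2| := by
  simp [zoom_apply, Real.dist_eq, abs_mul]

/-- The reaction is controlled in the parabolic units of a clean box. -/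
theorem SolOn.reaction_le (hr : 0 < r) (hβ : ∀ i j, 0 ≤ β i j) (hu : SolOn β r G u) {C : ℝ}
    (hC : 0 < C)
    (hloc : ∀ (P : SpT N) (ρ : ℝ), 0 < ρ → (∀ Q ∈ pbox N 1, _root_.zoom ρ P Q ∈ G) →
      ∑ i, u i P ≤ C * ρ ^ (-(1 / r))) {P : SpT N} {d : ℝ} (hd : 0 < d)
    (hbox : ∀ Q : SpT N, dist Q.1 P.1 < d → dist Q.2 P.2 < d ^ 2 → Q ∈ G)
    {Q : SpT N} (h1 : dist Q.1 P.1 ≤ d / 2) (h2 : dist Q.2 P.2 ≤ d ^ 2 / 4) :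
    Q ∈ G ∧ d ^ 2 * ∑ i, nlf β r u i Q ≤ 16 * bsum β * C ^ (2 * r) * ∑ i, u i Q := by
  have hd2 : 0 < d ^ 2 := by positivity
  have hQ : Q ∈ G := hbox Q (by linarith) (by linarith)
  have hw := hloc Q (d / 4) (by positivity) fun Q' hQ' => by
    refine hbox _ ((dist_triangle _ Q.1 _).trans_lt ?_) ((dist_triangle _ Q.2 _).trans_lt ?_)
    · rw [dist_zoom_fst, abs_of_pos (by positivity)]
      have := mul_le_mul_of_nonneg_left hQ'.1 (show 0 ≤ d / 4 by positivity)
      linarith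
    · rw [dist_zoom_snd]
      have := mul_le_mul_of_nonneg_left hQ'.2 (sq_nonneg (d / 4))
      nlinarith
  refine ⟨hQ, ?_⟩
  have h3 := sum_nl_le hr hβ (y := fun j => u j Q) (fun j => hu.nonneg j Q hQ) fun i =>
    (Finset.single_le_sum (f := fun j => u j Q) (fun j _ => hu.nonneg j Q hQ)
      (Finset.mem_univ i)).trans hw
  have h4 : (C * (d / 4) ^ (-(1 / r))) ^ (2 * r) = 16 * C ^ (2 * r) / d ^ 2 := by
    rw [mul_rpow hC.le (by positivity), ← rpow_mul (by positivity),
      show -(1 / r) * (2 * r) = -(2 : ℕ) by field_simp; norm_num, rpow_neg (by positivity),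
      rpow_natCast]
    field_simp
    norm_num
  rw [h4] at h3
  have h5 := mul_le_mul_of_nonneg_left h3 hd2.le
  refine le_trans (le_of_eq rfl) (h5.trans (le_of_eq ?_))
  field_simp

theorem Flat.exists_bound (hN : 1 ≤ N) (hr : 0 < r) (hβ : ∀ i j, 0 ≤ β i j)
    (hu : SolOn β r G u) (hG : IsOpen G) {C : ℝ} (hC : 0 < C)
    (hloc : ∀ (P : SpT N) (ρ : ℝ), 0 < ρ → (∀ Q ∈ pbox N 1, zoom ρ P Q ∈ G) →
      ∑ i, u i P ≤ C * ρ ^ (-(1 / r)))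
    (hF : Flat u G P₀ ρ n) (h0 : ∀ i, ∀ P ∈ closedBall P₀ ρ, 0 ≤ u i P) :
    ∃ ρ' > 0, ∃ M, ∀ P ∈ closedBall P₀ ρ', ∀ i, u i P ≤ M := by
  have hb := bsum_nonneg hβ
  obtain ⟨R, R', Cc, hR, hR', hCc, hcen⟩ := exists_center_bound hN
    (C₀ := 16 * bsum β * C ^ (2 * r)) (by positivity)
  obtain ⟨K, hK⟩ : ∃ K, K = ∑ i, (u i P₀ + n * (4 * ρ)) := ⟨_, rfl⟩
  have hρ := hF.pos
  have hn := hF.nonneg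
  have hK0 : 0 ≤ K := hK ▸ Finset.sum_nonneg fun i _ =>
    add_nonneg (h0 i P₀ (mem_closedBall_self hρ.le)) (by positivity)
  obtain ⟨κ, hκ, hκ1, hκρ⟩ : ∃ κ > 0, κ ≤ 1 ∧ κ * (1 + R') ≤ ρ / 2 := by
    refine ⟨min 1 (ρ / (2 * (1 + R'))), by positivity, min_le_left _ _, ?_⟩
    refine (mul_le_mul_of_nonneg_right (min_le_right _ _) (by positivity)).trans (le_of_eq ?_)
    field_simp
  refine ⟨min (ρ / 2) (κ ^ 2), by positivity, Cc * K + K, fun P hP i => ?_⟩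
  have hPρ := mem_closedBall_spt.1 (closedBall_subset_closedBall (min_le_left _ _) hP)
  have hPκ := mem_closedBall_spt.1 (closedBall_subset_closedBall (min_le_right _ _) hP)
  have hPB : P ∈ closedBall P₀ ρ := mem_closedBall_spt.2 ⟨by linarith [hPρ.1], by linarith [hPρ.2]⟩
  have hsingle : u i P ≤ ∑ i, u i P :=
    Finset.single_le_sum (f := fun i => u i P) (fun j _ => h0 j P hPB) (Finset.mem_univ i)
  have hCK : 0 ≤ Cc * K := by positivity
  by_cases hPG : P ∈ G
  swap
  · have := hF.sum_slice_le hPB hPG (mem_closedBall_spt.1 hPB).1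
    rw [← hK] at this
    linarith
  obtain ⟨d, hd, hdle, ⟨Y, hYB, hYG, hYd⟩, hclean⟩ := hF.exists_dist hG hPG
  have hdκ : d ≤ κ := hdle.trans (max_le (hPκ.1.trans (by nlinarith))
    (sqrt_le_iff.2 ⟨hκ.le, hPκ.2⟩))
  have hd1 : d ≤ 1 := hdκ.trans hκ1
  have hdR : d * (1 + R') ≤ ρ / 2 := (mul_le_mul_of_nonneg_right hdκ (by positivity)).trans hκρ
  have hdρ : d ≤ ρ / 2 := by nlinarith
  have hd2 : d ^ 2 ≤ d := by nlinarith
  have hinB : ∀ Q : SpT N, dist Q.1 P.1 ≤ ρ / 2 → dist Q.2 P.2 ≤ ρ / 2 → Q ∈ closedBall P₀ ρ :=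
    fun Q h1 h2 => mem_closedBall_spt.2
      ⟨(dist_triangle _ P.1 _).trans (by linarith [hPρ.1]),
        (dist_triangle _ P.2 _).trans (by linarith [hPρ.2])⟩
  obtain ⟨a, ha⟩ : ∃ a, a = d / (2 * R) := ⟨_, rfl⟩
  have ha0 : 0 < a := by rw [ha]; positivity
  have haR : a * R = d / 2 := by rw [ha]; field_simp
  have had : a ≤ d / 2 := by nlinarith
  have ha2 : a ^ 2 ≤ d ^ 2 / 4 := by nlinarith
  have hreact := fun Q => hu.reaction_le hr hβ hC hloc hd
    (fun Q h1 h2 => hclean Q (hinB Q (by linarith) (by linarith)) h1 h2) (Q := Q)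
  have hv := (HeatOn.sum (s := Finset.univ) hG fun i _ => hu.heatOn i).zoom a P
  have hbox : ∀ s ∈ Icc (-1 : ℝ) 1, ∀ z ∈ closedBall (0 : Sp N) R,
      dist (zoom a P (z, s)).1 P.1 ≤ d / 2 ∧ dist (zoom a P (z, s)).2 P.2 ≤ d ^ 2 / 4 :=
    fun s hs z hz => by
      rw [dist_zoom_fst, dist_zoom_snd, abs_of_pos ha0]
      refine ⟨(mul_le_mul_of_nonneg_left (mem_closedBall_zero_iff.1 hz) ha0.le).trans_eq haR,
        (mul_le_of_le_one_right (sq_nonneg a) (abs_le.2 hs)).trans ha2⟩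
  have hnl0 : ∀ Q ∈ G, 0 ≤ ∑ i, nlf β r u i Q := fun Q hQ =>
    Finset.sum_nonneg fun i _ => nl_nonneg hβ (fun j => hu.nonneg j Q hQ) i
  have hu0 : ∀ Q ∈ G, 0 ≤ ∑ i, u i Q := fun Q hQ =>
    Finset.sum_nonneg fun i _ => hu.nonneg i Q hQ
  have := hcen _ _ _ hv (fun Q hQ => hu0 _ hQ) (fun s hs z hz => by
    obtain ⟨h1, h2⟩ := hbox s hs z hz
    obtain ⟨h3, h4⟩ := hreact _ h1 h2
    refine ⟨h3, mul_nonneg (sq_nonneg a) (hnl0 _ h3), le_trans ?_ h4⟩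
    exact mul_le_mul_of_nonneg_right (by nlinarith) (hnl0 _ h3)) K hK0 ?_
  · have e : zoom a P (0, 0) = P := by simp [zoom_apply]
    rw [e] at this
    linarith
  by_cases hE : ∃ Q ∈ closedBall P₀ ρ, Q ∉ G ∧ Q.2 ∈ Icc P.2 (P.2 + a ^ 2)
  · left
    obtain ⟨Q, hQ, hQG, hQt⟩ := hE
    have hb1 : (Q.2 - P.2) / a ^ 2 ∈ Icc (0 : ℝ) 1 :=
      ⟨div_nonneg (by linarith [hQt.1]) (by positivity),
        div_le_one_of_le₀ (by linarith [hQt.2]) (by positivity)⟩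
    refine ⟨(Q.2 - P.2) / a ^ 2, hb1, fun z hz => ?_⟩
    have e : zoom a P (z, (Q.2 - P.2) / a ^ 2) = (a • z + P.1, Q.2) := by
      rw [zoom_apply]; ext1
      · rfl
      · field_simp; ring
    have h1 := (hbox _ ⟨by linarith [hb1.1], hb1.2⟩ z hz).1
    rw [e] at h1 ⊢
    rw [hK]
    exact hF.sum_slice_le hQ hQG ((dist_triangle _ P.1 _).trans (by linarith [hPρ.1, h1]))
  · right
    push Not at hE
    refine ⟨a⁻¹ • (Y.1 - P.1), ?_, fun s hs z hz => ?_, ?_⟩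
    · rw [norm_smul, norm_inv, norm_of_nonneg ha0.le, ← dist_eq_norm, inv_mul_le_iff₀ ha0]
      linarith
    · have hzn : ‖z‖ ≤ 2 * R + R' := by
        have h1 : ‖a⁻¹ • (Y.1 - P.1)‖ ≤ 2 * R := by
          rw [norm_smul, norm_inv, norm_of_nonneg ha0.le, ← dist_eq_norm, inv_mul_le_iff₀ ha0]
          linarith
        have h2 := norm_le_norm_add_norm_sub' z (a⁻¹ • (Y.1 - P.1))
        rw [mem_closedBall, dist_eq_norm] at hz
        linarith
      have hs1 : a ^ 2 * s ∈ Icc 0 (a ^ 2) :=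
        ⟨mul_nonneg (sq_nonneg a) (by linarith [hs.1]),
          mul_le_of_le_one_right (sq_nonneg a) (by linarith [hs.2])⟩
      have hin : zoom a P (z, s) ∈ G := by
        by_contra hb
        refine hE _ (hinB _ ?_ ?_) hb ?_
        · rw [dist_zoom_fst, abs_of_pos ha0]
          have := mul_le_mul_of_nonneg_left hzn ha0.le
          nlinarith
        · rw [dist_zoom_snd]
          simp only
          rw [abs_of_nonneg (by linarith [hs.1])]
          linarith [hs1.2]
        · rw [zoom_apply]
          exact ⟨by linarith [hs1.1], by linarith [hs1.2]⟩
      exact ⟨hin, mul_nonneg (sq_nonneg a) (hnl0 _ hin)⟩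
    · have e : zoom a P (a⁻¹ • (Y.1 - P.1), 7 / 8) = (Y.1, a ^ 2 * (7 / 8) + P.2) := by
        rw [zoom_apply, smul_inv_smul₀ ha0.ne', sub_add_cancel]
      rw [e, hK]
      refine hF.sum_vert_le hYB hYG ((dist_triangle _ P.2 _).trans ?_)
      have : dist (a ^ 2 * (7 / 8) + P.2) P.2 = a ^ 2 * (7 / 8) := by
        rw [Real.dist_eq, add_sub_cancel_right, abs_of_nonneg (by positivity)]
      rw [this]
      linarith [hPρ.2]

end

section
variable {N : ℕ} {ψ : Sp N → ℝ}

theorem IsPatch.abs_rep_at (hψ : IsPatch ψ) :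
    ∃ C : ℝ, 0 ≤ C ∧ ∀ (Ω : Set (SpT N)) (V g : SpT N → ℝ), HeatOn Ω V g →
    ∀ (M M' : ℝ) (x : Sp N) (t σ : ℝ), 0 < σ → σ ≤ 1 →
    (∀ s ∈ Ioc (t - σ) t, ∀ y ∈ closedBall x 1,
      (y, s) ∈ Ω ∧ |V (y, s)| ≤ M ∧ |g (y, s)| ≤ M') →
    (∀ y ∈ closedBall x 1,
      Tendsto (fun s => V (y, s)) (𝓝[>] (t - σ)) (𝓝 (V (y, t - σ)))) →
    |hmass N * V (x, t) - ∫ z in closedBall (0 : Sp N) 1, hk z σ * (ψ z * V (z + x, t - σ))|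
      ≤ C * (M + M') * σ := by
  obtain ⟨C, hC, h⟩ := hψ.abs_rep_le
  refine ⟨C, hC, fun Ω V g hV M M' x t σ hσ hσ1 hin hlim => ?_⟩
  have hmem : ∀ z ∈ closedBall (0 : Sp N) 1, z + x ∈ closedBall x 1 := fun z hz => by
    simpa [mem_closedBall_iff_norm] using hz
  have h1 := h _ _ _ (hV.zoom 1 (x, t)) M M' (-σ) ⟨by linarith, by linarith⟩ (by linarith)
    (fun s hs z hz => by
      have h2 := hin (s + t) ⟨by linarith [hs.1], by linarith [hs.2]⟩ _ (hmem z hz)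
      rw [mem_preimage, zoom_one]
      simpa using h2)
    (fun z hz => by
      simp only [zoom_one]
      rw [show -σ + t = t - σ by ring]
      refine (hlim _ (hmem z hz)).comp (tendsto_nhdsWithin_iff.2 ⟨?_, ?_⟩)
      · have : Continuous fun s : ℝ => s + t := by fun_prop
        have h3 := this.tendsto (-σ)
        rw [show -σ + t = t - σ by ring] at h3
        exact h3.mono_left nhdsWithin_le_nhds
      · filter_upwards [self_mem_nhdsWithin] with s hs
        have : -σ < s := hs
        show t - σ < s + t
        linarith)
  simp only [zoom_one] at h1
  rw [show -σ + t = t - σ by ring, neg_neg, zero_add, zero_add] at h1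
  exact h1

variable {Ω : Set (SpT N)} {v g : SpT N → ℝ}

/-- Evolution of data which are almost constant. -/
theorem IsPatch.abs_sub_le_of_start (hψ : IsPatch ψ) :
    ∃ C : ℝ, 0 ≤ C ∧ ∀ (Ω : Set (SpT N)) (v g : SpT N → ℝ), HeatOn Ω v g →
    ∀ (M M' n c : ℝ) (x : Sp N) (t σ : ℝ), 0 < σ → σ ≤ 1 → 0 ≤ n →
    (∀ s ∈ Ioc (t - σ) t, ∀ y ∈ closedBall x 1,
      (y, s) ∈ Ω ∧ |-c + v (y, s)| ≤ M ∧ |g (y, s)| ≤ M') →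
    (∀ y ∈ closedBall x 1, ContinuousAt (fun s => v (y, s)) (t - σ)) →
    (∀ y ∈ closedBall x 1, |-c + v (y, t - σ)| ≤ n * (‖y‖ + |t - σ|)) →
    hmass N * |-c + v (x, t)| ≤ C * (M + M') * σ + (n * (∫ z, hk z σ * (ψ z * ‖z‖))
      + n * (‖x‖ + |t - σ|) * hmass N) := by
  obtain ⟨C, hC, h⟩ := hψ.abs_rep_at
  refine ⟨C, hC, fun Ω v g hv M M' n c x t σ hσ hσ1 hn hin hlim hst => ?_⟩
  have h1 := h _ _ _ (hv.const_add (-c)) M M' x t σ hσ hσ1 hin fun y hy =>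
    ((hlim y hy).const_add (-c)).mono_left nhdsWithin_le_nhds
  have hmem : ∀ z ∈ closedBall (0 : Sp N) 1, z + x ∈ closedBall x 1 := fun z hz => by
    simpa [mem_closedBall_iff_norm] using hz
  have i1 : IntegrableOn (fun z => hk z σ * (ψ z * ‖z‖)) (closedBall (0 : Sp N) 1) volume :=
    hψ.hk_integrableOn σ continuous_norm.continuousOn
  have i2 : IntegrableOn (fun z => hk z σ * ψ z) (closedBall (0 : Sp N) 1) volume := by
    simpa using hψ.hk_integrableOn σ (f := fun _ => 1) continuousOn_const
  have h2 : |∫ z in closedBall (0 : Sp N) 1, hk z σ * (ψ z * (-c + v (z + x, t - σ)))|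
      ≤ ∫ z in closedBall (0 : Sp N) 1, (n * (hk z σ * (ψ z * ‖z‖))
        + n * (‖x‖ + |t - σ|) * (hk z σ * ψ z)) := by
    rw [← Real.norm_eq_abs]
    refine norm_integral_le_of_norm_le ((i1.const_mul n).add (i2.const_mul _)) ?_
    refine (ae_restrict_iff' measurableSet_closedBall).2 (Eventually.of_forall fun z hz => ?_)
    rw [norm_mul, norm_mul, norm_of_nonneg (hk_pos z hσ).le, norm_of_nonneg (hψ.nonneg z),
      Real.norm_eq_abs]
    have h3 := (hst _ (hmem z hz)).trans (mul_le_mul_of_nonneg_left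
      (add_le_add_left (norm_add_le z x) |t - σ|) hn)
    have h4 := mul_le_mul_of_nonneg_left h3 (mul_nonneg (hk_pos z hσ).le (hψ.nonneg z))
    linarith
  rw [integral_add (i1.const_mul n) (i2.const_mul _), integral_const_mul, integral_const_mul,
    hψ.setIntegral (fun z => ‖z‖)] at h2
  have h5 := mul_le_mul_of_nonneg_left (hψ.integral_hk_le hσ)
    (show 0 ≤ n * (‖x‖ + |t - σ|) by positivity)
  have h6 : hmass N * |-c + v (x, t)| = |hmass N * (-c + v (x, t))| := by
    rw [abs_mul, abs_of_pos (hmass_pos N)]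
  rw [h6]
  have h7 := abs_sub_abs_le_abs_sub (hmass N * (-c + v (x, t)))
    (∫ z in closedBall (0 : Sp N) 1, hk z σ * (ψ z * (-c + v (z + x, t - σ))))
  linarith

theorem hk_le_hk_add (z : Sp N) {τ σ : ℝ} (hτ : 0 < τ) (hσ : 0 ≤ σ) (h : σ ≤ τ ^ 2) :
    hk z τ ≤ (1 + τ) ^ (N / 2 : ℝ) * hk z (τ + σ) := by
  unfold hk
  have h1 : exp (-(1 / (4 * τ)) * ‖z‖ ^ 2) ≤ exp (-(1 / (4 * (τ + σ))) * ‖z‖ ^ 2) := by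
    gcongr
    linarith
  have h2 : τ ^ (-(N / 2 : ℝ)) ≤ (1 + τ) ^ (N / 2 : ℝ) * (τ + σ) ^ (-(N / 2 : ℝ)) := by
    rw [rpow_neg hτ.le, rpow_neg (by positivity), ← div_eq_mul_inv, le_div_iff₀ (by positivity),
      inv_mul_le_iff₀ (by positivity), ← mul_rpow hτ.le (by positivity)]
    exact rpow_le_rpow (by positivity) (by nlinarith) (by positivity)
  calc _ ≤ _ := mul_le_mul h2 h1 (exp_pos _).le (by positivity)
    _ = _ := by ring

/-- Comparison of the values of a nonnegative solution at two nearby times. -/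
theorem IsPatch.le_of_later (hψ : IsPatch ψ) :
    ∃ C : ℝ, 0 ≤ C ∧ ∀ (Ω : Set (SpT N)) (v g : SpT N → ℝ), HeatOn Ω v g →
    ∀ (M M' : ℝ) (x : Sp N) (t τ σ : ℝ), 0 < τ → τ + σ ≤ 1 → 0 ≤ σ → σ ≤ τ ^ 2 →
    (∀ s ∈ Icc (t - τ) (t + σ), ∀ y ∈ closedBall x 1,
      (y, s) ∈ Ω ∧ 0 ≤ v (y, s) ∧ v (y, s) ≤ M ∧ |g (y, s)| ≤ M') →
    (∀ y ∈ closedBall x 1, ContinuousAt (fun s => v (y, s)) (t - τ)) →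
    hmass N * v (x, t) ≤ (1 + τ) ^ (N / 2 : ℝ) *
      (hmass N * v (x, t + σ) + C * (M + M') * (τ + σ)) + C * (M + M') * τ := by
  obtain ⟨C, hC, h⟩ := hψ.abs_rep_at
  refine ⟨C, hC, fun Ω v g hv M M' x t τ σ hτ hτ1 hσ hστ hin hlim => ?_⟩
  have hin' : ∀ s ∈ Icc (t - τ) (t + σ), ∀ y ∈ closedBall x 1,
      (y, s) ∈ Ω ∧ |v (y, s)| ≤ M ∧ |g (y, s)| ≤ M' := fun s hs y hy => by
    obtain ⟨h1, h2, h3, h4⟩ := hin s hs y hy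
    exact ⟨h1, by rwa [abs_of_nonneg h2], h4⟩
  have h1 := h _ _ _ hv M M' x t τ hτ (by linarith)
    (fun s hs => hin' s ⟨hs.1.le, by linarith [hs.2]⟩)
    fun y hy => (hlim y hy).mono_left nhdsWithin_le_nhds
  have h2 := h _ _ _ hv M M' x (t + σ) (τ + σ) (by linarith) hτ1
    (fun s hs => hin' s ⟨by linarith [hs.1], hs.2⟩)
  rw [show t + σ - (τ + σ) = t - τ by ring] at h2
  replace h2 := h2 fun y hy => (hlim y hy).mono_left nhdsWithin_le_nhds
  have hmem : ∀ z ∈ closedBall (0 : Sp N) 1, z + x ∈ closedBall x 1 := fun z hz => by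
    simpa [mem_closedBall_iff_norm] using hz
  have hcont : ContinuousOn (fun z => v (z + x, t - τ)) (closedBall (0 : Sp N) 1) := by
    have : Continuous fun z : Sp N => (z + x, t - τ) := by fun_prop
    exact hv.cont.comp this.continuousOn fun z hz =>
      (hin (t - τ) ⟨le_rfl, by linarith⟩ _ (hmem z hz)).1
  have h3 : ∫ z in closedBall (0 : Sp N) 1, hk z τ * (ψ z * v (z + x, t - τ)) ≤
      ∫ z in closedBall (0 : Sp N) 1,
        (1 + τ) ^ (N / 2 : ℝ) * (hk z (τ + σ) * (ψ z * v (z + x, t - τ))) := by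
    refine setIntegral_mono_on (hψ.hk_integrableOn τ hcont)
      ((hψ.hk_integrableOn (τ + σ) hcont).const_mul _) measurableSet_closedBall fun z hz => ?_
    rw [← mul_assoc ((1 + τ) ^ (N / 2 : ℝ))]
    exact mul_le_mul_of_nonneg_right (hk_le_hk_add z hτ hσ hστ) (mul_nonneg (hψ.nonneg z)
      (hin (t - τ) ⟨le_rfl, by linarith⟩ _ (hmem z hz)).2.1)
  rw [integral_const_mul] at h3
  have h4 := (abs_le.1 h1).2
  have h5 : (∫ z in closedBall (0 : Sp N) 1, hk z (τ + σ) * (ψ z * v (z + x, t - τ)))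
      ≤ hmass N * v (x, t + σ) + C * (M + M') * (τ + σ) := by
    linarith [(abs_le.1 h2).1]
  have h6 := mul_le_mul_of_nonneg_left h5 (show 0 ≤ (1 + τ) ^ (N / 2 : ℝ) by positivity)
  linarith

end

section
variable {N : ℕ} {ψ : Sp N → ℝ}

theorem IsPatch.sub_le_of_later (hψ : IsPatch ψ) :
    ∃ C : ℝ, 0 ≤ C ∧ ∀ (Ω : Set (SpT N)) (v g : SpT N → ℝ), HeatOn Ω v g →
    ∀ (M M' : ℝ) (x : Sp N) (t τ b : ℝ), 0 < τ → τ ≤ 1 / 2 → t < b → b - t ≤ τ ^ 2 →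
    (∀ s ∈ Ico (t - τ) b, ∀ y ∈ closedBall x 1,
      (y, s) ∈ Ω ∧ 0 ≤ v (y, s) ∧ v (y, s) ≤ M ∧ |g (y, s)| ≤ M') →
    (∀ y ∈ closedBall x 1, ContinuousAt (fun s => v (y, s)) (t - τ)) →
    ContinuousAt (fun s => v (x, s)) b →
    hmass N * (v (x, t) - v (x, b)) ≤ ((1 + τ) ^ (N / 2 : ℝ) - 1) * (hmass N * M) +
      (2 * (1 + τ) ^ (N / 2 : ℝ) + 1) * (C * (M + M') * τ) := by
  obtain ⟨C, hC, h⟩ := hψ.le_of_later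
  refine ⟨C, hC, fun Ω v g hv M M' x t τ b hτ hτ1 hb hbτ hin hlim hlimb => ?_⟩
  have hx : x ∈ closedBall x 1 := mem_closedBall_self zero_le_one
  have hM : 0 ≤ M := by
    have := hin t ⟨by linarith, hb⟩ x hx
    exact this.2.1.trans this.2.2.1
  have hM' : 0 ≤ M' := (abs_nonneg _).trans (hin t ⟨by linarith, hb⟩ x hx).2.2.2
  have hA : 1 ≤ (1 + τ) ^ (N / 2 : ℝ) := one_le_rpow (by linarith) (by positivity)
  have hτ2 : τ ^ 2 ≤ τ := by nlinarith
  have hev : ∀ᶠ s in 𝓝[<] b, hmass N * v (x, t) ≤ (1 + τ) ^ (N / 2 : ℝ) *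
      (hmass N * v (x, s) + C * (M + M') * (2 * τ)) + C * (M + M') * τ := by
    filter_upwards [Ioo_mem_nhdsLT hb] with s hs
    have h1 := h _ _ _ hv M M' x t τ (s - t) hτ (by linarith [hs.2]) (by linarith [hs.1])
      (by linarith [hs.2]) (fun s' hs' => hin s' ⟨hs'.1, by linarith [hs'.2, hs.2]⟩) hlim
    rw [add_sub_cancel] at h1
    refine h1.trans ?_
    gcongr
    linarith [hs.2]
  have hlim2 := ge_of_tendsto (((((hlimb.mono_left nhdsWithin_le_nhds : Tendsto _ (𝓝[<] b) _
    ).const_mul (hmass N)).add_const (C * (M + M') * (2 * τ))).const_mul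
    ((1 + τ) ^ (N / 2 : ℝ))).add_const (C * (M + M') * τ)) hev
  have hvb : v (x, b) ≤ M := by
    refine le_of_tendsto (hlimb.mono_left nhdsWithin_le_nhds : Tendsto _ (𝓝[<] b) _) ?_
    filter_upwards [Ioo_mem_nhdsLT hb] with s hs
    exact (hin s ⟨by linarith [hs.1], hs.2⟩ x hx).2.2.1
  have h3 := mul_le_mul_of_nonneg_left (mul_le_mul_of_nonneg_left hvb (hmass_pos N).le)
    (sub_nonneg.2 hA)
  linarith

theorem exists_last {E : Set ℝ} (hE : IsClosed E) {a t : ℝ} (h : (E ∩ Icc a t).Nonempty) :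
    ∃ b ∈ E, b ∈ Icc a t ∧ ∀ s ∈ Ioc b t, s ∉ E := by
  obtain ⟨b, hb, hmax⟩ := (isCompact_Icc.inter_left hE).exists_isMaxOn h continuousOn_id
  refine ⟨b, hb.1, hb.2, fun s hs hsE => ?_⟩
  have : s ≤ b := hmax ⟨hsE, by linarith [hb.2.1, hs.1], hs.2⟩
  linarith [hs.1]

theorem exists_first {E : Set ℝ} (hE : IsClosed E) {a t : ℝ} (h : (E ∩ Icc t a).Nonempty) :
    ∃ b ∈ E, b ∈ Icc t a ∧ ∀ s ∈ Ico t b, s ∉ E := by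
  obtain ⟨b, hb, hmin⟩ := (isCompact_Icc.inter_left hE).exists_isMinOn h continuousOn_id
  refine ⟨b, hb.1, hb.2, fun s hs hsE => ?_⟩
  have : b ≤ s := hmin ⟨hsE, hs.1, by linarith [hb.2.2, hs.2]⟩
  linarith [hs.2]

theorem exists_modulus_start (hψ : IsPatch ψ) (K n : ℝ) {ε : ℝ} (hε : 0 < ε) :
    ∃ σ₀ > 0, ∀ σ, 0 < σ → σ ≤ σ₀ →
      K * σ + n * (∫ z : Sp N, hk z σ * (ψ z * ‖z‖)) ≤ ε := by
  have h1 := tendsto_hk (N := N) (f := fun z => ψ z * ‖z‖) (hψ.sm.cont.mul continuous_norm)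
    hψ.hcs.mul_right
  have h2 : Tendsto (fun σ : ℝ => K * σ) (𝓝[>] 0) (𝓝 (K * 0)) :=
    (tendsto_id.const_mul K).mono_left nhdsWithin_le_nhds
  have h3 := h2.add (h1.const_mul n)
  rw [norm_zero, mul_zero, mul_zero, mul_zero, mul_zero, add_zero] at h3
  obtain ⟨σ₀, hσ₀, h4⟩ := mem_nhdsGT_iff_exists_Ioc_subset.1 (h3.eventually_le_const hε)
  exact ⟨σ₀, hσ₀, fun σ h5 h6 => h4 ⟨h5, h6⟩⟩

theorem exists_modulus_later (a K K' : ℝ) {ε : ℝ} (hε : 0 < ε) :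
    ∃ τ₀ > 0, ∀ τ, 0 < τ → τ ≤ τ₀ →
      ((1 + τ) ^ a - 1) * K + (2 * (1 + τ) ^ a + 1) * (K' * τ) ≤ ε := by
  have h1 : ContinuousAt (fun τ : ℝ => (1 + τ) ^ a) 0 :=
    (continuousAt_const.add continuousAt_id).rpow_const (by left; norm_num)
  have h2 : ContinuousAt (fun τ : ℝ => ((1 + τ) ^ a - 1) * K + (2 * (1 + τ) ^ a + 1) * (K' * τ))
    0 := by fun_prop
  have h3 := h2.tendsto
  simp only [add_zero, one_rpow, sub_self, zero_mul, mul_zero] at h3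
  obtain ⟨τ₀, hτ₀, h4⟩ := mem_nhdsGT_iff_exists_Ioc_subset.1
    ((h3.mono_left nhdsWithin_le_nhds : Tendsto _ (𝓝[>] (0 : ℝ)) _).eventually_le_const hε)
  exact ⟨τ₀, hτ₀, fun τ h5 h6 => h4 ⟨h5, h6⟩⟩

/-- A bounded solution which is uniformly Lipschitz on the slices at the times of `E`, and regular
at all other times, is continuous at the origin. -/
theorem exists_close_of_slices {G : Set (SpT N)} {v g : SpT N → ℝ} (hv : HeatOn G v g) {E : Set ℝ}
    (hEc : IsClosed E) (h0 : 0 ∈ E) {M M' n c : ℝ} (hn : 0 ≤ n) (hc : c ∈ Icc 0 M)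
    (hE : ∀ s ∈ Icc (-1 : ℝ) 1, s ∉ E → ∀ y : Sp N, ‖y‖ ≤ 2 → (y, s) ∈ G ∧ |g (y, s)| ≤ M')
    (hM : ∀ s ∈ Icc (-1 : ℝ) 1, ∀ y : Sp N, ‖y‖ ≤ 2 → 0 ≤ v (y, s) ∧ v (y, s) ≤ M)
    (hvert : ∀ s ∈ Icc (-1 : ℝ) 1, ∀ y : Sp N, ‖y‖ ≤ 2 → ContinuousAt (fun s => v (y, s)) s)
    (hst : ∀ s ∈ Icc (-1 : ℝ) 1, s ∈ E → ∀ y : Sp N, ‖y‖ ≤ 2 →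
      |-c + v (y, s)| ≤ n * (‖y‖ + |s|)) {ε : ℝ} (hε : 0 < ε) :
    ∃ δ > 0, ∀ (x : Sp N) (t : ℝ), ‖x‖ ≤ δ → |t| ≤ δ → |-c + v (x, t)| ≤ ε := by
  obtain ⟨ψ, hψ⟩ := exists_patch N
  obtain ⟨C₁, hC₁, h₁⟩ := hψ.abs_sub_le_of_start
  obtain ⟨C₂, hC₂, h₂⟩ := hψ.sub_le_of_later
  have hm := hmass_pos N
  obtain ⟨σ₀, hσ₀, hσ⟩ := exists_modulus_start hψ (C₁ * (M + M') + n * hmass N) n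
    (ε := hmass N * (ε / 2)) (by positivity)
  obtain ⟨τ₀, hτ₀, hτ⟩ := exists_modulus_later (N / 2 : ℝ) (hmass N * M) (C₂ * (M + M'))
    (ε := hmass N * (ε / 2)) (by positivity)
  obtain ⟨δ, hδ, hδ1, hδ2, hδ3, hδ4⟩ : ∃ δ > 0, δ ≤ 1 / 4 ∧ √δ ≤ σ₀ ∧ √δ ≤ τ₀ ∧
      n * (2 * δ) ≤ ε / 2 := by
    refine ⟨min (min (1 / 4) (ε / (4 * (n + 1)))) (min (σ₀ ^ 2) (τ₀ ^ 2)), by positivity,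
      (min_le_left _ _).trans (min_le_left _ _), ?_, ?_, ?_⟩
    · exact sqrt_le_iff.2 ⟨hσ₀.le, (min_le_right _ _).trans (min_le_left _ _)⟩
    · exact sqrt_le_iff.2 ⟨hτ₀.le, (min_le_right _ _).trans (min_le_right _ _)⟩
    · have h1 : min (min (1 / 4) (ε / (4 * (n + 1)))) (min (σ₀ ^ 2) (τ₀ ^ 2))
        ≤ ε / (4 * (n + 1)) := (min_le_left _ _).trans (min_le_right _ _)
      rw [le_div_iff₀ (by positivity)] at h1
      have h2 : 0 ≤ min (min (1 / 4) (ε / (4 * (n + 1)))) (min (σ₀ ^ 2) (τ₀ ^ 2)) := by positivity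
      linarith
  refine ⟨δ, hδ, fun x t hx ht => ?_⟩
  have htI := abs_le.1 ht
  have hball : ∀ y ∈ closedBall x 1, ‖y‖ ≤ 2 := fun y hy => by
    have h1 := norm_le_norm_add_norm_sub' y x
    rw [mem_closedBall_iff_norm] at hy
    linarith
  have hx2 : ‖x‖ ≤ 2 := by linarith
  have hstart : ∀ s ∈ Icc (-1 : ℝ) 1, ∀ y : Sp N, ‖y‖ ≤ 2 → |-c + v (y, s)| ≤ M :=
    fun s hs y hy => by
      have := hM s hs y hy
      exact abs_le.2 ⟨by linarith [hc.2], by linarith [hc.1]⟩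
  have htIcc : t ∈ Icc (-1 : ℝ) 1 := ⟨by linarith [htI.1], by linarith [htI.2]⟩
  by_cases htE : t ∈ E
  · refine (hst t htIcc htE x hx2).trans ?_
    have := mul_le_mul_of_nonneg_left (add_le_add hx ht) hn
    linarith
  have ht0 : t ≠ 0 := fun h => htE (h ▸ h0)
  obtain ⟨τ, hτe⟩ : ∃ τ, τ = √|t| := ⟨_, rfl⟩
  have hτ0 : 0 < τ := hτe ▸ sqrt_pos.2 (abs_pos.2 ht0)
  have hτsq : τ ^ 2 = |t| := hτe ▸ sq_sqrt (abs_nonneg t)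
  have hτδ : τ ≤ √δ := hτe ▸ sqrt_le_sqrt ht
  have hτhalf : τ ≤ 1 / 2 := hτδ.trans (sqrt_le_iff.2 ⟨by norm_num, by linarith⟩)
  by_cases hne : (E ∩ Icc (t - τ) t).Nonempty
  · obtain ⟨a, haE, haI, hclean⟩ := exists_last hEc hne
    have hat : a < t := haI.2.lt_of_ne fun h => htE (h ▸ haE)
    have haIcc : a ∈ Icc (-1 : ℝ) 1 := ⟨by linarith [haI.1, htI.1], by linarith [htI.2]⟩
    have h3 := h₁ _ _ _ hv M M' n c x t (t - a) (by linarith) (by linarith [haI.1]) hn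
    rw [show t - (t - a) = a by ring] at h3
    have h4 := h3 (fun s hs y hy => by
        have hsI : s ∈ Icc (-1 : ℝ) 1 := ⟨by linarith [haIcc.1, hs.1], by linarith [hs.2, htIcc.2]⟩
        obtain ⟨h5, h6⟩ := hE s hsI (hclean s hs) y (hball y hy)
        exact ⟨h5, hstart s hsI y (hball y hy), h6⟩)
      (fun y hy => hvert a haIcc y (hball y hy))
      (fun y hy => hst a haIcc haE y (hball y hy))
    have h5 := hσ (t - a) (by linarith) (by linarith [haI.1])
    have h6 : |a| ≤ |t| + (t - a) := by
      have := abs_sub_abs_le_abs_sub a t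
      rw [abs_sub_comm, abs_of_pos (sub_pos.2 hat)] at this
      linarith
    have h7 : n * (‖x‖ + |a|) * hmass N ≤ (n * (2 * δ) + n * (t - a)) * hmass N := by
      refine mul_le_mul_of_nonneg_right ?_ hm.le
      have := mul_le_mul_of_nonneg_left (show ‖x‖ + |a| ≤ 2 * δ + (t - a) by linarith) hn
      linarith
    have h8 := mul_le_mul_of_nonneg_right hδ4 hm.le
    have h9 : hmass N * |-c + v (x, t)| ≤ hmass N * ε := by linarith
    exact le_of_mul_le_mul_left h9 hm
  · have htneg : t < 0 := by
      by_contra! h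
      refine hne ⟨0, h0, ?_, h⟩
      rw [abs_of_nonneg h] at hτsq
      nlinarith
    rw [abs_of_neg htneg] at hτsq
    obtain ⟨b, hbE, hbI, hclean⟩ := exists_first hEc ⟨0, h0, htneg.le, le_rfl⟩
    have htb : t < b := hbI.1.lt_of_ne fun h => htE (h ▸ hbE)
    have hbIcc : b ∈ Icc (-1 : ℝ) 1 := ⟨by linarith [htIcc.1], by linarith [hbI.2]⟩
    have hin : ∀ s ∈ Ico (t - τ) b, s ∈ Icc (-1 : ℝ) 1 ∧ s ∉ E := fun s hs =>
      ⟨⟨by linarith [hs.1, htI.1], by linarith [hs.2, hbI.2]⟩, fun h => by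
        rcases le_or_gt s t with h1 | h1
        · exact hne ⟨s, h, hs.1, h1⟩
        · exact hclean s ⟨h1.le, hs.2⟩ h⟩
    have htτ : t - τ ∈ Icc (-1 : ℝ) 1 := ⟨by linarith [htI.1], by linarith⟩
    have h3 := h₂ _ _ _ hv M M' x t τ b hτ0 hτhalf htb (by linarith [hbI.2]) (fun s hs y hy => by
        obtain ⟨h3, h4⟩ := hin s hs
        obtain ⟨h5, h6⟩ := hE s h3 h4 y (hball y hy)
        exact ⟨h5, (hM s h3 y (hball y hy)).1, (hM s h3 y (hball y hy)).2, h6⟩)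
      (fun y hy => hvert _ htτ y (hball y hy)) (hvert b hbIcc x hx2)
    have h4 := h₂ _ _ _ ((hv.const_mul (-1)).const_add M) M M' x t τ b hτ0 hτhalf htb
      (by linarith [hbI.2]) (fun s hs y hy => by
        obtain ⟨h3, h4⟩ := hin s hs
        obtain ⟨h5, h6⟩ := hE s h3 h4 y (hball y hy)
        have h7 := hM s h3 y (hball y hy)
        refine ⟨h5, by linarith [h7.2], by linarith [h7.1], by simpa using h6⟩)
      (fun y hy => ((hvert _ htτ y (hball y hy)).const_mul (-1)).const_add M)
      (((hvert b hbIcc x hx2).const_mul (-1)).const_add M)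
    have h5 := hτ τ hτ0 (hτδ.trans hδ3)
    have h6 : v (x, t) - v (x, b) ≤ ε / 2 := le_of_mul_le_mul_left (h3.trans h5) hm
    have h7 := le_of_mul_le_mul_left (h4.trans h5) hm
    have h8 := abs_le.1 (hst b hbIcc hbE x hx2)
    have h9 : |b| ≤ δ := abs_le.2 ⟨by linarith, by linarith [hbI.2]⟩
    have h10 := mul_le_mul_of_nonneg_left (add_le_add hx h9) hn
    exact abs_le.2 ⟨by linarith, by linarith⟩

end

section
variable {N m : ℕ} {β : Fin m → Fin m → ℝ} {r : ℝ}
variable {u : Fin m → SpT N → ℝ} {G : Set (SpT N)} {P₀ : SpT N} {ρ n : ℝ}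

theorem Flat.continuousAt (hr : 0 < r) (hβ : ∀ i j, 0 ≤ β i j) (hu : SolOn β r G u)
    (hG : IsOpen G) (hF : Flat u G P₀ ρ n) (h0 : ∀ i, ∀ P ∈ closedBall P₀ ρ, 0 ≤ u i P) {M : ℝ}
    (hM : ∀ P ∈ closedBall P₀ ρ, ∀ i, u i P ≤ M)
    (hvert : ∀ i, ∀ P ∈ closedBall P₀ ρ, ContinuousAt (fun s => u i (P.1, s)) P.2) (i : Fin m) :
    ContinuousAt (u i) P₀ := by
  have hρ := hF.pos
  obtain ⟨a, ha, ha1, haρ⟩ : ∃ a > 0, a ≤ 1 ∧ 2 * a ≤ ρ :=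
    ⟨min 1 (ρ / 2), by positivity, min_le_left _ _, by linarith [min_le_right 1 (ρ / 2)]⟩
  have ha2 : a ^ 2 ≤ a := by nlinarith
  obtain ⟨E, hEe⟩ : ∃ E : Set ℝ, E = (fun s => a ^ 2 * s + P₀.2) ⁻¹'
    (Prod.snd '' (closedBall P₀ ρ \ G)) := ⟨_, rfl⟩
  have hEc : IsClosed E := by
    rw [hEe]
    refine IsClosed.preimage (by fun_prop) ?_
    exact (((isCompact_closedBall P₀ ρ).diff hG).image continuous_snd).isClosed
  have hP₀ : P₀ ∈ closedBall P₀ ρ := mem_closedBall_self hρ.le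
  have h0E : 0 ∈ E := by
    rw [hEe]
    exact ⟨P₀, ⟨hP₀, hF.bad⟩, by simp⟩
  have hin : ∀ s ∈ Icc (-1 : ℝ) 1, ∀ y : Sp N, ‖y‖ ≤ 2 → zoom a P₀ (y, s) ∈ closedBall P₀ ρ :=
    fun s hs y hy => by
      rw [mem_closedBall_spt, dist_zoom_fst, dist_zoom_snd, abs_of_pos ha]
      have h1 := mul_le_mul_of_nonneg_left hy ha.le
      have h2 := mul_le_mul_of_nonneg_left (abs_le.2 hs) (sq_nonneg a)
      constructor <;> simp only <;> linarith
  have key := fun ε hε => exists_close_of_slices ((hu.heatOn i).zoom a P₀) hEc h0E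
    (M := M) (M' := a ^ 2 * (2 * bsum β * M ^ (2 * r + 1))) (n := n) (c := u i P₀)
    hF.nonneg ⟨h0 i _ hP₀, hM _ hP₀ i⟩ (fun s hs hsE y hy => by
      have hQ := hin s hs y hy
      have hQG : zoom a P₀ (y, s) ∈ G := by
        by_contra hb
        refine hsE ?_
        rw [hEe]
        exact ⟨_, ⟨hQ, hb⟩, rfl⟩
      have hy0 : ∀ j, 0 ≤ u j (zoom a P₀ (y, s)) := fun j => h0 j _ hQ
      refine ⟨hQG, ?_⟩
      have h1 : nlf β r u i (zoom a P₀ (y, s)) ≤ 2 * bsum β * M ^ (2 * r + 1) :=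
        nl_le hr hβ hy0
          (fun j => rpow_le_rpow (hy0 j) (hM _ hQ j) (by linarith)) i
      have h2 : 0 ≤ nlf β r u i (zoom a P₀ (y, s)) := nl_nonneg hβ hy0 i
      rw [abs_of_nonneg (by positivity)]
      exact mul_le_mul_of_nonneg_left h1 (sq_nonneg a))
    (fun s hs y hy => ⟨h0 i _ (hin s hs y hy), hM _ (hin s hs y hy) i⟩)
    (fun s hs y hy => by
      have h1 := hvert i _ (hin s hs y hy)
      rw [zoom_apply] at h1
      have h2 : ContinuousAt (fun s : ℝ => a ^ 2 * s + P₀.2) s := by fun_prop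
      exact ContinuousAt.comp (f := fun s : ℝ => a ^ 2 * s + P₀.2) (x := s) h1 h2)
    (fun s hs hsE y hy => by
      rw [hEe] at hsE
      obtain ⟨Q, ⟨hQ, hQG⟩, hQs⟩ := hsE
      have h1 := mem_closedBall_spt.1 (hin s hs y hy)
      have h2 := hF.slice_close hQ hQG i (y := a • y + P₀.1) (by
        rw [zoom_apply] at h1; exact h1.1)
      have h3 : dist (a • y + P₀.1) P₀.1 = |a| * ‖y‖ := dist_zoom_fst a P₀ (y, s)
      have h4 : dist Q.2 P₀.2 = a ^ 2 * |s| := by rw [hQs]; exact dist_zoom_snd a P₀ (y, s)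
      rw [h3, h4, abs_of_pos ha, hQs] at h2
      rw [neg_add_eq_sub, zoom_apply]
      refine h2.trans (mul_le_mul_of_nonneg_left (add_le_add ?_ ?_) hF.nonneg)
      · exact mul_le_of_le_one_left (norm_nonneg y) ha1
      · exact mul_le_of_le_one_left (abs_nonneg s) (ha2.trans ha1)) (ε := ε) hε
  rw [Metric.continuousAt_iff]
  intro ε hε
  obtain ⟨δ, hδ, h⟩ := key (ε / 2) (by positivity)
  refine ⟨a ^ 2 * δ, by positivity, fun Q hQ => ?_⟩
  rw [Prod.dist_eq, max_lt_iff] at hQ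
  have h1 := h (a⁻¹ • (Q.1 - P₀.1)) ((a ^ 2)⁻¹ * (Q.2 - P₀.2)) (by
    rw [norm_smul, norm_inv, norm_of_nonneg ha.le, ← dist_eq_norm, inv_mul_le_iff₀ ha]
    have := mul_le_mul_of_nonneg_right ha2 hδ.le
    linarith [hQ.1]) (by
    rw [abs_mul, abs_inv, abs_of_nonneg (sq_nonneg a), ← Real.dist_eq,
      inv_mul_le_iff₀ (by positivity)]
    exact hQ.2.le)
  have e : zoom a P₀ (a⁻¹ • (Q.1 - P₀.1), (a ^ 2)⁻¹ * (Q.2 - P₀.2)) = Q := by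
    rw [zoom_apply, smul_inv_smul₀ ha.ne', mul_inv_cancel_left₀ (by positivity)]
    simp
  rw [e, neg_add_eq_sub] at h1
  rw [Real.dist_eq]
  linarith

theorem Flat.of_mem (hF : Flat u G P₀ ρ n) {P : SpT N} {ρ' : ℝ} (hρ' : 0 < ρ')
    (hP : closedBall P ρ' ⊆ closedBall P₀ ρ) (hb : P ∉ G) : Flat u G P ρ' n := by
  have hsp : ∀ Q ∈ closedBall P ρ', Q ∈ closedBall P₀ ρ := fun Q hQ => hP hQ
  have h1 : ∀ y ∈ closedBall P.1 ρ', y ∈ closedBall P₀.1 ρ := fun y hy =>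
    (mem_closedBall_spt.1 (hsp (y, P.2)
      (mem_closedBall_spt.2 ⟨hy, by simpa using hρ'.le⟩))).1
  have h2 : ∀ s ∈ closedBall P.2 ρ', s ∈ closedBall P₀.2 ρ := fun s hs =>
    (mem_closedBall_spt.1 (hsp (P.1, s)
      (mem_closedBall_spt.2 ⟨by simpa using hρ'.le, hs⟩))).2
  exact ⟨hρ', hF.nonneg, hb, fun Q hQ hQG i y hy y' hy' =>
    hF.slice Q (hP hQ) hQG i y (h1 y hy) y' (h1 y' hy'),
    fun Q hQ hQG i s hs => hF.vert Q (hP hQ) hQG i s (h2 s hs)⟩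

end

section
variable {N m : ℕ} {β : Fin m → Fin m → ℝ} {r T : ℝ} {u : Fin m → SpT N → ℝ}

/-- A solution on `ℝ^N × (0,T)` which is regular separately in space and in time. -/
structure SepSol (β : Fin m → Fin m → ℝ) (r T : ℝ) (u : Fin m → SpT N → ℝ) : Prop where
  heatAt : ∀ i (P : SpT N), P.2 ∈ Ioo 0 T → HeatAt (u i) P (nlf β r u i P)
  nonneg : ∀ i (P : SpT N), P.2 ∈ Ioo 0 T → 0 ≤ u i P
  slice : ∀ i (P : SpT N), P.2 ∈ Ioo 0 T → ∃ K : ℝ, ∃ ε > 0, ∀ y ∈ ball P.1 ε, ∀ y' ∈ ball P.1 ε,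
    |u i (y, P.2) - u i (y', P.2)| ≤ K * dist y y'
  vert : ∀ i (P : SpT N), P.2 ∈ Ioo 0 T → ∃ K : ℝ, ∃ ε > 0, ∀ s ∈ ball P.2 ε,
    |u i (P.1, s) - u i P| ≤ K * dist s P.2

theorem SepSol.continuousAt_slice (h : SepSol β r T u) (i : Fin m) {x : Sp N} {t : ℝ}
    (ht : t ∈ Ioo 0 T) : ContinuousAt (fun y => u i (y, t)) x := by
  obtain ⟨K, ε, hε, hK⟩ := h.slice i (x, t) ht
  exact continuousAt_of_locally_lipschitz hε K fun y hy => hK y hy x (mem_ball_self hε)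

theorem SepSol.continuousAt_vert (h : SepSol β r T u) (i : Fin m) {x : Sp N} {t : ℝ}
    (ht : t ∈ Ioo 0 T) : ContinuousAt (fun s => u i (x, s)) t := by
  obtain ⟨K, ε, hε, hK⟩ := h.vert i (x, t) ht
  exact continuousAt_of_locally_lipschitz hε K fun s hs => hK s hs

/-- The points where the functions `u i` are Lipschitz with constant `k` at scale `1 / k`. -/
def lipAt (T : ℝ) (u : Fin m → SpT N → ℝ) (k : ℕ) (P : SpT N) : Prop :=
  ∀ i, (∀ y ∈ ball P.1 (1 / ((k : ℝ) + 1)), ∀ y' ∈ ball P.1 (1 / ((k : ℝ) + 1)),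
    |u i (y, P.2) - u i (y', P.2)| ≤ ((k : ℝ) + 1) * dist y y') ∧
    ∀ s ∈ Ioo 0 T, s ∈ ball P.2 (1 / ((k : ℝ) + 1)) →
      |u i (P.1, s) - u i P| ≤ ((k : ℝ) + 1) * dist s P.2

theorem SepSol.exists_lipAt (h : SepSol β r T u) {P : SpT N} (hP : P.2 ∈ Ioo 0 T) :
    ∃ k, lipAt T u k P := by
  have key : ∀ K ε : ℝ, 0 < ε → ∀ᶠ k : ℕ in atTop, K ≤ (k : ℝ) + 1 ∧ 1 / ((k : ℝ) + 1) ≤ ε :=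
    fun K ε hε => by
      filter_upwards [tendsto_natCast_atTop_atTop.eventually_ge_atTop (max K (1 / ε))] with k hk
      have h1 := (le_max_left _ _).trans hk
      have h2 := (le_max_right _ _).trans hk
      rw [div_le_iff₀ hε] at h2
      refine ⟨by linarith, ?_⟩
      rw [div_le_iff₀ (by positivity)]
      linarith
  have hev : ∀ᶠ k in atTop, lipAt T u k P := by
    refine eventually_all.2 fun i => ?_
    obtain ⟨K, ε, hε, h1⟩ := h.slice i P hP
    obtain ⟨K', ε', hε', h2⟩ := h.vert i P hP
    filter_upwards [key K ε hε, key K' ε' hε'] with k hk hk'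
    exact ⟨fun y hy y' hy' => (h1 y (ball_subset_ball hk.2 hy) y' (ball_subset_ball hk.2 hy')).trans
      (mul_le_mul_of_nonneg_right hk.1 dist_nonneg), fun s _ hs =>
      (h2 s (ball_subset_ball hk'.2 hs)).trans (mul_le_mul_of_nonneg_right hk'.1 dist_nonneg)⟩
  exact hev.exists

theorem SepSol.lipAt_of_closure (h : SepSol β r T u) {k : ℕ} {P : SpT N} (hP : P.2 ∈ Ioo 0 T)
    (hc : P ∈ closure {Q : SpT N | lipAt T u k Q}) : lipAt T u k P := by
  obtain ⟨L, hL⟩ : ∃ L, L = (k : ℝ) + 1 := ⟨_, rfl⟩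
  obtain ⟨x, hx, hlim⟩ := mem_closure_iff_seq_limit.1 hc
  have hx1 : Tendsto (fun j => (x j).1) atTop (𝓝 P.1) := (continuous_fst.tendsto P).comp hlim
  have hx2 : Tendsto (fun j => (x j).2) atTop (𝓝 P.2) := (continuous_snd.tendsto P).comp hlim
  have hball : ∀ {X : Type _} [PseudoMetricSpace X] {f : ℕ → X} {a y : X} {δ : ℝ},
      Tendsto f atTop (𝓝 a) → y ∈ ball a δ → ∀ᶠ j in atTop, y ∈ ball (f j) δ :=
    fun hf hy => by
      have h1 := (tendsto_const_nhds.dist hf).eventually_lt_const hy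
      exact h1
  refine fun i => ⟨fun y hy y' hy' => ?_, fun s hsT hs => ?_⟩
  · have hv : ∀ z, Tendsto (fun j => u i (z, (x j).2)) atTop (𝓝 (u i (z, P.2))) := fun z =>
      (h.continuousAt_vert i (x := z) hP).tendsto.comp hx2
    refine le_of_tendsto ((hv y).sub (hv y')).abs ?_
    filter_upwards [hball hx1 hy, hball hx1 hy'] with j h1 h2
    exact (hx j i).1 y h1 y' h2
  · have hv : ∀ s ∈ Ioo 0 T, Tendsto (fun j => u i ((x j).1, s)) atTop (𝓝 (u i (P.1, s))) :=
      fun s hs => (h.continuousAt_slice i (x := P.1) hs).tendsto.comp hx1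
    have hd : ∀ s, Tendsto (fun j => dist s (x j).2) atTop (𝓝 (dist s P.2)) := fun s =>
      tendsto_const_nhds.dist hx2
    have h1 := ((hd s).const_mul ((k : ℝ) + 1)).add ((hd P.2).const_mul ((k : ℝ) + 1))
    rw [dist_self, mul_zero, add_zero] at h1
    refine le_of_tendsto_of_tendsto ((hv s hsT).sub (hv P.2 hP)).abs h1 ?_
    filter_upwards [hball hx2 hs, hball hx2 (mem_ball_self (by positivity) :
      P.2 ∈ ball P.2 (1 / ((k : ℝ) + 1)))] with j h2 h3
    refine (abs_sub_le _ (u i (x j)) _).trans (add_le_add ((hx j i).2 s hsT h2) ?_)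
    rw [abs_sub_comm]
    exact (hx j i).2 P.2 hP h3

/-- Baire's theorem on the difference of two open sets. -/
theorem exists_ball_of_cover {X : Type*} [MetricSpace X] [LocallyCompactSpace X] {Ω G : Set X}
    (hΩ : IsOpen Ω) (hG : IsOpen G) (f : ℕ → Set X) (hc : ∀ k, ∀ P ∈ Ω, P ∈ closure (f k) → P ∈ f k)
    (hcov : ∀ P ∈ Ω, ∃ k, P ∈ f k) (hne : ∃ P ∈ Ω, P ∉ G) :
    ∃ P ∈ Ω, P ∉ G ∧ ∃ k, ∃ ε > 0, ∀ Q ∈ Ω, Q ∉ G → dist Q P < ε → Q ∈ f k := by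
  have hSl : IsLocallyClosed (Ω ∩ Gᶜ) := hΩ.isLocallyClosed.inter hG.isClosed_compl.isLocallyClosed
  have : LocallyCompactSpace ↥(Ω ∩ Gᶜ) := hSl.locallyCompactSpace
  obtain ⟨P₁, h1, h2⟩ := hne
  have : Nonempty ↥(Ω ∩ Gᶜ) := ⟨⟨P₁, h1, h2⟩⟩
  obtain ⟨k, P₀, hP₀⟩ := nonempty_interior_of_iUnion_of_closed
    (f := fun k : ℕ => ((↑) : ↥(Ω ∩ Gᶜ) → X) ⁻¹' f k)
    (fun k => isClosed_of_closure_subset fun P hP => hc k P P.2.1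
      (continuous_subtype_val.closure_preimage_subset _ hP))
    (eq_univ_of_forall fun P => mem_iUnion.2 (hcov P P.2.1))
  obtain ⟨ε, hε, hball⟩ := Metric.mem_nhds_iff.1 (mem_interior_iff_mem_nhds.1 hP₀)
  exact ⟨P₀, P₀.2.1, P₀.2.2, k, ε, hε, fun Q hQ hQG hd =>
    hball (show (⟨Q, hQ, hQG⟩ : ↥(Ω ∩ Gᶜ)) ∈ ball P₀ ε from hd)⟩

theorem SepSol.exists_flat (h : SepSol β r T u) {G : Set (SpT N)} (hG : IsOpen G)
    (hne : ∃ P : SpT N, P.2 ∈ Ioo 0 T ∧ P ∉ G) :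
    ∃ P ρ n, Flat u G P ρ n ∧ ∀ Q ∈ closedBall P ρ, Q.2 ∈ Ioo 0 T := by
  have hΩ : IsOpen {P : SpT N | P.2 ∈ Ioo 0 T} := isOpen_Ioo.preimage continuous_snd
  obtain ⟨P₀, hP₀, hP₀G, k, ε, hε, hball⟩ := exists_ball_of_cover hΩ hG
    (fun k => {P : SpT N | lipAt T u k P}) (fun k P hP hPc => h.lipAt_of_closure hP hPc)
    (fun P hP => h.exists_lipAt hP) hne
  obtain ⟨ε', hε', hball'⟩ := Metric.mem_nhds_iff.1 (hΩ.mem_nhds hP₀)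
  obtain ⟨ρ, hρ, hρ1, hρ2, hρ3⟩ : ∃ ρ > 0, ρ < ε ∧ ρ < ε' ∧ 2 * ρ < 1 / ((k : ℝ) + 1) := by
    refine ⟨min (ε / 2) (min (ε' / 2) (1 / ((k : ℝ) + 1) / 4)), by positivity, ?_, ?_, ?_⟩
    · exact (min_le_left _ _).trans_lt (by linarith)
    · exact ((min_le_right _ _).trans (min_le_left _ _)).trans_lt (by linarith)
    · have h1 : 0 < 1 / ((k : ℝ) + 1) := by positivity
      have h2 : min (ε / 2) (min (ε' / 2) (1 / ((k : ℝ) + 1) / 4)) ≤ 1 / ((k : ℝ) + 1) / 4 :=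
        (min_le_right _ _).trans (min_le_right _ _)
      linarith
  have hT : ∀ Q ∈ closedBall P₀ ρ, Q.2 ∈ Ioo 0 T := fun Q hQ =>
    hball' (closedBall_subset_ball hρ2 hQ)
  have hlip : ∀ Q ∈ closedBall P₀ ρ, Q ∉ G → lipAt T u k Q := fun Q hQ hQG =>
    hball Q (hT Q hQ) hQG ((mem_closedBall.1 hQ).trans_lt hρ1)
  refine ⟨P₀, ρ, (k : ℝ) + 1, ⟨hρ, by positivity, hP₀G, ?_, ?_⟩, hT⟩
  · intro P hP hb i y hy y' hy'
    have h1 := dist_comm P.1 P₀.1 ▸ (mem_closedBall_spt.1 hP).1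
    have h2 : ∀ z ∈ closedBall P₀.1 ρ, z ∈ ball P.1 (1 / ((k : ℝ) + 1)) := fun z hz =>
      (dist_triangle _ P₀.1 _).trans_lt (by linarith [mem_closedBall.1 hz])
    exact (hlip P hP hb i).1 y (h2 y hy) y' (h2 y' hy')
  · intro P hP hb i s hs
    have h1 := dist_comm P.2 P₀.2 ▸ (mem_closedBall_spt.1 hP).2
    refine (hlip P hP hb i).2 s ?_ ?_
    · exact hT (P₀.1, s) (mem_closedBall_spt.2 ⟨by simpa using hρ.le, hs⟩)
    · exact (dist_triangle _ P₀.2 _).trans_lt (by linarith [mem_closedBall.1 hs])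

/-- Joint continuity of separately regular solutions. -/
theorem SepSol.solOn (hN : 1 ≤ N) (hr : 0 < r) (hβ : ∀ i j, 0 ≤ β i j) (h : SepSol β r T u)
    {C : ℝ} (hC : 0 < C) (hloc : ∀ (Ω : Set (SpT N)) (u : Fin m → SpT N → ℝ), SolOn β r Ω u →
      ∀ (P : SpT N) (ρ : ℝ), 0 < ρ → (∀ Q ∈ pbox N 1, zoom ρ P Q ∈ Ω) →
      ∑ i, u i P ≤ C * ρ ^ (-(1 / r))) :
    SolOn β r {P | P.2 ∈ Ioo 0 T} u := by
  have hΩ : IsOpen {P : SpT N | P.2 ∈ Ioo 0 T} := isOpen_Ioo.preimage continuous_snd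
  obtain ⟨G, hGe⟩ : ∃ G : Set (SpT N), G = {P | P.2 ∈ Ioo 0 T} ∩
    {P | ∀ᶠ Q in 𝓝 P, ∀ i, ContinuousAt (u i) Q} := ⟨_, rfl⟩
  have hG : IsOpen G := hGe ▸ hΩ.inter isOpen_setOfPred_eventually_nhds
  have hGc : ∀ P ∈ G, ∀ i, ContinuousAt (u i) P := fun P hP => by
    rw [hGe] at hP
    exact hP.2.self_of_nhds
  have hGT : ∀ P ∈ G, P.2 ∈ Ioo 0 T := fun P hP => by
    rw [hGe] at hP
    exact hP.1
  have hsol : SolOn β r G u := ⟨fun i => ⟨hG, fun P hP => (hGc P hP i).continuousWithinAt,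
    fun P hP => (ContinuousAt.comp (f := fun P j => u j P) (continuous_nl hr i).continuousAt
      (continuousAt_pi.2 (hGc P hP))).continuousWithinAt,
    fun P hP => h.heatAt i P (hGT P hP)⟩, fun i P hP => h.nonneg i P (hGT P hP)⟩
  have hall : ∀ P : SpT N, P.2 ∈ Ioo 0 T → P ∈ G := by
    by_contra! hne
    obtain ⟨P₀, ρ, n, hF, hT⟩ := h.exists_flat hG hne
    obtain ⟨ρ₁, hρ₁, M, hM⟩ := hF.exists_bound hN hr hβ hsol hG hC (hloc G u hsol)
      fun i P hP => h.nonneg i P (hT P hP)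
    obtain ⟨ρ₂, hρ₂, h1, h2⟩ : ∃ ρ₂ > 0, 2 * ρ₂ ≤ ρ ∧ 2 * ρ₂ ≤ ρ₁ :=
      ⟨min ρ ρ₁ / 2, by have := hF.pos; positivity, by linarith [min_le_left ρ ρ₁],
        by linarith [min_le_right ρ ρ₁]⟩
    refine hF.bad ?_
    rw [hGe]
    refine ⟨hT P₀ (mem_closedBall_self hF.pos.le), ?_⟩
    show ∀ᶠ Q in 𝓝 P₀, ∀ i, ContinuousAt (u i) Q
    filter_upwards [closedBall_mem_nhds P₀ hρ₂] with Q hQ i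
    by_cases hQG : Q ∈ G
    · exact hGc Q hQG i
    have hsub : closedBall Q ρ₂ ⊆ closedBall P₀ (2 * ρ₂) :=
      closedBall_subset_closedBall' (by linarith [mem_closedBall.1 hQ])
    have hsub1 := hsub.trans (closedBall_subset_closedBall h1)
    exact (hF.of_mem hρ₂ hsub1 hQG).continuousAt hr hβ hsol hG
      (fun i P hP => h.nonneg i P (hT P (hsub1 hP)))
      (fun P hP => hM P (hsub.trans (closedBall_subset_closedBall h2) hP))
      (fun i P hP => h.continuousAt_vert i (hT P (hsub1 hP))) i
  have e : {P : SpT N | P.2 ∈ Ioo 0 T} = G :=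
    Subset.antisymm (fun P hP => hall P hP) fun P hP => hGT P hP
  rw [e]
  exact hsol

end

section
variable {N m : ℕ} {β : Fin m → Fin m → ℝ} {r T : ℝ}

theorem hasD2_of_contDiff {f : Sp N → ℝ} (hf : ContDiff ℝ 2 f) (x e : Sp N) :
    HasD2 (fun s : ℝ => f (x + s • e)) (iteratedFDeriv ℝ 2 f x ![e, e]) := by
  have hl : ∀ s : ℝ, HasDerivAt (fun s : ℝ => x + s • e) e s := fun s => by
    simpa using ((hasDerivAt_id s).smul_const e).const_add x
  have h1 : ∀ s : ℝ, HasDerivAt (fun s : ℝ => f (x + s • e)) (fderiv ℝ f (x + s • e) e) s :=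
    fun s => ((hf.differentiable (by norm_num)) (x + s • e)).hasFDerivAt.comp_hasDerivAt s (hl s)
  refine ⟨Eventually.of_forall fun s => (h1 s).differentiableAt, ?_⟩
  rw [show deriv (fun s : ℝ => f (x + s • e)) = fun s => fderiv ℝ f (x + s • e) e from
    funext fun s => (h1 s).deriv, iteratedFDeriv_two_apply]
  have h2 : Differentiable ℝ (fderiv ℝ f) :=
    (hf.fderiv_right (m := 1) (by norm_num)).differentiable (by norm_num)
  have h3 := (h2 (x + (0 : ℝ) • e)).hasFDerivAt.comp_hasDerivAt (0 : ℝ) (hl 0)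
  rw [zero_smul, add_zero] at h3
  simpa using HasDerivAt.clm_apply h3 (hasDerivAt_const (0 : ℝ) e)

theorem sepSol_of_separate {u : Fin m → EuclideanSpace ℝ (Fin N) → ℝ → ℝ}
    (hx : ∀ i, ∀ t ∈ Ioo (0 : ℝ) T, ContDiff ℝ 2 (fun x => u i x t))
    (ht : ∀ i (x : EuclideanSpace ℝ (Fin N)), ContDiffOn ℝ 1 (fun s => u i x s) (Ioo (0 : ℝ) T))
    (hu : ∀ i (x : EuclideanSpace ℝ (Fin N)), ∀ t ∈ Ioo (0 : ℝ) T, 0 ≤ u i x t)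
    (heq : ∀ i (x : EuclideanSpace ℝ (Fin N)), ∀ t ∈ Ioo (0 : ℝ) T,
      deriv (fun s => u i x s) t - lap (fun y => u i y t) x
        = ∑ j, β i j * u i x t ^ r * u j x t ^ (r + 1)) :
    SepSol β r T (fun i (P : SpT N) => u i P.1 P.2) := by
  have hta : ∀ i (P : SpT N), P.2 ∈ Ioo 0 T → ContDiffAt ℝ 1 (fun s => u i P.1 s) P.2 :=
    fun i P hP => (ht i P.1).contDiffAt (Ioo_mem_nhds hP.1 hP.2)
  refine ⟨fun i P hP => ?_, fun i P hP => hu i P.1 P.2 hP, fun i P hP => ?_, fun i P hP => ?_⟩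
  · refine ⟨deriv (fun s => u i P.1 s) P.2, fun k => iteratedFDeriv ℝ 2 (fun y => u i y P.2) P.1
      ![EuclideanSpace.single k 1, EuclideanSpace.single k 1], ?_, fun k => ?_, heq i P.1 P.2 hP⟩
    · have h1 := ((hta i P hP).differentiableAt (by norm_num)).hasDerivAt
      have h2 : HasDerivAt (fun s : ℝ => P.2 + s) 1 0 := (hasDerivAt_id _).const_add _
      have h3 : HasDerivAt (fun s => u i P.1 s) (deriv (fun s => u i P.1 s) P.2) (P.2 + 0) := by
        rwa [add_zero]
      have h4 := h3.comp (0 : ℝ) h2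
      rw [mul_one] at h4
      simpa [bt, Function.comp_def] using h4
    · simpa [bx] using hasD2_of_contDiff (hx i P.2 hP) P.1 (EuclideanSpace.single k 1)
  · obtain ⟨K, s, hs, hK⟩ := ((hx i P.2 hP).of_le (by norm_num : (1 : WithTop ℕ∞) ≤ 2)
      ).contDiffAt.exists_lipschitzOnWith (x := P.1)
    obtain ⟨ε, hε, hb⟩ := Metric.mem_nhds_iff.1 hs
    exact ⟨K, ε, hε, fun y hy y' hy' => hK.dist_le_mul y (hb hy) y' (hb hy')⟩
  · obtain ⟨K, s, hs, hK⟩ := (hta i P hP).exists_lipschitzOnWith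
    obtain ⟨ε, hε, hb⟩ := Metric.mem_nhds_iff.1 hs
    exact ⟨K, ε, hε, fun y hy => hK.dist_le_mul y (hb hy) P.2 (hb (mem_ball_self hε))⟩

end

end

/-- universal initial and final blow-up estimate for nonnegative solutions
of the system (S) on `ℝ^N × (0,T)`, with a constant depending only on `N`, `p` and `B`. -/
theorem universal_time_estimate_whole_space
    (N m : ℕ) (hN : 1 ≤ N) (hm : 2 ≤ m)
    (r : ℝ) (hr : 0 < r)
    (β : Fin m → Fin m → ℝ)
    (hsym : ∀ i j, β i j = β j i)
    (hoff : ∀ i j, i ≠ j → 0 ≤ β i j)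
    (hdiag : ∀ i, 0 < β i i)
    (hpB : N ≤ 2 ∨ (3 ≤ N ∧ 2 * r + 1 < ((N : ℝ) * (N + 2)) / ((N : ℝ) - 1) ^ 2)) :
    ∃ C : ℝ, 0 < C ∧
      ∀ (T : ℝ), 0 < T →
      ∀ (u : Fin m → EuclideanSpace ℝ (Fin N) → ℝ → ℝ),
        (∀ i, ∀ t ∈ Ioo (0 : ℝ) T, ContDiff ℝ 2 (fun x => u i x t)) →
        (∀ i (x : EuclideanSpace ℝ (Fin N)),
          ContDiffOn ℝ 1 (fun s => u i x s) (Ioo (0 : ℝ) T)) →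
        (∀ i (x : EuclideanSpace ℝ (Fin N)), ∀ t ∈ Ioo (0 : ℝ) T, 0 ≤ u i x t) →
        (∀ i (x : EuclideanSpace ℝ (Fin N)), ∀ t ∈ Ioo (0 : ℝ) T,
          deriv (fun s => u i x s) t - lap (fun y => u i y t) x
            = ∑ j, β i j * u i x t ^ r * u j x t ^ (r + 1)) →
        ∀ i (x : EuclideanSpace ℝ (Fin N)), ∀ t ∈ Ioo (0 : ℝ) T,
          u i x t ≤ C * (t ^ (-(1 / (2 * r + 1 - 1))) + (T - t) ^ (-(1 / (2 * r + 1 - 1)))) := by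
  have hβ : ∀ i j, 0 ≤ β i j := fun i j => by
    rcases eq_or_ne i j with rfl | h
    exacts [(hdiag i).le, hoff i j h]
  obtain ⟨C, hC, hloc⟩ := exists_local_bound hN hr hsym hβ hdiag hpB
  refine ⟨C * (1 / 2) ^ (-(1 / (2 * r + 1 - 1))), by positivity, fun T hT u hx ht hu heq i x t htT =>
    ?_⟩
  have hsol := (sepSol_of_separate hx ht hu heq).solOn hN hr hβ hC hloc
  obtain ⟨q, hq, hq0, hqt, hqT⟩ : ∃ q, q = min t (T - t) ∧ 0 < q ∧ q ≤ t ∧ q ≤ T - t :=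
    ⟨_, rfl, lt_min htT.1 (sub_pos.2 htT.2), min_le_left _ _, min_le_right _ _⟩
  have h1 := hloc _ _ hsol (x, t) (√(1 / 2 * q)) (by positivity) fun Q hQ => by
    have h2 := abs_le.1 hQ.2
    show (zoom (√(1 / 2 * q)) (x, t) Q).2 ∈ Ioo 0 T
    rw [zoom_apply, sq_sqrt (by positivity)]
    constructor <;> simp only <;> nlinarith [h2.1, h2.2]
  have h2 : u i x t ≤ ∑ j, u j x t :=
    Finset.single_le_sum (f := fun j => u j x t) (fun j _ => hu j x t htT) (Finset.mem_univ i)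
  have h3 : √(1 / 2 * q) ^ (-(1 / r)) =
      (1 / 2) ^ (-(1 / (2 * r + 1 - 1))) * q ^ (-(1 / (2 * r + 1 - 1))) := by
    rw [← mul_rpow (by norm_num) hq0.le, sqrt_eq_rpow, ← rpow_mul (by positivity)]
    congr 1
    field_simp
    ring
  have h4 : q ^ (-(1 / (2 * r + 1 - 1))) ≤
      t ^ (-(1 / (2 * r + 1 - 1))) + (T - t) ^ (-(1 / (2 * r + 1 - 1))) := by
    have ht0 := rpow_nonneg htT.1.le (-(1 / (2 * r + 1 - 1)))
    have hT0 := rpow_nonneg (sub_pos.2 htT.2).le (-(1 / (2 * r + 1 - 1)))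
    rcases min_choice t (T - t) with h | h <;> rw [hq, h] <;> linarith
  refine h2.trans (h1.trans ?_)
  rw [h3, ← mul_assoc]
  exact mul_le_mul_of_nonneg_left h4 (by positivity)
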